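/- Let Ω ⊂ ℝ^d be a nonempty bounded domain with smooth boundary and fix B > 0. For every multi-index length m there is a constant C such that: if u ∈ C^∞(ℝ_+×ℝ³×Ω̄) satisfies u(t,x,y)=0 for t ≤ 2B, □u(t,x,y)=0 for |x| > t−B, and the Neumann condition ∂_ν u|_{y∈∂Ω}=0, then for every product Γ̃^β of |β| ≤ m admissible vector fields and all t ≥ 2B, x, y: (1+t) |Γ̃^β ∂_{t,x} u(t,x,y)| ≤ C Σ_{|α|≤|β|+(5d+16)/2} Σ_{k∈ℤ} sup_{τ∈[2^{k−1},2^{k+1}]∩[2B,t]} 2^k ‖Γ̃^α □u(τ,·)‖_{L²(ℝ³×Ω)} + C (1+t) Σ_{|α|≤|β|+(5d+6)/2} ‖Γ̃^α □u(t,·)‖_{L²(ℝ³×Ω)}. -/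

import Mathlib

open MeasureTheory

noncomputable section

/-- The partial derivative in the `i`-th coordinate direction on `ℝⁿ`. -/
def pd {n : ℕ} (i : Fin n) (u : (Fin n → ℝ) → ℝ) : (Fin n → ℝ) → ℝ :=
  fun z => fderiv ℝ u z (Pi.single i 1)

/-- Iterated application of a family of first-order operators along a list of indices. -/
def opIter {α γ : Type*} (F : α → γ → γ) : List α → γ → γ
  | [] => id
  | i :: L => fun u => F i (opIter F L u)

/-- The ten vector fields Γ on ℝ×ℝ³ (coordinates: `0 = t`, `1,2,3 = x`):
`∂_t, ∂_{x₁}, ∂_{x₂}, ∂_{x₃}`, the rotations `Ω_{jk} = x_j∂_k - x_k∂_j` (`1 ≤ j < k ≤ 3`)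
and the boosts `Ω_{0k} = x_k∂_t + t∂_k` (`k = 1,2,3`). -/
def GammaField (i : Fin 10) (u : (Fin 4 → ℝ) → ℝ) : (Fin 4 → ℝ) → ℝ :=
  if i.val = 0 then pd 0 u
  else if i.val = 1 then pd 1 u
  else if i.val = 2 then pd 2 u
  else if i.val = 3 then pd 3 u
  else if i.val = 4 then fun z => z 1 * pd 2 u z - z 2 * pd 1 u z
  else if i.val = 5 then fun z => z 1 * pd 3 u z - z 3 * pd 1 u z
  else if i.val = 6 then fun z => z 2 * pd 3 u z - z 3 * pd 2 u z
  else if i.val = 7 then fun z => z 1 * pd 0 u z + z 0 * pd 1 u z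
  else if i.val = 8 then fun z => z 2 * pd 0 u z + z 0 * pd 2 u z
  else fun z => z 3 * pd 0 u z + z 0 * pd 3 u z

/-- The spatial radius `r = |x|` of a space-time point. -/
def rad (z : Fin 4 → ℝ) : ℝ := Real.sqrt ((z 1)^2 + (z 2)^2 + (z 3)^2)

/-- The d'Alembertian `□ = ∂_t² - Δ` on ℝ×ℝ³. -/
def Box (u : (Fin 4 → ℝ) → ℝ) : (Fin 4 → ℝ) → ℝ :=
  fun z => pd 0 (pd 0 u) z - pd 1 (pd 1 u) z - pd 2 (pd 2 u) z - pd 3 (pd 3 u) z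

/-- The `L²` norm in `x ∈ ℝ³` at fixed time `t`. -/
def L2x (f : (Fin 4 → ℝ) → ℝ) (t : ℝ) : ℝ :=
  Real.sqrt (∫ x : Fin 3 → ℝ, (f (Fin.cons t x))^2)

/-- A nonempty bounded domain `Ω ⊂ ℝ^d` with smooth boundary, described by a smooth global
defining function: `Ω = {ρ < 0}`, `∂Ω = {ρ = 0}` and `∇ρ ≠ 0` on `∂Ω` (so `∇ρ` points in the
outward normal direction along the boundary). -/
structure SmoothDomain (d : ℕ) where
  carrier : Set (Fin d → ℝ)
  isConnected : IsConnected carrier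
  isOpen : IsOpen carrier
  isBounded : Bornology.IsBounded carrier
  defFun : (Fin d → ℝ) → ℝ
  defFun_smooth : ContDiff ℝ (⊤ : ℕ∞) defFun
  carrier_eq : carrier = {y | defFun y < 0}
  frontier_eq : frontier carrier = {y | defFun y = 0}
  grad_ne : ∀ y ∈ frontier carrier, fderiv ℝ defFun y ≠ 0

/-- The normal derivative `∂_ν h` on `∂Ω` (computed against the outward normal direction
`∇ρ`; it vanishes iff the genuine normal derivative does). -/
def SmoothDomain.nder {d : ℕ} (D : SmoothDomain d) (h : (Fin d → ℝ) → ℝ)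
    (y : Fin d → ℝ) : ℝ :=
  ∑ i : Fin d, fderiv ℝ D.defFun y (Pi.single i 1) * fderiv ℝ h y (Pi.single i 1)

/-- Partial derivative in the `i`-th `(t,x)` direction of a function on `(ℝ×ℝ³) × ℝ^d`
(coordinates of the first factor: `0 = t`, `1,2,3 = x`). -/
def pdtx {d : ℕ} (i : Fin 4) (u : (Fin 4 → ℝ) → (Fin d → ℝ) → ℝ) :
    (Fin 4 → ℝ) → (Fin d → ℝ) → ℝ :=
  fun z y => fderiv ℝ (fun z' => u z' y) z (Pi.single i 1)

/-- Partial derivative in the `j`-th `y` direction of a function on `(ℝ×ℝ³) × ℝ^d`. -/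
def pdy {d : ℕ} (j : Fin d) (u : (Fin 4 → ℝ) → (Fin d → ℝ) → ℝ) :
    (Fin 4 → ℝ) → (Fin d → ℝ) → ℝ :=
  fun z y => fderiv ℝ (fun y' => u z y') y (Pi.single j 1)

/-- A partial derivative in any of the `t,x,y` directions. -/
def pdmix {d : ℕ} : Fin 4 ⊕ Fin d →
    ((Fin 4 → ℝ) → (Fin d → ℝ) → ℝ) → ((Fin 4 → ℝ) → (Fin d → ℝ) → ℝ)
  | Sum.inl i => pdtx i
  | Sum.inr j => pdy j

/-- The d'Alembertian `□ = ∂_t² - Δ_{ℝ³} - Δ_Ω` on the waveguide `ℝ×ℝ³×ℝ^d`. -/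
def wBox {d : ℕ} (u : (Fin 4 → ℝ) → (Fin d → ℝ) → ℝ) :
    (Fin 4 → ℝ) → (Fin d → ℝ) → ℝ :=
  fun z y => pdtx 0 (pdtx 0 u) z y - pdtx 1 (pdtx 1 u) z y - pdtx 2 (pdtx 2 u) z y -
    pdtx 3 (pdtx 3 u) z y - ∑ j : Fin d, pdy j (pdy j u) z y

/-- Smoothness of a function of `((t,x),y)`, jointly in all variables. -/
def SmoothC {d : ℕ} (u : (Fin 4 → ℝ) → (Fin d → ℝ) → ℝ) : Prop :=
  ContDiff ℝ (⊤ : ℕ∞) (fun p : (Fin 4 → ℝ) × (Fin d → ℝ) => u p.1 p.2)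

/-- The Dirichlet boundary condition `u|_{y ∈ ∂Ω} = 0`. -/
def DirichletBC {d : ℕ} (D : SmoothDomain d) (u : (Fin 4 → ℝ) → (Fin d → ℝ) → ℝ) : Prop :=
  ∀ z : Fin 4 → ℝ, ∀ y ∈ frontier D.carrier, u z y = 0

/-- The Neumann boundary condition `∂_ν u|_{y ∈ ∂Ω} = 0`. -/
def NeumannBC {d : ℕ} (D : SmoothDomain d) (u : (Fin 4 → ℝ) → (Fin d → ℝ) → ℝ) : Prop :=
  ∀ z : Fin 4 → ℝ, ∀ y ∈ frontier D.carrier, D.nder (u z) y = 0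

/-- The `L²(Ω)` norm of `u(t,x,·)` at fixed `(t,x)`. -/
def L2y {d : ℕ} (D : SmoothDomain d) (u : (Fin 4 → ℝ) → (Fin d → ℝ) → ℝ)
    (z : Fin 4 → ℝ) : ℝ :=
  Real.sqrt (∫ y in D.carrier, (u z y)^2)

/-- The dyadic sum `Σ_k sup_{τ ∈ [2^{k-1},2^{k+1}] ∩ [2B,t]} 2^k g(τ)`; for each `k ∈ ℤ` the
supremum is taken over the (possibly empty) intersection, and `sSup ∅ = 0` in `ℝ`. -/
def dyadic (g : ℝ → ℝ) (B t : ℝ) : ℝ :=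
  ∑' k : ℤ, sSup ((fun τ => (2:ℝ)^k * g τ) ''
    (Set.Icc ((2:ℝ)^(k-1)) ((2:ℝ)^(k+1)) ∩ Set.Icc (2*B) t))

/-- The admissible vector fields `Γ̃ = {Γ, ∂_{y₁}, …, ∂_{y_d}}` acting on functions on the
waveguide: the `Γ` fields act in the `(t,x)` variables and the remaining fields are the
`y`-derivatives. -/
def gtF {d : ℕ} : Fin 10 ⊕ Fin d →
    ((Fin 4 → ℝ) → (Fin d → ℝ) → ℝ) → ((Fin 4 → ℝ) → (Fin d → ℝ) → ℝ)
  | Sum.inl i => fun u z y => GammaField i (fun z' => u z' y) z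
  | Sum.inr j => pdy j

/-- The `L²(ℝ³×Ω)` norm at fixed time `t`. -/
def L2txy {d : ℕ} (D : SmoothDomain d) (u : (Fin 4 → ℝ) → (Fin d → ℝ) → ℝ) (t : ℝ) : ℝ :=
  Real.sqrt (∫ x : Fin 3 → ℝ, ∫ y in D.carrier, (u (Fin.cons t x) y)^2)

namespace Waveguide

variable {d : ℕ}

/-- Functions of `((t,x),y)`. -/
abbrev V (d : ℕ) := (Fin 4 → ℝ) → (Fin d → ℝ) → ℝ

/-- The uncurried form of a function of `((t,x),y)`. -/
def un {d : ℕ} (u : V d) : (Fin 4 → ℝ) × (Fin d → ℝ) → ℝ := fun p => u p.1 p.2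


lemma smooth_un {u : V d} (hu : SmoothC u) : ContDiff ℝ (⊤ : ℕ∞) (un u) := hu

lemma diff_un {u : V d} (hu : SmoothC u) : Differentiable ℝ (un u) :=
  (smooth_un hu).differentiable (by simp)

lemma pdtx_eq {u : V d} (hu : SmoothC u) (i : Fin 4) (z : Fin 4 → ℝ) (y : Fin d → ℝ) :
    pdtx i u z y = fderiv ℝ (un u) (z, y) (Pi.single i 1, 0) := by
  have h1 : HasFDerivAt (fun z' : Fin 4 → ℝ => (z', y))
      ((ContinuousLinearMap.id ℝ _).prod 0) z :=
    (hasFDerivAt_id z).prodMk (hasFDerivAt_const y z)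
  have h2 := ((diff_un hu) (z, y)).hasFDerivAt.comp z h1
  have h3 : (un u ∘ fun z' : Fin 4 → ℝ => (z', y)) = fun z' => u z' y := rfl
  rw [h3] at h2
  simp [pdtx, h2.fderiv]

lemma pdy_eq {u : V d} (hu : SmoothC u) (j : Fin d) (z : Fin 4 → ℝ) (y : Fin d → ℝ) :
    pdy j u z y = fderiv ℝ (un u) (z, y) (0, Pi.single j 1) := by
  have h1 : HasFDerivAt (fun y' : Fin d → ℝ => (z, y'))
      ((0 : (Fin d → ℝ) →L[ℝ] (Fin 4 → ℝ)).prod (ContinuousLinearMap.id ℝ _)) y :=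
    (hasFDerivAt_const z y).prodMk (hasFDerivAt_id y)
  have h2 := ((diff_un hu) (z, y)).hasFDerivAt.comp y h1
  have h3 : (un u ∘ fun y' : Fin d → ℝ => (z, y')) = fun y' => u z y' := rfl
  rw [h3] at h2
  simp [pdy, h2.fderiv]

/-- The coordinate direction attached to a mixed index. -/
def dir : Fin 4 ⊕ Fin d → (Fin 4 → ℝ) × (Fin d → ℝ)
  | Sum.inl i => (Pi.single i 1, 0)
  | Sum.inr j => (0, Pi.single j 1)

lemma pdmix_eq {u : V d} (hu : SmoothC u) (i : Fin 4 ⊕ Fin d) (z : Fin 4 → ℝ)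
    (y : Fin d → ℝ) : pdmix i u z y = fderiv ℝ (un u) (z, y) (dir i) := by
  cases i with
  | inl i => exact pdtx_eq hu i z y
  | inr j => exact pdy_eq hu j z y

lemma un_pdmix {u : V d} (hu : SmoothC u) (i : Fin 4 ⊕ Fin d) :
    un (pdmix i u) = fun p => fderiv ℝ (un u) p (dir i) := by
  funext p
  exact pdmix_eq hu i p.1 p.2

lemma smooth_pdmix {u : V d} (hu : SmoothC u) (i : Fin 4 ⊕ Fin d) : SmoothC (pdmix i u) := by
  have h : ContDiff ℝ (⊤ : ℕ∞) (un (pdmix i u)) := by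
    rw [un_pdmix hu i]
    exact ((smooth_un hu).fderiv_right (by simp)).clm_apply contDiff_const
  exact h

lemma smooth_pdtx {u : V d} (hu : SmoothC u) (i : Fin 4) : SmoothC (pdtx i u) :=
  smooth_pdmix hu (Sum.inl i)

lemma smooth_pdy {u : V d} (hu : SmoothC u) (j : Fin d) : SmoothC (pdy j u) :=
  smooth_pdmix hu (Sum.inr j)

lemma pdmix_comm {u : V d} (hu : SmoothC u) (i j : Fin 4 ⊕ Fin d) :
    pdmix i (pdmix j u) = pdmix j (pdmix i u) := by
  funext z y
  rw [pdmix_eq (smooth_pdmix hu j), pdmix_eq (smooth_pdmix hu i), un_pdmix hu, un_pdmix hu]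
  have hd : DifferentiableAt ℝ (fderiv ℝ (un u)) (z, y) :=
    ((smooth_un hu).fderiv_right (m := (⊤ : ℕ∞)) (by simp)).differentiable (by simp) _
  rw [fderiv_clm_apply hd (by fun_prop), fderiv_clm_apply hd (by fun_prop)]
  have hs : IsSymmSndFDerivAt ℝ (un u) (z, y) :=
    (smooth_un hu).contDiffAt.isSymmSndFDerivAt (by simpa using WithTop.coe_le_coe.2 (le_top (a := (2 : ℕ∞))))
  simpa using hs.eq (dir i) (dir j)

lemma pdmix_add {u v : V d} (hu : SmoothC u) (hv : SmoothC v) (i : Fin 4 ⊕ Fin d) :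
    pdmix i (fun z y => u z y + v z y) = fun z y => pdmix i u z y + pdmix i v z y := by
  funext z y
  have hs : SmoothC (fun z y => u z y + v z y) := ContDiff.add hu hv
  rw [pdmix_eq hs, pdmix_eq hu, pdmix_eq hv]
  have h : un (fun z y => u z y + v z y) = un u + un v := rfl
  rw [h, fderiv_add (diff_un hu _) (diff_un hv _)]
  rfl

lemma pdmix_mul {u v : V d} (hu : SmoothC u) (hv : SmoothC v) (i : Fin 4 ⊕ Fin d) :
    pdmix i (fun z y => u z y * v z y) =
      fun z y => u z y * pdmix i v z y + pdmix i u z y * v z y := by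
  funext z y
  have hs : SmoothC (fun z y => u z y * v z y) := ContDiff.mul hu hv
  rw [pdmix_eq hs, pdmix_eq hu, pdmix_eq hv]
  have h : un (fun z y => u z y * v z y) = un u * un v := rfl
  rw [h, fderiv_mul (diff_un hu _) (diff_un hv _)]
  simp [un]
  ring

lemma pdmix_const_mul {u : V d} (hu : SmoothC u) (c : ℝ) (i : Fin 4 ⊕ Fin d) :
    pdmix i (fun z y => c * u z y) = fun z y => c * pdmix i u z y := by
  funext z y
  have hs : SmoothC (fun z y => c * u z y) := ContDiff.mul contDiff_const hu
  rw [pdmix_eq hs, pdmix_eq hu]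
  have h : un (fun z y => c * u z y) = c • un u := rfl
  rw [h, fderiv_const_smul (diff_un hu _)]
  rfl

lemma smooth_add {u v : V d} (hu : SmoothC u) (hv : SmoothC v) :
    SmoothC (fun z y => u z y + v z y) := ContDiff.add hu hv

lemma smooth_mul {u v : V d} (hu : SmoothC u) (hv : SmoothC v) :
    SmoothC (fun z y => u z y * v z y) := ContDiff.mul hu hv

lemma smooth_const_mul {u : V d} (hu : SmoothC u) (c : ℝ) :
    SmoothC (fun z y => c * u z y) := ContDiff.mul contDiff_const hu

lemma smooth_sum {ι : Type*} (s : Finset ι) {f : ι → V d} (h : ∀ k, SmoothC (f k)) :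
    SmoothC (fun z y => ∑ k ∈ s, f k z y) := ContDiff.sum fun k _ => h k

lemma smooth_zero : SmoothC (fun _ _ => 0 : V d) := contDiff_const

lemma pdmix_zero (i : Fin 4 ⊕ Fin d) : pdmix i (fun _ _ => 0 : V d) = fun _ _ => 0 := by
  funext z y
  rw [pdmix_eq smooth_zero]
  have : un (fun _ _ => 0 : V d) = fun _ => 0 := rfl
  simp [this]

lemma pdmix_sum {ι : Type*} (s : Finset ι) {f : ι → V d} (h : ∀ k, SmoothC (f k))
    (i : Fin 4 ⊕ Fin d) :
    pdmix i (fun z y => ∑ k ∈ s, f k z y) = fun z y => ∑ k ∈ s, pdmix i (f k) z y := by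
  classical
  induction s using Finset.induction_on with
  | empty => simpa using pdmix_zero i
  | insert a s ha ih =>
    simp only [Finset.sum_insert ha]
    rw [pdmix_add (h a) (smooth_sum s h), ih]

/-- Linear coefficients of the vector fields `Γ`. -/
def gc (i : Fin 10) (a b : Fin 4) : ℝ :=
  if i.val = 4 then (if a = 1 ∧ b = 2 then 1 else if a = 2 ∧ b = 1 then -1 else 0)
  else if i.val = 5 then (if a = 1 ∧ b = 3 then 1 else if a = 3 ∧ b = 1 then -1 else 0)
  else if i.val = 6 then (if a = 2 ∧ b = 3 then 1 else if a = 3 ∧ b = 2 then -1 else 0)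
  else if i.val = 7 then (if a = 1 ∧ b = 0 then 1 else if a = 0 ∧ b = 1 then 1 else 0)
  else if i.val = 8 then (if a = 2 ∧ b = 0 then 1 else if a = 0 ∧ b = 2 then 1 else 0)
  else if i.val = 9 then (if a = 3 ∧ b = 0 then 1 else if a = 0 ∧ b = 3 then 1 else 0)
  else 0

/-- Constant coefficients of the vector fields `Γ`. -/
def ge (i : Fin 10) (b : Fin 4) : ℝ := if i.val = b.val then 1 else 0

lemma gtF_inl (i : Fin 10) (u : V d) :
    gtF (Sum.inl i) u =
      fun z y => ∑ b : Fin 4, (ge i b + ∑ a : Fin 4, gc i a b * z a) * pdtx b u z y := by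
  funext z y
  fin_cases i <;>
    simp [gtF, GammaField, pd, pdtx, gc, ge, Fin.sum_univ_four] <;> ring

lemma smooth_coef (i : Fin 10) (b : Fin 4) :
    SmoothC (fun z _ => ge i b + ∑ a : Fin 4, gc i a b * z a : V d) := by
  unfold SmoothC
  fun_prop

lemma smooth_gtF {u : V d} (hu : SmoothC u) (i : Fin 10 ⊕ Fin d) : SmoothC (gtF i u) := by
  cases i with
  | inl i =>
    rw [gtF_inl]
    exact smooth_sum _ fun b => smooth_mul (smooth_coef i b) (smooth_pdtx hu b)
  | inr j => exact smooth_pdy hu j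

lemma smooth_word {u : V d} (hu : SmoothC u) (L : List (Fin 10 ⊕ Fin d)) :
    SmoothC (opIter gtF L u) := by
  induction L with
  | nil => exact hu
  | cons i L ih => exact smooth_gtF ih i

lemma pdmix_coef_inl (i : Fin 10) (b j : Fin 4) (z : Fin 4 → ℝ) (y : Fin d → ℝ) :
    pdmix (Sum.inl j) (fun z _ => ge i b + ∑ a : Fin 4, gc i a b * z a : V d) z y
      = gc i j b := by
  have h : HasFDerivAt (fun z : Fin 4 → ℝ => ge i b + ∑ a : Fin 4, gc i a b * z a)
      (∑ a : Fin 4, gc i a b • ContinuousLinearMap.proj (R := ℝ) (φ := fun _ : Fin 4 => ℝ) a)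
      z := by
    refine HasFDerivAt.const_add _ (HasFDerivAt.fun_sum fun a _ => ?_)
    exact (hasFDerivAt_apply a z).const_smul (gc i a b)
  simp only [pdmix, pdtx, h.fderiv]
  simp [Pi.single_apply]

lemma pdmix_coef_inr (i : Fin 10) (b : Fin 4) (j : Fin d) (z : Fin 4 → ℝ) (y : Fin d → ℝ) :
    pdmix (Sum.inr j) (fun z _ => ge i b + ∑ a : Fin 4, gc i a b * z a : V d) z y = 0 := by
  simp [pdmix, pdy]

lemma pdy_gtF {u : V d} (hu : SmoothC u) (i : Fin 10) (j : Fin d) :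
    pdy j (gtF (Sum.inl i) u) = gtF (Sum.inl i) (pdy j u) := by
  change pdmix (Sum.inr j) _ = _
  rw [gtF_inl, gtF_inl, pdmix_sum _ (fun b => smooth_mul (smooth_coef i b) (smooth_pdtx hu b))]
  funext z y
  refine Finset.sum_congr rfl fun b _ => ?_
  rw [pdmix_mul (smooth_coef i b) (smooth_pdtx hu b)]
  beta_reduce
  rw [pdmix_coef_inr]
  have := congrFun (congrFun (pdmix_comm hu (Sum.inr j) (Sum.inl b)) z) y
  simp only [pdmix] at this ⊢
  rw [this]; ring

lemma pdtx_gtF {u : V d} (hu : SmoothC u) (i : Fin 10) (j : Fin 4) :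
    pdtx j (gtF (Sum.inl i) u) =
      fun z y => gtF (Sum.inl i) (pdtx j u) z y + ∑ b : Fin 4, gc i j b * pdtx b u z y := by
  change pdmix (Sum.inl j) _ = _
  rw [gtF_inl, gtF_inl, pdmix_sum _ (fun b => smooth_mul (smooth_coef i b) (smooth_pdtx hu b))]
  funext z y
  rw [← Finset.sum_add_distrib]
  refine Finset.sum_congr rfl fun b _ => ?_
  rw [pdmix_mul (smooth_coef i b) (smooth_pdtx hu b)]
  beta_reduce
  rw [pdmix_coef_inl]
  have := congrFun (congrFun (pdmix_comm hu (Sum.inl j) (Sum.inl b)) z) y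
  simp only [pdmix] at this ⊢
  rw [this]

lemma gtF_add {u v : V d} (hu : SmoothC u) (hv : SmoothC v) (i : Fin 10 ⊕ Fin d) :
    gtF i (fun z y => u z y + v z y) = fun z y => gtF i u z y + gtF i v z y := by
  cases i with
  | inr j => exact pdmix_add hu hv (Sum.inr j)
  | inl i =>
    have h : ∀ b : Fin 4, pdtx b (fun z y => u z y + v z y) = _ :=
      fun b => pdmix_add hu hv (Sum.inl b)
    funext z y
    simp only [gtF_inl, h, pdmix]
    rw [← Finset.sum_add_distrib]
    exact Finset.sum_congr rfl fun b _ => by ring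

lemma gtF_const_mul {u : V d} (hu : SmoothC u) (c : ℝ) (i : Fin 10 ⊕ Fin d) :
    gtF i (fun z y => c * u z y) = fun z y => c * gtF i u z y := by
  cases i with
  | inr j => exact pdmix_const_mul hu c (Sum.inr j)
  | inl i =>
    have h : ∀ b : Fin 4, pdtx b (fun z y => c * u z y) = _ :=
      fun b => pdmix_const_mul hu c (Sum.inl b)
    funext z y
    simp only [gtF_inl, h, pdmix]
    rw [Finset.mul_sum]
    exact Finset.sum_congr rfl fun b _ => by ring

lemma gtF_zero (i : Fin 10 ⊕ Fin d) : gtF i (fun _ _ => 0 : V d) = fun _ _ => 0 := by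
  have := gtF_const_mul (smooth_zero (d := d)) 0 i
  simpa using this

lemma gtF_sum {ι : Type*} (s : Finset ι) {f : ι → V d} (h : ∀ k, SmoothC (f k))
    (i : Fin 10 ⊕ Fin d) :
    gtF i (fun z y => ∑ k ∈ s, f k z y) = fun z y => ∑ k ∈ s, gtF i (f k) z y := by
  classical
  induction s using Finset.induction_on with
  | empty => simpa using gtF_zero i
  | insert a s ha ih =>
    simp only [Finset.sum_insert ha]
    rw [gtF_add (h a) (smooth_sum s h), ih]

lemma smooth_wBox {u : V d} (hu : SmoothC u) : SmoothC (wBox u) := by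
  unfold wBox
  refine ContDiff.sub (ContDiff.sub (ContDiff.sub (ContDiff.sub ?_ ?_) ?_) ?_) ?_
  · exact smooth_pdtx (smooth_pdtx hu 0) 0
  · exact smooth_pdtx (smooth_pdtx hu 1) 1
  · exact smooth_pdtx (smooth_pdtx hu 2) 2
  · exact smooth_pdtx (smooth_pdtx hu 3) 3
  · exact smooth_sum _ fun j => smooth_pdy (smooth_pdy hu j) j

lemma pdtx_pdtx_gtF {u : V d} (hu : SmoothC u) (i : Fin 10) (j : Fin 4) (z : Fin 4 → ℝ)
    (y : Fin d → ℝ) :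
    pdtx j (pdtx j (gtF (Sum.inl i) u)) z y =
      gtF (Sum.inl i) (pdtx j (pdtx j u)) z y +
        2 * ∑ b : Fin 4, gc i j b * pdtx b (pdtx j u) z y := by
  have h0 : ∀ b, SmoothC (fun z y => gc i j b * pdtx b u z y) :=
    fun b => smooth_const_mul (smooth_pdtx hu b) _
  have hs : ∀ b : Fin 4, pdtx j (fun z y => gc i j b * pdtx b u z y) =
      fun z y => gc i j b * pdtx b (pdtx j u) z y := fun b => by
    have := pdmix_const_mul (smooth_pdtx hu b) (gc i j b) (Sum.inl j)
    have h2 := pdmix_comm hu (Sum.inl j) (Sum.inl b)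
    simp only [pdmix] at this h2
    rw [this, h2]
  have h1 := pdmix_add (smooth_gtF (smooth_pdtx hu j) (Sum.inl i))
    (smooth_sum Finset.univ h0) (Sum.inl j)
  have h2 := pdmix_sum Finset.univ h0 (Sum.inl j)
  simp only [pdmix] at h1 h2
  rw [pdtx_gtF hu i j, h1, h2, pdtx_gtF (smooth_pdtx hu j)]
  simp only [hs]
  ring

lemma gtF_sub {u v : V d} (hu : SmoothC u) (hv : SmoothC v) (i : Fin 10 ⊕ Fin d) :
    gtF i (fun z y => u z y - v z y) = fun z y => gtF i u z y - gtF i v z y := by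
  have h1 := gtF_add hu (smooth_const_mul hv (-1)) i
  have h2 := gtF_const_mul hv (-1) i
  simp only [h2] at h1
  simpa [sub_eq_add_neg] using h1

lemma smooth_sub {u v : V d} (hu : SmoothC u) (hv : SmoothC v) :
    SmoothC (fun z y => u z y - v z y) := ContDiff.sub hu hv

lemma wBox_gtF_inl {u : V d} (hu : SmoothC u) (i : Fin 10) :
    wBox (gtF (Sum.inl i) u) = gtF (Sum.inl i) (wBox u) := by
  have s2 : ∀ j, SmoothC (pdtx j (pdtx j u)) := fun j => smooth_pdtx (smooth_pdtx hu j) j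
  have y2 : ∀ j, SmoothC (pdy j (pdy j u)) := fun j => smooth_pdy (smooth_pdy hu j) j
  have hy : ∀ j, pdy j (pdy j (gtF (Sum.inl i) u)) = gtF (Sum.inl i) (pdy j (pdy j u)) :=
    fun j => by rw [pdy_gtF hu, pdy_gtF (smooth_pdy hu j)]
  unfold wBox
  rw [gtF_sub (smooth_sub (smooth_sub (smooth_sub (s2 0) (s2 1)) (s2 2)) (s2 3))
      (smooth_sum Finset.univ y2),
    gtF_sub (smooth_sub (smooth_sub (s2 0) (s2 1)) (s2 2)) (s2 3),
    gtF_sub (smooth_sub (s2 0) (s2 1)) (s2 2), gtF_sub (s2 0) (s2 1),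
    gtF_sum Finset.univ y2]
  funext z y
  simp only [hy, pdtx_pdtx_gtF hu]
  have hc : ∀ a b, pdtx a (pdtx b u) z y = pdtx b (pdtx a u) z y := fun a b =>
    congrFun (congrFun (pdmix_comm hu (Sum.inl a) (Sum.inl b)) z) y
  have h10 := hc 1 0
  have h20 := hc 2 0
  have h30 := hc 3 0
  have h21 := hc 2 1
  have h31 := hc 3 1
  have h32 := hc 3 2
  have key : 2 * ∑ b : Fin 4, gc i 0 b * pdtx b (pdtx 0 u) z y
      - 2 * ∑ b : Fin 4, gc i 1 b * pdtx b (pdtx 1 u) z y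
      - 2 * ∑ b : Fin 4, gc i 2 b * pdtx b (pdtx 2 u) z y
      - 2 * ∑ b : Fin 4, gc i 3 b * pdtx b (pdtx 3 u) z y = 0 := by
    simp only [Fin.sum_univ_four]
    fin_cases i <;> simp [gc, h10, h20, h30, h21, h31, h32]
  linarith

lemma wBox_pdmix {u : V d} (hu : SmoothC u) (i : Fin 4 ⊕ Fin d) :
    wBox (pdmix i u) = pdmix i (wBox u) := by
  have s2 : ∀ j, SmoothC (pdtx j (pdtx j u)) := fun j => smooth_pdtx (smooth_pdtx hu j) j
  have y2 : ∀ j, SmoothC (pdy j (pdy j u)) := fun j => smooth_pdy (smooth_pdy hu j) j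
  have c2 : ∀ k : Fin 4 ⊕ Fin d, pdmix k (pdmix k (pdmix i u)) = pdmix i (pdmix k (pdmix k u)) :=
    fun k => by rw [pdmix_comm hu k i, pdmix_comm (smooth_pdmix hu k) k i]
  have ht : ∀ j, pdtx j (pdtx j (pdmix i u)) = pdmix i (pdtx j (pdtx j u)) :=
    fun j => c2 (Sum.inl j)
  have hy : ∀ j, pdy j (pdy j (pdmix i u)) = pdmix i (pdy j (pdy j u)) := fun j => c2 (Sum.inr j)
  have hsub : ∀ {u v : V d}, SmoothC u → SmoothC v →
      pdmix i (fun z y => u z y - v z y) = fun z y => pdmix i u z y - pdmix i v z y := by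
    intro u v hu hv
    have h1 := pdmix_add hu (smooth_const_mul hv (-1)) i
    have h2 := pdmix_const_mul hv (-1) i
    simp only [h2] at h1
    simpa [sub_eq_add_neg] using h1
  unfold wBox
  rw [hsub (smooth_sub (smooth_sub (smooth_sub (s2 0) (s2 1)) (s2 2)) (s2 3))
      (smooth_sum Finset.univ y2),
    hsub (smooth_sub (smooth_sub (s2 0) (s2 1)) (s2 2)) (s2 3),
    hsub (smooth_sub (s2 0) (s2 1)) (s2 2), hsub (s2 0) (s2 1),
    pdmix_sum Finset.univ y2]
  simp only [ht, hy]

/-- The product of `Γ` fields along a word. -/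
def zw (β : List (Fin 10)) (u : V d) : V d := opIter gtF (β.map Sum.inl) u

lemma zw_nil (u : V d) : zw [] u = u := rfl

lemma zw_cons (i : Fin 10) (β : List (Fin 10)) (u : V d) :
    zw (i :: β) u = gtF (Sum.inl i) (zw β u) := rfl

lemma opIter_append {α γ : Type*} (F : α → γ → γ) (L M : List α) (u : γ) :
    opIter F (L ++ M) u = opIter F L (opIter F M u) := by
  induction L with
  | nil => rfl
  | cons i L ih => simp [opIter, ih]

lemma zw_append (β δ : List (Fin 10)) (u : V d) : zw (β ++ δ) u = zw β (zw δ u) := by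
  simp [zw, opIter_append]

lemma smooth_zw {u : V d} (hu : SmoothC u) (β : List (Fin 10)) : SmoothC (zw β u) :=
  smooth_word hu _

lemma wBox_zw {u : V d} (hu : SmoothC u) (β : List (Fin 10)) :
    wBox (zw β u) = zw β (wBox u) := by
  induction β with
  | nil => rfl
  | cons i β ih => rw [zw_cons, zw_cons, wBox_gtF_inl (smooth_zw hu β), ih]

lemma pdy_zw {u : V d} (hu : SmoothC u) (β : List (Fin 10)) (j : Fin d) :
    pdy j (zw β u) = zw β (pdy j u) := by
  induction β with
  | nil => rfl
  | cons i β ih => rw [zw_cons, zw_cons, pdy_gtF (smooth_zw hu β), ih]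

lemma zw_add {u v : V d} (hu : SmoothC u) (hv : SmoothC v) (β : List (Fin 10)) :
    zw β (fun z y => u z y + v z y) = fun z y => zw β u z y + zw β v z y := by
  induction β with
  | nil => rfl
  | cons i β ih => rw [zw_cons, ih, gtF_add (smooth_zw hu β) (smooth_zw hv β)]; rfl

lemma zw_const_mul {u : V d} (hu : SmoothC u) (c : ℝ) (β : List (Fin 10)) :
    zw β (fun z y => c * u z y) = fun z y => c * zw β u z y := by
  induction β with
  | nil => rfl
  | cons i β ih => rw [zw_cons, ih, gtF_const_mul (smooth_zw hu β)]; rfl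

lemma zw_zero (β : List (Fin 10)) : zw β (fun _ _ => 0 : V d) = fun _ _ => 0 := by
  induction β with
  | nil => rfl
  | cons i β ih => rw [zw_cons, ih, gtF_zero]

lemma zw_sum {ι : Type*} (s : Finset ι) {f : ι → V d} (h : ∀ k, SmoothC (f k))
    (β : List (Fin 10)) :
    zw β (fun z y => ∑ k ∈ s, f k z y) = fun z y => ∑ k ∈ s, zw β (f k) z y := by
  classical
  induction s using Finset.induction_on with
  | empty => simpa using zw_zero β
  | insert a s ha ih =>
    simp only [Finset.sum_insert ha]
    rw [zw_add (h a) (smooth_sum s h), ih]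

/-- Sum over all words of length at most `N`. -/
def wsum {A : Type*} [Fintype A] {R : Type*} [AddCommMonoid R] (N : ℕ) (f : List A → R) : R :=
  ∑ n ∈ Finset.range (N + 1), ∑ σ : Fin n → A, f (List.ofFn σ)

lemma le_wsum {A : Type*} [Fintype A] {R : Type*} [AddCommMonoid R] [PartialOrder R]
    [IsOrderedAddMonoid R] {N : ℕ} {f : List A → R}
    (hf : ∀ L, 0 ≤ f L) {L : List A} (hL : L.length ≤ N) : f L ≤ wsum N f := by
  classical
  have h1 : f L ≤ ∑ σ : Fin L.length → A, f (List.ofFn σ) := by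
    have := Finset.single_le_sum (f := fun σ : Fin L.length → A => f (List.ofFn σ))
      (fun σ _ => hf _) (Finset.mem_univ (fun i => L.get i))
    simpa using this
  refine h1.trans ?_
  exact Finset.single_le_sum (f := fun n => ∑ σ : Fin n → A, f (List.ofFn σ))
    (fun n _ => Finset.sum_nonneg fun σ _ => hf _) (Finset.mem_range.2 (by omega))

lemma wsum_le_wsum {A : Type*} [Fintype A] {R : Type*} [AddCommMonoid R] [PartialOrder R]
    [IsOrderedAddMonoid R] {N : ℕ} {f g : List A → R}
    (h : ∀ L, L.length ≤ N → f L ≤ g L) : wsum N f ≤ wsum N g := by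
  refine Finset.sum_le_sum fun n hn => Finset.sum_le_sum fun σ _ => h _ ?_
  have := Finset.mem_range.1 hn
  simp; omega

lemma wsum_nonneg {A : Type*} [Fintype A] {R : Type*} [AddCommMonoid R] [PartialOrder R]
    [IsOrderedAddMonoid R] {N : ℕ} {f : List A → R}
    (hf : ∀ L, 0 ≤ f L) : 0 ≤ wsum N f :=
  Finset.sum_nonneg fun _ _ => Finset.sum_nonneg fun _ _ => hf _

/-- The number of words of length at most `N`. -/
def wcard (A : Type*) [Fintype A] (N : ℕ) : ℝ := wsum (A := A) N fun _ => (1 : ℝ)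

lemma wcard_nonneg (A : Type*) [Fintype A] (N : ℕ) : 0 ≤ wcard A N :=
  wsum_nonneg fun _ => zero_le_one

lemma wsum_mul {A : Type*} [Fintype A] (N : ℕ) (f : List A → ℝ) (c : ℝ) :
    wsum N (fun L => f L * c) = wsum N f * c := by
  simp [wsum, Finset.sum_mul]

lemma wsum_le_card {A : Type*} [Fintype A] {N : ℕ} {f : List A → ℝ} {M : ℝ}
    (h : ∀ L, L.length ≤ N → f L ≤ M) : wsum N f ≤ wcard A N * M := by
  rw [wcard, ← wsum_mul]
  exact wsum_le_wsum fun L hL => by simpa using h L hL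

/-- The pointwise energy density. -/
def ed (w : V d) (z : Fin 4 → ℝ) (y : Fin d → ℝ) : ℝ :=
  ∑ i : Fin 4, (pdtx i w z y) ^ 2 + ∑ j : Fin d, (pdy j w z y) ^ 2

lemma ed_nonneg (w : V d) (z : Fin 4 → ℝ) (y : Fin d → ℝ) : 0 ≤ ed w z y := by
  unfold ed; positivity

lemma pdtx_sq_le_ed (w : V d) (z : Fin 4 → ℝ) (y : Fin d → ℝ) (i : Fin 4) :
    (pdtx i w z y) ^ 2 ≤ ed w z y := by
  have h1 := Finset.single_le_sum (f := fun i => (pdtx i w z y) ^ 2)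
    (fun i _ => sq_nonneg _) (Finset.mem_univ i)
  have h2 : 0 ≤ ∑ j : Fin d, (pdy j w z y) ^ 2 := by positivity
  unfold ed; linarith

lemma pdy_sq_le_ed (w : V d) (z : Fin 4 → ℝ) (y : Fin d → ℝ) (j : Fin d) :
    (pdy j w z y) ^ 2 ≤ ed w z y := by
  have h1 := Finset.single_le_sum (f := fun i => (pdy i w z y) ^ 2)
    (fun i _ => sq_nonneg _) (Finset.mem_univ j)
  have h2 : 0 ≤ ∑ j : Fin 4, (pdtx j w z y) ^ 2 := by positivity
  unfold ed; linarith

/-- The pointwise energy density of order `N`. -/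
def EE (N : ℕ) (w : V d) (z : Fin 4 → ℝ) (y : Fin d → ℝ) : ℝ :=
  wsum N fun β : List (Fin 10) => ed (zw β w) z y

lemma EE_nonneg (N : ℕ) (w : V d) (z : Fin 4 → ℝ) (y : Fin d → ℝ) : 0 ≤ EE N w z y :=
  wsum_nonneg fun _ => ed_nonneg _ _ _

lemma ed_le_EE {N : ℕ} (w : V d) (z : Fin 4 → ℝ) (y : Fin d → ℝ) {β : List (Fin 10)}
    (h : β.length ≤ N) : ed (zw β w) z y ≤ EE N w z y :=
  le_wsum (f := fun β : List (Fin 10) => ed (zw β w) z y) (fun _ => ed_nonneg _ _ _) h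

lemma EE_zw_le (N : ℕ) (w : V d) (z : Fin 4 → ℝ) (y : Fin d → ℝ) (δ : List (Fin 10)) :
    EE N (zw δ w) z y ≤ wcard (Fin 10) N * EE (N + δ.length) w z y := by
  refine wsum_le_card fun β hβ => ?_
  rw [← zw_append]
  exact ed_le_EE w z y (by simp; omega)

lemma EE_mono {N M : ℕ} (h : N ≤ M) (w : V d) (z : Fin 4 → ℝ) (y : Fin d → ℝ) :
    EE N w z y ≤ EE M w z y := by
  unfold EE wsum
  exact Finset.sum_le_sum_of_subset_of_nonneg (Finset.range_mono (by omega))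
    fun _ _ _ => Finset.sum_nonneg fun _ _ => ed_nonneg _ _ _

lemma abs_gc_le (i : Fin 10) (a b : Fin 4) : |gc i a b| ≤ 1 := by
  unfold gc
  split_ifs <;> simp

/-- Products of fields applied to a `(t,x)`-derivative are controlled by the energy density. -/
lemma zw_pdtx_sq_le (n : ℕ) : ∃ C : ℝ, 0 < C ∧ ∀ (β : List (Fin 10)), β.length = n →
    ∀ w : V d, SmoothC w → ∀ j z y, (zw β (pdtx j w) z y) ^ 2 ≤ C * EE n w z y := by
  induction n with
  | zero =>
    refine ⟨1, one_pos, fun β hβ w _ j z y => ?_⟩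
    obtain rfl : β = [] := List.length_eq_zero_iff.1 hβ
    rw [one_mul]
    exact (pdtx_sq_le_ed w z y j).trans (ed_le_EE (β := []) w z y le_rfl)
  | succ n ih =>
    obtain ⟨C, hC, h⟩ := ih
    refine ⟨5 * (C * wcard (Fin 10) n + 4 * C), by
      have := wcard_nonneg (Fin 10) n; positivity, fun β hβ w hw j z y => ?_⟩
    obtain ⟨δ, i, rfl⟩ : ∃ δ i, β = δ ++ [i] :=
      by
      simpa using (List.eq_nil_or_concat β).resolve_left (by rintro rfl; simp at hβ)
    have hδ : δ.length = n := by simpa using hβ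
    have e1 : gtF (Sum.inl i) (pdtx j w) = fun z y => pdtx j (gtF (Sum.inl i) w) z y +
        ∑ b : Fin 4, (-gc i j b) * pdtx b w z y := by
      rw [pdtx_gtF hw i j]; funext z y; simp
    have e2 : zw (δ ++ [i]) (pdtx j w) z y = zw δ (pdtx j (gtF (Sum.inl i) w)) z y +
        ∑ b : Fin 4, (-gc i j b) * zw δ (pdtx b w) z y := by
      have hs : ∀ b, SmoothC (fun z y => (-gc i j b) * pdtx b w z y) :=
        fun b => smooth_const_mul (smooth_pdtx hw b) _
      rw [zw_append]
      change zw δ (gtF (Sum.inl i) (pdtx j w)) z y = _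
      rw [e1, zw_add (smooth_pdtx (smooth_gtF hw _) j) (smooth_sum _ hs), zw_sum _ hs]
      simp only [zw_const_mul (smooth_pdtx hw _)]
    have h1 := h δ hδ (gtF (Sum.inl i) w) (smooth_gtF hw _) j z y
    have h2 : EE n (gtF (Sum.inl i) w) z y ≤ wcard (Fin 10) n * EE (n + 1) w z y :=
      EE_zw_le n w z y [i]
    have h3 : ∀ b, ((-gc i j b) * zw δ (pdtx b w) z y) ^ 2 ≤ C * EE (n + 1) w z y := by
      intro b
      have := h δ hδ w hw b z y
      have h4 : (gc i j b) ^ 2 ≤ 1 := by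
        have := abs_gc_le i j b
        rw [← sq_abs]; nlinarith [abs_nonneg (gc i j b)]
      have h5 := EE_mono (Nat.le_succ n) w z y
      rw [mul_pow, neg_sq]
      nlinarith [sq_nonneg (zw δ (pdtx b w) z y), mul_le_mul_of_nonneg_left h5 hC.le]
    rw [e2, Fin.sum_univ_four]
    have h30 := h3 0
    have h31 := h3 1
    have h32 := h3 2
    have h33 := h3 3
    have h6 : (zw δ (pdtx j (gtF (Sum.inl i) w)) z y) ^ 2 ≤
        C * wcard (Fin 10) n * EE (n + 1) w z y := by
      rw [mul_assoc]; exact h1.trans (mul_le_mul_of_nonneg_left h2 hC.le)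
    have key : ∀ a b c d e : ℝ, (a + (b + c + d + e)) ^ 2 ≤
        5 * (a ^ 2 + b ^ 2 + c ^ 2 + d ^ 2 + e ^ 2) := by
      intro a b c d e
      nlinarith [sq_nonneg (a - b), sq_nonneg (a - c), sq_nonneg (a - d), sq_nonneg (a - e),
        sq_nonneg (b - c), sq_nonneg (b - d), sq_nonneg (b - e), sq_nonneg (c - d),
        sq_nonneg (c - e), sq_nonneg (d - e)]
    refine (key _ _ _ _ _).trans ?_
    nlinarith

/-- A single family of functions whose squares make up the energy density of order `N`. -/
lemma zw_pdmix_zw_sq_le (n N : ℕ) : ∃ C : ℝ, 0 < C ∧ ∀ (δ β : List (Fin 10)), δ.length ≤ n →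
    β.length ≤ N → ∀ w : V d, SmoothC w → ∀ j z y,
      (zw δ (pdmix j (zw β w)) z y) ^ 2 ≤ C * EE (N + n) w z y := by
  choose C hC h using fun n => zw_pdtx_sq_le (d := d) n
  refine ⟨1 + ∑ k ∈ Finset.range (n + 1), C k * wcard (Fin 10) k, ?_, ?_⟩
  · have : 0 ≤ ∑ k ∈ Finset.range (n + 1), C k * wcard (Fin 10) k :=
      Finset.sum_nonneg fun k _ => mul_nonneg (hC k).le (wcard_nonneg _ _)
    linarith
  intro δ β hδ hβ w hw j z y
  have h0 : 0 ≤ ∑ k ∈ Finset.range (n + 1), C k * wcard (Fin 10) k :=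
    Finset.sum_nonneg fun k _ => mul_nonneg (hC k).le (wcard_nonneg _ _)
  have hE := EE_nonneg (N + n) w z y
  cases j with
  | inr j =>
    change (zw δ (pdy j (zw β w)) z y) ^ 2 ≤ _
    rw [← pdy_zw (smooth_zw hw β), ← zw_append]
    have h1 := (pdy_sq_le_ed (zw (δ ++ β) w) z y j).trans
      (ed_le_EE (N := N + n) w z y (by simp; omega))
    nlinarith
  | inl j =>
    have h1 := h δ.length δ rfl (zw β w) (smooth_zw hw β) j z y
    have h2 := EE_zw_le δ.length w z y β
    have h3 := EE_mono (show δ.length + β.length ≤ N + n by omega) w z y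
    have h4 : C δ.length * wcard (Fin 10) δ.length ≤
        ∑ k ∈ Finset.range (n + 1), C k * wcard (Fin 10) k :=
      Finset.single_le_sum (f := fun k => C k * wcard (Fin 10) k)
        (fun k _ => mul_nonneg (hC k).le (wcard_nonneg _ _)) (Finset.mem_range.2 (by omega))
    have hw0 := wcard_nonneg (Fin 10) δ.length
    calc (zw δ (pdmix (Sum.inl j) (zw β w)) z y) ^ 2
        ≤ C δ.length * (wcard (Fin 10) δ.length * EE (N + n) w z y) :=
          h1.trans (mul_le_mul_of_nonneg_left (h2.trans (mul_le_mul_of_nonneg_left h3 hw0))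
            (hC _).le)
      _ = C δ.length * wcard (Fin 10) δ.length * EE (N + n) w z y := by ring
      _ ≤ _ := mul_le_mul_of_nonneg_right (by linarith) hE

lemma ed_eq_sum (w : V d) (z : Fin 4 → ℝ) (y : Fin d → ℝ) :
    ed w z y = ∑ j : Fin 4 ⊕ Fin d, (pdmix j w z y) ^ 2 := by
  simp [ed, pdmix]

lemma smooth_ed {w : V d} (hw : SmoothC w) : SmoothC (ed w) := by
  have : ed w = fun z y => ∑ j : Fin 4 ⊕ Fin d, (pdmix j w z y) ^ 2 := by
    funext z y; exact ed_eq_sum w z y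
  rw [this]
  exact smooth_sum _ fun j => ContDiff.pow (smooth_pdmix hw j) 2

lemma smooth_EE {w : V d} (hw : SmoothC w) (N : ℕ) : SmoothC (EE N w) := by
  unfold EE wsum
  exact smooth_sum _ fun n => smooth_sum _ fun σ => smooth_ed (smooth_zw hw _)

lemma sq_le_integral_of_hasDerivAt {f f' : ℝ → ℝ} {ℓ : ℝ} (hℓ : 0 < ℓ)
    (hd : ∀ s ∈ Set.Icc 0 ℓ, HasDerivAt f (f' s) s) (hc : ContinuousOn f' (Set.Icc 0 ℓ)) :
    f 0 ^ 2 ≤ (2 / ℓ) * ∫ s in (0 : ℝ)..ℓ, (f s ^ 2 + ℓ ^ 2 * f' s ^ 2) := by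
  have hfc : ContinuousOn f (Set.Icc 0 ℓ) := fun s hs => (hd s hs).continuousAt.continuousWithinAt
  have hu : Set.uIcc 0 ℓ = Set.Icc 0 ℓ := Set.uIcc_of_le hℓ.le
  have h1 : ∀ s ∈ Set.uIcc 0 ℓ, HasDerivAt (fun s => (1 - s / ℓ) * f s ^ 2)
      (-(1 / ℓ) * f s ^ 2 + (1 - s / ℓ) * (2 * f s * f' s)) s := by
    intro s hs
    rw [hu] at hs
    have a1 : HasDerivAt (fun s : ℝ => 1 - s / ℓ) (-(1 / ℓ)) s := by
      simpa using ((hasDerivAt_id s).div_const ℓ).const_sub 1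
    have a2 := (hd s hs).pow 2
    exact (a1.mul a2).congr_deriv (by simp)
  have hci : ContinuousOn (fun s => -(1 / ℓ) * f s ^ 2 + (1 - s / ℓ) * (2 * f s * f' s))
      (Set.uIcc 0 ℓ) := by
    rw [hu]; fun_prop
  have h2 := intervalIntegral.integral_eq_sub_of_hasDerivAt h1 hci.intervalIntegrable
  have h3 : f 0 ^ 2 = ∫ s in (0 : ℝ)..ℓ,
      -(-(1 / ℓ) * f s ^ 2 + (1 - s / ℓ) * (2 * f s * f' s)) := by
    rw [intervalIntegral.integral_neg, h2]
    field_simp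
    ring
  rw [h3, ← intervalIntegral.integral_const_mul]
  refine intervalIntegral.integral_mono_on hℓ.le hci.neg.intervalIntegrable ?_ ?_
  · refine ContinuousOn.intervalIntegrable ?_
    rw [hu]; fun_prop
  · intro s hs
    have b1 : 0 ≤ 1 - s / ℓ := by
      have := div_le_one_of_le₀ hs.2 hℓ.le; linarith
    have b2 : 1 - s / ℓ ≤ 1 := by
      have := div_nonneg hs.1 hℓ.le; linarith
    have b3 : 2 / ℓ * (f s ^ 2 + ℓ ^ 2 * f' s ^ 2) = 2 / ℓ * f s ^ 2 + 2 * ℓ * f' s ^ 2 := by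
      field_simp
    have b4 : |2 * f s * f' s| ≤ 1 / ℓ * f s ^ 2 + ℓ * f' s ^ 2 := by
      have h5 : 1 / ℓ * f s ^ 2 + ℓ * f' s ^ 2 = ℓ * ((f s / ℓ) ^ 2 + f' s ^ 2) := by
        field_simp
      have h6 : 2 * f s * f' s = ℓ * (2 * (f s / ℓ) * f' s) := by field_simp
      rw [h5, h6, abs_mul, abs_of_pos hℓ]
      refine mul_le_mul_of_nonneg_left ?_ hℓ.le
      rw [abs_le]; constructor <;> nlinarith [sq_nonneg (f s / ℓ + f' s), sq_nonneg (f s / ℓ - f' s)]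
    have b5 : |(1 - s / ℓ) * (2 * f s * f' s)| ≤ 1 / ℓ * f s ^ 2 + ℓ * f' s ^ 2 := by
      rw [abs_mul, abs_of_nonneg b1]
      exact (mul_le_of_le_one_left (abs_nonneg _) b2).trans b4
    have b6 := (abs_le.1 b5).1
    have b7 : 2 / ℓ * f s ^ 2 = 1 / ℓ * f s ^ 2 + 1 / ℓ * f s ^ 2 := by ring
    rw [b3, b7]
    nlinarith [mul_nonneg hℓ.le (sq_nonneg (f' s))]

lemma ofReal_intervalIntegral {g : ℝ → ℝ} {a b : ℝ} (hab : a ≤ b)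
    (hg : ContinuousOn g (Set.Icc a b)) (h0 : ∀ s ∈ Set.Icc a b, 0 ≤ g s) :
    ENNReal.ofReal (∫ s in a..b, g s) = ∫⁻ s in Set.Icc a b, ENNReal.ofReal (g s) := by
  rw [intervalIntegral.integral_of_le hab, ← integral_Icc_eq_integral_Ioc]
  refine ofReal_integral_eq_lintegral_ofReal (hg.integrableOn_Icc) ?_
  exact (ae_restrict_iff' measurableSet_Icc).2 (Filter.Eventually.of_forall h0)

/-- The `Ω`-integrated energy density of order `N`. -/
def NN (D : SmoothDomain d) (N : ℕ) (u : V d) (z : Fin 4 → ℝ) : ENNReal :=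
  ∫⁻ y in D.carrier, ENNReal.ofReal (EE N u z y)

lemma continuous_of_smooth {u : V d} (hu : SmoothC u) : Continuous (un u) :=
  (smooth_un hu).continuous

lemma SmoothC.continuous_comp {X : Type*} [TopologicalSpace X] {v : V d} (hv : SmoothC v)
    {f : X → Fin 4 → ℝ} {g : X → Fin d → ℝ} (hf : Continuous f) (hg : Continuous g) :
    Continuous fun x => v (f x) (g x) :=
  (continuous_of_smooth hv).comp (hf.prodMk hg)

lemma measurable_NN (D : SmoothDomain d) (N : ℕ) {u : V d} (hu : SmoothC u) :
    Measurable (NN D N u) := by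
  have h : Measurable (fun p : (Fin 4 → ℝ) × (Fin d → ℝ) => ENNReal.ofReal (EE N u p.1 p.2)) :=
    (continuous_of_smooth (smooth_EE hu N)).measurable.ennreal_ofReal
  exact h.lintegral_prod_right'

lemma NN_le_of_forall (D : SmoothDomain d) {N : ℕ} {u : V d} {z : Fin 4 → ℝ} {c ℓ : ℝ}
    (hc : 0 ≤ c) (hℓ : 0 ≤ ℓ) {g : ℝ → (Fin d → ℝ) → ℝ}
    (hg : Continuous (fun p : ℝ × (Fin d → ℝ) => g p.1 p.2))
    (h0 : ∀ s ∈ Set.Icc 0 ℓ, ∀ y, 0 ≤ g s y)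
    (h : ∀ y, EE N u z y ≤ c * ∫ s in (0 : ℝ)..ℓ, g s y) :
    NN D N u z ≤ ENNReal.ofReal c *
      ∫⁻ s in Set.Icc 0 ℓ, ∫⁻ y in D.carrier, ENNReal.ofReal (g s y) := by
  have hm : Measurable (fun p : ℝ × (Fin d → ℝ) => ENNReal.ofReal (g p.1 p.2)) :=
    hg.measurable.ennreal_ofReal
  rw [lintegral_lintegral_swap hm.aemeasurable,
    ← lintegral_const_mul (ENNReal.ofReal c)
      (show Measurable fun y => ∫⁻ s in Set.Icc 0 ℓ, ENNReal.ofReal (g s y) from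
        (hm.comp measurable_swap).lintegral_prod_right')]
  refine lintegral_mono fun y => ?_
  have hy : Continuous fun s => g s y := hg.comp (continuous_id.prodMk continuous_const)
  rw [← ofReal_intervalIntegral hℓ hy.continuousOn (fun s hs => h0 s hs y),
    ← ENNReal.ofReal_mul hc]
  exact ENNReal.ofReal_le_ofReal (h y)

/-- Sobolev inequality along a path generated by one of the vector fields. -/
lemma NN_of_path (D : SmoothDomain d) (N : ℕ) : ∃ C : ℝ, 0 < C ∧ ∀ u : V d, SmoothC u →
    ∀ (i : Fin 10) (ℓ : ℝ), 0 < ℓ → ∀ γ : ℝ → Fin 4 → ℝ, Continuous γ → ∀ m : ℝ → ℝ,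
      ContinuousOn m (Set.Icc 0 ℓ) → (∀ s ∈ Set.Icc 0 ℓ, |m s| * ℓ ≤ 1) →
      (∀ v : V d, SmoothC v → ∀ y, ∀ s ∈ Set.Icc 0 ℓ,
        HasDerivAt (fun s => v (γ s) y) (m s * gtF (Sum.inl i) v (γ s) y) s) →
      NN D N u (γ 0) ≤ ENNReal.ofReal (C / ℓ) *
        ∫⁻ s in Set.Icc 0 ℓ, NN D (N + 1) u (γ s) := by
  obtain ⟨C, hC, h⟩ := zw_pdmix_zw_sq_le (d := d) 1 N
  refine ⟨wcard (Fin 10) N * (4 + d) * (2 * (2 * C)) + 1, by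
    have := wcard_nonneg (Fin 10) N; positivity, ?_⟩
  intro u hu i ℓ hℓ γ hγ m hm hm1 hder
  have hw := wcard_nonneg (Fin 10) N
  have hcy : ∀ (v : V d), SmoothC v → ∀ y, Continuous fun s => v (γ s) y := fun v hv y =>
    SmoothC.continuous_comp hv hγ continuous_const
  have hgc : Continuous (fun p : ℝ × (Fin d → ℝ) => EE (N + 1) u (γ p.1) p.2) :=
    SmoothC.continuous_comp (smooth_EE hu (N + 1)) (hγ.comp continuous_fst) continuous_snd
  have hc0 : 0 ≤ (wcard (Fin 10) N * (4 + d) * (2 * (2 * C)) + 1) / ℓ := by positivity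
  refine NN_le_of_forall D hc0 hℓ.le (g := fun s y => EE (N + 1) u (γ s) y) hgc
    (fun _ _ _ => EE_nonneg _ _ _ _) fun y => ?_
  set I := ∫ s in (0 : ℝ)..ℓ, EE (N + 1) u (γ s) y with hI
  have hI0 : 0 ≤ I := intervalIntegral.integral_nonneg hℓ.le fun _ _ => EE_nonneg _ _ _ _
  have key : ∀ β : List (Fin 10), β.length ≤ N → ∀ j : Fin 4 ⊕ Fin d,
      (pdmix j (zw β u) (γ 0) y) ^ 2 ≤ (2 / ℓ) * (2 * C * I) := by
    intro β hβ j
    have hs := smooth_pdmix (smooth_zw hu β) j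
    have hsc := hcy _ (smooth_gtF hs (Sum.inl i)) y
    have h1 := sq_le_integral_of_hasDerivAt hℓ (hder _ hs y) (hm.mul hsc.continuousOn)
    refine h1.trans (mul_le_mul_of_nonneg_left ?_ (by positivity))
    rw [hI, ← intervalIntegral.integral_const_mul]
    refine intervalIntegral.integral_mono_on hℓ.le ?_ ?_ ?_
    · refine ContinuousOn.intervalIntegrable ?_
      rw [Set.uIcc_of_le hℓ.le]
      exact ((hcy _ hs y).pow 2).continuousOn.add
        (continuousOn_const.mul ((hm.mul hsc.continuousOn).pow 2))
    · exact ((hcy _ (smooth_EE hu (N + 1)) y).const_mul _).intervalIntegrable _ _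
    · intro s hsI
      have a1 := h [] β (by simp) hβ u hu j (γ s) y
      have a2 := h [i] β (by simp) hβ u hu j (γ s) y
      rw [zw_nil] at a1
      rw [zw_cons, zw_nil] at a2
      have a3 := hm1 s hsI
      have a4 : ℓ ^ 2 * (m s * gtF (Sum.inl i) (pdmix j (zw β u)) (γ s) y) ^ 2 ≤
          (gtF (Sum.inl i) (pdmix j (zw β u)) (γ s) y) ^ 2 := by
        have : ℓ ^ 2 * (m s * gtF (Sum.inl i) (pdmix j (zw β u)) (γ s) y) ^ 2 =
          (|m s| * ℓ) ^ 2 * (gtF (Sum.inl i) (pdmix j (zw β u)) (γ s) y) ^ 2 := by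
          rw [mul_pow |m s|, sq_abs]; ring
        rw [this]
        refine mul_le_of_le_one_left (sq_nonneg _) ?_
        have : 0 ≤ |m s| * ℓ := by positivity
        nlinarith
      linarith
  have h1 : EE N u (γ 0) y ≤ wcard (Fin 10) N * ((4 + d) * ((2 / ℓ) * (2 * C * I))) := by
    refine wsum_le_card fun β hβ => ?_
    rw [ed_eq_sum]
    refine (Finset.sum_le_sum fun j _ => key β hβ j).trans ?_
    simp
  refine h1.trans ?_
  have : (wcard (Fin 10) N * (4 + d) * (2 * (2 * C)) + 1) / ℓ * I =
    wcard (Fin 10) N * ((4 + d) * ((2 / ℓ) * (2 * C * I))) + 1 / ℓ * I := by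
    field_simp
  rw [this]
  have : 0 ≤ 1 / ℓ * I := by positivity
  linarith

lemma hasDerivAt_comp_path {v : V d} (hv : SmoothC v) {γ : ℝ → Fin 4 → ℝ} {γ' : Fin 4 → ℝ}
    {s : ℝ} (h : ∀ i, HasDerivAt (fun s => γ s i) (γ' i) s) (y : Fin d → ℝ) :
    HasDerivAt (fun s => v (γ s) y) (∑ i, γ' i * pdtx i v (γ s) y) s := by
  have h1 : HasDerivAt γ γ' s := hasDerivAt_pi.2 h
  have h2 : HasDerivAt (fun s => (γ s, y)) (γ', (0 : Fin d → ℝ)) s :=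
    h1.prodMk (hasDerivAt_const s y)
  have h3 := ((diff_un hv) (γ s, y)).hasFDerivAt.comp_hasDerivAt s h2
  refine HasDerivAt.congr_deriv h3 ?_
  have h4 : (γ', (0 : Fin d → ℝ)) = ∑ i, γ' i • ((Pi.single i 1 : Fin 4 → ℝ), (0 : Fin d → ℝ)) := by
    ext k
    · simp [Prod.fst_sum, Finset.sum_apply, Pi.single_apply]
    · simp [Prod.snd_sum]
  rw [h4, map_sum]
  refine Finset.sum_congr rfl fun i _ => ?_
  rw [map_smul, pdtx_eq hv, smul_eq_mul]

/-- Admissible pairs of axes: hyperbolic rotations (`η = 1`) and rotations (`η = -1`). -/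
def AxisPair (a b : Fin 4) (η : ℝ) : Prop :=
  (a = 0 ∧ b ≠ 0 ∧ η = 1) ∨ (a ≠ 0 ∧ b ≠ 0 ∧ a ≠ b ∧ η = -1)

lemma exists_gtF_of_axisPair {a b : Fin 4} {η : ℝ} (h : AxisPair a b η) :
    ∃ (i : Fin 10) (κ : ℝ), |κ| = 1 ∧ ∀ (v : V d) z y,
      z a * pdtx b v z y + η * z b * pdtx a v z y = κ * gtF (Sum.inl i) v z y := by
  rcases h with ⟨rfl, hb, rfl⟩ | ⟨ha, hb, hab, rfl⟩
  · fin_cases b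
    · simp at hb
    · exact ⟨7, 1, by simp, fun v z y => by simp [gtF, GammaField, pdtx, pd]; ring⟩
    · exact ⟨8, 1, by simp, fun v z y => by simp [gtF, GammaField, pdtx, pd]; ring⟩
    · exact ⟨9, 1, by simp, fun v z y => by simp [gtF, GammaField, pdtx, pd]; ring⟩
  · fin_cases a <;> fin_cases b <;> simp at ha hb hab
    · exact ⟨4, 1, by simp, fun v z y => by simp [gtF, GammaField, pdtx, pd]; ring⟩
    · exact ⟨5, 1, by simp, fun v z y => by simp [gtF, GammaField, pdtx, pd]; ring⟩
    · exact ⟨4, -1, by simp, fun v z y => by simp [gtF, GammaField, pdtx, pd]; ring⟩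
    · exact ⟨6, 1, by simp, fun v z y => by simp [gtF, GammaField, pdtx, pd]; ring⟩
    · exact ⟨5, -1, by simp, fun v z y => by simp [gtF, GammaField, pdtx, pd]; ring⟩
    · exact ⟨6, -1, by simp, fun v z y => by simp [gtF, GammaField, pdtx, pd]; ring⟩

/-- The curve through `z` moving coordinate `b` and keeping `z a ^ 2 - η * z b ^ 2` fixed. -/
def rpath (a b : Fin 4) (η ε εa : ℝ) (z : Fin 4 → ℝ) (s : ℝ) : Fin 4 → ℝ :=
  Function.update (Function.update z b (z b - ε * s)) a
    (εa * Real.sqrt (z a ^ 2 + η * ((z b - ε * s) ^ 2 - z b ^ 2)))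

lemma AxisPair.ne {a b : Fin 4} {η : ℝ} (h : AxisPair a b η) : a ≠ b := by
  rcases h with ⟨rfl, hb, rfl⟩ | ⟨ha, hb, hab, rfl⟩
  · exact hb.symm
  · exact hab

lemma rpath_zero {a b : Fin 4} {η ε εa : ℝ} {z : Fin 4 → ℝ} (hεa : εa = 1 ∨ εa = -1)
    (hz : 0 ≤ εa * z a) : rpath a b η ε εa z 0 = z := by
  have : εa * Real.sqrt (z a ^ 2) = z a := by
    rw [Real.sqrt_sq_eq_abs]
    rcases hεa with rfl | rfl
    · rw [abs_of_nonneg (by linarith)]; ring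
    · rw [abs_of_nonpos (by linarith)]; ring
  simp [rpath, this]

lemma NN_rpath (D : SmoothDomain d) (N : ℕ) : ∃ C : ℝ, 0 < C ∧ ∀ u : V d, SmoothC u →
    ∀ (a b : Fin 4) (η : ℝ), AxisPair a b η → ∀ (z : Fin 4 → ℝ) (ε εa ℓ : ℝ),
      (ε = 1 ∨ ε = -1) → (εa = 1 ∨ εa = -1) → 0 ≤ εa * z a → 0 < ℓ →
      (∀ s ∈ Set.Icc 0 ℓ, ℓ ^ 2 ≤ z a ^ 2 + η * ((z b - ε * s) ^ 2 - z b ^ 2)) →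
      NN D N u z ≤ ENNReal.ofReal (C / ℓ) *
        ∫⁻ s in Set.Icc 0 ℓ, NN D (N + 1) u (rpath a b η ε εa z s) := by
  obtain ⟨C, hC, h⟩ := NN_of_path D N
  refine ⟨C, hC, fun u hu a b η hab z ε εa ℓ hε hεa hz hℓ hr => ?_⟩
  obtain ⟨i, κ, hκ, hi⟩ := exists_gtF_of_axisPair (d := d) hab
  have hne := hab.ne
  have hεa2 : εa * εa = 1 := by rcases hεa with rfl | rfl <;> norm_num
  have hεabs : |ε| = 1 := by rcases hε with rfl | rfl <;> simp
  have hεaabs : |εa| = 1 := by rcases hεa with rfl | rfl <;> simp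
  set ρ : ℝ → ℝ := fun s => z a ^ 2 + η * ((z b - ε * s) ^ 2 - z b ^ 2) with hρ
  have hρc : Continuous ρ := by rw [hρ]; fun_prop
  have hpos : ∀ s ∈ Set.Icc 0 ℓ, 0 < ρ s := fun s hs => lt_of_lt_of_le (by positivity) (hr s hs)
  have hcont : Continuous (rpath a b η ε εa z) := by
    unfold rpath
    refine Continuous.update (Continuous.update continuous_const b (by fun_prop)) a ?_
    exact continuous_const.mul (Real.continuous_sqrt.comp hρc)
  have h0 := h u hu i ℓ hℓ (rpath a b η ε εa z) hcont
    (fun s => -ε * κ * εa / Real.sqrt (ρ s)) ?_ ?_ ?_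
  · rwa [rpath_zero hεa hz] at h0
  · refine ContinuousOn.div continuousOn_const (Real.continuous_sqrt.comp hρc).continuousOn ?_
    intro s hs
    exact (Real.sqrt_pos.2 (hpos s hs)).ne'
  · intro s hs
    have h1 : ℓ ≤ Real.sqrt (ρ s) := Real.le_sqrt_of_sq_le (hr s hs)
    have h2 := Real.sqrt_pos.2 (hpos s hs)
    rw [abs_div, abs_mul, abs_mul, abs_neg, hεabs, hκ, hεaabs, abs_of_pos h2]
    rw [one_mul, one_mul, div_mul_eq_mul_div, one_mul]
    exact div_le_one_of_le₀ h1 h2.le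
  · intro v hv y s hs
    have h2 := Real.sqrt_pos.2 (hpos s hs)
    set γ := rpath a b η ε εa z with hγ
    have hγa : γ s a = εa * Real.sqrt (ρ s) := by simp [hγ, rpath, hρ]
    have hγb : γ s b = z b - ε * s := by simp [hγ, rpath, hne.symm]
    have hda : HasDerivAt (fun s => γ s a) (-ε * εa / Real.sqrt (ρ s) * (η * γ s b)) s := by
      have e1 : (fun s => γ s a) = fun s => εa * Real.sqrt (ρ s) := by
        funext s; simp [hγ, rpath, hρ]
      have e2 : HasDerivAt ρ (η * (2 * (z b - ε * s) * (-ε))) s := by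
        have a1 : HasDerivAt (fun s : ℝ => z b - ε * s) (-ε) s := by
          simpa using ((hasDerivAt_id s).const_mul ε).const_sub (z b)
        have a2 := ((a1.pow 2).sub_const (z b ^ 2)).const_mul η
        have a3 := a2.const_add (z a ^ 2)
        exact a3.congr_deriv (by simp)
      rw [e1]
      refine ((e2.sqrt (hpos s hs).ne').const_mul εa).congr_deriv ?_
      rw [hγb]
      field_simp
    have hdb : HasDerivAt (fun s => γ s b) (-ε) s := by
      have e1 : (fun s => γ s b) = fun s => z b - ε * s := by
        funext s; simp [hγ, rpath, hne.symm]
      rw [e1]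
      simpa using ((hasDerivAt_id s).const_mul ε).const_sub (z b)
    have hall : ∀ k, HasDerivAt (fun s => γ s k)
        (Function.update (Function.update (0 : Fin 4 → ℝ) b (-ε)) a
          (-ε * εa / Real.sqrt (ρ s) * (η * γ s b)) k) s := by
      intro k
      by_cases hka : k = a
      · subst hka; simpa using hda
      by_cases hkb : k = b
      · subst hkb; simpa [hka] using hdb
      · have e1 : (fun s => γ s k) = fun _ => z k := by
          funext s; simp [hγ, rpath, hka, hkb]
        rw [e1]
        simpa [hka, hkb] using hasDerivAt_const s (z k)
    have hfin := hasDerivAt_comp_path hv hall y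
    refine hfin.congr_deriv ?_
    have e3 : ∑ k, Function.update (Function.update (0 : Fin 4 → ℝ) b (-ε)) a
          (-ε * εa / Real.sqrt (ρ s) * (η * γ s b)) k * pdtx k v (γ s) y =
        (-ε * εa / Real.sqrt (ρ s) * (η * γ s b)) * pdtx a v (γ s) y
          + (-ε) * pdtx b v (γ s) y := by
      rw [← Finset.add_sum_erase _ _ (Finset.mem_univ a),
        ← Finset.add_sum_erase _ _ (Finset.mem_erase.2 ⟨hne.symm, Finset.mem_univ b⟩)]
      rw [Finset.sum_eq_zero]
      · simp [hne.symm]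
      · intro k hk
        simp only [Finset.mem_erase] at hk
        simp [hk.1, hk.2.1]
    rw [e3]
    have h5 := hi v (γ s) y
    have h6 : -ε * κ * εa / Real.sqrt (ρ s) * gtF (Sum.inl i) v (γ s) y =
        -ε * εa / Real.sqrt (ρ s) * (κ * gtF (Sum.inl i) v (γ s) y) := by ring
    rw [h6, ← h5, hγa]
    field_simp
    linear_combination (ε * Real.sqrt (ρ s) * pdtx b v (γ s) y) * hεa2

lemma NN_flat (D : SmoothDomain d) (N : ℕ) : ∃ C : ℝ, 0 < C ∧ ∀ u : V d, SmoothC u →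
    ∀ (b : Fin 4) (z : Fin 4 → ℝ) (ε : ℝ), (ε = 1 ∨ ε = -1) →
      NN D N u z ≤ ENNReal.ofReal C *
        ∫⁻ s in Set.Icc 0 1, NN D (N + 1) u (Function.update z b (z b + ε * s)) := by
  obtain ⟨C, hC, h⟩ := NN_of_path D N
  refine ⟨C, hC, fun u hu b z ε hε => ?_⟩
  have hεabs : |ε| = 1 := by rcases hε with rfl | rfl <;> simp
  have h0 := h u hu (Fin.castLE (by omega) b) 1 one_pos
    (fun s => Function.update z b (z b + ε * s))
    (Continuous.update continuous_const b (by fun_prop)) (fun _ => ε) continuousOn_const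
    (fun s _ => by simp [hεabs]) ?_
  · simpa using h0
  · intro v hv y s _
    have hall : ∀ k, HasDerivAt (fun s => Function.update z b (z b + ε * s) k)
        (Pi.single (M := fun _ : Fin 4 => ℝ) b ε k) s := by
      intro k
      by_cases hkb : k = b
      · subst hkb
        simpa using ((hasDerivAt_id s).const_mul ε).const_add (z k)
      · simpa [hkb] using hasDerivAt_const s (z k)
    refine (hasDerivAt_comp_path hv hall y).congr_deriv ?_
    rw [Finset.sum_eq_single b]
    · congr 1
      · simp
      · symm
        rw [gtF_inl]
        simp only
        rw [Finset.sum_eq_single b]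
        · have : ∑ a, gc (Fin.castLE (by omega) b) a b *
            (Function.update z b (z b + ε * s)) a = 0 := by
            refine Finset.sum_eq_zero fun a _ => ?_
            fin_cases b <;> simp [gc]
          rw [this]
          simp [ge]
        · intro a _ hab
          have h1 : ge (Fin.castLE (by omega) b) a = 0 := by
            simp only [ge, Fin.val_castLE]
            rw [if_neg]
            intro h; exact hab (Fin.ext h.symm)
          have h2 : ∑ c, gc (Fin.castLE (by omega) b) c a *
            (Function.update z b (z b + ε * s)) c = 0 := by
            refine Finset.sum_eq_zero fun c _ => ?_
            fin_cases b <;> simp [gc]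
          rw [h1, h2]; simp
        · simp
    · intro a _ hab; simp [hab]
    · simp

lemma sq_le_integral_weight {f f' f'' : ℝ → ℝ}
    (hd : ∀ s ∈ Set.Icc (0 : ℝ) 1, HasDerivAt f (f' s) s)
    (hd' : ∀ s ∈ Set.Icc (0 : ℝ) 1, HasDerivAt f' (f'' s) s)
    (hc : ContinuousOn f'' (Set.Icc (0 : ℝ) 1)) :
    f 0 ^ 2 ≤ ∫ s in (0 : ℝ)..1, s * Real.sqrt s * (21 * (f s ^ 2 + f' s ^ 2 + f'' s ^ 2)) := by
  have hfc : ContinuousOn f (Set.Icc 0 1) := fun s hs => (hd s hs).continuousAt.continuousWithinAt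
  have hfc' : ContinuousOn f' (Set.Icc 0 1) :=
    fun s hs => (hd' s hs).continuousAt.continuousWithinAt
  have hu : Set.uIcc (0 : ℝ) 1 = Set.Icc 0 1 := Set.uIcc_of_le zero_le_one
  set g : ℝ → ℝ := fun s => 2 * f s - 4 * (1 - s) * f' s + (1 - s) ^ 2 * f'' s with hg
  have hgc : ContinuousOn g (Set.Icc 0 1) := by rw [hg]; fun_prop
  have h1 : ∀ s ∈ Set.uIcc (0 : ℝ) 1, HasDerivAt
      (fun s => s * (-2 * (1 - s) * f s + (1 - s) ^ 2 * f' s) - (1 - s) ^ 2 * f s)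
      (s * g s) s := by
    intro s hs
    rw [hu] at hs
    have a1 : HasDerivAt (fun s : ℝ => 1 - s) (-1) s := by
      simpa using (hasDerivAt_id s).const_sub 1
    have b1 := ((a1.const_mul (-2)).mul (hd s hs)).add ((a1.pow 2).mul (hd' s hs))
    have b2 := ((hasDerivAt_id s).mul b1).sub ((a1.pow 2).mul (hd s hs))
    refine b2.congr_deriv ?_
    simp only [hg, Pi.mul_apply, Pi.add_apply, Pi.pow_apply, id, Nat.cast_ofNat, Nat.add_one_sub_one,
      pow_one]
    ring
  have hic : ContinuousOn (fun s => s * g s) (Set.uIcc 0 1) := by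
    rw [hu]; fun_prop
  have h2 := intervalIntegral.integral_eq_sub_of_hasDerivAt h1 hic.intervalIntegrable
  have h3 : f 0 = ∫ s in (0 : ℝ)..1, s * g s := by
    rw [h2]; ring
  set J := ∫ s in (0 : ℝ)..1, s * Real.sqrt s * (21 * (f s ^ 2 + f' s ^ 2 + f'' s ^ 2)) with hJ
  have hJc : ContinuousOn (fun s => s * Real.sqrt s * (21 * (f s ^ 2 + f' s ^ 2 + f'' s ^ 2)))
      (Set.uIcc 0 1) := by
    rw [hu]; fun_prop
  have key : ∀ l : ℝ, 0 < l → |f 0| ≤ l / 2 + J / (2 * l) := by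
    intro l hl
    have hi1 : IntervalIntegrable (fun _ : ℝ => l / 2) volume 0 1 := intervalIntegrable_const
    have hi2 : IntervalIntegrable (fun s => 1 / (2 * l) *
        (s * Real.sqrt s * (21 * (f s ^ 2 + f' s ^ 2 + f'' s ^ 2)))) volume 0 1 :=
      (hJc.const_smul (1 / (2 * l))).intervalIntegrable
    have e1 : ∫ s in (0 : ℝ)..1, (l / 2 + 1 / (2 * l) *
        (s * Real.sqrt s * (21 * (f s ^ 2 + f' s ^ 2 + f'' s ^ 2)))) = l / 2 + J / (2 * l) := by
      rw [intervalIntegral.integral_add hi1 hi2, intervalIntegral.integral_const_mul]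
      simp
      ring
    rw [← e1, h3]
    refine (intervalIntegral.abs_integral_le_integral_abs zero_le_one).trans ?_
    refine intervalIntegral.integral_mono_on zero_le_one hic.abs.intervalIntegrable ?_ ?_
    · exact (continuousOn_const.add (hJc.const_smul (1 / (2 * l)))).intervalIntegrable
    · intro s hs
      set q := Real.sqrt s with hq
      have hq0 : 0 ≤ q := Real.sqrt_nonneg s
      have hq2 : q ^ 2 = s := Real.sq_sqrt hs.1
      have hq1 : q ≤ 1 := by rw [hq]; exact Real.sqrt_le_one.2 hs.2
      have g2 : g s ^ 2 ≤ 21 * (f s ^ 2 + f' s ^ 2 + f'' s ^ 2) := by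
        have t0 : 0 ≤ 1 - s := by linarith [hs.2]
        have t1 : 1 - s ≤ 1 := by linarith [hs.1]
        have t2 : (1 - s) ^ 2 ≤ 1 := by nlinarith
        have t3 : (1 - s) ^ 4 ≤ 1 := by nlinarith [sq_nonneg (1 - s)]
        have c1 : g s ^ 2 ≤ 21 * (f s ^ 2 + ((1 - s) * f' s) ^ 2 + ((1 - s) ^ 2 * f'' s) ^ 2) := by
          simp only [hg]
          nlinarith [sq_nonneg (4 * f s + 2 * ((1 - s) * f' s)),
            sq_nonneg (f s - 2 * ((1 - s) ^ 2 * f'' s)),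
            sq_nonneg ((1 - s) * f' s + 4 * ((1 - s) ^ 2 * f'' s))]
        have c2 : ((1 - s) * f' s) ^ 2 ≤ f' s ^ 2 := by
          rw [mul_pow]; exact mul_le_of_le_one_left (sq_nonneg _) t2
        have c3 : ((1 - s) ^ 2 * f'' s) ^ 2 ≤ f'' s ^ 2 := by
          rw [mul_pow]
          refine mul_le_of_le_one_left (sq_nonneg _) ?_
          calc ((1 - s) ^ 2) ^ 2 = (1 - s) ^ 4 := by ring
            _ ≤ 1 := t3
        linarith
      have hs0 := hs.1
      have e2 : |s * g s| ≤ l / 2 + 1 / (2 * l) * (s * q * g s ^ 2) := by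
        rw [abs_mul, abs_of_nonneg hs0]
        have e3 : l / 2 + 1 / (2 * l) * (s * q * g s ^ 2) - s * |g s| =
            1 / (2 * l) * (l ^ 2 - 2 * l * s * |g s| + s * q * |g s| ^ 2) := by
          rw [sq_abs]; field_simp; ring
        have e4 : 0 ≤ l ^ 2 - 2 * l * s * |g s| + s * q * |g s| ^ 2 := by
          generalize |g s| = G
          rw [← hq2]
          nlinarith [mul_nonneg hq0 (sq_nonneg (l - q * G)),
            mul_nonneg (sub_nonneg.2 hq1) (sq_nonneg l)]
        have := mul_nonneg (show 0 ≤ 1 / (2 * l) by positivity) e4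
        linarith
      refine e2.trans ?_
      have := mul_le_mul_of_nonneg_left g2 (show 0 ≤ 1 / (2 * l) * (s * q) by positivity)
      linarith
  by_cases h0 : f 0 = 0
  · rw [h0]
    have : 0 ≤ J := intervalIntegral.integral_nonneg zero_le_one fun s hs => by
      have := hs.1
      positivity
    simpa using this
  · have h4 := key |f 0| (abs_pos.2 h0)
    have h5 : 0 < |f 0| := abs_pos.2 h0
    have h6 : |f 0| / 2 ≤ J / (2 * |f 0|) := by linarith
    rw [le_div_iff₀ (by positivity)] at h6
    rw [← sq_abs]
    nlinarith

lemma gtF_inl_zero (v : V d) : gtF (Sum.inl 0) v = pdtx 0 v := by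
  funext z y; simp [gtF, GammaField, pdtx, pd]

/-- Second-order Sobolev inequality backwards in time. -/
lemma NN_time (D : SmoothDomain d) (N : ℕ) : ∃ C : ℝ, 0 < C ∧ ∀ u : V d, SmoothC u →
    ∀ z : Fin 4 → ℝ, NN D N u z ≤ ENNReal.ofReal C *
      ∫⁻ s in Set.Icc (0 : ℝ) 1, ENNReal.ofReal (s * Real.sqrt s) *
        NN D (N + 2) u (Function.update z 0 (z 0 - s)) := by
  obtain ⟨C, hC, h⟩ := zw_pdmix_zw_sq_le (d := d) 2 N
  refine ⟨wcard (Fin 10) N * (4 + d) * (63 * C) + 1, by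
    have := wcard_nonneg (Fin 10) N; positivity, ?_⟩
  intro u hu z
  have hw := wcard_nonneg (Fin 10) N
  set γ : ℝ → Fin 4 → ℝ := fun s => Function.update z 0 (z 0 - s) with hγd
  have hγ : Continuous γ := Continuous.update continuous_const 0 (by fun_prop)
  have hγ0 : γ 0 = z := by simp [hγd]
  have hcy : ∀ (v : V d), SmoothC v → ∀ y, Continuous fun s => v (γ s) y := fun v hv y =>
    SmoothC.continuous_comp hv hγ continuous_const
  have hgc : Continuous (fun p : ℝ × (Fin d → ℝ) =>
      (|p.1| * Real.sqrt p.1) * EE (N + 2) u (γ p.1) p.2) :=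
    (by fun_prop : Continuous fun p : ℝ × (Fin d → ℝ) => |p.1| * Real.sqrt p.1).mul
      (SmoothC.continuous_comp (smooth_EE hu (N + 2)) (hγ.comp continuous_fst) continuous_snd)
  have hder : ∀ v : V d, SmoothC v → ∀ y s,
      HasDerivAt (fun s => v (γ s) y) (-pdtx 0 v (γ s) y) s := by
    intro v hv y s
    have hall : ∀ k, HasDerivAt (fun s => γ s k) (Pi.single (M := fun _ : Fin 4 => ℝ) 0 (-1) k) s := by
      intro k
      by_cases hk : k = 0
      · subst hk
        simpa [hγd] using (hasDerivAt_id s).const_sub (z 0)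
      · simpa [hγd, hk] using hasDerivAt_const s (z k)
    refine (hasDerivAt_comp_path hv hall y).congr_deriv ?_
    rw [Finset.sum_eq_single 0]
    · simp
    · intro a _ ha; simp [ha]
    · simp
  have hc0 : 0 ≤ wcard (Fin 10) N * (4 + d) * (63 * C) + 1 := by positivity
  have main := NN_le_of_forall D (N := N) (u := u) (z := z) hc0 zero_le_one
    (g := fun s y => (|s| * Real.sqrt s) * EE (N + 2) u (γ s) y) hgc
    (fun s _ y => mul_nonneg (by positivity) (EE_nonneg _ _ _ _)) ?_
  · refine main.trans (le_of_eq ?_)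
    congr 1
    refine setLIntegral_congr_fun measurableSet_Icc fun s hs => ?_
    simp only [abs_of_nonneg hs.1]
    rw [NN, ← lintegral_const_mul]
    · refine lintegral_congr fun y => ?_
      rw [ENNReal.ofReal_mul]
      exact mul_nonneg hs.1 (Real.sqrt_nonneg _)
    · exact (SmoothC.continuous_comp (smooth_EE hu (N + 2)) continuous_const
        continuous_id).measurable.ennreal_ofReal
  intro y
  set I := ∫ s in (0 : ℝ)..1, (|s| * Real.sqrt s) * EE (N + 2) u (γ s) y with hI
  have hI0 : 0 ≤ I := intervalIntegral.integral_nonneg zero_le_one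
    fun _ _ => mul_nonneg (by positivity) (EE_nonneg _ _ _ _)
  have key : ∀ β : List (Fin 10), β.length ≤ N → ∀ j : Fin 4 ⊕ Fin d,
      (pdmix j (zw β u) z y) ^ 2 ≤ 63 * C * I := by
    intro β hβ j
    have hs := smooth_pdmix (smooth_zw hu β) j
    have h1 := sq_le_integral_weight (fun s _ => hder _ hs y s)
      (fun s _ => (hder _ (smooth_pdtx hs 0) y s).neg)
      (hcy _ (smooth_pdtx (smooth_pdtx hs 0) 0) y).neg.neg.continuousOn
    simp only [hγ0] at h1
    refine h1.trans ?_
    rw [hI, ← intervalIntegral.integral_const_mul]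
    refine intervalIntegral.integral_mono_on zero_le_one ?_ ?_ ?_
    · refine Continuous.intervalIntegrable ?_ _ _
      have c0 := hcy _ hs y
      have c1 := hcy _ (smooth_pdtx hs 0) y
      have c2 := hcy _ (smooth_pdtx (smooth_pdtx hs 0) 0) y
      fun_prop
    · refine Continuous.intervalIntegrable ?_ _ _
      have c0 := hcy _ (smooth_EE hu (N + 2)) y
      fun_prop
    · intro s hsI
      have a0 := h [] β (by simp) hβ u hu j (γ s) y
      have a1 := h [0] β (by simp) hβ u hu j (γ s) y
      have a2 := h [0, 0] β (by simp) hβ u hu j (γ s) y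
      rw [zw_nil] at a0
      rw [zw_cons, zw_nil, gtF_inl_zero] at a1
      rw [zw_cons, zw_cons, zw_nil, gtF_inl_zero, gtF_inl_zero] at a2
      rw [abs_of_nonneg hsI.1]
      have hsn := hsI.1
      have : 0 ≤ s * Real.sqrt s := by positivity
      have h3 : 21 * ((pdmix j (zw β u) (γ s) y) ^ 2 + (-pdtx 0 (pdmix j (zw β u)) (γ s) y) ^ 2 +
        (- -pdtx 0 (pdtx 0 (pdmix j (zw β u))) (γ s) y) ^ 2) ≤ 63 * C * EE (N + 2) u (γ s) y := by
        rw [neg_sq, neg_neg]; linarith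
      calc _ ≤ s * Real.sqrt s * (63 * C * EE (N + 2) u (γ s) y) :=
            mul_le_mul_of_nonneg_left h3 this
        _ = _ := by ring
  have h1 : EE N u z y ≤ wcard (Fin 10) N * ((4 + d) * (63 * C * I)) := by
    refine wsum_le_card fun β hβ => ?_
    rw [ed_eq_sum]
    refine (Finset.sum_le_sum fun j _ => key β hβ j).trans ?_
    simp
  refine h1.trans ?_
  nlinarith

lemma lintegral_sqrt_subst {a b k K : ℝ} (ha : 0 < a) (hk : 0 < a ^ 2 + k)
    (hK : ∀ s ∈ Set.Icc a b, Real.sqrt (s ^ 2 + k) ≤ K * s) (g : ℝ → ENNReal) :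
    ∫⁻ s in Set.Icc a b, g (Real.sqrt (s ^ 2 + k)) ≤ ENNReal.ofReal K *
      ∫⁻ s in Set.Icc (Real.sqrt (a ^ 2 + k)) (Real.sqrt (b ^ 2 + k)), g s := by
  by_cases hab : a ≤ b
  swap
  · simp [Set.Icc_eq_empty hab]
  have hpos : ∀ s ∈ Set.Icc a b, 0 < s ^ 2 + k := fun s hs => by
    have := hs.1; nlinarith
  have hKp : 0 ≤ K := by
    have := hK a ⟨le_rfl, hab⟩
    by_contra hneg
    have h1 := Real.sqrt_nonneg (a ^ 2 + k)
    nlinarith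
  have hinj : Set.InjOn (fun s => Real.sqrt (s ^ 2 + k)) (Set.Icc a b) := by
    intro s hs t ht hst
    have := (Real.sqrt_inj (hpos s hs).le (hpos t ht).le).1 hst
    have h1 : s ^ 2 = t ^ 2 := by linarith
    have hs0 : 0 < s := lt_of_lt_of_le ha hs.1
    have ht0 : 0 < t := lt_of_lt_of_le ha ht.1
    exact (sq_eq_sq₀ hs0.le ht0.le).1 h1
  have hder : ∀ s ∈ Set.Icc a b, HasDerivWithinAt (fun s => Real.sqrt (s ^ 2 + k))
      (s / Real.sqrt (s ^ 2 + k)) (Set.Icc a b) s := by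
    intro s hs
    have h1 : HasDerivAt (fun s : ℝ => s ^ 2 + k) (2 * s) s := by
      simpa using (hasDerivAt_pow 2 s).add_const k
    have h2 := h1.sqrt (hpos s hs).ne'
    refine (h2.congr_deriv ?_).hasDerivWithinAt
    field_simp
  have himg := lintegral_image_eq_lintegral_abs_deriv_mul measurableSet_Icc hder hinj g
  have hsub : (fun s => Real.sqrt (s ^ 2 + k)) '' Set.Icc a b ⊆
      Set.Icc (Real.sqrt (a ^ 2 + k)) (Real.sqrt (b ^ 2 + k)) := by
    rintro _ ⟨s, hs, rfl⟩
    have h1 := hs.1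
    have h2 := hs.2
    exact ⟨Real.sqrt_le_sqrt (by nlinarith), Real.sqrt_le_sqrt (by nlinarith)⟩
  calc ∫⁻ s in Set.Icc a b, g (Real.sqrt (s ^ 2 + k))
      ≤ ∫⁻ s in Set.Icc a b, ENNReal.ofReal K *
          (ENNReal.ofReal |s / Real.sqrt (s ^ 2 + k)| * g (Real.sqrt (s ^ 2 + k))) := by
        refine setLIntegral_mono' measurableSet_Icc fun s hs => ?_
        rw [← mul_assoc, ← ENNReal.ofReal_mul hKp]
        have hq := Real.sqrt_pos.2 (hpos s hs)
        have hs0 : 0 < s := lt_of_lt_of_le ha hs.1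
        have h1 : 1 ≤ K * |s / Real.sqrt (s ^ 2 + k)| := by
          rw [abs_of_pos (by positivity), ← mul_div_assoc, le_div_iff₀ hq, one_mul]
          exact hK s hs
        calc g (Real.sqrt (s ^ 2 + k)) = 1 * g (Real.sqrt (s ^ 2 + k)) := (one_mul _).symm
          _ ≤ _ := mul_le_mul_left (by simpa using ENNReal.ofReal_le_ofReal h1) _
    _ = ENNReal.ofReal K * ∫⁻ s in Set.Icc a b,
          (ENNReal.ofReal |s / Real.sqrt (s ^ 2 + k)| * g (Real.sqrt (s ^ 2 + k))) := by
        rw [lintegral_const_mul' _ _ ENNReal.ofReal_ne_top]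
    _ ≤ _ := by
        rw [← himg]
        exact mul_le_mul_right (lintegral_mono_set hsub) _

lemma lintegral_insertNth {n : ℕ} (p : Fin (n + 1)) {G : (Fin (n + 1) → ℝ) → ENNReal}
    (hG : Measurable G) :
    ∫⁻ x, G x = ∫⁻ a : ℝ, ∫⁻ x' : Fin n → ℝ, G (p.insertNth a x') := by
  have h := (volume_preserving_piFinSuccAbove (fun _ : Fin (n + 1) => ℝ) p).symm
  rw [← h.lintegral_comp hG]
  have hm := hG.comp (MeasurableEquiv.piFinSuccAbove (fun _ : Fin (n + 1) => ℝ) p).symm.measurable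
  exact lintegral_prod _ hm.aemeasurable

/-- The admissible positions reached from `a` by moving inwards over a distance at most `ℓ`. -/
def Sset (a ℓ : ℝ) : Set ℝ := {b | |b - a| ≤ ℓ ∧ b ^ 2 ≤ a ^ 2 + ℓ ^ 2}

lemma measurableSet_Sset (a ℓ : ℝ) : MeasurableSet (Sset a ℓ) := by
  refine MeasurableSet.inter ?_ ?_
  · exact measurableSet_le (f := fun b => |b - a|) (by fun_prop) measurable_const
  · exact measurableSet_le (measurable_id.pow_const 2) measurable_const

lemma self_mem_Sset (a : ℝ) {ℓ : ℝ} (hℓ : 0 ≤ ℓ) : a ∈ Sset a ℓ :=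
  ⟨by simpa using hℓ, by nlinarith [sq_nonneg ℓ]⟩

/-- The inward sign at `a`. -/
def sgn (a : ℝ) : ℝ := if 0 ≤ a then 1 else -1

lemma sgn_or (a : ℝ) : sgn a = 1 ∨ sgn a = -1 := by
  unfold sgn; split_ifs <;> simp

lemma sgn_mul_self (a : ℝ) : sgn a * a = |a| := by
  unfold sgn; split_ifs with h
  · rw [abs_of_nonneg h]; ring
  · rw [abs_of_neg (not_le.1 h)]; ring

lemma sub_sgn_mem_Sset (a : ℝ) {ℓ s : ℝ} (hs : s ∈ Set.Icc 0 ℓ) : a - sgn a * s ∈ Sset a ℓ := by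
  have h0 := hs.1
  have h1 := hs.2
  have h2 := sgn_mul_self a
  have h3 := abs_nonneg a
  have h4 : sgn a ^ 2 = 1 := by rcases sgn_or a with h | h <;> simp [h]
  constructor
  · rw [show a - sgn a * s - a = - (sgn a * s) by ring, abs_neg, abs_mul]
    rcases sgn_or a with h | h <;> simp [h, abs_of_nonneg h0, h1]
  · have : (a - sgn a * s) ^ 2 = a ^ 2 - 2 * |a| * s + s ^ 2 := by
      rw [← h2]; linear_combination s ^ 2 * h4
    rw [this]
    nlinarith [mul_nonneg h3 h0]

lemma lintegral_sub_sign (G : ℝ → ENNReal) (a : ℝ) {ε : ℝ} (hε : ε = 1 ∨ ε = -1) :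
    ∫⁻ s, G (a - ε * s) = ∫⁻ b, G b := by
  rcases hε with rfl | rfl
  · simpa using lintegral_sub_left_eq_self (μ := (volume : Measure ℝ)) G a
  · have := lintegral_add_left_eq_self (μ := (volume : Measure ℝ)) G a
    simpa using this

lemma lintegral_sub_sign_le (G : ℝ → ENNReal) (a : ℝ) {ε ℓ : ℝ} (hε : ε = 1 ∨ ε = -1)
    {A : Set ℝ} (hA : MeasurableSet A) (h : ∀ s ∈ Set.Icc 0 ℓ, a - ε * s ∈ A) :
    ∫⁻ s in Set.Icc 0 ℓ, G (a - ε * s) ≤ ∫⁻ b in A, G b := by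
  rw [← lintegral_indicator hA, ← lintegral_sub_sign _ a hε, ← lintegral_indicator measurableSet_Icc]
  refine lintegral_mono fun s => ?_
  by_cases hs : s ∈ Set.Icc 0 ℓ
  · simp [hs, h s hs]
  · simp [hs]

lemma lintegral_fin_three {G : (Fin 3 → ℝ) → ENNReal} (hG : Measurable G) :
    ∫⁻ x, G x = ∫⁻ a : ℝ, ∫⁻ b : ℝ, ∫⁻ c : ℝ, G ![a, b, c] := by
  rw [lintegral_insertNth 0 hG]
  refine lintegral_congr fun a => ?_
  have h1 : Measurable fun v : Fin 2 → ℝ => G (Fin.insertNth (α := fun _ => ℝ) 0 a v) := by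
    refine hG.comp (measurable_pi_iff.2 fun i => ?_)
    refine Fin.cases ?_ (fun j => ?_) i
    · simp
    · simpa using measurable_pi_apply j
  rw [lintegral_insertNth 0 h1]
  refine lintegral_congr fun b => ?_
  have h2 : Measurable fun v : Fin 1 → ℝ => G (Fin.insertNth (α := fun _ => ℝ) 0 a
      (Fin.insertNth (α := fun _ => ℝ) 0 b v)) := by
    refine h1.comp (measurable_pi_iff.2 fun i => ?_)
    refine Fin.cases ?_ (fun j => ?_) i
    · simp
    · simpa using measurable_pi_apply j
  rw [lintegral_insertNth 0 h2]
  refine lintegral_congr fun c => ?_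
  have : ∀ v : Fin 0 → ℝ, v = ![] := fun v => Subsingleton.elim _ _
  simp only [this]
  rw [lintegral_const]
  have hv : (volume : Measure (Fin 0 → ℝ)) Set.univ = 1 := by
    simp [volume_pi]
  rw [hv, mul_one]
  simp only [Fin.insertNth_zero']
  rfl

lemma setLIntegral_fin_three {G : (Fin 3 → ℝ) → ENNReal} (hG : Measurable G)
    {A : Fin 3 → Set ℝ} (hA : ∀ k, MeasurableSet (A k)) :
    ∫⁻ x in {x | ∀ k, x k ∈ A k}, G x =
      ∫⁻ a in A 0, ∫⁻ b in A 1, ∫⁻ c in A 2, G ![a, b, c] := by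
  have hM : MeasurableSet {x : Fin 3 → ℝ | ∀ k, x k ∈ A k} := by
    rw [Set.ofPred_forall]
    exact MeasurableSet.iInter fun k => measurable_pi_apply k (hA k)
  rw [← lintegral_indicator hM, lintegral_fin_three (hG.indicator hM),
    ← lintegral_indicator (hA 0)]
  refine lintegral_congr fun a => ?_
  by_cases ha : a ∈ A 0
  · rw [Set.indicator_of_mem ha, ← lintegral_indicator (hA 1)]
    refine lintegral_congr fun b => ?_
    by_cases hb : b ∈ A 1
    · rw [Set.indicator_of_mem hb, ← lintegral_indicator (hA 2)]
      refine lintegral_congr fun c => ?_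
      by_cases hc : c ∈ A 2
      · rw [Set.indicator_of_mem hc, Set.indicator_of_mem]
        intro k; fin_cases k <;> simpa
      · rw [Set.indicator_of_notMem hc, Set.indicator_of_notMem]
        intro h; exact hc (by simpa using h 2)
    · rw [Set.indicator_of_notMem hb]
      rw [lintegral_congr (g := 0), Pi.zero_def, lintegral_zero]
      intro c
      rw [Set.indicator_of_notMem]; · rfl
      intro h; exact hb (by simpa using h 1)
  · rw [Set.indicator_of_notMem ha]
    rw [lintegral_congr (g := 0), Pi.zero_def, lintegral_zero]
    intro b
    rw [Pi.zero_apply, lintegral_congr (g := 0), Pi.zero_def, lintegral_zero]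
    intro c
    rw [Set.indicator_of_notMem]; · rfl
    intro h; exact ha (by simpa using h 0)

lemma le_iterate_three {F0 F1 F2 F3 : (Fin 3 → ℝ) → ENNReal} (hF : Measurable F3)
    {A : Fin 3 → Set ℝ} (hA : ∀ k, MeasurableSet (A k)) {x : Fin 3 → ℝ}
    (hx : ∀ k, x k ∈ A k) {c0 c1 c2 : ENNReal} (ht1 : c1 ≠ ⊤) (ht2 : c2 ≠ ⊤)
    (h0 : ∀ x', (∀ k, x' k ∈ A k) → x' 0 = x 0 → F0 x' ≤ c0 * ∫⁻ a in A 0, F1 (Function.update x' 0 a))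
    (h1 : ∀ x', (∀ k, x' k ∈ A k) → x' 1 = x 1 → F1 x' ≤ c1 * ∫⁻ a in A 1, F2 (Function.update x' 1 a))
    (h2 : ∀ x', (∀ k, x' k ∈ A k) → x' 2 = x 2 → F2 x' ≤ c2 * ∫⁻ a in A 2, F3 (Function.update x' 2 a)) :
    F0 x ≤ c0 * c1 * c2 * ∫⁻ x' in {x | ∀ k, x k ∈ A k}, F3 x' := by
  have hup : ∀ (x : Fin 3 → ℝ) k a, (∀ k, x k ∈ A k) → a ∈ A k →
      ∀ k', Function.update x k a k' ∈ A k' := by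
    intro x k a hx ha k'
    by_cases hk : k' = k
    · subst hk; simpa using ha
    · simpa [hk] using hx k'
  rw [setLIntegral_fin_three hF hA, mul_assoc, mul_assoc]
  refine (h0 x hx rfl).trans (mul_le_mul_right ?_ _)
  rw [← lintegral_const_mul' _ _ ht2, ← lintegral_const_mul' _ _ ht1]
  refine setLIntegral_mono' (hA 0) fun a ha => ?_
  refine (h1 _ (hup x 0 a hx ha) (by simp)).trans (mul_le_mul_right ?_ _)
  rw [← lintegral_const_mul' _ _ ht2]
  refine setLIntegral_mono' (hA 1) fun b hb => ?_
  refine (h2 _ (hup _ 1 b (hup x 0 a hx ha) hb) (by simp)).trans (mul_le_mul_right (le_of_eq ?_) _)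
  refine lintegral_congr fun c => ?_
  congr 1
  ext k; fin_cases k <;> simp

/-- The point over `x` on the hyperboloid of parameter `σ`. -/
def hp (σ : ℝ) (x : Fin 3 → ℝ) : Fin 4 → ℝ := Fin.cons (Real.sqrt (σ + ∑ k, x k ^ 2)) x

lemma measurable_cons (t : ℝ) : Measurable fun x : Fin 3 → ℝ => (Fin.cons t x : Fin 4 → ℝ) := by
  refine measurable_pi_iff.2 fun i => ?_
  refine Fin.cases ?_ (fun j => ?_) i
  · simp
  · simpa using measurable_pi_apply j

lemma measurable_hp (σ : ℝ) : Measurable (hp σ) := by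
  refine measurable_pi_iff.2 fun i => ?_
  refine Fin.cases ?_ (fun j => ?_) i
  · simp only [hp, Fin.cons_zero]; fun_prop
  · simpa [hp] using measurable_pi_apply j

lemma sum_sq_update (x : Fin 3 → ℝ) (k : Fin 3) (b : ℝ) :
    ∑ j, Function.update x k b j ^ 2 = ∑ j, x j ^ 2 + (b ^ 2 - x k ^ 2) := by
  fin_cases k <;> simp [Fin.sum_univ_three, Function.update] <;> ring

lemma rpath_hp {σ : ℝ} {x : Fin 3 → ℝ} (h : 0 ≤ σ + ∑ k, x k ^ 2) (k : Fin 3) (ε s : ℝ) :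
    rpath 0 k.succ 1 ε 1 (hp σ x) s = hp σ (Function.update x k (x k - ε * s)) := by
  have h1 : (hp σ x) 0 ^ 2 = σ + ∑ k, x k ^ 2 := by simp [hp, Real.sq_sqrt h]
  have h2 : (hp σ x) k.succ = x k := by simp [hp]
  unfold rpath
  rw [h1, h2, one_mul, one_mul]
  conv_rhs => rw [hp, sum_sq_update]
  rw [hp, ← Fin.cons_update, Fin.update_cons_zero, add_assoc]

lemma NN_hp_step (D : SmoothDomain d) (N : ℕ) : ∃ C : ℝ, 0 < C ∧ ∀ u : V d, SmoothC u →
    ∀ (σ ℓ : ℝ) (x : Fin 3 → ℝ) (k : Fin 3), 0 < ℓ →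
      (∀ b ∈ Sset (x k) ℓ, ℓ ^ 2 ≤ σ + ∑ j, Function.update x k b j ^ 2) →
      NN D N u (hp σ x) ≤ ENNReal.ofReal (C / ℓ) *
        ∫⁻ b in Sset (x k) ℓ, NN D (N + 1) u (hp σ (Function.update x k b)) := by
  obtain ⟨C, hC, h⟩ := NN_rpath D N
  refine ⟨C, hC, fun u hu σ ℓ x k hℓ hb => ?_⟩
  have hx0 : 0 ≤ σ + ∑ k, x k ^ 2 := by
    have := hb (x k) (self_mem_Sset _ hℓ.le)
    rw [Function.update_eq_self] at this
    exact (sq_nonneg ℓ).trans this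
  have h1 := h u hu 0 k.succ 1 (Or.inl ⟨rfl, Fin.succ_ne_zero k, rfl⟩) (hp σ x) (sgn (x k)) 1 ℓ
    (sgn_or _) (Or.inl rfl) (by simp [hp, Real.sqrt_nonneg]) hℓ ?_
  · refine h1.trans (mul_le_mul_right ?_ _)
    simp only [rpath_hp hx0]
    exact lintegral_sub_sign_le (fun b => NN D (N + 1) u (hp σ (Function.update x k b))) (x k)
      (sgn_or _) (measurableSet_Sset _ _) fun s hs => sub_sgn_mem_Sset _ hs
  · intro s hs
    have := hb _ (sub_sgn_mem_Sset (x k) hs)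
    rw [sum_sq_update] at this
    simp only [hp, Fin.cons_zero, Fin.cons_succ, Real.sq_sqrt hx0]
    linarith

/-- Sobolev inequality along hyperboloids. -/
lemma NN_hyp (D : SmoothDomain d) (N : ℕ) : ∃ C : ℝ, 0 < C ∧ ∀ u : V d, SmoothC u →
    ∀ (σ ℓ : ℝ) (x : Fin 3 → ℝ), 0 < ℓ →
      (∀ x' : Fin 3 → ℝ, (∀ k, x' k ∈ Sset (x k) ℓ) → ℓ ^ 2 ≤ σ + ∑ j, x' j ^ 2) →
      NN D N u (hp σ x) ≤ ENNReal.ofReal (C / ℓ ^ 3) *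
        ∫⁻ x' in {x' | ∀ k, x' k ∈ Sset (x k) ℓ}, NN D (N + 3) u (hp σ x') := by
  obtain ⟨C0, hC0, h0⟩ := NN_hp_step D N
  obtain ⟨C1, hC1, h1⟩ := NN_hp_step D (N + 1)
  obtain ⟨C2, hC2, h2⟩ := NN_hp_step D (N + 2)
  refine ⟨C0 * C1 * C2, by positivity, fun u hu σ ℓ x hℓ hb => ?_⟩
  have hup : ∀ (x' : Fin 3 → ℝ) k a, (∀ k, x' k ∈ Sset (x k) ℓ) → a ∈ Sset (x k) ℓ →
      ∀ k', Function.update x' k a k' ∈ Sset (x k') ℓ := by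
    intro x' k a hx ha k'
    by_cases hk : k' = k
    · subst hk; simpa using ha
    · simpa [hk] using hx k'
  have h := le_iterate_three (F0 := fun x => NN D N u (hp σ x))
    (F1 := fun x => NN D (N + 1) u (hp σ x)) (F2 := fun x => NN D (N + 2) u (hp σ x))
    (F3 := fun x => NN D (N + 3) u (hp σ x)) ((measurable_NN D (N + 3) hu).comp (measurable_hp σ))
    (A := fun k => Sset (x k) ℓ) (fun k => measurableSet_Sset _ _) (x := x)
    (fun k => self_mem_Sset _ hℓ.le) (c0 := ENNReal.ofReal (C0 / ℓ))
    (c1 := ENNReal.ofReal (C1 / ℓ)) (c2 := ENNReal.ofReal (C2 / ℓ)) ENNReal.ofReal_ne_top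
    ENNReal.ofReal_ne_top
    (fun x' hx' he => by
      have := h0 u hu σ ℓ x' 0 hℓ (fun b hb' => hb _ (hup x' 0 b hx' (he ▸ hb')))
      rwa [he] at this)
    (fun x' hx' he => by
      have := h1 u hu σ ℓ x' 1 hℓ (fun b hb' => hb _ (hup x' 1 b hx' (he ▸ hb')))
      rwa [he] at this)
    (fun x' hx' he => by
      have := h2 u hu σ ℓ x' 2 hℓ (fun b hb' => hb _ (hup x' 2 b hx' (he ▸ hb')))
      rwa [he] at this)
  have hc : ENNReal.ofReal (C0 / ℓ) * ENNReal.ofReal (C1 / ℓ) * ENNReal.ofReal (C2 / ℓ) =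
      ENNReal.ofReal (C0 * C1 * C2 / ℓ ^ 3) := by
    rw [← ENNReal.ofReal_mul (by positivity), ← ENNReal.ofReal_mul (by positivity)]
    congr 1; field_simp
  rw [hc] at h
  exact h

/-- Sobolev inequality in `x` at fixed time. -/
lemma NN_flat_three (D : SmoothDomain d) (N : ℕ) : ∃ C : ℝ, 0 < C ∧ ∀ u : V d, SmoothC u →
    ∀ (t : ℝ) (x : Fin 3 → ℝ), NN D N u (Fin.cons t x) ≤ ENNReal.ofReal C *
        ∫⁻ x' in {x' : Fin 3 → ℝ | ∀ k, x' k ∈ Set.Icc (x k - 1) (x k + 1)},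
          NN D (N + 3) u (Fin.cons t x') := by
  obtain ⟨C0, hC0, h0⟩ := NN_flat D N
  obtain ⟨C1, hC1, h1⟩ := NN_flat D (N + 1)
  obtain ⟨C2, hC2, h2⟩ := NN_flat D (N + 2)
  refine ⟨C0 * C1 * C2, by positivity, fun u hu t x => ?_⟩
  have step : ∀ (N : ℕ) (C : ℝ), (∀ (b : Fin 4) (z : Fin 4 → ℝ) (ε : ℝ), (ε = 1 ∨ ε = -1) →
      NN D N u z ≤ ENNReal.ofReal C *
        ∫⁻ s in Set.Icc 0 1, NN D (N + 1) u (Function.update z b (z b + ε * s))) →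
      ∀ (k : Fin 3) (x' : Fin 3 → ℝ), x' k = x k → NN D N u (Fin.cons t x') ≤ ENNReal.ofReal C *
        ∫⁻ a in Set.Icc (x k - 1) (x k + 1),
          NN D (N + 1) u (Fin.cons t (Function.update x' k a)) := by
    intro N C h k x' he
    refine (h k.succ (Fin.cons t x') (-1) (Or.inr rfl)).trans (mul_le_mul_right ?_ _)
    refine le_trans (le_of_eq ?_) (lintegral_sub_sign_le
      (fun a => NN D (N + 1) u (Fin.cons t (Function.update x' k a))) (x k) (ε := 1) (ℓ := 1)
      (Or.inl rfl) measurableSet_Icc fun s hs => ?_)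
    · refine lintegral_congr fun s => ?_
      rw [Fin.cons_update, Fin.cons_succ, he]
      congr 2; ring
    · have := hs.1
      have := hs.2
      constructor <;> linarith
  have h := le_iterate_three (F0 := fun x => NN D N u (Fin.cons t x))
    (F1 := fun x => NN D (N + 1) u (Fin.cons t x)) (F2 := fun x => NN D (N + 2) u (Fin.cons t x))
    (F3 := fun x => NN D (N + 3) u (Fin.cons t x))
    ((measurable_NN D (N + 3) hu).comp (measurable_cons t))
    (A := fun k => Set.Icc (x k - 1) (x k + 1)) (fun k => measurableSet_Icc) (x := x)
    (fun k => ⟨by linarith, by linarith⟩) (c0 := ENNReal.ofReal C0)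
    (c1 := ENNReal.ofReal C1) (c2 := ENNReal.ofReal C2) ENNReal.ofReal_ne_top
    ENNReal.ofReal_ne_top
    (fun x' _ he => step N C0 (h0 u hu) 0 x' he)
    (fun x' _ he => step (N + 1) C1 (h1 u hu) 1 x' he)
    (fun x' _ he => step (N + 2) C2 (h2 u hu) 2 x' he)
  rw [ENNReal.ofReal_mul (by positivity), ENNReal.ofReal_mul (by positivity)]
  exact h

/-- The point with `p`-th spatial coordinate `a` and the other ones `b, c`. -/
def pt3 (p : Fin 3) (t a b c : ℝ) : Fin 4 → ℝ :=
  Fin.cons t (p.insertNth (α := fun _ => ℝ) a ![b, c])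

lemma update_pt3_self (p : Fin 3) (t a b c a' : ℝ) :
    Function.update (pt3 p t a b c) p.succ a' = pt3 p t a' b c := by
  unfold pt3
  rw [← Fin.cons_update]
  congr 1
  ext i
  fin_cases p <;> fin_cases i <;> rfl

lemma update_pt3_fst (p : Fin 3) (t a b c b' : ℝ) :
    Function.update (pt3 p t a b c) (p.succAbove 0).succ b' = pt3 p t a b' c := by
  unfold pt3
  rw [← Fin.cons_update]
  congr 1
  ext i
  fin_cases p <;> fin_cases i <;> rfl

lemma update_pt3_snd (p : Fin 3) (t a b c c' : ℝ) :
    Function.update (pt3 p t a b c) (p.succAbove 1).succ c' = pt3 p t a b c' := by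
  unfold pt3
  rw [← Fin.cons_update]
  congr 1
  ext i
  fin_cases p <;> fin_cases i <;> rfl

lemma pt3_self (p : Fin 3) (t a b c : ℝ) : pt3 p t a b c p.succ = a := by
  simp [pt3]

lemma pt3_fst (p : Fin 3) (t a b c : ℝ) : pt3 p t a b c (p.succAbove 0).succ = b := by
  simp [pt3]

lemma pt3_snd (p : Fin 3) (t a b c : ℝ) : pt3 p t a b c (p.succAbove 1).succ = c := by
  simp [pt3]

lemma continuous_pt3 (p : Fin 3) (t : ℝ) :
    Continuous fun q : ℝ × ℝ × ℝ => pt3 p t q.1 q.2.1 q.2.2 := by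
  refine continuous_pi fun i => ?_
  fin_cases p <;> fin_cases i <;> simp [pt3, Fin.insertNth, Fin.succAboveCases] <;> fun_prop

lemma lintegral_pt3 (p : Fin 3) (t : ℝ) {G : (Fin 4 → ℝ) → ENNReal} (hG : Measurable G) :
    ∫⁻ x : Fin 3 → ℝ, G (Fin.cons t x) = ∫⁻ a, ∫⁻ b, ∫⁻ c, G (pt3 p t a b c) := by
  refine (lintegral_insertNth p (hG.comp (measurable_cons t))).trans ?_
  refine lintegral_congr fun a => ?_
  have h1 : Measurable fun v : Fin 2 → ℝ =>
      G (Fin.cons t (p.insertNth (α := fun _ => ℝ) a v)) := by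
    refine (hG.comp (measurable_cons t)).comp (measurable_pi_iff.2 fun i => ?_)
    fin_cases p <;> fin_cases i <;> simp [Fin.insertNth, Fin.succAboveCases] <;> fun_prop
  refine (lintegral_insertNth 0 h1).trans ?_
  refine lintegral_congr fun b => ?_
  have h2 : Measurable fun v : Fin 1 → ℝ => G (Fin.cons t (p.insertNth (α := fun _ => ℝ) a
      (Fin.insertNth (α := fun _ => ℝ) 0 b v))) := by
    refine h1.comp (measurable_pi_iff.2 fun i => ?_)
    refine Fin.cases ?_ (fun j => ?_) i
    · simp
    · simpa using measurable_pi_apply j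
  rw [lintegral_insertNth 0 h2]
  refine lintegral_congr fun c => ?_
  have : ∀ v : Fin 0 → ℝ, v = ![] := fun v => Subsingleton.elim _ _
  simp only [this]
  rw [lintegral_const]
  have hv : (volume : Measure (Fin 0 → ℝ)) Set.univ = 1 := by
    simp [volume_pi]
  rw [hv, mul_one]
  simp only [Fin.insertNth_zero']
  rfl

lemma rpath_fst (p : Fin 3) (t a b c η ε εa s : ℝ) :
    rpath p.succ (p.succAbove 0).succ η ε εa (pt3 p t a b c) s =
      pt3 p t (εa * Real.sqrt (a ^ 2 + η * ((b - ε * s) ^ 2 - b ^ 2))) (b - ε * s) c := by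
  rw [rpath, pt3_self, pt3_fst, update_pt3_fst, update_pt3_self]

lemma rpath_snd (p : Fin 3) (t a b c η ε εa s : ℝ) :
    rpath p.succ (p.succAbove 1).succ η ε εa (pt3 p t a b c) s =
      pt3 p t (εa * Real.sqrt (a ^ 2 + η * ((c - ε * s) ^ 2 - c ^ 2))) b (c - ε * s) := by
  rw [rpath, pt3_self, pt3_snd, update_pt3_snd, update_pt3_self]

lemma lintegral_rotate {H : ℝ × ℝ × ℝ → ENNReal} (hH : Measurable H) (μ ν κ : Measure ℝ)
    [SFinite μ] [SFinite ν] [SFinite κ] :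
    ∫⁻ a, ∫⁻ b, ∫⁻ c, H (a, b, c) ∂κ ∂ν ∂μ = ∫⁻ b, ∫⁻ c, ∫⁻ a, H (a, b, c) ∂μ ∂κ ∂ν := by
  rw [lintegral_lintegral_swap]
  · refine lintegral_congr fun b => ?_
    rw [lintegral_lintegral_swap]
    exact (hH.comp (by fun_prop : Measurable fun q : ℝ × ℝ => (q.1, b, q.2))).aemeasurable
  · refine Measurable.aemeasurable ?_
    refine Measurable.lintegral_prod_right' (f := fun q : (ℝ × ℝ) × ℝ => H (q.1.1, q.1.2, q.2)) ?_
    exact hH.comp (by fun_prop : Measurable fun q : (ℝ × ℝ) × ℝ => (q.1.1, q.1.2, q.2))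

lemma NN_pt3 (D : SmoothDomain d) (N : ℕ) : ∃ C : ℝ, 0 < C ∧ ∀ u : V d, SmoothC u →
    ∀ (p : Fin 3) (t A b0 c0 : ℝ) (e : ℝ), (e = 1 ∨ e = -1) → 0 < A → |b0| ≤ A → |c0| ≤ A →
      NN D N u (pt3 p t (e * A) b0 c0) ≤ ENNReal.ofReal (C / A ^ 2) *
        ∫⁻ x : Fin 3 → ℝ, NN D (N + 3) u (Fin.cons t x) := by
  obtain ⟨C0, hC0, h0⟩ := NN_flat D N
  obtain ⟨C1, hC1, h1⟩ := NN_rpath D (N + 1)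
  obtain ⟨C2, hC2, h2⟩ := NN_rpath D (N + 2)
  refine ⟨8 * (C0 * C1 * C2), by positivity, fun u hu p t A b0 c0 e he hA hb0 hc0 => ?_⟩
  have he2 : e ^ 2 = 1 := by rcases he with rfl | rfl <;> norm_num
  have hee : e * e = 1 := by rw [← sq, he2]
  set ℓ := A / 2 with hℓd
  have hℓ : 0 < ℓ := by positivity
  have hne0 : p.succ ≠ (p.succAbove 0).succ := fun h =>
    Fin.succAbove_ne p 0 (Fin.succ_injective _ h).symm
  have hne1 : p.succ ≠ (p.succAbove 1).succ := fun h =>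
    Fin.succAbove_ne p 1 (Fin.succ_injective _ h).symm
  have hb2 : b0 ^ 2 ≤ A ^ 2 := sq_le_sq' (abs_le.1 hb0).1 (abs_le.1 hb0).2
  have hc2 : c0 ^ 2 ≤ A ^ 2 := sq_le_sq' (abs_le.1 hc0).1 (abs_le.1 hc0).2
  set M := NN D (N + 3) u with hM
  have hMm : Measurable M := measurable_NN D (N + 3) hu
  -- the second rotation
  have s2 : ∀ a : ℝ, A ^ 2 / 2 ≤ a ^ 2 → 0 ≤ e * a → ∀ b, NN D (N + 2) u (pt3 p t a b c0) ≤
      ENNReal.ofReal (C2 / ℓ) * ∫⁻ c in Sset c0 ℓ,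
        M (pt3 p t (e * Real.sqrt (a ^ 2 + (c0 ^ 2 - c ^ 2))) b c) := by
    intro a ha hea b
    refine (h2 u hu p.succ _ (-1) (Or.inr ⟨Fin.succ_ne_zero _, Fin.succ_ne_zero _, hne1, rfl⟩)
      (pt3 p t a b c0) (sgn c0) e ℓ (sgn_or _) he (by rwa [pt3_self]) hℓ ?_).trans
      (mul_le_mul_right ?_ _)
    · intro s hs
      rw [pt3_self, pt3_snd]
      have := (sub_sgn_mem_Sset c0 hs).2
      nlinarith
    · simp only [rpath_snd]
      refine le_trans (le_of_eq ?_) (lintegral_sub_sign_le (fun c => M (pt3 p t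
        (e * Real.sqrt (a ^ 2 + (c0 ^ 2 - c ^ 2))) b c)) c0 (sgn_or _) (measurableSet_Sset _ _)
        fun s hs => sub_sgn_mem_Sset _ hs)
      refine lintegral_congr fun s => ?_
      rw [hM]
      congr 4
      ring
  have s1 : ∀ a : ℝ, A ≤ a → NN D (N + 1) u (pt3 p t (e * a) b0 c0) ≤
      ENNReal.ofReal (C1 / ℓ) * ∫⁻ b in Sset b0 ℓ, (ENNReal.ofReal (C2 / ℓ) *
        ∫⁻ c in Sset c0 ℓ, M (pt3 p t (e * Real.sqrt (a ^ 2 + (b0 ^ 2 - b ^ 2 +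
          (c0 ^ 2 - c ^ 2)))) b c)) := by
    intro a ha
    have ha2 : A ^ 2 ≤ a ^ 2 := by nlinarith
    refine (h1 u hu p.succ _ (-1) (Or.inr ⟨Fin.succ_ne_zero _, Fin.succ_ne_zero _, hne0, rfl⟩)
      (pt3 p t (e * a) b0 c0) (sgn b0) e ℓ (sgn_or _) he ?_ hℓ ?_).trans
      (mul_le_mul_right ?_ _)
    · rw [pt3_self, ← mul_assoc, hee]; linarith
    · intro s hs
      rw [pt3_self, pt3_fst, mul_pow, he2]
      have := (sub_sgn_mem_Sset b0 hs).2
      nlinarith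
    · simp only [rpath_fst]
      refine le_trans (le_of_eq ?_) ((lintegral_sub_sign_le (ℓ := ℓ) (fun b => NN D (N + 1 + 1) u (pt3 p t
        (e * Real.sqrt (a ^ 2 + (b0 ^ 2 - b ^ 2))) b c0)) b0 (sgn_or _) (measurableSet_Sset _ _)
        fun s hs => sub_sgn_mem_Sset _ hs).trans ?_)
      · refine lintegral_congr fun s => ?_
        congr 4
        rw [mul_pow, he2]
        ring
      · refine setLIntegral_mono' (measurableSet_Sset _ _) fun b hb => ?_
        have hb' := hb.2
        have hpos : A ^ 2 / 2 ≤ a ^ 2 + (b0 ^ 2 - b ^ 2) := by nlinarith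
        have hp0 : 0 ≤ a ^ 2 + (b0 ^ 2 - b ^ 2) := le_trans (by positivity) hpos
        have hsq : (e * Real.sqrt (a ^ 2 + (b0 ^ 2 - b ^ 2))) ^ 2 = a ^ 2 + (b0 ^ 2 - b ^ 2) := by
          rw [mul_pow, he2, Real.sq_sqrt hp0, one_mul]
        refine (s2 _ (by rw [hsq]; exact hpos) ?_ b).trans (le_of_eq ?_)
        · rw [← mul_assoc, hee, one_mul]; exact Real.sqrt_nonneg _
        · rw [hsq]
          simp only [add_assoc]
  have s0 : NN D N u (pt3 p t (e * A) b0 c0) ≤ ENNReal.ofReal C0 *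
      ∫⁻ a in Set.Icc A (A + 1), NN D (N + 1) u (pt3 p t (e * a) b0 c0) := by
    refine (h0 u hu p.succ (pt3 p t (e * A) b0 c0) e he).trans (mul_le_mul_right ?_ _)
    simp only [pt3_self, update_pt3_self]
    refine le_trans (le_of_eq ?_) (lintegral_sub_sign_le (fun a =>
      NN D (N + 1) u (pt3 p t (e * a) b0 c0)) A (ε := -1) (ℓ := 1) (Or.inr rfl) measurableSet_Icc
      fun s hs => ?_)
    · refine lintegral_congr fun s => ?_
      congr 2
      ring
    · have := hs.1
      have := hs.2
      constructor <;> linarith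
  have hsubst : ∀ b ∈ Sset b0 ℓ, ∀ c ∈ Sset c0 ℓ, ∫⁻ a in Set.Icc A (A + 1),
      M (pt3 p t (e * Real.sqrt (a ^ 2 + (b0 ^ 2 - b ^ 2 + (c0 ^ 2 - c ^ 2)))) b c) ≤
      ENNReal.ofReal 2 * ∫⁻ a, M (pt3 p t a b c) := by
    intro b hb c hc
    have hb' := hb.2
    have hc' := hc.2
    refine (lintegral_sqrt_subst (K := 2) hA (by nlinarith) ?_
      (fun a => M (pt3 p t (e * a) b c))).trans (mul_le_mul_right ?_ _)
    · intro s hs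
      have hs1 := hs.1
      rw [show (2 : ℝ) * s = Real.sqrt ((2 * s) ^ 2) by rw [Real.sqrt_sq (by linarith)]]
      refine Real.sqrt_le_sqrt ?_
      nlinarith [sq_nonneg b, sq_nonneg c]
    · refine (setLIntegral_le_lintegral _ _).trans (le_of_eq ?_)
      have := lintegral_sub_sign (fun a => M (pt3 p t a b c)) 0 (ε := -e)
        (by rcases he with rfl | rfl <;> simp)
      simpa using this
  have hmeas : Measurable fun q : ℝ × ℝ × ℝ => M (pt3 p t (e * Real.sqrt (q.1 ^ 2 +
      (b0 ^ 2 - q.2.1 ^ 2 + (c0 ^ 2 - q.2.2 ^ 2)))) q.2.1 q.2.2) := by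
    refine hMm.comp ?_
    have h := continuous_pt3 p t
    have h' : Continuous fun q : ℝ × ℝ × ℝ => ((e * Real.sqrt (q.1 ^ 2 +
      (b0 ^ 2 - q.2.1 ^ 2 + (c0 ^ 2 - q.2.2 ^ 2))), q.2.1, q.2.2) : ℝ × ℝ × ℝ) := by fun_prop
    exact (h.comp h').measurable
  have hmeasM : Measurable fun q : ℝ × ℝ × ℝ => M (pt3 p t q.1 q.2.1 q.2.2) :=
    hMm.comp (continuous_pt3 p t).measurable
  calc NN D N u (pt3 p t (e * A) b0 c0)
      ≤ ENNReal.ofReal C0 * ∫⁻ a in Set.Icc A (A + 1), ENNReal.ofReal (C1 / ℓ) *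
          ∫⁻ b in Sset b0 ℓ, (ENNReal.ofReal (C2 / ℓ) *
          ∫⁻ c in Sset c0 ℓ, M (pt3 p t (e * Real.sqrt (a ^ 2 + (b0 ^ 2 - b ^ 2 +
          (c0 ^ 2 - c ^ 2)))) b c)) :=
        s0.trans (mul_le_mul_right (setLIntegral_mono' measurableSet_Icc fun a ha => s1 a ha.1) _)
    _ = ENNReal.ofReal C0 * ENNReal.ofReal (C1 / ℓ) * ENNReal.ofReal (C2 / ℓ) *
          ∫⁻ a in Set.Icc A (A + 1), ∫⁻ b in Sset b0 ℓ, ∫⁻ c in Sset c0 ℓ,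
          M (pt3 p t (e * Real.sqrt (a ^ 2 + (b0 ^ 2 - b ^ 2 + (c0 ^ 2 - c ^ 2)))) b c) := by
        simp only [lintegral_const_mul' _ _ ENNReal.ofReal_ne_top]
        ring
    _ = ENNReal.ofReal C0 * ENNReal.ofReal (C1 / ℓ) * ENNReal.ofReal (C2 / ℓ) *
          ∫⁻ b in Sset b0 ℓ, ∫⁻ c in Sset c0 ℓ, ∫⁻ a in Set.Icc A (A + 1),
          M (pt3 p t (e * Real.sqrt (a ^ 2 + (b0 ^ 2 - b ^ 2 + (c0 ^ 2 - c ^ 2)))) b c) := by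
        congr 1
        exact lintegral_rotate hmeas _ _ _
    _ ≤ ENNReal.ofReal C0 * ENNReal.ofReal (C1 / ℓ) * ENNReal.ofReal (C2 / ℓ) *
          ∫⁻ b, ∫⁻ c, ENNReal.ofReal 2 * ∫⁻ a, M (pt3 p t a b c) := by
        refine mul_le_mul_right ?_ _
        refine (setLIntegral_mono' (measurableSet_Sset _ _) fun b hb =>
          (setLIntegral_mono' (measurableSet_Sset _ _) fun c hc => hsubst b hb c hc).trans
            (setLIntegral_le_lintegral _ _)).trans (setLIntegral_le_lintegral _ _)
    _ = ENNReal.ofReal C0 * ENNReal.ofReal (C1 / ℓ) * ENNReal.ofReal (C2 / ℓ) *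
          ENNReal.ofReal 2 * ∫⁻ a, ∫⁻ b, ∫⁻ c, M (pt3 p t a b c) := by
        simp only [lintegral_const_mul' _ _ ENNReal.ofReal_ne_top]
        rw [mul_assoc _ (ENNReal.ofReal 2)]
        congr 2
        exact (lintegral_rotate hmeasM volume volume volume).symm
    _ = _ := by
        rw [lintegral_pt3 p t hMm]
        congr 1
        rw [← ENNReal.ofReal_mul (by positivity), ← ENNReal.ofReal_mul (by positivity),
          ← ENNReal.ofReal_mul (by positivity)]
        congr 1
        rw [hℓd]; field_simp; ring

/-- Sobolev inequality on spheres. -/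
lemma NN_rot (D : SmoothDomain d) (N : ℕ) : ∃ C : ℝ, 0 < C ∧ ∀ u : V d, SmoothC u →
    ∀ (t : ℝ) (x : Fin 3 → ℝ) (r : ℝ), 0 < r → r ^ 2 ≤ ∑ k, x k ^ 2 →
      NN D N u (Fin.cons t x) ≤ ENNReal.ofReal (C / r ^ 2) *
        ∫⁻ x : Fin 3 → ℝ, NN D (N + 3) u (Fin.cons t x) := by
  obtain ⟨C, hC, h⟩ := NN_pt3 D N
  refine ⟨3 * C, by positivity, fun u hu t x r hr hx => ?_⟩
  obtain ⟨p, -, hp⟩ := Finset.exists_max_image Finset.univ (fun k : Fin 3 => |x k|)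
    Finset.univ_nonempty
  have hmax : ∀ k, |x k| ≤ |x p| := fun k => hp k (Finset.mem_univ k)
  have hle : r ^ 2 ≤ 3 * |x p| ^ 2 := by
    refine hx.trans ?_
    have : ∀ k, x k ^ 2 ≤ |x p| ^ 2 := fun k => by
      rw [← sq_abs (x k)]
      exact pow_le_pow_left₀ (abs_nonneg _) (hmax k) 2
    calc ∑ k, x k ^ 2 ≤ ∑ _k : Fin 3, |x p| ^ 2 := Finset.sum_le_sum fun k _ => this k
      _ = _ := by simp
  have hA : 0 < |x p| := by
    rcases (abs_nonneg (x p)).lt_or_eq with h | h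
    · exact h
    · rw [← h] at hle; nlinarith
  have hxe : (Fin.cons t x : Fin 4 → ℝ) =
      pt3 p t (sgn (x p) * |x p|) (x (p.succAbove 0)) (x (p.succAbove 1)) := by
    have h1 : sgn (x p) * |x p| = x p := by
      rw [← sgn_mul_self, ← mul_assoc]
      rcases sgn_or (x p) with h | h <;> simp [h]
    rw [h1, pt3]
    congr 1
    ext i
    fin_cases p <;> fin_cases i <;> rfl
  rw [hxe]
  refine (h u hu p t _ _ _ _ (sgn_or _) hA (hmax _) (hmax _)).trans (mul_le_mul_left ?_ _)
  refine ENNReal.ofReal_le_ofReal ?_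
  rw [div_le_div_iff₀ (by positivity) (by positivity)]
  nlinarith

lemma deriv_smoothTransition_of_neg {s : ℝ} (h : s < 0) : deriv Real.smoothTransition s = 0 := by
  have : Real.smoothTransition =ᶠ[nhds s] fun _ => 0 := by
    filter_upwards [Iio_mem_nhds h] with x hx
    exact Real.smoothTransition.zero_of_nonpos (le_of_lt hx)
  rw [this.deriv_eq]; simp

lemma deriv_smoothTransition_of_one_lt {s : ℝ} (h : 1 < s) :
    deriv Real.smoothTransition s = 0 := by
  have : Real.smoothTransition =ᶠ[nhds s] fun _ => 1 := by
    filter_upwards [Ioi_mem_nhds h] with x hx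
    exact Real.smoothTransition.one_of_one_le (le_of_lt hx)
  rw [this.deriv_eq]; simp

lemma continuous_deriv_smoothTransition : Continuous (deriv Real.smoothTransition) :=
  (Real.smoothTransition.contDiff (n := 1)).continuous_deriv le_rfl

lemma exists_bound_deriv_smoothTransition :
    ∃ M : ℝ, 0 < M ∧ ∀ s, |deriv Real.smoothTransition s| ≤ M := by
  obtain ⟨M, hM⟩ := (isCompact_Icc (a := (0 : ℝ)) (b := 1)).exists_bound_of_continuousOn
    continuous_deriv_smoothTransition.continuousOn
  refine ⟨|M| + 1, by positivity, fun s => ?_⟩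
  by_cases h0 : s < 0
  · rw [deriv_smoothTransition_of_neg h0]; simp; positivity
  by_cases h1 : 1 < s
  · rw [deriv_smoothTransition_of_one_lt h1]; simp; positivity
  have := hM s ⟨not_lt.1 h0, not_lt.1 h1⟩
  rw [Real.norm_eq_abs] at this
  linarith [le_abs_self M]

lemma closure_eq (D : SmoothDomain d) : closure D.carrier = {y | D.defFun y ≤ 0} := by
  rw [closure_eq_self_union_frontier, D.frontier_eq]
  nth_rewrite 1 [D.carrier_eq]
  ext y
  simp [le_iff_lt_or_eq]

lemma isCompact_closure (D : SmoothDomain d) : IsCompact (closure D.carrier) :=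
  Metric.isCompact_of_isClosed_isBounded isClosed_closure D.isBounded.closure

lemma integrableOn_of_continuous (D : SmoothDomain d) {f : (Fin d → ℝ) → ℝ} (hf : Continuous f) :
    IntegrableOn f D.carrier :=
  (hf.continuousOn.integrableOn_compact (isCompact_closure D)).mono_set subset_closure

/-- The defining function, as a function on the waveguide. -/
def rho (D : SmoothDomain d) : V d := fun _ y => D.defFun y

lemma smooth_rho (D : SmoothDomain d) : SmoothC (rho D) :=
  D.defFun_smooth.comp contDiff_snd

lemma smooth_slice {u : V d} (hu : SmoothC u) (z : Fin 4 → ℝ) : ContDiff ℝ (⊤ : ℕ∞) (u z) :=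
  (smooth_un hu).comp (contDiff_const.prodMk contDiff_id)

lemma exists_dir_of_ne {l : (Fin d → ℝ) →L[ℝ] ℝ} (h : l ≠ 0) : ∃ e, 0 < l e := by
  obtain ⟨e, he⟩ : ∃ e, l e ≠ 0 := by
    by_contra! hc
    exact h (ContinuousLinearMap.ext hc)
  rcases lt_or_gt_of_ne he with h1 | h1
  · exact ⟨-e, by simpa using h1⟩
  · exact ⟨e, h1⟩

lemma abs_le_of_vanish_local (D : SmoothDomain d) {h : (Fin d → ℝ) → ℝ}
    (hs : ContDiff ℝ (⊤ : ℕ∞) h) (hv : ∀ y ∈ frontier D.carrier, h y = 0)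
    {y0 : Fin d → ℝ} (hy0 : y0 ∈ frontier D.carrier) :
    ∃ K : ℝ, ∀ᶠ y in nhds y0, y ∈ D.carrier → |h y| ≤ K * |D.defFun y| := by
  obtain ⟨e, he⟩ := exists_dir_of_ne (D.grad_ne y0 hy0)
  have hρc : Continuous D.defFun := D.defFun_smooth.continuous
  have hρd : Differentiable ℝ D.defFun := D.defFun_smooth.differentiable (by simp)
  have hhd : Differentiable ℝ h := hs.differentiable (by simp)
  set c := fderiv ℝ D.defFun y0 e / 2 with hc
  have hc0 : 0 < c := by positivity
  have hcont : Continuous fun y => fderiv ℝ D.defFun y e :=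
    (D.defFun_smooth.continuous_fderiv (by simp)).clm_apply continuous_const
  have hcont' : Continuous fun y => fderiv ℝ h y e :=
    (hs.continuous_fderiv (by simp)).clm_apply continuous_const
  have hev : ∀ᶠ y in nhds y0, c < fderiv ℝ D.defFun y e ∧
      |fderiv ℝ h y e| < |fderiv ℝ h y0 e| + 1 := by
    refine (hcont.continuousAt.eventually (lt_mem_nhds ?_)).and
      (hcont'.abs.continuousAt.eventually (gt_mem_nhds ?_))
    · rw [hc]; linarith
    · linarith
  obtain ⟨δ, hδ, hball⟩ := Metric.eventually_nhds_iff_ball.1 hev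
  have hρ0 : D.defFun y0 = 0 := by
    have := hy0; rw [D.frontier_eq] at this; exact this
  have hsmall : ∀ᶠ y in nhds y0, ‖y - y0‖ < δ / 2 ∧ |D.defFun y| / c * ‖e‖ < δ / 2 := by
    have h1 : Continuous fun y => ‖y - y0‖ := by fun_prop
    have h2 : Continuous fun y => |D.defFun y| / c * ‖e‖ := by fun_prop
    refine (h1.continuousAt.eventually (gt_mem_nhds ?_)).and
      (h2.continuousAt.eventually (gt_mem_nhds ?_))
    · simpa using hδ
    · simpa [hρ0] using hδ
  refine ⟨(|fderiv ℝ h y0 e| + 1) / c, ?_⟩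
  filter_upwards [hsmall] with y hy hyD
  have hneg : D.defFun y < 0 := by
    have := hyD; rw [D.carrier_eq] at this; exact this
  set s1 := |D.defFun y| / c with hs1
  have hs10 : 0 ≤ s1 := by positivity
  have hin : ∀ s ∈ Set.Icc 0 s1, y + s • e ∈ Metric.ball y0 δ := by
    intro s hsI
    rw [Metric.mem_ball, dist_eq_norm]
    calc ‖y + s • e - y0‖ = ‖(y - y0) + s • e‖ := by congr 1; abel
      _ ≤ ‖y - y0‖ + ‖s • e‖ := norm_add_le _ _
      _ = ‖y - y0‖ + s * ‖e‖ := by rw [norm_smul, Real.norm_of_nonneg hsI.1]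
      _ ≤ ‖y - y0‖ + s1 * ‖e‖ := by gcongr; exact hsI.2
      _ < δ := by linarith [hy.1, hy.2]
  have hder : ∀ (f : (Fin d → ℝ) → ℝ), Differentiable ℝ f → ∀ s : ℝ,
      HasDerivAt (fun s : ℝ => f (y + s • e)) (fderiv ℝ f (y + s • e) e) s := by
    intro f hf s
    have h1 : HasDerivAt (fun s : ℝ => y + s • e) e s := by
      simpa using ((hasDerivAt_id s).smul_const e).const_add y
    exact (hf _).hasFDerivAt.comp_hasDerivAt s h1
  have hmono : c * (s1 - 0) ≤ D.defFun (y + s1 • e) - D.defFun (y + (0 : ℝ) • e) := by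
    refine Convex.mul_sub_le_image_sub_of_le_deriv (convex_Icc 0 s1)
      (f := fun s : ℝ => D.defFun (y + s • e)) ?_ ?_ ?_ 0 ⟨le_rfl, hs10⟩ s1 ⟨hs10, le_rfl⟩ hs10
    · exact fun s _ => (hder _ hρd s).continuousAt.continuousWithinAt
    · exact fun s _ => (hder _ hρd s).differentiableAt.differentiableWithinAt
    · intro s hsI
      rw [interior_Icc] at hsI
      rw [(hder _ hρd s).deriv]
      exact (hball _ (hin s ⟨hsI.1.le, hsI.2.le⟩)).1.le
  have hpos : 0 ≤ D.defFun (y + s1 • e) := by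
    rw [hs1, sub_zero, mul_div_cancel₀ _ hc0.ne', zero_smul, add_zero, abs_of_neg hneg] at hmono
    rw [hs1, abs_of_neg hneg]; linarith
  obtain ⟨s, hsI, hs0⟩ : ∃ s ∈ Set.Icc 0 s1, D.defFun (y + s • e) = 0 := by
    have := intermediate_value_Icc hs10 (f := fun s : ℝ => D.defFun (y + s • e))
      (fun s _ => (hder _ hρd s).continuousAt.continuousWithinAt)
    have hm := this ⟨by simpa using hneg.le, hpos⟩
    obtain ⟨s, hs, h⟩ := hm
    exact ⟨s, hs, h⟩
  have hz : h (y + s • e) = 0 := hv _ (by rw [D.frontier_eq]; exact hs0)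
  have hmv := (convex_Icc 0 s).norm_image_sub_le_of_norm_hasDerivWithin_le
    (f := fun s : ℝ => h (y + s • e)) (f' := fun s => fderiv ℝ h (y + s • e) e)
    (C := |fderiv ℝ h y0 e| + 1)
    (fun τ hτ => (hder _ hhd τ).hasDerivWithinAt)
    (fun τ hτ => (hball _ (hin τ ⟨hτ.1, hτ.2.trans hsI.2⟩)).2.le) ⟨le_rfl, hsI.1⟩ ⟨hsI.1, le_rfl⟩
  simp only [hz, zero_smul, add_zero, zero_sub, norm_neg, sub_zero, Real.norm_eq_abs] at hmv
  rw [abs_of_nonneg hsI.1] at hmv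
  calc |h y| ≤ (|fderiv ℝ h y0 e| + 1) * s := hmv
    _ ≤ (|fderiv ℝ h y0 e| + 1) * s1 := by gcongr; exact hsI.2
    _ = _ := by rw [hs1]; ring

lemma abs_le_of_vanish (D : SmoothDomain d) {h : (Fin d → ℝ) → ℝ}
    (hs : ContDiff ℝ (⊤ : ℕ∞) h) (hv : ∀ y ∈ frontier D.carrier, h y = 0) :
    ∃ K : ℝ, 0 ≤ K ∧ ∀ y ∈ D.carrier, |h y| ≤ K * |D.defFun y| := by
  have key : ∀ s ⊆ closure D.carrier, IsCompact s →
      ∃ K : ℝ, 0 ≤ K ∧ ∀ y ∈ s ∩ D.carrier, |h y| ≤ K * |D.defFun y| := by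
    intro s hsub hsc
    refine hsc.induction_on (p := fun s => ∃ K : ℝ, 0 ≤ K ∧ ∀ y ∈ s ∩ D.carrier,
      |h y| ≤ K * |D.defFun y|) ⟨0, le_rfl, by simp⟩ ?_ ?_ ?_
    · rintro s t hst ⟨K, hK, h1⟩
      exact ⟨K, hK, fun y hy => h1 y ⟨hst hy.1, hy.2⟩⟩
    · rintro s t ⟨K, hK, h1⟩ ⟨K', hK', h2⟩
      refine ⟨K + K', by positivity, fun y hy => ?_⟩
      have h3 := abs_nonneg (D.defFun y)
      rcases hy.1 with hy1 | hy1
      · have := h1 y ⟨hy1, hy.2⟩; nlinarith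
      · have := h2 y ⟨hy1, hy.2⟩; nlinarith
    · intro y0 hy0
      have hcl := hsub hy0
      suffices hh : ∃ K : ℝ, ∀ᶠ y in nhds y0, y ∈ D.carrier → |h y| ≤ K * |D.defFun y| by
        obtain ⟨K, hK⟩ := hh
        refine ⟨_, mem_nhdsWithin_of_mem_nhds hK, |K|, abs_nonneg _, fun y hy => ?_⟩
        exact (hy.1 hy.2).trans (mul_le_mul_of_nonneg_right (le_abs_self K) (abs_nonneg _))
      rw [closure_eq_self_union_frontier] at hcl
      rcases hcl with hin | hfr
      · have hneg : D.defFun y0 < 0 := by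
          have := hin; rw [D.carrier_eq] at this; exact this
        have hc1 : Continuous D.defFun := D.defFun_smooth.continuous
        refine ⟨(|h y0| + 1) / (|D.defFun y0| / 2), ?_⟩
        have hpos : 0 < |D.defFun y0| := abs_pos.2 hneg.ne
        filter_upwards [hc1.abs.continuousAt.eventually (lt_mem_nhds
          (show |D.defFun y0| / 2 < |D.defFun y0| by linarith)),
          hs.continuous.abs.continuousAt.eventually (gt_mem_nhds
          (show |h y0| < |h y0| + 1 by linarith))] with y h1 h2 _
        rw [div_mul_eq_mul_div, le_div_iff₀ (by positivity)]
        have := abs_nonneg (h y)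
        nlinarith [abs_nonneg (h y0)]
      · exact abs_le_of_vanish_local D hs hv hfr
  obtain ⟨K, hK, h1⟩ := key _ subset_rfl (isCompact_closure D)
  exact ⟨K, hK, fun y hy => h1 y ⟨subset_closure hy, hy⟩⟩

/-- Interior cutoff functions of the domain. -/
def cut (D : SmoothDomain d) (n : ℕ) (y : Fin d → ℝ) : ℝ :=
  Real.smoothTransition (-(n * D.defFun y))

lemma contDiff_cut (D : SmoothDomain d) (n : ℕ) : ContDiff ℝ (⊤ : ℕ∞) (cut D n) := by
  have h := D.defFun_smooth
  exact Real.smoothTransition.contDiff.comp (contDiff_const.mul h).neg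

lemma cut_eq_zero (D : SmoothDomain d) (n : ℕ) {y : Fin d → ℝ} (hy : y ∉ D.carrier) :
    cut D n y = 0 := by
  have h : 0 ≤ D.defFun y := by
    rw [D.carrier_eq] at hy; exact not_lt.1 hy
  exact Real.smoothTransition.zero_of_nonpos (by have := mul_nonneg (Nat.cast_nonneg n) h; linarith)

lemma hasCompactSupport_cut (D : SmoothDomain d) (n : ℕ) : HasCompactSupport (cut D n) :=
  HasCompactSupport.intro (isCompact_closure D) fun _ hy =>
    cut_eq_zero D n fun h => hy (subset_closure h)

lemma fderiv_cut (D : SmoothDomain d) (n : ℕ) (y e : Fin d → ℝ) :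
    fderiv ℝ (cut D n) y e =
      -(n * deriv Real.smoothTransition (-(n * D.defFun y)) * fderiv ℝ D.defFun y e) := by
  have h1 : HasFDerivAt (fun y => -(n * D.defFun y)) (-((n : ℝ) • fderiv ℝ D.defFun y)) y :=
    (((D.defFun_smooth.differentiable (by simp)) y).hasFDerivAt.const_mul (n : ℝ)).neg
  have h2 : HasDerivAt Real.smoothTransition (deriv Real.smoothTransition (-(n * D.defFun y)))
      (-(n * D.defFun y)) :=
    ((Real.smoothTransition.contDiff (n := 1)).differentiable (by simp) _).hasDerivAt
  have h3 := h2.comp_hasFDerivAt y h1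
  have h4 : fderiv ℝ (cut D n) y = _ := h3.fderiv
  rw [h4]
  simp
  ring

lemma fderiv_cut_eq_zero (D : SmoothDomain d) (n : ℕ) {y : Fin d → ℝ} (hy : y ∉ D.carrier)
    (e : Fin d → ℝ) : fderiv ℝ (cut D n) y e = 0 := by
  have h : 0 ≤ D.defFun y := by
    rw [D.carrier_eq] at hy; exact not_lt.1 hy
  rw [fderiv_cut]
  have h0 : deriv Real.smoothTransition 0 = 0 := by
    have hc := continuous_deriv_smoothTransition
    have hmem : (0 : ℝ) ∈ closure (Set.Iio (0 : ℝ)) := by rw [closure_Iio]; simp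
    have hsub : Set.Iio (0 : ℝ) ⊆ {s | deriv Real.smoothTransition s = 0} :=
      fun s hs => deriv_smoothTransition_of_neg hs
    exact (closure_minimal hsub (isClosed_eq hc continuous_const)) hmem
  have : -((n : ℝ) * D.defFun y) ≤ 0 := by
    have := mul_nonneg (Nat.cast_nonneg (α := ℝ) n) h; linarith
  rcases this.lt_or_eq with h1 | h1
  · rw [deriv_smoothTransition_of_neg h1]; simp
  · rw [h1, h0]; simp

/-- **Divergence theorem** for fields tangent to the boundary. -/
lemma integral_div_eq_zero (D : SmoothDomain d) {X : Fin d → V d} (hX : ∀ i, SmoothC (X i))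
    (z : Fin 4 → ℝ) (ht : ∀ y ∈ frontier D.carrier, ∑ i, X i z y * pdy i (rho D) z y = 0) :
    ∫ y in D.carrier, ∑ i, pdy i (X i) z y = 0 := by
  set h : (Fin d → ℝ) → ℝ := fun y => ∑ i, X i z y * pdy i (rho D) z y with hh
  have hhs : ContDiff ℝ (⊤ : ℕ∞) h :=
    smooth_slice (smooth_sum Finset.univ fun i => smooth_mul (hX i) (smooth_pdy (smooth_rho D) i)) z
  obtain ⟨K, hK, hKb⟩ := abs_le_of_vanish D hhs ht
  obtain ⟨M, hM, hMb⟩ := exists_bound_deriv_smoothTransition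
  set dv : (Fin d → ℝ) → ℝ := fun y => ∑ i, pdy i (X i) z y with hdv
  have hdvs : Continuous dv :=
    (smooth_slice (smooth_sum Finset.univ fun i => smooth_pdy (hX i) i) z).continuous
  have ibp : ∀ n : ℕ, ∫ y in D.carrier, cut D n y * dv y =
      ∫ y in D.carrier, n * deriv Real.smoothTransition (-(n * D.defFun y)) * h y := by
    intro n
    have hcs := hasCompactSupport_cut D n
    have hcc := (contDiff_cut D n).continuous
    have hcd := (contDiff_cut D n).differentiable (by simp)
    have e1 : ∀ i, ∫ y, cut D n y * fderiv ℝ (X i z) y (Pi.single i 1) =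
        -∫ y, fderiv ℝ (cut D n) y (Pi.single i 1) * X i z y := by
      intro i
      have hXs := smooth_slice (hX i) z
      have hc1 : Continuous fun y => fderiv ℝ (X i z) y (Pi.single i 1) :=
        (hXs.continuous_fderiv (by simp)).clm_apply continuous_const
      have hc2 : Continuous fun y => fderiv ℝ (cut D n) y (Pi.single i 1) :=
        ((contDiff_cut D n).continuous_fderiv (by simp)).clm_apply continuous_const
      refine integral_mul_fderiv_eq_neg_fderiv_mul_of_integrable ?_ ?_ ?_ (fun y _ => hcd y)
        (fun y _ => hXs.differentiable (by simp) y)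
      · exact (hc2.mul hXs.continuous).integrable_of_hasCompactSupport
          ((hcs.fderiv_apply (𝕜 := ℝ) (v := Pi.single i 1)).mul_right)
      · exact (hcc.mul hc1).integrable_of_hasCompactSupport hcs.mul_right
      · exact (hcc.mul hXs.continuous).integrable_of_hasCompactSupport hcs.mul_right
    have r1 : ∀ i, ∫ y in D.carrier, cut D n y * pdy i (X i) z y =
        ∫ y, cut D n y * fderiv ℝ (X i z) y (Pi.single i 1) := fun i =>
      setIntegral_eq_integral_of_forall_compl_eq_zero fun y hy => by simp [cut_eq_zero D n hy]
    have r2 : ∀ i, ∫ y in D.carrier, fderiv ℝ (cut D n) y (Pi.single i 1) * X i z y =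
        ∫ y, fderiv ℝ (cut D n) y (Pi.single i 1) * X i z y := fun i =>
      setIntegral_eq_integral_of_forall_compl_eq_zero fun y hy => by
        simp [fderiv_cut_eq_zero D n hy]
    have i1 : ∀ i ∈ Finset.univ, Integrable (fun y => cut D n y * pdy i (X i) z y)
        (volume.restrict D.carrier) := fun i _ =>
      integrableOn_of_continuous D (hcc.mul (smooth_slice (smooth_pdy (hX i) i) z).continuous)
    have i2 : ∀ i ∈ Finset.univ, Integrable (fun y => -(fderiv ℝ (cut D n) y (Pi.single i 1) *
        X i z y)) (volume.restrict D.carrier) := fun i _ => by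
      have hc2 : Continuous fun y => fderiv ℝ (cut D n) y (Pi.single i 1) :=
        ((contDiff_cut D n).continuous_fderiv (by simp)).clm_apply continuous_const
      exact integrableOn_of_continuous D (hc2.mul (smooth_slice (hX i) z).continuous).neg
    calc ∫ y in D.carrier, cut D n y * dv y
        = ∑ i, ∫ y in D.carrier, cut D n y * pdy i (X i) z y := by
          rw [← integral_finsetSum _ i1]; simp only [hdv, Finset.mul_sum]
      _ = ∑ i, ∫ y in D.carrier, -(fderiv ℝ (cut D n) y (Pi.single i 1) * X i z y) := by
          refine Finset.sum_congr rfl fun i _ => ?_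
          rw [r1, e1, integral_neg, r2]
      _ = _ := by
          rw [← integral_finsetSum _ i2]
          congr 1; funext y
          simp only [hh, Finset.mul_sum, fderiv_cut]
          refine Finset.sum_congr rfl fun i _ => ?_
          simp only [pdy, rho]
          ring
  have ev : ∀ y ∈ D.carrier, ∀ᶠ n : ℕ in Filter.atTop, 1 < -(n * D.defFun y) := by
    intro y hy
    have hneg : D.defFun y < 0 := by
      have := hy; rw [D.carrier_eq] at this; exact this
    obtain ⟨N, hN⟩ := exists_nat_gt (1 / (-D.defFun y))
    filter_upwards [Filter.eventually_ge_atTop N] with n hn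
    have h1 : 1 / (-D.defFun y) < n := lt_of_lt_of_le hN (by exact_mod_cast hn)
    rw [div_lt_iff₀ (by linarith)] at h1
    linarith
  have hmeas := D.isOpen.measurableSet
  have t1 : Filter.Tendsto (fun n : ℕ => ∫ y in D.carrier, cut D n y * dv y) Filter.atTop
      (nhds (∫ y in D.carrier, dv y)) := by
    refine tendsto_integral_of_dominated_convergence (fun y => |dv y|) ?_ ?_ ?_ ?_
    · exact fun n => ((contDiff_cut D n).continuous.mul hdvs).aestronglyMeasurable
    · exact integrableOn_of_continuous D hdvs.abs
    · intro n
      refine Filter.Eventually.of_forall fun y => ?_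
      rw [norm_mul, Real.norm_eq_abs, Real.norm_eq_abs]
      refine mul_le_of_le_one_left (abs_nonneg _) ?_
      rw [cut, abs_of_nonneg (Real.smoothTransition.nonneg _)]
      exact Real.smoothTransition.le_one _
    · refine (ae_restrict_iff' hmeas).2 (Filter.Eventually.of_forall fun y hy => ?_)
      refine tendsto_const_nhds.congr' ?_
      filter_upwards [ev y hy] with n hn
      rw [cut, Real.smoothTransition.one_of_one_le hn.le, one_mul]
  have t2 : Filter.Tendsto (fun n : ℕ => ∫ y in D.carrier,
      n * deriv Real.smoothTransition (-(n * D.defFun y)) * h y) Filter.atTop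
      (nhds (∫ y in D.carrier, (0 : ℝ))) := by
    refine tendsto_integral_of_dominated_convergence (fun _ => M * K) ?_ ?_ ?_ ?_
    · intro n
      have : Continuous fun y => n * deriv Real.smoothTransition (-(n * D.defFun y)) * h y :=
        (continuous_const.mul (continuous_deriv_smoothTransition.comp
          (continuous_const.mul D.defFun_smooth.continuous).neg)).mul hhs.continuous
      exact this.aestronglyMeasurable
    · exact integrableOn_of_continuous D continuous_const
    · intro n
      refine (ae_restrict_iff' hmeas).2 (Filter.Eventually.of_forall fun y hy => ?_)
      have hneg : D.defFun y < 0 := by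
        have := hy; rw [D.carrier_eq] at this; exact this
      rw [norm_mul, norm_mul, Real.norm_eq_abs, Real.norm_eq_abs, Real.norm_eq_abs,
        abs_of_nonneg (Nat.cast_nonneg n)]
      by_cases h1 : 1 < -(n * D.defFun y)
      · rw [deriv_smoothTransition_of_one_lt h1]; simp; positivity
      · have h2 := hKb y hy
        have h3 := hMb (-(n * D.defFun y))
        rw [abs_of_neg hneg] at h2
        push Not at h1
        calc n * |deriv Real.smoothTransition (-(n * D.defFun y))| * |h y|
            ≤ n * M * (K * -D.defFun y) := by gcongr
          _ = M * K * (-(n * D.defFun y)) := by ring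
          _ ≤ M * K * 1 := by gcongr
          _ = M * K := mul_one _
    · refine (ae_restrict_iff' hmeas).2 (Filter.Eventually.of_forall fun y hy => ?_)
      refine tendsto_const_nhds.congr' ?_
      filter_upwards [ev y hy] with n hn
      rw [deriv_smoothTransition_of_one_lt hn]; simp
  have t3 := tendsto_nhds_unique (t1.congr ibp) t2
  rw [t3]; simp

lemma pdy_mul {u v : V d} (hu : SmoothC u) (hv : SmoothC v) (i : Fin d) :
    pdy i (fun z y => u z y * v z y) = fun z y => u z y * pdy i v z y + pdy i u z y * v z y :=
  pdmix_mul hu hv (Sum.inr i)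

lemma pdy_comm {u : V d} (hu : SmoothC u) (i j : Fin d) : pdy i (pdy j u) = pdy j (pdy i u) :=
  pdmix_comm hu (Sum.inr i) (Sum.inr j)

lemma integrableOn_slice (D : SmoothDomain d) {u : V d} (hu : SmoothC u) (z : Fin 4 → ℝ) :
    IntegrableOn (u z) D.carrier :=
  integrableOn_of_continuous D (smooth_slice hu z).continuous

/-- Weak form of the Neumann condition. -/
lemma integral_grad_mul_grad (D : SmoothDomain d) {w ψ : V d} (hw : SmoothC w) (hψ : SmoothC ψ)
    {z : Fin 4 → ℝ} (hn : ∀ y ∈ frontier D.carrier, D.nder (w z) y = 0) :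
    ∫ y in D.carrier, ∑ i, pdy i w z y * pdy i ψ z y =
      -∫ y in D.carrier, (∑ i, pdy i (pdy i w) z y) * ψ z y := by
  have h := integral_div_eq_zero D (X := fun i z y => ψ z y * pdy i w z y)
    (fun i => smooth_mul hψ (smooth_pdy hw i)) z ?_
  · have hs1 : SmoothC (fun z y => ∑ i, pdy i w z y * pdy i ψ z y) :=
      smooth_sum _ fun i => smooth_mul (smooth_pdy hw i) (smooth_pdy hψ i)
    have hs2 : SmoothC (fun z y => (∑ i, pdy i (pdy i w) z y) * ψ z y) :=
      smooth_mul (smooth_sum _ fun i => smooth_pdy (smooth_pdy hw i) i) hψ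
    rw [eq_neg_iff_add_eq_zero, ← integral_add (integrableOn_slice D hs1 z)
      (integrableOn_slice D hs2 z), ← h]
    congr 1; funext y
    rw [Finset.sum_mul, ← Finset.sum_add_distrib]
    refine Finset.sum_congr rfl fun i _ => ?_
    rw [pdy_mul hψ (smooth_pdy hw i)]
    ring
  · intro y hy
    have := hn y hy
    rw [SmoothDomain.nder] at this
    rw [← mul_zero (ψ z y), ← this, Finset.mul_sum]
    refine Finset.sum_congr rfl fun i _ => ?_
    simp only [pdy, rho]
    ring

/-- The measure `dx dy` on `K × Ω`. -/
def muK (D : SmoothDomain d) (K : Set (Fin 3 → ℝ)) : Measure ((Fin 3 → ℝ) × (Fin d → ℝ)) :=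
  (volume.restrict K).prod (volume.restrict D.carrier)

/-- The integral of a function over `K × Ω` at time `τ`. -/
def IK (D : SmoothDomain d) (K : Set (Fin 3 → ℝ)) (F : V d) (τ : ℝ) : ℝ :=
  ∫ p, F (Fin.cons τ p.1) p.2 ∂(muK D K)

lemma continuous_cons_comp {F : V d} (hF : SmoothC F) :
    Continuous fun q : ℝ × (Fin 3 → ℝ) × (Fin d → ℝ) => F (Fin.cons q.1 q.2.1) q.2.2 :=
  SmoothC.continuous_comp hF (Continuous.finCons (A := fun _ => ℝ) continuous_fst
    (continuous_fst.comp continuous_snd)) (continuous_snd.comp continuous_snd)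

lemma continuous_slice_cons {F : V d} (hF : SmoothC F) (τ : ℝ) :
    Continuous fun p : (Fin 3 → ℝ) × (Fin d → ℝ) => F (Fin.cons τ p.1) p.2 :=
  (continuous_cons_comp hF).comp (continuous_const.prodMk continuous_id)

lemma muK_eq (D : SmoothDomain d) (K : Set (Fin 3 → ℝ)) :
    muK D K = volume.restrict (K ×ˢ D.carrier) := by
  rw [muK, Measure.prod_restrict]; rfl

lemma isFiniteMeasure_muK (D : SmoothDomain d) {K : Set (Fin 3 → ℝ)} (hK : IsCompact K) :
    IsFiniteMeasure (muK D K) := by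
  rw [muK_eq]
  exact isFiniteMeasure_restrict.2 ((hK.isBounded.prod D.isBounded).measure_lt_top).ne

lemma integrable_of_continuous_muK (D : SmoothDomain d) {K : Set (Fin 3 → ℝ)} (hK : IsCompact K)
    {f : (Fin 3 → ℝ) × (Fin d → ℝ) → ℝ} (hf : Continuous f) : Integrable f (muK D K) := by
  rw [muK_eq]
  exact (hf.continuousOn.integrableOn_compact (hK.prod (isCompact_closure D))).mono_set
    (Set.prod_mono le_rfl subset_closure)

lemma integrable_IK (D : SmoothDomain d) {K : Set (Fin 3 → ℝ)} (hK : IsCompact K) {F : V d}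
    (hF : SmoothC F) (τ : ℝ) : Integrable (fun p => F (Fin.cons τ p.1) p.2) (muK D K) :=
  integrable_of_continuous_muK D hK (continuous_slice_cons hF τ)

lemma ae_muK (D : SmoothDomain d) {K : Set (Fin 3 → ℝ)} (hK : IsCompact K)
    {P : (Fin 3 → ℝ) × (Fin d → ℝ) → Prop} (h : ∀ x ∈ K, ∀ y ∈ D.carrier, P (x, y)) :
    ∀ᵐ p ∂(muK D K), P p := by
  rw [muK_eq]
  refine (ae_restrict_iff' (hK.measurableSet.prod D.isOpen.measurableSet)).2
    (Filter.Eventually.of_forall fun p hp => h p.1 hp.1 p.2 hp.2)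

lemma hasDerivAt_cons_time {F : V d} (hF : SmoothC F) (τ : ℝ) (x : Fin 3 → ℝ) (y : Fin d → ℝ) :
    HasDerivAt (fun s => F (Fin.cons s x) y) (pdtx 0 F (Fin.cons τ x) y) τ := by
  have := hasDerivAt_comp_path hF (γ := fun s => Fin.cons s x)
    (γ' := Fin.cons 1 fun _ => 0) (s := τ) ?_ y
  · refine this.congr_deriv ?_
    simp [Fin.sum_univ_succ]
  · intro i
    refine Fin.cases ?_ (fun k => ?_) i
    · simpa using hasDerivAt_id' τ
    · simpa using hasDerivAt_const τ (x k)

lemma hasDerivAt_IK (D : SmoothDomain d) {K : Set (Fin 3 → ℝ)} (hK : IsCompact K) {F : V d}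
    (hF : SmoothC F) (τ : ℝ) : HasDerivAt (IK D K F) (IK D K (pdtx 0 F) τ) τ := by
  have hc := continuous_cons_comp (smooth_pdtx hF 0)
  obtain ⟨M, hM⟩ := ((isCompact_Icc (a := τ - 1) (b := τ + 1)).prod
    (hK.prod (isCompact_closure D))).exists_bound_of_continuousOn hc.continuousOn
  haveI := isFiniteMeasure_muK D hK
  have h := hasDerivAt_integral_of_dominated_loc_of_deriv_le (μ := muK D K)
    (F := fun s p => F (Fin.cons s p.1) p.2) (F' := fun s p => pdtx 0 F (Fin.cons s p.1) p.2)
    (x₀ := τ) (s := Set.Icc (τ - 1) (τ + 1)) (bound := fun _ => M)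
    (Icc_mem_nhds (by linarith) (by linarith))
    (Filter.Eventually.of_forall fun s => (continuous_slice_cons hF s).aestronglyMeasurable)
    (integrable_IK D hK hF τ)
    (continuous_slice_cons (smooth_pdtx hF 0) τ).aestronglyMeasurable
    (ae_muK D hK fun x hx y hy s hs => hM (s, x, y) ⟨hs, hx, subset_closure hy⟩)
    (integrable_const _)
    (Filter.Eventually.of_forall fun p s _ => hasDerivAt_cons_time hF s p.1 p.2)
  exact h.2

lemma continuous_IK (D : SmoothDomain d) {K : Set (Fin 3 → ℝ)} (hK : IsCompact K) {F : V d}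
    (hF : SmoothC F) : Continuous (IK D K F) :=
  continuous_iff_continuousAt.2 fun τ => (hasDerivAt_IK D hK hF τ).continuousAt

lemma IK_add (D : SmoothDomain d) {K : Set (Fin 3 → ℝ)} (hK : IsCompact K) {F G : V d}
    (hF : SmoothC F) (hG : SmoothC G) (τ : ℝ) :
    IK D K (fun z y => F z y + G z y) τ = IK D K F τ + IK D K G τ :=
  integral_add (integrable_IK D hK hF τ) (integrable_IK D hK hG τ)

lemma IK_sum (D : SmoothDomain d) {K : Set (Fin 3 → ℝ)} (hK : IsCompact K) {ι : Type*}
    (s : Finset ι) {F : ι → V d} (hF : ∀ i, SmoothC (F i)) (τ : ℝ) :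
    IK D K (fun z y => ∑ i ∈ s, F i z y) τ = ∑ i ∈ s, IK D K (F i) τ :=
  integral_finsetSum s fun i _ => integrable_IK D hK (hF i) τ

lemma IK_mono (D : SmoothDomain d) {K : Set (Fin 3 → ℝ)} (hK : IsCompact K) {F G : V d}
    (hF : SmoothC F) (hG : SmoothC G) {τ : ℝ}
    (h : ∀ x ∈ K, ∀ y, F (Fin.cons τ x) y ≤ G (Fin.cons τ x) y) : IK D K F τ ≤ IK D K G τ :=
  integral_mono_ae (integrable_IK D hK hF τ) (integrable_IK D hK hG τ)
    (ae_muK D hK fun x hx y _ => h x hx y)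

lemma IK_nonneg (D : SmoothDomain d) {K : Set (Fin 3 → ℝ)} (hK : IsCompact K) {F : V d} {τ : ℝ}
    (h : ∀ x ∈ K, ∀ y, 0 ≤ F (Fin.cons τ x) y) : 0 ≤ IK D K F τ :=
  integral_nonneg_of_ae (ae_muK D hK fun x hx y _ => h x hx y)

lemma IK_eq_iterated (D : SmoothDomain d) {K : Set (Fin 3 → ℝ)} (hK : IsCompact K) {F : V d}
    (hF : SmoothC F) (τ : ℝ) :
    IK D K F τ = ∫ x in K, ∫ y in D.carrier, F (Fin.cons τ x) y :=
  integral_prod (fun p : (Fin 3 → ℝ) × (Fin d → ℝ) => F (Fin.cons τ p.1) p.2)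
    (integrable_IK D hK hF τ)

lemma IK_eq_iterated_swap (D : SmoothDomain d) {K : Set (Fin 3 → ℝ)} (hK : IsCompact K) {F : V d}
    (hF : SmoothC F) (τ : ℝ) :
    IK D K F τ = ∫ y in D.carrier, ∫ x in K, F (Fin.cons τ x) y :=
  integral_prod_symm (fun p : (Fin 3 → ℝ) × (Fin d → ℝ) => F (Fin.cons τ p.1) p.2)
    (integrable_IK D hK hF τ)

/-- Cauchy–Schwarz. -/
lemma IK_mul_sq_le (D : SmoothDomain d) {K : Set (Fin 3 → ℝ)} (hK : IsCompact K) {F G : V d}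
    (hF : SmoothC F) (hG : SmoothC G) (τ : ℝ) :
    (IK D K (fun z y => F z y * G z y) τ) ^ 2 ≤
      IK D K (fun z y => F z y * F z y) τ * IK D K (fun z y => G z y * G z y) τ := by
  have key : ∀ s : ℝ, 0 ≤ IK D K (fun z y => F z y * F z y) τ * (s * s) +
      2 * IK D K (fun z y => F z y * G z y) τ * s + IK D K (fun z y => G z y * G z y) τ := by
    intro s
    have h : IK D K (fun z y => (s * F z y + G z y) * (s * F z y + G z y)) τ =
        IK D K (fun z y => F z y * F z y) τ * (s * s) +
      2 * IK D K (fun z y => F z y * G z y) τ * s + IK D K (fun z y => G z y * G z y) τ := by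
      unfold IK
      rw [mul_comm (2 : ℝ), mul_assoc, ← integral_mul_const, ← integral_mul_const,
        ← integral_add, ← integral_add]
      · congr 1; funext p; ring
      · exact (integrable_IK D hK (smooth_mul hF hF) τ).mul_const _ |>.add
          ((integrable_IK D hK (smooth_mul hF hG) τ).mul_const _)
      · exact integrable_IK D hK (smooth_mul hG hG) τ
      · exact (integrable_IK D hK (smooth_mul hF hF) τ).mul_const _
      · exact ((integrable_IK D hK (smooth_mul hF hG) τ).mul_const _)
    rw [← h]
    exact IK_nonneg D hK fun x _ y => mul_self_nonneg _
  have := discrim_le_zero key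
  rw [discrim] at this
  nlinarith

lemma hasFDerivAt_cons_space {F : V d} (hF : SmoothC F) (τ : ℝ) (x : Fin 3 → ℝ) (y : Fin d → ℝ)
    (k : Fin 3) :
    DifferentiableAt ℝ (fun x : Fin 3 → ℝ => F (Fin.cons τ x) y) x ∧
    fderiv ℝ (fun x : Fin 3 → ℝ => F (Fin.cons τ x) y) x (Pi.single k 1) =
      pdtx k.succ F (Fin.cons τ x) y := by
  have hcons : HasFDerivAt (fun x : Fin 3 → ℝ => (Fin.cons τ x : Fin 4 → ℝ))
      (ContinuousLinearMap.pi (Fin.cons (α := fun _ => (Fin 3 → ℝ) →L[ℝ] ℝ) 0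
        (fun k => ContinuousLinearMap.proj k))) x := by
    refine hasFDerivAt_pi'.2 fun i => ?_
    refine Fin.cases ?_ (fun k => ?_) i
    · simpa using hasFDerivAt_const τ x
    · simpa using hasFDerivAt_apply k x
  have h2 := ((diff_un hF) (Fin.cons τ x, y)).hasFDerivAt.comp x
    (hcons.prodMk (hasFDerivAt_const y x))
  have h3 : (un F ∘ fun x : Fin 3 → ℝ => ((Fin.cons τ x : Fin 4 → ℝ), y)) =
    fun x => F (Fin.cons τ x) y := rfl
  rw [h3] at h2
  refine ⟨h2.differentiableAt, ?_⟩
  rw [h2.fderiv, pdtx_eq hF]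
  simp only [ContinuousLinearMap.comp_apply, ContinuousLinearMap.prod_apply]
  congr 2
  ext i
  refine Fin.cases ?_ (fun j => ?_) i
  · simp
  · simp [Pi.single_apply]

lemma IK_pdtx_succ (D : SmoothDomain d) {K : Set (Fin 3 → ℝ)} (hK : IsCompact K) {F : V d}
    (hF : SmoothC F) {τ : ℝ} (h0 : ∀ x ∉ K, ∀ y, F (Fin.cons τ x) y = 0) (k : Fin 3) :
    IK D K (pdtx k.succ F) τ = 0 := by
  rw [IK_eq_iterated_swap D hK (smooth_pdtx hF _)]
  refine integral_eq_zero_of_ae (Filter.Eventually.of_forall fun y => ?_)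
  set f : (Fin 3 → ℝ) → ℝ := fun x => F (Fin.cons τ x) y with hf
  have hfc : Continuous f := (continuous_slice_cons hF τ).comp (continuous_id.prodMk continuous_const)
  have hgc : Continuous fun x : Fin 3 → ℝ => pdtx k.succ F (Fin.cons τ x) y :=
    (continuous_slice_cons (smooth_pdtx hF _) τ).comp (continuous_id.prodMk continuous_const)
  have hfd : Differentiable ℝ f := fun x => (hasFDerivAt_cons_space hF τ x y k).1
  have hfe : ∀ x, fderiv ℝ f x (Pi.single k 1) = pdtx k.succ F (Fin.cons τ x) y :=
    fun x => (hasFDerivAt_cons_space hF τ x y k).2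
  have hg0 : ∀ x ∉ K, pdtx k.succ F (Fin.cons τ x) y = 0 := by
    intro x hx
    rw [← hfe]
    have : f =ᶠ[nhds x] fun _ => 0 := by
      filter_upwards [hK.isClosed.isOpen_compl.mem_nhds hx] with x' hx'
      exact h0 x' hx' y
    rw [this.fderiv_eq]; simp
  change ∫ x in K, pdtx k.succ F (Fin.cons τ x) y = 0
  rw [setIntegral_eq_integral_of_forall_compl_eq_zero hg0]
  have hs : HasCompactSupport f := HasCompactSupport.intro hK fun x hx => h0 x hx y
  have hs' : HasCompactSupport fun x : Fin 3 → ℝ => pdtx k.succ F (Fin.cons τ x) y :=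
    HasCompactSupport.intro hK hg0
  have ibp := integral_mul_fderiv_eq_neg_fderiv_mul_of_integrable (μ := volume) (f := f)
    (g := fun _ : Fin 3 → ℝ => (1 : ℝ)) (v := Pi.single k 1)
    ?_ ?_ ?_ (fun x _ => hfd x) (fun x _ => differentiableAt_const _)
  · simp only [hfe] at ibp
    simpa using ibp
  · simp only [hfe, mul_one]; exact hgc.integrable_of_hasCompactSupport hs'
  · simp
  · simp only [mul_one]; exact hfc.integrable_of_hasCompactSupport hs

lemma IK_div_y (D : SmoothDomain d) {K : Set (Fin 3 → ℝ)} (hK : IsCompact K) {X : Fin d → V d}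
    (hX : ∀ i, SmoothC (X i)) (τ : ℝ)
    (hn : ∀ z, ∀ y ∈ frontier D.carrier, ∑ i, X i z y * pdy i (rho D) z y = 0) :
    IK D K (fun z y => ∑ i, pdy i (X i) z y) τ = 0 := by
  rw [IK_eq_iterated D hK (smooth_sum _ fun i => smooth_pdy (hX i) i)]
  refine integral_eq_zero_of_ae (Filter.Eventually.of_forall fun x => ?_)
  exact integral_div_eq_zero D hX _ (hn _)

lemma pdmix_ed {w : V d} (hw : SmoothC w) (a : Fin 4 ⊕ Fin d) :
    pdmix a (ed w) = fun z y => ∑ j, 2 * (pdmix j w z y * pdmix j (pdmix a w) z y) := by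
  have h : ed w = fun z y => ∑ j, pdmix j w z y * pdmix j w z y := by
    funext z y
    rw [ed_eq_sum]
    exact Finset.sum_congr rfl fun j _ => sq _
  rw [h, pdmix_sum _ fun j => smooth_mul (smooth_pdmix hw j) (smooth_pdmix hw j)]
  funext z y
  refine Finset.sum_congr rfl fun j _ => ?_
  rw [pdmix_mul (smooth_pdmix hw j) (smooth_pdmix hw j), pdmix_comm hw a j]
  ring

/-- Local conservation of energy, with a weight `ψ` independent of `y`. -/
lemma pdtx_weight_ed {w ψ : V d} (hw : SmoothC w) (hψ : SmoothC ψ)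
    (hψy : ∀ j z y, pdy j ψ z y = 0) (z : Fin 4 → ℝ) (y : Fin d → ℝ) :
    pdtx 0 (fun z y => ψ z y * ed w z y) z y =
      (pdtx 0 ψ z y * ed w z y - 2 * ∑ k : Fin 3, pdtx k.succ ψ z y *
        (pdtx 0 w z y * pdtx k.succ w z y) + 2 * (ψ z y * (pdtx 0 w z y * wBox w z y))) +
      (∑ k : Fin 3, pdtx k.succ (fun z y => 2 * (ψ z y * (pdtx 0 w z y * pdtx k.succ w z y))) z y +
      ∑ j, pdy j (fun z y => 2 * (ψ z y * (pdtx 0 w z y * pdy j w z y))) z y) := by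
  have s0 := smooth_pdtx hw 0
  have hX : ∀ a b : Fin 4 ⊕ Fin d, pdmix a (fun z y => 2 * (ψ z y * (pdtx 0 w z y * pdmix b w z y)))
      z y = 2 * (ψ z y * (pdtx 0 w z y * pdmix a (pdmix b w) z y +
        pdmix a (pdtx 0 w) z y * pdmix b w z y) +
        pdmix a ψ z y * (pdtx 0 w z y * pdmix b w z y)) := by
    intro a b
    have s1 := smooth_mul s0 (smooth_pdmix hw b)
    rw [pdmix_const_mul (smooth_mul hψ s1), pdmix_mul hψ s1, pdmix_mul s0 (smooth_pdmix hw b)]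
  have hXk : ∀ k : Fin 3, _ := fun k => hX (Sum.inl k.succ) (Sum.inl k.succ)
  have hXj : ∀ j : Fin d, _ := fun j => hX (Sum.inr j) (Sum.inr j)
  simp only [pdmix] at hXk hXj
  have hL : pdtx 0 (fun z y => ψ z y * ed w z y) z y =
      ψ z y * pdmix (Sum.inl 0) (ed w) z y + pdtx 0 ψ z y * ed w z y := by
    have := pdmix_mul hψ (smooth_ed hw) (Sum.inl 0)
    exact congrFun (congrFun this z) y
  rw [hL, pdmix_ed hw]
  simp only [hXk, hXj, hψy, wBox]
  simp only [Fintype.sum_sum_type, Fin.sum_univ_four, Fin.sum_univ_three, pdmix,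
    zero_mul, add_zero, ← Finset.mul_sum, Finset.sum_add_distrib]
  simp only [Fin.succ_zero_eq_one, Fin.succ_one_eq_two,
    show Fin.succ (2 : Fin 3) = 3 from rfl]
  have c : ∀ j, pdy j w z y * pdy j (pdtx 0 w) z y = pdy j (pdtx 0 w) z y * pdy j w z y :=
    fun j => mul_comm _ _
  simp only [c]
  ring

lemma energy_deriv (D : SmoothDomain d) {K : Set (Fin 3 → ℝ)} (hK : IsCompact K) {w ψ : V d}
    (hw : SmoothC w) (hψ : SmoothC ψ) (hψy : ∀ j z y, pdy j ψ z y = 0) (hn : NeumannBC D w)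
    {τ : ℝ} (h0 : ∀ x ∉ K, ∀ y, ψ (Fin.cons τ x) y = 0) :
    IK D K (pdtx 0 (fun z y => ψ z y * ed w z y)) τ =
      IK D K (fun z y => pdtx 0 ψ z y * ed w z y - 2 * ∑ k : Fin 3, pdtx k.succ ψ z y *
        (pdtx 0 w z y * pdtx k.succ w z y) + 2 * (ψ z y * (pdtx 0 w z y * wBox w z y))) τ := by
  have s0 := smooth_pdtx hw 0
  have hF : SmoothC (fun z y => pdtx 0 ψ z y * ed w z y - 2 * ∑ k : Fin 3, pdtx k.succ ψ z y *
        (pdtx 0 w z y * pdtx k.succ w z y) + 2 * (ψ z y * (pdtx 0 w z y * wBox w z y))) :=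
    smooth_add (smooth_sub (smooth_mul (smooth_pdtx hψ 0) (smooth_ed hw))
      (smooth_const_mul (smooth_sum _ fun k => smooth_mul (smooth_pdtx hψ _)
        (smooth_mul s0 (smooth_pdtx hw _))) 2))
      (smooth_const_mul (smooth_mul hψ (smooth_mul s0 (smooth_wBox hw))) 2)
  have hA : ∀ k : Fin 3, SmoothC
      (fun z y => 2 * (ψ z y * (pdtx 0 w z y * pdtx k.succ w z y))) := fun k =>
    smooth_const_mul (smooth_mul hψ (smooth_mul s0 (smooth_pdtx hw _))) 2
  have hB : ∀ j : Fin d, SmoothC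
      (fun z y => 2 * (ψ z y * (pdtx 0 w z y * pdy j w z y))) := fun k =>
    smooth_const_mul (smooth_mul hψ (smooth_mul s0 (smooth_pdy hw _))) 2
  have e : pdtx 0 (fun z y => ψ z y * ed w z y) = _ :=
    funext fun z => funext fun y => pdtx_weight_ed hw hψ hψy z y
  rw [e, IK_add D hK hF (smooth_add (smooth_sum _ fun k => smooth_pdtx (hA k) k.succ)
    (smooth_sum _ fun j => smooth_pdy (hB j) j)),
    IK_add D hK (smooth_sum _ fun k => smooth_pdtx (hA k) k.succ)
    (smooth_sum _ fun j => smooth_pdy (hB j) j),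
    IK_sum D hK _ fun k => smooth_pdtx (hA k) k.succ, IK_div_y D hK hB]
  · rw [Finset.sum_eq_zero, add_zero, add_zero]
    intro k _
    refine IK_pdtx_succ D hK (hA k) (fun x hx y => ?_) k
    rw [h0 x hx y]; ring
  · intro z y hy
    have := hn z y hy
    rw [SmoothDomain.nder] at this
    rw [← mul_zero (2 * (ψ z y * pdtx 0 w z y)), ← this, Finset.mul_sum]
    refine Finset.sum_congr rfl fun i _ => ?_
    simp only [pdy, rho]
    ring

lemma two_mul_sum_mul_le {a : ℝ} {p q : Fin 3 → ℝ} {c : ℝ} (hc : 0 ≤ c)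
    (hp : ∑ k, p k ^ 2 ≤ c ^ 2) :
    -(2 * ∑ k, p k * (a * q k)) ≤ c * (a ^ 2 + ∑ k, q k ^ 2) := by
  rcases hc.eq_or_lt with rfl | hc'
  · have h : ∀ k, p k = 0 := by
      intro k
      have h1 := Finset.single_le_sum (f := fun k => p k ^ 2) (fun i _ => sq_nonneg _)
        (Finset.mem_univ k)
      have : p k ^ 2 ≤ 0 := by simpa using h1.trans hp
      exact pow_eq_zero_iff (two_ne_zero) |>.1 (le_antisymm this (sq_nonneg _))
    simp [h]
  · have h2 : 0 ≤ ∑ k, (p k * a + c * q k) ^ 2 := Finset.sum_nonneg fun _ _ => sq_nonneg _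
    have h3 : ∑ k, (p k * a + c * q k) ^ 2 = a ^ 2 * ∑ k, p k ^ 2 +
        c * (2 * ∑ k, p k * (a * q k)) + c ^ 2 * ∑ k, q k ^ 2 := by
      simp only [Fin.sum_univ_three]; ring
    have h4 : a ^ 2 * ∑ k, p k ^ 2 ≤ a ^ 2 * c ^ 2 := by gcongr
    have h5 : 0 ≤ c * (c * (a ^ 2 + ∑ k, q k ^ 2) + 2 * ∑ k, p k * (a * q k)) := by nlinarith
    have := nonneg_of_mul_nonneg_right h5 hc'
    linarith

/-- The weighted energy inequality with flux term. -/
lemma energy_ineq (D : SmoothDomain d) {K : Set (Fin 3 → ℝ)} (hK : IsCompact K) {w ψ φ : V d}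
    (hw : SmoothC w) (hψ : SmoothC ψ) (hφ : SmoothC φ)
    (hψy : ∀ j z y, pdy j ψ z y = 0) (hn : NeumannBC D w)
    {τ1 τ2 A S : ℝ} (hτ : τ1 ≤ τ2)
    (h0 : ∀ τ ∈ Set.Icc τ1 τ2, ∀ x ∉ K, ∀ y, ψ (Fin.cons τ x) y = 0)
    (hψ0 : ∀ τ ∈ Set.Icc τ1 τ2, ∀ x y, 0 ≤ ψ (Fin.cons τ x) y)
    (hφ0 : ∀ τ ∈ Set.Icc τ1 τ2, ∀ x y, 0 ≤ φ (Fin.cons τ x) y)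
    (hA : 0 ≤ A) (hψA : ∀ τ ∈ Set.Icc τ1 τ2, ∀ x y, ψ (Fin.cons τ x) y ≤ A)
    (hc1 : ∀ τ ∈ Set.Icc τ1 τ2, ∀ x y,
      0 ≤ -pdtx 0 ψ (Fin.cons τ x) y - φ (Fin.cons τ x) y)
    (hc2 : ∀ τ ∈ Set.Icc τ1 τ2, ∀ x y, ∑ k : Fin 3, (pdtx k.succ ψ (Fin.cons τ x) y) ^ 2 ≤
      (-pdtx 0 ψ (Fin.cons τ x) y - φ (Fin.cons τ x) y) ^ 2)
    (hS : ∫ τ in τ1..τ2, √(IK D K (fun z y => wBox w z y * wBox w z y) τ) ≤ S) :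
    (∀ τ ∈ Set.Icc τ1 τ2, IK D K (fun z y => ψ z y * ed w z y) τ ≤
      2 * IK D K (fun z y => ψ z y * ed w z y) τ1 + 4 * A * S ^ 2) ∧
    ∫ τ in τ1..τ2, IK D K (fun z y => φ z y * ed w z y) τ ≤
      2 * IK D K (fun z y => ψ z y * ed w z y) τ1 + 4 * A * S ^ 2 := by
  set E : ℝ → ℝ := IK D K (fun z y => ψ z y * ed w z y) with hE
  set Φ : ℝ → ℝ := IK D K (fun z y => φ z y * ed w z y) with hΦ
  set g : ℝ → ℝ := fun τ => √(IK D K (fun z y => wBox w z y * wBox w z y) τ) with hg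
  have s0 := smooth_pdtx hw 0
  have sG := smooth_wBox hw
  have sE := smooth_mul hψ (smooth_ed hw)
  have sΦ := smooth_mul hφ (smooth_ed hw)
  have cE : Continuous E := continuous_IK D hK sE
  have cΦ : Continuous Φ := continuous_IK D hK sΦ
  have cg : Continuous g := (continuous_IK D hK (smooth_mul sG sG)).sqrt
  have E0 : ∀ τ ∈ Set.Icc τ1 τ2, 0 ≤ E τ := fun τ hτ =>
    IK_nonneg D hK fun x _ y => mul_nonneg (hψ0 τ hτ x y) (ed_nonneg _ _ _)
  have Φ0 : ∀ τ ∈ Set.Icc τ1 τ2, 0 ≤ Φ τ := fun τ hτ =>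
    IK_nonneg D hK fun x _ y => mul_nonneg (hφ0 τ hτ x y) (ed_nonneg _ _ _)
  have g0 : ∀ τ, 0 ≤ g τ := fun τ => Real.sqrt_nonneg _
  obtain ⟨τm, hτm, hmax⟩ := (isCompact_Icc (a := τ1) (b := τ2)).exists_isMaxOn
    (Set.nonempty_Icc.2 hτ) cE.continuousOn
  set M := E τm with hM
  have hM0 : 0 ≤ M := E0 τm hτm
  have hEd : ∀ τ, HasDerivAt E (IK D K (pdtx 0 (fun z y => ψ z y * ed w z y)) τ) τ :=
    fun τ => hasDerivAt_IK D hK sE τ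
  have hsrc : ∀ τ ∈ Set.Icc τ1 τ2,
      IK D K (fun z y => ψ z y * (pdtx 0 w z y * wBox w z y)) τ ≤ √(A * M) * g τ := by
    intro τ hτ
    have h1 := IK_mul_sq_le D hK (smooth_mul hψ s0) sG τ
    have h2 : IK D K (fun z y => ψ z y * pdtx 0 w z y * (ψ z y * pdtx 0 w z y)) τ ≤ A * M := by
      have h3 : IK D K (fun z y => ψ z y * pdtx 0 w z y * (ψ z y * pdtx 0 w z y)) τ ≤
          IK D K (fun z y => A * (ψ z y * ed w z y)) τ := by
        refine IK_mono D hK (smooth_mul (smooth_mul hψ s0) (smooth_mul hψ s0))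
          (smooth_const_mul sE A) fun x _ y => ?_
        have a1 := pdtx_sq_le_ed w (Fin.cons τ x) y 0
        have a2 := hψ0 τ hτ x y
        have a3 := hψA τ hτ x y
        calc _ = ψ (Fin.cons τ x) y * (ψ (Fin.cons τ x) y * (pdtx 0 w (Fin.cons τ x) y) ^ 2) := by
              ring
          _ ≤ _ := by gcongr
      have h4 : IK D K (fun z y => A * (ψ z y * ed w z y)) τ = A * E τ := integral_const_mul _ _
      rw [h4] at h3
      exact h3.trans (by gcongr; exact hmax hτ)
    have h5 : (IK D K (fun z y => ψ z y * (pdtx 0 w z y * wBox w z y)) τ) ^ 2 ≤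
        A * M * IK D K (fun z y => wBox w z y * wBox w z y) τ := by
      have h6 : (fun z y => ψ z y * pdtx 0 w z y * wBox w z y) =
        fun z y => ψ z y * (pdtx 0 w z y * wBox w z y) := by funext z y; ring
      rw [h6] at h1
      refine h1.trans ?_
      gcongr
      exact IK_nonneg D hK fun x _ y => mul_self_nonneg _
    rw [hg]
    beta_reduce
    rw [← Real.sqrt_mul (by positivity)]
    exact Real.le_sqrt_of_sq_le h5
  have hder : ∀ τ ∈ Set.Icc τ1 τ2, IK D K (pdtx 0 (fun z y => ψ z y * ed w z y)) τ ≤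
      -Φ τ + 2 * (√(A * M) * g τ) := by
    intro τ hτ
    rw [energy_deriv D hK hw hψ hψy hn (h0 τ hτ)]
    have sP : SmoothC (fun z y => 2 * (ψ z y * (pdtx 0 w z y * wBox w z y))) :=
      smooth_const_mul (smooth_mul hψ (smooth_mul s0 sG)) 2
    have h1 : IK D K (fun z y => pdtx 0 ψ z y * ed w z y - 2 * ∑ k : Fin 3, pdtx k.succ ψ z y *
        (pdtx 0 w z y * pdtx k.succ w z y) + 2 * (ψ z y * (pdtx 0 w z y * wBox w z y))) τ ≤
        IK D K (fun z y => (-1) * (φ z y * ed w z y) +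
          2 * (ψ z y * (pdtx 0 w z y * wBox w z y))) τ := by
      refine IK_mono D hK ?_ (smooth_add (smooth_const_mul sΦ (-1)) sP) fun x _ y => ?_
      · exact smooth_add (smooth_sub (smooth_mul (smooth_pdtx hψ 0) (smooth_ed hw))
          (smooth_const_mul (smooth_sum _ fun k => smooth_mul (smooth_pdtx hψ _)
          (smooth_mul s0 (smooth_pdtx hw _))) 2)) sP
      · have a1 := two_mul_sum_mul_le (a := pdtx 0 w (Fin.cons τ x) y)
          (p := fun k => pdtx k.succ ψ (Fin.cons τ x) y)
          (q := fun k => pdtx k.succ w (Fin.cons τ x) y) (hc1 τ hτ x y) (hc2 τ hτ x y)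
        have a2 : pdtx 0 w (Fin.cons τ x) y ^ 2 + ∑ k : Fin 3, pdtx k.succ w (Fin.cons τ x) y ^ 2
            ≤ ed w (Fin.cons τ x) y := by
          have e := Fin.sum_univ_succ fun i : Fin 4 => pdtx i w (Fin.cons τ x) y ^ 2
          rw [ed, e]
          have : 0 ≤ ∑ j : Fin d, (pdy j w (Fin.cons τ x) y) ^ 2 := by positivity
          linarith
        have a3 := mul_le_mul_of_nonneg_left a2 (hc1 τ hτ x y)
        nlinarith
    refine h1.trans ?_
    rw [IK_add D hK (smooth_const_mul sΦ (-1)) sP]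
    have e1 : IK D K (fun z y => (-1) * (φ z y * ed w z y)) τ = (-1) * Φ τ :=
      integral_const_mul _ _
    have e2 : IK D K (fun z y => 2 * (ψ z y * (pdtx 0 w z y * wBox w z y))) τ =
      2 * IK D K (fun z y => ψ z y * (pdtx 0 w z y * wBox w z y)) τ := integral_const_mul _ _
    rw [e1, e2]
    linarith [hsrc τ hτ]
  have hint : ∀ τ ∈ Set.Icc τ1 τ2,
      E τ + ∫ s in τ1..τ, Φ s ≤ E τ1 + 2 * √(A * M) * S := by
    intro τ hτ
    have e1 : ∫ s in τ1..τ, IK D K (pdtx 0 (fun z y => ψ z y * ed w z y)) s = E τ - E τ1 :=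
      intervalIntegral.integral_eq_sub_of_hasDerivAt (fun s _ => hEd s)
        ((continuous_IK D hK (smooth_pdtx sE 0)).intervalIntegrable _ _)
    have e2 : ∫ s in τ1..τ, IK D K (pdtx 0 (fun z y => ψ z y * ed w z y)) s ≤
        ∫ s in τ1..τ, (-Φ s + 2 * (√(A * M) * g s)) := by
      refine intervalIntegral.integral_mono_on hτ.1
        ((continuous_IK D hK (smooth_pdtx sE 0)).intervalIntegrable _ _)
        (Continuous.intervalIntegrable (by fun_prop) _ _) fun s hs => ?_
      exact hder s ⟨hs.1, hs.2.trans hτ.2⟩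
    rw [intervalIntegral.integral_add (f := fun s => -Φ s) (g := fun s => 2 * (√(A * M) * g s))
      (cΦ.neg.intervalIntegrable _ _)
      (Continuous.intervalIntegrable (by fun_prop) _ _), intervalIntegral.integral_neg,
      intervalIntegral.integral_const_mul, intervalIntegral.integral_const_mul] at e2
    have e3 : ∫ s in τ1..τ, g s ≤ S := by
      refine le_trans ?_ hS
      exact intervalIntegral.integral_mono_interval le_rfl hτ.1 hτ.2
        (Filter.Eventually.of_forall g0) (cg.intervalIntegrable _ _)
    have e4 : √(A * M) * ∫ s in τ1..τ, g s ≤ √(A * M) * S := by gcongr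
    linarith
  have hyoung : 2 * √(A * M) * S ≤ M / 2 + 2 * A * S ^ 2 := by
    rw [Real.sqrt_mul hA]
    nlinarith [sq_nonneg (√M - 2 * √A * S), Real.sq_sqrt hA, Real.sq_sqrt hM0]
  have hΦi : ∀ τ ∈ Set.Icc τ1 τ2, 0 ≤ ∫ s in τ1..τ, Φ s := fun τ hτ =>
    intervalIntegral.integral_nonneg hτ.1 fun s hs => Φ0 s ⟨hs.1, hs.2.trans hτ.2⟩
  have hMle : M ≤ 2 * E τ1 + 4 * A * S ^ 2 := by
    have := hint τm hτm
    have := hΦi τm hτm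
    linarith
  refine ⟨fun τ hτ => (hmax hτ).trans hMle, ?_⟩
  have h1 := hint τ2 ⟨hτ, le_rfl⟩
  have h2 := E0 τ2 ⟨hτ, le_rfl⟩
  linarith

lemma nder_zw (D : SmoothDomain d) {u : V d} (hu : SmoothC u) (hn : NeumannBC D u)
    (β : List (Fin 10)) : NeumannBC D (zw β u) := by
  induction β with
  | nil => exact hn
  | cons i β ih =>
    intro z y hy
    have h1 : ∀ z, ∑ j, pdy j (rho D) z y * pdy j (zw β u) z y = 0 := fun z => ih z y hy
    have h2 : ∀ b : Fin 4, ∑ j, pdy j (rho D) z y * pdtx b (pdy j (zw β u)) z y = 0 := by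
      intro b
      have s := fun j => smooth_pdy (smooth_zw hu β) j
      have h4 : HasDerivAt (fun τ => ∑ j, pdy j (rho D) z y *
          pdy j (zw β u) (Function.update z b τ) y)
          (∑ j, pdy j (rho D) z y * pdtx b (pdy j (zw β u)) z y) (z b) := by
        refine HasDerivAt.fun_sum fun j _ => HasDerivAt.const_mul _ ?_
        have := hasDerivAt_comp_path (s j) (γ := fun τ => Function.update z b τ)
          (γ' := Pi.single b 1) (s := z b) ?_ y
        · refine this.congr_deriv ?_
          simp [Pi.single_apply]
        · intro i
          by_cases hi : i = b
          · subst hi; simpa using hasDerivAt_id' (z i)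
          · simpa [hi] using hasDerivAt_const (z b) (z i)
      have h5 : (fun τ => ∑ j, pdy j (rho D) z y *
          pdy j (zw β u) (Function.update z b τ) y) = fun _ => 0 :=
        funext fun τ => h1 (Function.update z b τ)
      rw [h5] at h4
      exact h4.unique (hasDerivAt_const _ _)
    change ∑ j, pdy j (rho D) z y * pdy j (zw (i :: β) u) z y = 0
    have h6 : ∀ j, pdy j (zw (i :: β) u) z y =
        ∑ b : Fin 4, (ge i b + ∑ a : Fin 4, gc i a b * z a) * pdtx b (pdy j (zw β u)) z y := by
      intro j
      rw [zw_cons, pdy_gtF (smooth_zw hu β), gtF_inl]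
    simp only [h6, Finset.mul_sum]
    rw [Finset.sum_comm]
    refine Finset.sum_eq_zero fun b _ => ?_
    rw [← mul_zero (ge i b + ∑ a : Fin 4, gc i a b * z a), ← h2 b, Finset.mul_sum]
    exact Finset.sum_congr rfl fun j _ => by ring

lemma IK_weight_EE (D : SmoothDomain d) {K : Set (Fin 3 → ℝ)} (hK : IsCompact K) {u ψ : V d}
    (hu : SmoothC u) (hψ : SmoothC ψ) (N : ℕ) (τ : ℝ) :
    IK D K (fun z y => ψ z y * EE N u z y) τ =
      wsum N fun β : List (Fin 10) => IK D K (fun z y => ψ z y * ed (zw β u) z y) τ := by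
  have e : (fun z y => ψ z y * EE N u z y) = fun z y => ∑ n ∈ Finset.range (N + 1),
      ∑ σ : Fin n → Fin 10, ψ z y * ed (zw (List.ofFn σ) u) z y := by
    funext z y
    simp only [EE, wsum, Finset.mul_sum]
  have hs : ∀ n, ∀ σ : Fin n → Fin 10,
      SmoothC (fun z y => ψ z y * ed (zw (List.ofFn σ) u) z y) :=
    fun n σ => smooth_mul hψ (smooth_ed (smooth_zw hu _))
  rw [e, IK_sum D hK _ fun n => smooth_sum _ (hs n)]
  refine Finset.sum_congr rfl fun n _ => ?_
  rw [IK_sum D hK _ (hs n)]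

/-- Control of the source term over a time interval. -/
structure Src (D : SmoothDomain d) (B : ℝ) (N : ℕ) (u : V d) (t Q : ℝ) : Prop where
  nonneg : 0 ≤ Q
  sup_le : ∀ β : List (Fin 10), β.length ≤ N → ∀ K : Set (Fin 3 → ℝ), IsCompact K →
    ∀ τ ∈ Set.Icc (2 * B) t,
      τ * √(IK D K (fun z y => zw β (wBox u) z y * zw β (wBox u) z y) τ) ≤ Q
  int_le : ∀ β : List (Fin 10), β.length ≤ N → ∀ K : Set (Fin 3 → ℝ), IsCompact K →
    ∫ τ in (2 * B)..t, √(IK D K (fun z y => zw β (wBox u) z y * zw β (wBox u) z y) τ) ≤ Q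

lemma wsum_add_const {N : ℕ} {f g : List (Fin 10) → ℝ} {c : ℝ}
    (h : ∀ β, β.length ≤ N → f β ≤ 2 * g β + c) :
    wsum N f ≤ 2 * wsum N g + wcard (Fin 10) N * c := by
  have h1 := wsum_le_wsum h
  refine h1.trans (le_of_eq ?_)
  simp only [wcard, wsum, Finset.sum_add_distrib, Finset.mul_sum, Finset.sum_mul, one_mul]

/-- The weighted energy inequality for all words of length at most `N`. -/
lemma energy_ineq_EE (D : SmoothDomain d) {K : Set (Fin 3 → ℝ)} (hK : IsCompact K) {u ψ φ : V d}
    (hu : SmoothC u) (hψ : SmoothC ψ) (hφ : SmoothC φ)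
    (hψy : ∀ j z y, pdy j ψ z y = 0) (hn : NeumannBC D u) {N : ℕ}
    {τ1 τ2 A S : ℝ} (hτ : τ1 ≤ τ2)
    (h0 : ∀ τ ∈ Set.Icc τ1 τ2, ∀ x ∉ K, ∀ y, ψ (Fin.cons τ x) y = 0)
    (hψ0 : ∀ τ ∈ Set.Icc τ1 τ2, ∀ x y, 0 ≤ ψ (Fin.cons τ x) y)
    (hφ0 : ∀ τ ∈ Set.Icc τ1 τ2, ∀ x y, 0 ≤ φ (Fin.cons τ x) y)
    (hA : 0 ≤ A) (hψA : ∀ τ ∈ Set.Icc τ1 τ2, ∀ x y, ψ (Fin.cons τ x) y ≤ A)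
    (hc1 : ∀ τ ∈ Set.Icc τ1 τ2, ∀ x y,
      0 ≤ -pdtx 0 ψ (Fin.cons τ x) y - φ (Fin.cons τ x) y)
    (hc2 : ∀ τ ∈ Set.Icc τ1 τ2, ∀ x y, ∑ k : Fin 3, (pdtx k.succ ψ (Fin.cons τ x) y) ^ 2 ≤
      (-pdtx 0 ψ (Fin.cons τ x) y - φ (Fin.cons τ x) y) ^ 2)
    (hS : ∀ β : List (Fin 10), β.length ≤ N →
      ∫ τ in τ1..τ2, √(IK D K (fun z y => zw β (wBox u) z y * zw β (wBox u) z y) τ) ≤ S) :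
    (∀ τ ∈ Set.Icc τ1 τ2, IK D K (fun z y => ψ z y * EE N u z y) τ ≤
      2 * IK D K (fun z y => ψ z y * EE N u z y) τ1 + wcard (Fin 10) N * (4 * A * S ^ 2)) ∧
    ∫ τ in τ1..τ2, IK D K (fun z y => φ z y * EE N u z y) τ ≤
      2 * IK D K (fun z y => ψ z y * EE N u z y) τ1 + wcard (Fin 10) N * (4 * A * S ^ 2) := by
  have key : ∀ β : List (Fin 10), β.length ≤ N → _ := fun β hβ =>
    energy_ineq D hK (S := S) (smooth_zw hu β) hψ hφ hψy (nder_zw D hu hn β) hτ h0 hψ0 hφ0 hA hψA hc1 hc2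
      (by rw [wBox_zw hu β]; exact hS β hβ)
  constructor
  · intro τ hτ'
    rw [IK_weight_EE D hK hu hψ, IK_weight_EE D hK hu hψ]
    exact wsum_add_const fun β hβ => (key β hβ).1 τ hτ'
  · have e : (fun τ => IK D K (fun z y => φ z y * EE N u z y) τ) = fun τ =>
        ∑ n ∈ Finset.range (N + 1), ∑ σ : Fin n → Fin 10,
          IK D K (fun z y => φ z y * ed (zw (List.ofFn σ) u) z y) τ :=
      funext fun τ => IK_weight_EE D hK hu hφ N τ
    have hc : ∀ n, ∀ σ : Fin n → Fin 10, Continuous fun τ =>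
        IK D K (fun z y => φ z y * ed (zw (List.ofFn σ) u) z y) τ := fun n σ =>
      continuous_IK D hK (smooth_mul hφ (smooth_ed (smooth_zw hu _)))
    have e2 : ∫ τ in τ1..τ2, IK D K (fun z y => φ z y * EE N u z y) τ =
        wsum N fun β : List (Fin 10) =>
          ∫ τ in τ1..τ2, IK D K (fun z y => φ z y * ed (zw β u) z y) τ := by
      rw [e, intervalIntegral.integral_finsetSum
        fun n _ => (continuous_finsetSum _ fun σ _ => hc n σ).intervalIntegrable _ _]
      refine Finset.sum_congr rfl fun n _ => ?_
      rw [intervalIntegral.integral_finsetSum fun σ _ => (hc n σ).intervalIntegrable _ _]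
    rw [e2, IK_weight_EE D hK hu hψ]
    exact wsum_add_const fun β hβ => (key β hβ).2

lemma lintegral_weight_NN (D : SmoothDomain d) {K : Set (Fin 3 → ℝ)} (hK : IsCompact K) {u : V d}
    {f : (Fin 4 → ℝ) → ℝ} (hu : SmoothC u) (hf : SmoothC (fun z _ => f z : V d)) (N : ℕ) {τ : ℝ}
    (h0 : ∀ x ∉ K, f (Fin.cons τ x) = 0) (hf0 : ∀ x, 0 ≤ f (Fin.cons τ x)) :
    ∫⁻ x : Fin 3 → ℝ, ENNReal.ofReal (f (Fin.cons τ x)) * NN D N u (Fin.cons τ x) =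
      ENNReal.ofReal (IK D K (fun z y => f z * EE N u z y) τ) := by
  have hs := smooth_mul hf (smooth_EE hu N)
  have e1 : ENNReal.ofReal (IK D K (fun z y => f z * EE N u z y) τ) =
      ∫⁻ p, ENNReal.ofReal (f (Fin.cons τ p.1) * EE N u (Fin.cons τ p.1) p.2) ∂(muK D K) :=
    ofReal_integral_eq_lintegral_ofReal (integrable_IK D hK hs τ)
      (Filter.Eventually.of_forall fun p => mul_nonneg (hf0 _) (EE_nonneg _ _ _ _))
  rw [e1, muK, lintegral_prod]
  · rw [← lintegral_indicator hK.measurableSet]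
    refine lintegral_congr fun x => ?_
    by_cases hx : x ∈ K
    · rw [Set.indicator_of_mem hx, NN, ← lintegral_const_mul']
      · refine lintegral_congr fun y => ?_
        rw [ENNReal.ofReal_mul (hf0 x)]
      · exact ENNReal.ofReal_ne_top
    · rw [Set.indicator_of_notMem hx, h0 x hx]; simp
  · exact (continuous_slice_cons hs τ).measurable.ennreal_ofReal.aemeasurable

lemma pdtx_eq_of_hasDerivAt {v : V d} (hv : SmoothC v) {i : Fin 4} {z : Fin 4 → ℝ}
    {y : Fin d → ℝ} {c : ℝ} (h : HasDerivAt (fun s => v (Function.update z i s) y) c (z i)) :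
    pdtx i v z y = c := by
  have := hasDerivAt_comp_path hv (γ := fun τ => Function.update z i τ)
    (γ' := Pi.single i 1) (s := z i) ?_ y
  · have e : ∑ k, (Pi.single i 1 : Fin 4 → ℝ) k * pdtx k v (Function.update z i (z i)) y =
        pdtx i v z y := by
      simp [Pi.single_apply]
    rw [e] at this
    exact this.unique h
  · intro k
    by_cases hk : k = i
    · subst hk; simpa using hasDerivAt_id' (z k)
    · simpa [hk] using hasDerivAt_const (z i) (z k)

/-- The squared distance of the spatial part of `z` to `x₀`. -/
def dsq (x0 : Fin 3 → ℝ) (z : Fin 4 → ℝ) : ℝ := ∑ k : Fin 3, (z k.succ - x0 k) ^ 2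

/-- The argument of the cone cutoff. -/
def bumpArg (s : ℝ) (x0 : Fin 3 → ℝ) (z : Fin 4 → ℝ) : ℝ := s - z 0 - √(1 + dsq x0 z)

/-- A cutoff adapted to a backward light cone. -/
def bump (s : ℝ) (x0 : Fin 3 → ℝ) (z : Fin 4 → ℝ) : ℝ :=
  Real.smoothTransition (bumpArg s x0 z)

/-- The Lorentz square. -/
def sg (z : Fin 4 → ℝ) : ℝ := z 0 ^ 2 - ∑ k : Fin 3, z k.succ ^ 2

/-- A decreasing function of the Lorentz square. -/
def thet (a b : ℝ) (z : Fin 4 → ℝ) : ℝ := Real.pi / 2 - Real.arctan ((sg z - a) / (b - a))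

/-- Minus the derivative of `thet` in the Lorentz square. -/
def lam (a b : ℝ) (z : Fin 4 → ℝ) : ℝ := (1 + ((sg z - a) / (b - a)) ^ 2)⁻¹ * (b - a)⁻¹

lemma dsq_nonneg (x0 : Fin 3 → ℝ) (z : Fin 4 → ℝ) : 0 ≤ dsq x0 z :=
  Finset.sum_nonneg fun _ _ => sq_nonneg _

lemma contDiff_dsq (x0 : Fin 3 → ℝ) : ContDiff ℝ (⊤ : ℕ∞) (dsq x0) := by
  unfold dsq; fun_prop

lemma contDiff_sg : ContDiff ℝ (⊤ : ℕ∞) sg := by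
  unfold sg; fun_prop

lemma contDiff_bump (s : ℝ) (x0 : Fin 3 → ℝ) : ContDiff ℝ (⊤ : ℕ∞) (bump s x0) := by
  refine Real.smoothTransition.contDiff.comp ?_
  refine ContDiff.sub (by fun_prop) (ContDiff.sqrt (contDiff_const.add (contDiff_dsq x0)) ?_)
  intro z
  have := dsq_nonneg x0 z
  positivity

lemma contDiff_thet (a b : ℝ) : ContDiff ℝ (⊤ : ℕ∞) (thet a b) :=
  contDiff_const.sub (((contDiff_sg.sub contDiff_const).div_const _).arctan)

lemma contDiff_lam (a b : ℝ) : ContDiff ℝ (⊤ : ℕ∞) (lam a b) := by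
  refine ContDiff.mul (ContDiff.inv (contDiff_const.add
    (((contDiff_sg.sub contDiff_const).div_const _).pow 2)) ?_) contDiff_const
  intro z
  positivity

lemma smoothC_of_contDiff {f : (Fin 4 → ℝ) → ℝ} (hf : ContDiff ℝ (⊤ : ℕ∞) f) :
    SmoothC (fun z _ => f z : V d) := hf.comp contDiff_fst

lemma pdy_of_indep (f : (Fin 4 → ℝ) → ℝ) (j : Fin d) (z : Fin 4 → ℝ) (y : Fin d → ℝ) :
    pdy j (fun z _ => f z) z y = 0 := by
  simp [pdy]

lemma dsq_update_zero (x0 : Fin 3 → ℝ) (z : Fin 4 → ℝ) (s : ℝ) :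
    dsq x0 (Function.update z 0 s) = dsq x0 z := by
  simp [dsq]

lemma hasDerivAt_sum_sq_update (x0 : Fin 3 → ℝ) (z : Fin 4 → ℝ) (k : Fin 3) :
    HasDerivAt (fun s => ∑ j : Fin 3, (Function.update z k.succ s j.succ - x0 j) ^ 2)
      (2 * (z k.succ - x0 k)) (z k.succ) := by
  have : ∀ j : Fin 3, HasDerivAt (fun s => (Function.update z k.succ s j.succ - x0 j) ^ 2)
      (if j = k then 2 * (z k.succ - x0 k) else 0) (z k.succ) := by
    intro j
    by_cases hj : j = k
    · subst hj
      simpa using ((hasDerivAt_id' (z j.succ)).sub_const (x0 j)).fun_pow 2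
    · have : j.succ ≠ k.succ := fun h => hj (Fin.succ_injective _ h)
      simpa [this, hj] using hasDerivAt_const (z k.succ) ((z j.succ - x0 j) ^ 2)
  refine (HasDerivAt.fun_sum fun j _ => this j).congr_deriv ?_
  simp

lemma hasDerivAt_st (s : ℝ) :
    HasDerivAt Real.smoothTransition (deriv Real.smoothTransition s) s :=
  ((Real.smoothTransition.contDiff (n := 1)).differentiable (by simp) s).hasDerivAt

lemma pdtx_bump_zero (s : ℝ) (x0 : Fin 3 → ℝ) (z : Fin 4 → ℝ) (y : Fin d → ℝ) :
    pdtx 0 (fun z _ => bump s x0 z : V d) z y = -deriv Real.smoothTransition (bumpArg s x0 z) := by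
  refine pdtx_eq_of_hasDerivAt (smoothC_of_contDiff (contDiff_bump s x0)) ?_
  have e : (fun τ => bump s x0 (Function.update z 0 τ)) = fun τ =>
      Real.smoothTransition (s - τ - √(1 + dsq x0 z)) := by
    funext τ
    simp [bump, bumpArg, dsq_update_zero]
  rw [e]
  have h1 : HasDerivAt (fun τ => s - τ - √(1 + dsq x0 z)) (-1) (z 0) :=
    ((hasDerivAt_id' (z 0)).const_sub s).sub_const _
  refine ((hasDerivAt_st (bumpArg s x0 z)).comp (z 0) h1).congr_deriv ?_
  ring

lemma pdtx_bump_succ (s : ℝ) (x0 : Fin 3 → ℝ) (z : Fin 4 → ℝ) (y : Fin d → ℝ) (k : Fin 3) :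
    pdtx k.succ (fun z _ => bump s x0 z : V d) z y =
      -deriv Real.smoothTransition (bumpArg s x0 z) * ((z k.succ - x0 k) / √(1 + dsq x0 z)) := by
  refine pdtx_eq_of_hasDerivAt (smoothC_of_contDiff (contDiff_bump s x0)) ?_
  have hpos : 0 < 1 + dsq x0 z := by have := dsq_nonneg x0 z; positivity
  have hu : Function.update z k.succ (z k.succ) = z := Function.update_eq_self _ _
  have h1 : HasDerivAt (fun τ => 1 + dsq x0 (Function.update z k.succ τ))
      (2 * (z k.succ - x0 k)) (z k.succ) := (hasDerivAt_sum_sq_update x0 z k).const_add 1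
  have h2 := h1.sqrt (by rw [hu]; exact hpos.ne')
  have h3 : HasDerivAt (fun τ => bumpArg s x0 (Function.update z k.succ τ))
      (-((z k.succ - x0 k) / √(1 + dsq x0 z))) (z k.succ) := by
    have e : (fun τ => bumpArg s x0 (Function.update z k.succ τ)) = fun τ =>
        s - z 0 - √(1 + dsq x0 (Function.update z k.succ τ)) := by
      funext τ
      rw [bumpArg, Function.update_of_ne (Fin.succ_ne_zero k).symm]
    rw [e]
    refine (h2.const_sub (s - z 0)).congr_deriv ?_
    rw [hu]
    congr 1
    rw [mul_div_mul_left _ _ two_ne_zero]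
  have h4 := HasDerivAt.comp (z k.succ) (h₂ := Real.smoothTransition)
    (h₂' := deriv Real.smoothTransition (bumpArg s x0 z)) (by rw [hu]; exact hasDerivAt_st _) h3
  refine h4.congr_deriv ?_
  ring

lemma hasDerivAt_arctan_aff (a b X : ℝ) :
    HasDerivAt (fun σ => Real.pi / 2 - Real.arctan ((σ - a) / (b - a)))
      (-((1 + ((X - a) / (b - a)) ^ 2)⁻¹ * (b - a)⁻¹)) X := by
  have h1 : HasDerivAt (fun σ => (σ - a) / (b - a)) (1 / (b - a)) X :=
    ((hasDerivAt_id' X).sub_const a).div_const _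
  refine (h1.arctan.const_sub _).congr_deriv ?_
  rw [one_div, one_div]

lemma pdtx_thet_zero (a b : ℝ) (z : Fin 4 → ℝ) (y : Fin d → ℝ) :
    pdtx 0 (fun z _ => thet a b z : V d) z y = -(2 * z 0 * lam a b z) := by
  refine pdtx_eq_of_hasDerivAt (smoothC_of_contDiff (contDiff_thet a b)) ?_
  have hu : Function.update z 0 (z 0) = z := Function.update_eq_self _ _
  have h1 : HasDerivAt (fun τ => sg (Function.update z 0 τ)) (2 * z 0) (z 0) := by
    have e : (fun τ => sg (Function.update z 0 τ)) = fun τ =>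
        τ ^ 2 - ∑ k : Fin 3, z k.succ ^ 2 := by
      funext τ; simp [sg]
    rw [e]
    simpa using ((hasDerivAt_id' (z 0)).pow 2).sub_const (∑ k : Fin 3, z k.succ ^ 2)
  have h4 := HasDerivAt.comp (z 0)
    (h₂ := fun σ => Real.pi / 2 - Real.arctan ((σ - a) / (b - a)))
    (h₂' := -lam a b z) (by rw [hu]; exact hasDerivAt_arctan_aff a b (sg z)) h1
  refine h4.congr_deriv ?_
  ring

lemma pdtx_thet_succ (a b : ℝ) (z : Fin 4 → ℝ) (y : Fin d → ℝ) (k : Fin 3) :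
    pdtx k.succ (fun z _ => thet a b z : V d) z y = 2 * z k.succ * lam a b z := by
  refine pdtx_eq_of_hasDerivAt (smoothC_of_contDiff (contDiff_thet a b)) ?_
  have hu : Function.update z k.succ (z k.succ) = z := Function.update_eq_self _ _
  have h1 : HasDerivAt (fun τ => sg (Function.update z k.succ τ)) (-(2 * z k.succ))
      (z k.succ) := by
    have e : (fun τ => sg (Function.update z k.succ τ)) = fun τ =>
        z 0 ^ 2 - ∑ j : Fin 3, (Function.update z k.succ τ j.succ - (fun _ => 0) j) ^ 2 := by
      funext τ
      rw [sg, Function.update_of_ne (Fin.succ_ne_zero k).symm]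
      simp
    rw [e]
    refine ((hasDerivAt_sum_sq_update (fun _ => 0) z k).const_sub (z 0 ^ 2)).congr_deriv ?_
    simp
  have h4 := HasDerivAt.comp (z k.succ)
    (h₂ := fun σ => Real.pi / 2 - Real.arctan ((σ - a) / (b - a)))
    (h₂' := -lam a b z) (by rw [hu]; exact hasDerivAt_arctan_aff a b (sg z)) h1
  refine h4.congr_deriv ?_
  ring

lemma deriv_st_nonneg (s : ℝ) : 0 ≤ deriv Real.smoothTransition s :=
  Real.smoothTransition.monotone.deriv_nonneg

lemma deriv_st_of_nonpos {s : ℝ} (hs : s ≤ 0) : deriv Real.smoothTransition s = 0 := by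
  refine IsLocalMin.deriv_eq_zero (Filter.Eventually.of_forall fun x => ?_)
  rw [Real.smoothTransition.zero_of_nonpos hs]
  exact Real.smoothTransition.nonneg x

lemma sum_sq_comb_le {p q m : ℝ} {a b : Fin 3 → ℝ} (hp : 0 ≤ p) (hq : 0 ≤ q) (hm : 0 ≤ m)
    (ha : ∑ k, a k ^ 2 ≤ 1) (hb : ∑ k, b k ^ 2 ≤ m ^ 2) :
    ∑ k, (p * a k + q * b k) ^ 2 ≤ (p + q * m) ^ 2 := by
  have h1 : (∑ k, a k * b k) ^ 2 ≤ (∑ k, a k ^ 2) * ∑ k, b k ^ 2 :=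
    Finset.sum_mul_sq_le_sq_mul_sq _ _ _
  have ha0 : 0 ≤ ∑ k, a k ^ 2 := Finset.sum_nonneg fun _ _ => sq_nonneg _
  have hb0 : 0 ≤ ∑ k, b k ^ 2 := Finset.sum_nonneg fun _ _ => sq_nonneg _
  have h2 : ∑ k, a k * b k ≤ m := by
    refine abs_le_of_sq_le_sq' ?_ hm |>.2
    nlinarith
  have h3 : ∑ k, (p * a k + q * b k) ^ 2 = p ^ 2 * ∑ k, a k ^ 2 + 2 * (p * q) * ∑ k, a k * b k +
      q ^ 2 * ∑ k, b k ^ 2 := by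
    simp only [Fin.sum_univ_three]; ring
  rw [h3]
  have : p ^ 2 * ∑ k, a k ^ 2 ≤ p ^ 2 * 1 := by gcongr
  have : 2 * (p * q) * ∑ k, a k * b k ≤ 2 * (p * q) * m := by gcongr
  have : q ^ 2 * ∑ k, b k ^ 2 ≤ q ^ 2 * m ^ 2 := by gcongr
  nlinarith

lemma sum_ratio_sq_le (x0 : Fin 3 → ℝ) (z : Fin 4 → ℝ) :
    ∑ k : Fin 3, ((z k.succ - x0 k) / √(1 + dsq x0 z)) ^ 2 ≤ 1 := by
  have h := dsq_nonneg x0 z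
  simp only [div_pow, Real.sq_sqrt (show 0 ≤ 1 + dsq x0 z by positivity), ← Finset.sum_div]
  rw [div_le_one (by positivity)]
  exact (le_refl (dsq x0 z)).trans (by linarith)

lemma thet_nonneg (a b : ℝ) (z : Fin 4 → ℝ) : 0 ≤ thet a b z := by
  have := Real.arctan_lt_pi_div_two ((sg z - a) / (b - a))
  unfold thet; linarith

lemma thet_le (a b : ℝ) (z : Fin 4 → ℝ) : thet a b z ≤ 4 := by
  have := Real.neg_pi_div_two_lt_arctan ((sg z - a) / (b - a))
  have := Real.pi_le_four
  unfold thet; linarith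

lemma lam_nonneg {a b : ℝ} (hab : a < b) (z : Fin 4 → ℝ) : 0 ≤ lam a b z := by
  have : 0 < b - a := by linarith
  unfold lam; positivity

lemma le_lam {a b : ℝ} (hab : a < b) {z : Fin 4 → ℝ} (h1 : a ≤ sg z) (h2 : sg z ≤ b) :
    (2 * (b - a))⁻¹ ≤ lam a b z := by
  have h : 0 < b - a := by linarith
  unfold lam
  rw [mul_inv]
  gcongr
  have h3 : 0 ≤ (sg z - a) / (b - a) := div_nonneg (by linarith) h.le
  have h4 : (sg z - a) / (b - a) ≤ 1 := by rw [div_le_one h]; linarith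
  nlinarith

lemma bump_nonneg (s : ℝ) (x0 : Fin 3 → ℝ) (z : Fin 4 → ℝ) : 0 ≤ bump s x0 z :=
  Real.smoothTransition.nonneg _

lemma bump_le_one (s : ℝ) (x0 : Fin 3 → ℝ) (z : Fin 4 → ℝ) : bump s x0 z ≤ 1 :=
  Real.smoothTransition.le_one _

lemma dsq_lt_of_bumpArg_pos {s : ℝ} {x0 : Fin 3 → ℝ} {z : Fin 4 → ℝ}
    (h : 0 < bumpArg s x0 z) : 0 < s - z 0 ∧ dsq x0 z < (s - z 0) ^ 2 := by
  have h0 := dsq_nonneg x0 z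
  have h1 : 0 ≤ √(1 + dsq x0 z) := Real.sqrt_nonneg _
  have h2 := Real.sq_sqrt (show 0 ≤ 1 + dsq x0 z by positivity)
  rw [bumpArg] at h
  constructor
  · linarith
  · nlinarith

/-- The ball containing the support of the cutoff at time `τ`. -/
lemma bump_eq_zero {s : ℝ} {x0 : Fin 3 → ℝ} {τ τ1 : ℝ} (hτ : τ1 ≤ τ) {x : Fin 3 → ℝ}
    (hx : x ∉ Set.Icc (fun k => x0 k - (s - τ1)) (fun k => x0 k + (s - τ1))) :
    bump s x0 (Fin.cons τ x) = 0 := by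
  by_contra hne
  have h : 0 < bumpArg s x0 (Fin.cons τ x) := by
    by_contra hc
    exact hne (Real.smoothTransition.zero_of_nonpos (not_lt.1 hc))
  obtain ⟨h1, h2⟩ := dsq_lt_of_bumpArg_pos h
  simp only [Fin.cons_zero] at h1 h2
  have h3 : ∀ k, |x k - x0 k| ≤ s - τ1 := by
    intro k
    have h4 : (x k - x0 k) ^ 2 ≤ dsq x0 (Fin.cons τ x) := by
      have := Finset.single_le_sum (f := fun k => (x k - x0 k) ^ 2) (fun _ _ => sq_nonneg _)
        (Finset.mem_univ k)
      simpa [dsq] using this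
    have h5 : |x k - x0 k| ≤ s - τ := abs_le_of_sq_le_sq (by linarith) h1.le
    linarith
  exact hx ⟨fun k => by have := abs_le.1 (h3 k); linarith,
    fun k => by have := abs_le.1 (h3 k); linarith⟩

/-- The localized energy at time `τ`. -/
def EB (D : SmoothDomain d) (N : ℕ) (u : V d) (s : ℝ) (x0 : Fin 3 → ℝ) (τ : ℝ) : ENNReal :=
  ∫⁻ x : Fin 3 → ℝ, ENNReal.ofReal (bump s x0 (Fin.cons τ x)) * NN D N u (Fin.cons τ x)

/-- The `L¹L²` norm of the source on a time window is at most `S`. -/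
def SrcW (D : SmoothDomain d) (N : ℕ) (u : V d) (τ1 τ2 S : ℝ) : Prop :=
  ∀ β : List (Fin 10), β.length ≤ N → ∀ K : Set (Fin 3 → ℝ), IsCompact K →
    ∫ τ in τ1..τ2, √(IK D K (fun z y => zw β (wBox u) z y * zw β (wBox u) z y) τ) ≤ S

lemma isCompact_box (s τ1 : ℝ) (x0 : Fin 3 → ℝ) :
    IsCompact (Set.Icc (fun k => x0 k - (s - τ1)) (fun k => x0 k + (s - τ1))) := isCompact_Icc

lemma EB_eq (D : SmoothDomain d) {N : ℕ} {u : V d} (hu : SmoothC u) (s : ℝ) (x0 : Fin 3 → ℝ)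
    {τ τ1 : ℝ} (hτ : τ1 ≤ τ) : EB D N u s x0 τ = ENNReal.ofReal
      (IK D (Set.Icc (fun k => x0 k - (s - τ1)) (fun k => x0 k + (s - τ1)))
        (fun z y => bump s x0 z * EE N u z y) τ) :=
  lintegral_weight_NN D isCompact_Icc hu (smoothC_of_contDiff (contDiff_bump s x0)) N
    (fun _ hx => bump_eq_zero hτ hx) (fun _ => bump_nonneg _ _ _)

lemma EB_le (D : SmoothDomain d) {N : ℕ} {u : V d} (hu : SmoothC u) (hn : NeumannBC D u)
    {s : ℝ} {x0 : Fin 3 → ℝ} {τ1 τ2 S : ℝ} (hS : SrcW D N u τ1 τ2 S) {τ : ℝ}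
    (hτ : τ ∈ Set.Icc τ1 τ2) :
    EB D N u s x0 τ ≤ 2 * EB D N u s x0 τ1 +
      ENNReal.ofReal (wcard (Fin 10) N * (4 * S ^ 2)) := by
  have hb := smoothC_of_contDiff (d := d) (contDiff_bump s x0)
  have key := (energy_ineq_EE D (isCompact_box s τ1 x0) hu hb (smooth_zero (d := d))
    (fun j z y => pdy_of_indep _ j z y) hn (N := N) (A := 1) (hτ.1.trans hτ.2)
    (fun τ hτ x hx y => bump_eq_zero hτ.1 hx) (fun τ _ x y => bump_nonneg _ _ _)
    (fun _ _ _ _ => le_rfl) zero_le_one (fun τ _ x y => bump_le_one _ _ _)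
    (fun τ _ x y => by
      rw [pdtx_bump_zero, neg_neg, sub_zero]; exact deriv_st_nonneg _)
    (fun τ _ x y => by
      simp only [pdtx_bump_zero, pdtx_bump_succ, neg_neg, sub_zero, mul_pow, neg_sq]
      rw [← Finset.mul_sum]
      exact mul_le_of_le_one_right (sq_nonneg _) (sum_ratio_sq_le _ _))
    (fun β hβ => hS β hβ _ (isCompact_box s τ1 x0))).1 τ hτ
  rw [EB_eq D hu s x0 hτ.1, EB_eq D hu s x0 le_rfl, ← ENNReal.ofReal_ofNat 2,
    ← ENNReal.ofReal_mul (by norm_num), ← ENNReal.ofReal_add]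
  · exact ENNReal.ofReal_le_ofReal (by simpa using key)
  · exact mul_nonneg (by norm_num) (IK_nonneg D isCompact_Icc fun x _ y =>
      mul_nonneg (bump_nonneg _ _ _) (EE_nonneg _ _ _ _))
  · have := wcard_nonneg (Fin 10) N
    positivity

/-- The part of the cone over which the flux is estimated. -/
def Sdom (s : ℝ) (x0 : Fin 3 → ℝ) (a b : ℝ) : Set (Fin 4 → ℝ) :=
  {z | 1 + √(1 + dsq x0 z) ≤ s - z 0 ∧ a ≤ sg z ∧ sg z ≤ b}

lemma pdtx_mul {u v : V d} (hu : SmoothC u) (hv : SmoothC v) (i : Fin 4) (z : Fin 4 → ℝ)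
    (y : Fin d → ℝ) : pdtx i (fun z y => u z y * v z y) z y =
      u z y * pdtx i v z y + pdtx i u z y * v z y :=
  congrFun (congrFun (pdmix_mul hu hv (Sum.inl i)) z) y

lemma flux_le (D : SmoothDomain d) {N : ℕ} {u : V d} (hu : SmoothC u) (hn : NeumannBC D u)
    {s : ℝ} {x0 : Fin 3 → ℝ} {τ1 τ2 S a b : ℝ} (h1 : 0 < τ1) (h12 : τ1 ≤ τ2) (hab : a < b)
    (hS : SrcW D N u τ1 τ2 S)
    (hcone : ∀ x : Fin 3 → ℝ, ∑ k, (x k - x0 k) ^ 2 ≤ (s - τ1) ^ 2 →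
      ∑ k, x k ^ 2 ≤ (9 / 10 * τ1) ^ 2) :
    ∫⁻ τ in Set.Icc τ1 τ2, ∫⁻ x : Fin 3 → ℝ, (Sdom s x0 a b).indicator (NN D N u) (Fin.cons τ x)
      ≤ ENNReal.ofReal (10 * (b - a) / τ1) *
        (8 * EB D N u s x0 τ1 + ENNReal.ofReal (wcard (Fin 10) N * (16 * S ^ 2))) := by
  have hb := smoothC_of_contDiff (d := d) (contDiff_bump s x0)
  have ht := smoothC_of_contDiff (d := d) (contDiff_thet a b)
  have hl := smoothC_of_contDiff (d := d) (contDiff_lam a b)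
  have hz : SmoothC (fun z _ => 1 / 5 * z 0 : V d) := smoothC_of_contDiff (by fun_prop)
  have hψ := smooth_mul hb ht
  have hφ : SmoothC (fun z _ => 1 / 5 * z 0 * (bump s x0 z * lam a b z) : V d) :=
    smooth_mul hz (smooth_mul hb hl)
  have hsup : ∀ τ ∈ Set.Icc τ1 τ2, ∀ x, 0 < bumpArg s x0 (Fin.cons τ x) →
      ∑ k, x k ^ 2 ≤ (9 / 10 * τ) ^ 2 := by
    intro τ hτ x h
    obtain ⟨h2, h3⟩ := dsq_lt_of_bumpArg_pos h
    simp only [Fin.cons_zero] at h2 h3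
    have h4 : (s - τ) ^ 2 ≤ (s - τ1) ^ 2 := by
      have := hτ.1
      apply pow_le_pow_left₀ h2.le; linarith
    refine (hcone x ?_).trans ?_
    · refine (le_trans ?_ (h3.le.trans h4))
      simp [dsq]
    · have := hτ.1
      apply pow_le_pow_left₀ (by positivity); linarith
  have hd0 : ∀ z : Fin 4 → ℝ, ∀ y, pdtx 0 (fun z _ => bump s x0 z * thet a b z : V d) z y =
      -(bump s x0 z * (2 * z 0 * lam a b z)) -
        deriv Real.smoothTransition (bumpArg s x0 z) * thet a b z := by
    intro z y
    rw [pdtx_mul hb ht, pdtx_bump_zero, pdtx_thet_zero]; ring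
  have hdk : ∀ z : Fin 4 → ℝ, ∀ y, ∀ k : Fin 3,
      pdtx k.succ (fun z _ => bump s x0 z * thet a b z : V d) z y =
      deriv Real.smoothTransition (bumpArg s x0 z) * thet a b z *
        (-((z k.succ - x0 k) / √(1 + dsq x0 z))) +
        2 * bump s x0 z * lam a b z * z k.succ := by
    intro z y k
    rw [pdtx_mul hb ht, pdtx_bump_succ, pdtx_thet_succ]; ring
  have hτ0 : ∀ τ ∈ Set.Icc τ1 τ2, 0 < τ := fun τ hτ => h1.trans_le hτ.1
  have hφ0 : ∀ τ ∈ Set.Icc τ1 τ2, ∀ x : Fin 3 → ℝ, ∀ _ : Fin d → ℝ,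
      0 ≤ 1 / 5 * (Fin.cons τ x : Fin 4 → ℝ) 0 *
        (bump s x0 (Fin.cons τ x) * lam a b (Fin.cons τ x)) := fun τ hτ x _ =>
    mul_nonneg (by have := hτ0 τ hτ; simp; linarith)
      (mul_nonneg (bump_nonneg _ _ _) (lam_nonneg hab _))
  have key := (energy_ineq_EE D (isCompact_box s τ1 x0) hu hψ hφ
    (fun j z y => pdy_of_indep (fun z => bump s x0 z * thet a b z) j z y) hn (N := N) (A := 4) h12
    (fun τ hτ x hx y => by rw [bump_eq_zero hτ.1 hx, zero_mul])
    (fun τ _ x y => mul_nonneg (bump_nonneg _ _ _) (thet_nonneg _ _ _))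
    hφ0 (by norm_num)
    (fun τ _ x y => by
      refine (mul_le_of_le_one_left (thet_nonneg _ _ _) (bump_le_one _ _ _)).trans (thet_le _ _ _))
    (fun τ hτ x y => by
      have := mul_nonneg (bump_nonneg s x0 (Fin.cons τ x)) (lam_nonneg hab (Fin.cons τ x))
      have h3 := mul_nonneg (deriv_st_nonneg (bumpArg s x0 (Fin.cons τ x)))
        (thet_nonneg a b (Fin.cons τ x))
      have h4 := mul_nonneg (hτ0 τ hτ).le this
      rw [hd0]; simp only [Fin.cons_zero]; nlinarith)
    (fun τ hτ x y => by
      simp only [hdk, hd0]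
      by_cases hc : 0 < bumpArg s x0 (Fin.cons τ x)
      · have := sum_sq_comb_le (p := deriv Real.smoothTransition (bumpArg s x0 (Fin.cons τ x)) *
          thet a b (Fin.cons τ x)) (q := 2 * bump s x0 (Fin.cons τ x) * lam a b (Fin.cons τ x))
          (m := 9 / 10 * τ)
          (a := fun k => -(((Fin.cons τ x : Fin 4 → ℝ) k.succ - x0 k) /
            √(1 + dsq x0 (Fin.cons τ x)))) (b := fun k => (Fin.cons τ x : Fin 4 → ℝ) k.succ)
          (mul_nonneg (deriv_st_nonneg _) (thet_nonneg _ _ _))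
          (mul_nonneg (mul_nonneg (by norm_num) (bump_nonneg _ _ _)) (lam_nonneg hab _))
          (by have := hτ0 τ hτ; positivity)
          (by simp only [neg_sq]; exact sum_ratio_sq_le _ _)
          (by simpa using hsup τ hτ x hc)
        refine this.trans (le_of_eq ?_)
        simp only [Fin.cons_zero]
        ring
      · have e1 : bump s x0 (Fin.cons τ x) = 0 :=
          Real.smoothTransition.zero_of_nonpos (not_lt.1 hc)
        simp [e1, deriv_st_of_nonpos (not_lt.1 hc)])
    (fun β hβ => hS β hβ _ (isCompact_box s τ1 x0))).2
  have hpos : 0 < b - a := by linarith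
  have hpt : ∀ τ ∈ Set.Icc τ1 τ2, ∀ x : Fin 3 → ℝ,
      (Sdom s x0 a b).indicator (NN D N u) (Fin.cons τ x) ≤ ENNReal.ofReal (10 * (b - a) / τ1) *
        (ENNReal.ofReal (1 / 5 * (Fin.cons τ x : Fin 4 → ℝ) 0 *
        (bump s x0 (Fin.cons τ x) * lam a b (Fin.cons τ x))) * NN D N u (Fin.cons τ x)) := by
    intro τ hτ x
    by_cases hx : (Fin.cons τ x : Fin 4 → ℝ) ∈ Sdom s x0 a b
    · rw [Set.indicator_of_mem hx, ← mul_assoc, ← ENNReal.ofReal_mul (by positivity)]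
      refine le_mul_of_one_le_left' ?_
      rw [ENNReal.one_le_ofReal]
      have e1 : bump s x0 (Fin.cons τ x) = 1 := by
        refine Real.smoothTransition.one_of_one_le ?_
        have := hx.1
        rw [bumpArg]; linarith
      have h5 := le_lam hab hx.2.1 hx.2.2
      rw [e1, one_mul, Fin.cons_zero]
      have h6 := hτ.1
      have h7 : 0 ≤ τ := h1.le.trans h6
      calc (1 : ℝ) = 10 * (b - a) / τ1 * (1 / 5 * τ1 * (2 * (b - a))⁻¹) := by
            field_simp; norm_num
        _ ≤ _ := by gcongr
    · rw [Set.indicator_of_notMem hx]; exact zero_le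
  have hcont : Continuous fun τ => IK D
      (Set.Icc (fun k => x0 k - (s - τ1)) (fun k => x0 k + (s - τ1)))
      (fun z y => 1 / 5 * z 0 * (bump s x0 z * lam a b z) * EE N u z y) τ :=
    continuous_IK D isCompact_Icc (smooth_mul hφ (smooth_EE hu N))
  calc _ ≤ ∫⁻ τ in Set.Icc τ1 τ2, ENNReal.ofReal (10 * (b - a) / τ1) *
        ENNReal.ofReal (IK D (Set.Icc (fun k => x0 k - (s - τ1)) (fun k => x0 k + (s - τ1)))
        (fun z y => 1 / 5 * z 0 * (bump s x0 z * lam a b z) * EE N u z y) τ) := by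
        refine setLIntegral_mono' measurableSet_Icc fun τ hτ => ?_
        rw [← lintegral_weight_NN D isCompact_Icc hu
          (f := fun z => 1 / 5 * z 0 * (bump s x0 z * lam a b z)) hφ N
          (fun x hx => by simp only [bump_eq_zero hτ.1 hx]; simp)
          (fun x => hφ0 τ hτ x 0), ← lintegral_const_mul' _ _ ENNReal.ofReal_ne_top]
        exact lintegral_mono fun x => hpt τ hτ x
    _ = ENNReal.ofReal (10 * (b - a) / τ1) * ENNReal.ofReal (∫ τ in τ1..τ2, IK D
        (Set.Icc (fun k => x0 k - (s - τ1)) (fun k => x0 k + (s - τ1)))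
        (fun z y => 1 / 5 * z 0 * (bump s x0 z * lam a b z) * EE N u z y) τ) := by
        rw [lintegral_const_mul' _ _ ENNReal.ofReal_ne_top, ofReal_intervalIntegral h12
          hcont.continuousOn]
        exact fun τ hτ => IK_nonneg D isCompact_Icc fun x _ y =>
          mul_nonneg (hφ0 τ hτ x y) (EE_nonneg _ _ _ _)
    _ ≤ _ := by
        refine mul_le_mul_right ?_ _
        refine (ENNReal.ofReal_le_ofReal key).trans ?_
        have hw := wcard_nonneg (Fin 10) N
        have hIK := IK_mono D (isCompact_box s τ1 x0) (τ := τ1)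
          (smooth_mul hψ (smooth_EE hu N))
          (smooth_const_mul (smooth_mul hb (smooth_EE hu N)) 4) (fun x _ y => by
            have h7 := mul_nonneg (bump_nonneg s x0 (Fin.cons τ1 x))
              (EE_nonneg N u (Fin.cons τ1 x) y)
            have := mul_le_mul_of_nonneg_left (thet_le a b (Fin.cons τ1 x)) h7
            linarith)
        have hc4 : IK D (Set.Icc (fun k => x0 k - (s - τ1)) (fun k => x0 k + (s - τ1)))
            (fun z y => 4 * (bump s x0 z * EE N u z y)) τ1 =
            4 * IK D (Set.Icc (fun k => x0 k - (s - τ1)) (fun k => x0 k + (s - τ1)))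
            (fun z y => bump s x0 z * EE N u z y) τ1 := integral_const_mul _ _
        rw [hc4] at hIK
        rw [EB_eq D hu s x0 le_rfl, ← ENNReal.ofReal_ofNat 8,
          ← ENNReal.ofReal_mul (by norm_num), ← ENNReal.ofReal_add]
        · exact ENNReal.ofReal_le_ofReal (by linarith)
        · exact mul_nonneg (by norm_num) (IK_nonneg D isCompact_Icc fun x _ y =>
            mul_nonneg (bump_nonneg _ _ _) (EE_nonneg _ _ _ _))
        · positivity

lemma vanish_pdmix {U : Set ((Fin 4 → ℝ) × (Fin d → ℝ))} (hU : IsOpen U) {w : V d}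
    (hw : SmoothC w) (h : ∀ p ∈ U, w p.1 p.2 = 0) (i : Fin 4 ⊕ Fin d) :
    ∀ p ∈ U, pdmix i w p.1 p.2 = 0 := by
  intro p hp
  rw [pdmix_eq hw]
  have : un w =ᶠ[nhds (p.1, p.2)] fun _ => 0 :=
    Filter.eventuallyEq_of_mem (hU.mem_nhds hp) fun q hq => h q hq
  rw [this.fderiv_eq]
  simp

lemma vanish_gtF {U : Set ((Fin 4 → ℝ) × (Fin d → ℝ))} (hU : IsOpen U) {w : V d}
    (hw : SmoothC w) (h : ∀ p ∈ U, w p.1 p.2 = 0) (i : Fin 10 ⊕ Fin d) :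
    ∀ p ∈ U, gtF i w p.1 p.2 = 0 := by
  intro p hp
  cases i with
  | inl i =>
    rw [gtF_inl]
    exact Finset.sum_eq_zero fun b _ => by
      rw [show pdtx b w p.1 p.2 = 0 from vanish_pdmix hU hw h (Sum.inl b) p hp, mul_zero]
  | inr j => exact vanish_pdmix hU hw h (Sum.inr j) p hp

lemma vanish_word {U : Set ((Fin 4 → ℝ) × (Fin d → ℝ))} (hU : IsOpen U) {w : V d}
    (hw : SmoothC w) (h : ∀ p ∈ U, w p.1 p.2 = 0) (L : List (Fin 10 ⊕ Fin d)) :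
    ∀ p ∈ U, opIter gtF L w p.1 p.2 = 0 := by
  induction L with
  | nil => exact h
  | cons i L ih => exact vanish_gtF hU (smooth_word hw L) ih i

lemma vanish_EE {U : Set ((Fin 4 → ℝ) × (Fin d → ℝ))} (hU : IsOpen U) {w : V d}
    (hw : SmoothC w) (h : ∀ p ∈ U, w p.1 p.2 = 0) (N : ℕ) :
    ∀ p ∈ U, EE N w p.1 p.2 = 0 := by
  intro p hp
  unfold EE wsum
  refine Finset.sum_eq_zero fun n _ => Finset.sum_eq_zero fun σ _ => ?_
  beta_reduce
  rw [ed_eq_sum]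
  refine Finset.sum_eq_zero fun j _ => ?_
  rw [vanish_pdmix hU (smooth_zw hw _) (vanish_word hU hw h _) j p hp]
  simp

lemma isOpen_slab (D : SmoothDomain d) (a b : ℝ) :
    IsOpen {p : (Fin 4 → ℝ) × (Fin d → ℝ) | (a < p.1 0 ∧ p.1 0 < b) ∧ p.2 ∈ D.carrier} :=
  have hc : Continuous fun p : (Fin 4 → ℝ) × (Fin d → ℝ) => p.1 0 := by fun_prop
  ((isOpen_lt continuous_const hc).inter (isOpen_lt hc continuous_const)).inter
    (D.isOpen.preimage continuous_snd)

lemma NN_initial (D : SmoothDomain d) {B : ℝ} (hB : 0 < B) {u : V d} (hu : SmoothC u)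
    (h0 : ∀ z : Fin 4 → ℝ, ∀ y ∈ closure D.carrier, 0 ≤ z 0 → z 0 ≤ 2 * B → u z y = 0)
    (N : ℕ) (x : Fin 3 → ℝ) : NN D N u (Fin.cons (2 * B) x) = 0 := by
  have hz : ∀ y ∈ D.carrier, EE N u (Fin.cons (2 * B) x) y = 0 := by
    intro y hy
    have hc : Continuous fun τ => EE N u (Fin.cons τ x) y :=
      SmoothC.continuous_comp (smooth_EE hu N)
        (Continuous.finCons (A := fun _ => ℝ) continuous_id continuous_const) continuous_const
    have hcl : IsClosed {τ | EE N u (Fin.cons τ x) y = 0} := isClosed_eq hc continuous_const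
    have hsub : Set.Ioo 0 (2 * B) ⊆ {τ | EE N u (Fin.cons τ x) y = 0} := fun τ hτ =>
      vanish_EE (isOpen_slab D 0 (2 * B)) hu (fun p hp => h0 _ _ (subset_closure hp.2) hp.1.1.le
        hp.1.2.le) N (Fin.cons τ x, y) ⟨by simpa using hτ, hy⟩
    have := closure_minimal hsub hcl
    rw [closure_Ioo (by positivity)] at this
    exact this ⟨by positivity, le_rfl⟩
  rw [NN, setLIntegral_congr_fun D.isOpen.measurableSet
    (g := fun _ => 0) (fun y hy => by simp [hz y hy])]
  simp

lemma lintegral_NN_le (D : SmoothDomain d) {B : ℝ} (hB : 0 < B) {N : ℕ} {u : V d}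
    (hu : SmoothC u) (hn : NeumannBC D u)
    (h0 : ∀ z : Fin 4 → ℝ, ∀ y ∈ closure D.carrier, 0 ≤ z 0 → z 0 ≤ 2 * B → u z y = 0)
    {t Q : ℝ} (hQ : Src D B N u t Q) {τ : ℝ} (hτ : τ ∈ Set.Icc (2 * B) t) :
    ∫⁻ x : Fin 3 → ℝ, NN D N u (Fin.cons τ x) ≤
      ENNReal.ofReal (wcard (Fin 10) N * (4 * Q ^ 2)) := by
  have hEB : ∀ s, EB D N u s 0 τ ≤ ENNReal.ofReal (wcard (Fin 10) N * (4 * Q ^ 2)) := by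
    intro s
    refine (EB_le D hu hn (τ2 := t) (S := Q) hQ.int_le hτ).trans ?_
    have : EB D N u s 0 (2 * B) = 0 := by
      simp [EB, NN_initial D hB hu h0]
    simp [this]
  have hm := (measurable_NN D N hu).comp (measurable_cons τ)
  have hlim : ∀ x : Fin 3 → ℝ, Filter.Tendsto (fun n : ℕ =>
      ENNReal.ofReal (bump n 0 (Fin.cons τ x)) * NN D N u (Fin.cons τ x)) Filter.atTop
      (nhds (NN D N u (Fin.cons τ x))) := by
    intro x
    refine tendsto_const_nhds.congr' ?_
    obtain ⟨m, hm⟩ := exists_nat_ge (1 + τ + √(1 + dsq 0 (Fin.cons τ x)))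
    filter_upwards [Filter.eventually_ge_atTop m] with n hn
    have : bump n 0 (Fin.cons τ x) = 1 := by
      refine Real.smoothTransition.one_of_one_le ?_
      have : (m : ℝ) ≤ n := by exact_mod_cast hn
      simp only [bumpArg, Fin.cons_zero]
      linarith
    simp [this]
  calc _ = ∫⁻ x : Fin 3 → ℝ, Filter.liminf (fun n : ℕ =>
        ENNReal.ofReal (bump n 0 (Fin.cons τ x)) * NN D N u (Fin.cons τ x)) Filter.atTop :=
        lintegral_congr fun x => (hlim x).liminf_eq.symm
    _ ≤ Filter.liminf (fun n : ℕ => ∫⁻ x : Fin 3 → ℝ,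
        ENNReal.ofReal (bump n 0 (Fin.cons τ x)) * NN D N u (Fin.cons τ x)) Filter.atTop :=
        lintegral_liminf_le fun n =>
          (((contDiff_bump n 0).continuous.measurable.comp (measurable_cons τ)).ennreal_ofReal).mul
            hm
    _ ≤ _ := Filter.liminf_le_of_frequently_le'
        (Filter.Frequently.of_forall fun n => hEB n)

/-- The region over which the Sobolev inequality on hyperboloids averages. -/
def Pset (x : Fin 3 → ℝ) (ℓ : ℝ) : Set (Fin 3 → ℝ) := {x' | ∀ k, x' k ∈ Sset (x k) ℓ}

lemma measurableSet_Pset (x : Fin 3 → ℝ) (ℓ : ℝ) : MeasurableSet (Pset x ℓ) := by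
  have : Pset x ℓ = Set.pi Set.univ fun k => Sset (x k) ℓ := by
    ext x'; simp [Pset]
  rw [this]
  exact MeasurableSet.univ_pi fun k => measurableSet_Sset _ _

lemma Pset_mono {x : Fin 3 → ℝ} {ℓ ℓ' : ℝ} (h0 : 0 ≤ ℓ) (h : ℓ ≤ ℓ') : Pset x ℓ ⊆ Pset x ℓ' := by
  intro x' hx k
  have h2 : ℓ ^ 2 ≤ ℓ' ^ 2 := pow_le_pow_left₀ h0 h 2
  exact ⟨(hx k).1.trans h, (hx k).2.trans (by linarith)⟩

lemma sum_sq_le_of_mem_Pset {x x' : Fin 3 → ℝ} {ℓ : ℝ} (h : x' ∈ Pset x ℓ) :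
    ∑ k, x' k ^ 2 ≤ ∑ k, x k ^ 2 + 3 * ℓ ^ 2 := by
  simp only [Fin.sum_univ_three]
  have h0 := (h 0).2
  have h1 := (h 1).2
  have h2 := (h 2).2
  linarith

lemma le_sum_sq_of_mem_Pset {x x' : Fin 3 → ℝ} {ℓ X : ℝ} (hX : ∀ k, |x k| ≤ X)
    (h : x' ∈ Pset x ℓ) : ∑ k, x k ^ 2 - 6 * ℓ * X ≤ ∑ k, x' k ^ 2 := by
  have h1 : ∀ k, x k ^ 2 - 2 * (ℓ * X) ≤ x' k ^ 2 := by
    intro k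
    have h2 : |x' k - x k| * |x k| ≤ ℓ * X :=
      mul_le_mul (h k).1 (hX k) (abs_nonneg _) ((abs_nonneg _).trans (h k).1)
    rw [← abs_mul] at h2
    have := neg_le_of_abs_le h2
    nlinarith [sq_nonneg (x' k - x k)]
  simp only [Fin.sum_univ_three]
  have h0 := h1 0
  have h2 := h1 1
  have h3 := h1 2
  linarith

lemma hp_eq (τ : ℝ) (x x' : Fin 3 → ℝ) : hp (τ ^ 2 - ∑ k, x k ^ 2) x' =
    Fin.cons √(τ ^ 2 + (∑ k, x' k ^ 2 - ∑ k, x k ^ 2)) x' := by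
  rw [hp]; congr 2; ring

lemma hp_self {τ : ℝ} (hτ : 0 ≤ τ) (x : Fin 3 → ℝ) :
    hp (τ ^ 2 - ∑ k, x k ^ 2) x = Fin.cons τ x := by
  rw [hp_eq, sub_self, add_zero, Real.sqrt_sq hτ]

lemma measurable_cons_pair : Measurable fun p : ℝ × (Fin 3 → ℝ) => (Fin.cons p.1 p.2 : Fin 4 → ℝ) :=
  (Continuous.finCons (A := fun _ => ℝ) continuous_fst continuous_snd).measurable

lemma lintegral_hyp_subst {g : (Fin 4 → ℝ) → ENNReal} (hg : Measurable g) {x : Fin 3 → ℝ}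
    {a b ℓ : ℝ} (ha : 0 < a) (hℓ0 : 0 ≤ ℓ) (hℓ : ℓ ≤ a) (hx : ∑ k, x k ^ 2 < a ^ 2) :
    ∫⁻ τ in Set.Icc a b, ∫⁻ x' in Pset x ℓ, g (hp (τ ^ 2 - ∑ k, x k ^ 2) x') ≤
      2 * ∫⁻ τ : ℝ, ∫⁻ x' : Fin 3 → ℝ, g (Fin.cons τ x') := by
  have hm : Measurable fun p : ℝ × (Fin 3 → ℝ) => g (hp (p.1 ^ 2 - ∑ k, x k ^ 2) p.2) := by
    simp only [hp_eq]
    refine hg.comp (measurable_cons_pair.comp (f := fun p : ℝ × (Fin 3 → ℝ) =>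
      (√(p.1 ^ 2 + (∑ k, p.2 k ^ 2 - ∑ k, x k ^ 2)), p.2)) ?_)
    exact (Continuous.prodMk (by fun_prop) continuous_snd).measurable
  rw [lintegral_lintegral_swap hm.aemeasurable]
  calc _ ≤ ∫⁻ x' in Pset x ℓ, 2 * ∫⁻ τ : ℝ, g (Fin.cons τ x') := by
        refine setLIntegral_mono' (measurableSet_Pset x ℓ) fun x' hx' => ?_
        simp only [hp_eq]
        have h1 := sum_sq_le_of_mem_Pset hx'
        have h0 : 0 ≤ ∑ k, x' k ^ 2 := Finset.sum_nonneg fun _ _ => sq_nonneg _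
        refine (lintegral_sqrt_subst (K := 2) ha (by linarith) ?_
          (fun τ => g (Fin.cons τ x'))).trans ?_
        · intro s hs
          have hs0 : a ≤ s := hs.1
          refine Real.sqrt_le_iff.2 ⟨by linarith, ?_⟩
          have : ℓ ^ 2 ≤ a ^ 2 := pow_le_pow_left₀ hℓ0 hℓ 2
          have : a ^ 2 ≤ s ^ 2 := pow_le_pow_left₀ ha.le hs0 2
          nlinarith
        · rw [ENNReal.ofReal_ofNat]
          exact mul_le_mul_right (setLIntegral_le_lintegral _ _) _
    _ ≤ ∫⁻ x' : Fin 3 → ℝ, 2 * ∫⁻ τ : ℝ, g (Fin.cons τ x') := setLIntegral_le_lintegral _ _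
    _ = _ := by
        have hm2 : Measurable fun p : ℝ × (Fin 3 → ℝ) => g (Fin.cons p.1 p.2) :=
          hg.comp measurable_cons_pair
        rw [lintegral_const_mul' _ _ (by norm_num),
          lintegral_lintegral_swap (f := fun τ x' => g (Fin.cons τ x')) hm2.aemeasurable]

/-- The energy density cut off to a part of a cone and to a time window. -/
def cutNN (D : SmoothDomain d) (N : ℕ) (u : V d) (s : ℝ) (x0 : Fin 3 → ℝ) (a b τ1 τ2 : ℝ) :
    (Fin 4 → ℝ) → ENNReal :=
  {z | τ1 ≤ z 0 ∧ z 0 ≤ τ2}.indicator ((Sdom s x0 a b).indicator (NN D N u))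

lemma measurableSet_Sdom (s : ℝ) (x0 : Fin 3 → ℝ) (a b : ℝ) : MeasurableSet (Sdom s x0 a b) := by
  have h1 : Continuous (dsq x0) := (contDiff_dsq x0).continuous
  have h2 : Continuous sg := contDiff_sg.continuous
  have h3 : Continuous fun z : Fin 4 → ℝ => 1 + √(1 + dsq x0 z) := by fun_prop
  have h4 : Continuous fun z : Fin 4 → ℝ => s - z 0 := by fun_prop
  exact ((isClosed_le h3 h4).inter ((isClosed_le continuous_const h2).inter
    (isClosed_le h2 continuous_const))).measurableSet

lemma measurable_cutNN (D : SmoothDomain d) (N : ℕ) {u : V d} (hu : SmoothC u) (s : ℝ)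
    (x0 : Fin 3 → ℝ) (a b τ1 τ2 : ℝ) : Measurable (cutNN D N u s x0 a b τ1 τ2) := by
  have h : Continuous fun z : Fin 4 → ℝ => z 0 := by fun_prop
  exact ((measurable_NN D N hu).indicator (measurableSet_Sdom s x0 a b)).indicator
    ((isClosed_le continuous_const h).inter (isClosed_le h continuous_const)).measurableSet

lemma cutNN_eq (D : SmoothDomain d) (N : ℕ) (u : V d) {s : ℝ} {x0 : Fin 3 → ℝ} {a b τ1 τ2 : ℝ}
    {z : Fin 4 → ℝ} (h1 : τ1 ≤ z 0) (h2 : z 0 ≤ τ2) (h3 : z ∈ Sdom s x0 a b) :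
    cutNN D N u s x0 a b τ1 τ2 z = NN D N u z := by
  rw [cutNN, Set.indicator_of_mem (show z ∈ {z | τ1 ≤ z 0 ∧ z 0 ≤ τ2} from ⟨h1, h2⟩),
    Set.indicator_of_mem h3]

lemma lintegral_cutNN (D : SmoothDomain d) (N : ℕ) (u : V d) (s : ℝ) (x0 : Fin 3 → ℝ)
    (a b τ1 τ2 : ℝ) : ∫⁻ τ : ℝ, ∫⁻ x : Fin 3 → ℝ, cutNN D N u s x0 a b τ1 τ2 (Fin.cons τ x) =
      ∫⁻ τ in Set.Icc τ1 τ2, ∫⁻ x : Fin 3 → ℝ,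
        (Sdom s x0 a b).indicator (NN D N u) (Fin.cons τ x) := by
  rw [← lintegral_indicator measurableSet_Icc]
  refine lintegral_congr fun τ => ?_
  by_cases hτ : τ ∈ Set.Icc τ1 τ2
  · rw [Set.indicator_of_mem hτ]
    refine lintegral_congr fun x => ?_
    exact Set.indicator_of_mem (show (Fin.cons τ x : Fin 4 → ℝ) ∈ {z | τ1 ≤ z 0 ∧ z 0 ≤ τ2} from hτ) _
  · rw [Set.indicator_of_notMem hτ]
    refine (lintegral_congr fun x => ?_).trans lintegral_zero
    exact Set.indicator_of_notMem
      (show (Fin.cons τ x : Fin 4 → ℝ) ∉ {z | τ1 ≤ z 0 ∧ z 0 ≤ τ2} from hτ) _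

lemma sg_hp {τ : ℝ} {x x' : Fin 3 → ℝ} (h : 0 ≤ τ ^ 2 - ∑ k, x k ^ 2) :
    sg (hp (τ ^ 2 - ∑ k, x k ^ 2) x') = τ ^ 2 - ∑ k, x k ^ 2 := by
  have h0 : 0 ≤ ∑ k, x' k ^ 2 := Finset.sum_nonneg fun _ _ => sq_nonneg _
  simp only [sg, hp, Fin.cons_zero, Fin.cons_succ]
  rw [Real.sq_sqrt (by linarith)]
  ring

lemma pow_succ_ge {q : ℝ} (hq : 40 ≤ q) (n : ℕ) : 40 * q ^ n ≤ q ^ (n + 1) := by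
  rw [pow_succ, mul_comm]
  exact mul_le_mul_of_nonneg_left hq (by positivity)

lemma abs_le_of_sum_sq {x : Fin 3 → ℝ} {X : ℝ} (hX : 0 ≤ X) (h : ∑ k, x k ^ 2 ≤ X ^ 2)
    (k : Fin 3) : |x k| ≤ X := by
  refine abs_le_of_sq_le_sq ?_ hX
  exact (Finset.single_le_sum (f := fun k => x k ^ 2) (fun _ _ => sq_nonneg _)
    (Finset.mem_univ k)).trans h

lemma dsq_hp_le {x0 x' : Fin 3 → ℝ} {R σ : ℝ} (h : ∀ k, |x' k - x0 k| ≤ R) :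
    dsq x0 (hp σ x') ≤ 3 * R ^ 2 := by
  have h1 : ∀ k, (x' k - x0 k) ^ 2 ≤ R ^ 2 := fun k =>
    sq_le_sq' (neg_le_of_abs_le (h k)) (le_of_abs_le (h k))
  simp only [dsq, hp, Fin.cons_succ, Fin.sum_univ_three]
  linarith [h1 0, h1 1, h1 2]

lemma sum_sq_near {x x0 : Fin 3 → ℝ} {R X : ℝ} (hX : ∀ k, |x0 k| ≤ X)
    (h : ∀ k, |x k - x0 k| ≤ R) : ∑ k, x0 k ^ 2 - 6 * R * X ≤ ∑ k, x k ^ 2 ∧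
      ∑ k, x k ^ 2 ≤ ∑ k, x0 k ^ 2 + 6 * R * X + 3 * R ^ 2 := by
  have h1 : ∀ k, x0 k ^ 2 - 2 * (R * X) ≤ x k ^ 2 ∧
      x k ^ 2 ≤ x0 k ^ 2 + 2 * (R * X) + R ^ 2 := by
    intro k
    have h2 : |x k - x0 k| * |x0 k| ≤ R * X :=
      mul_le_mul (h k) (hX k) (abs_nonneg _) ((abs_nonneg _).trans (h k))
    have h4 : (x k - x0 k) ^ 2 ≤ R ^ 2 :=
      sq_le_sq' (neg_le_of_abs_le (h k)) (le_of_abs_le (h k))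
    rw [← abs_mul] at h2
    have := abs_le.1 h2
    constructor
    · nlinarith [sq_nonneg (x k - x0 k)]
    · nlinarith
  simp only [Fin.sum_univ_three]
  constructor
  · linarith [(h1 0).1, (h1 1).1, (h1 2).1]
  · linarith [(h1 0).2, (h1 1).2, (h1 2).2]

/-- The box of half side `R` around `x₀`. -/
def cbox (x0 : Fin 3 → ℝ) (R : ℝ) : Set (Fin 3 → ℝ) :=
  Set.Icc (fun k => x0 k - R) (fun k => x0 k + R)

lemma abs_of_mem_cbox {x0 x : Fin 3 → ℝ} {R : ℝ} (h : x ∈ cbox x0 R) (k : Fin 3) :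
    |x k - x0 k| ≤ R :=
  abs_le.2 ⟨by linarith [h.1 k], by linarith [h.2 k]⟩

lemma one_add_sqrt_le {X Y : ℝ} (hY : 1 ≤ Y) (h : 1 + X ≤ (Y - 1) ^ 2) : 1 + √(1 + X) ≤ Y := by
  have := Real.sqrt_le_iff.2 ⟨by linarith, h⟩
  linarith

lemma mem_region_early {q τ : ℝ} {x0 x x' : Fin 3 → ℝ} (hq : 40 ≤ q)
    (hx0 : ∑ k, x0 k ^ 2 ≤ (q ^ 4 / 2) ^ 2)
    (hτ : τ ∈ Set.Icc (q ^ 4 - 2 * q ^ 2) (q ^ 4 - q ^ 2)) (hx : x ∈ cbox x0 (4 * q ^ 2))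
    (hx' : x' ∈ Pset x (q ^ 3 / 2)) :
    19 / 20 * q ^ 4 ≤ hp (τ ^ 2 - ∑ k, x k ^ 2) x' 0 ∧ hp (τ ^ 2 - ∑ k, x k ^ 2) x' 0 ≤ q ^ 4 ∧
      hp (τ ^ 2 - ∑ k, x k ^ 2) x' ∈ Sdom (q ^ 4 + q ^ 4 / 20) x0
        ((q ^ 4 - 2 * q ^ 2) ^ 2 - ∑ k, x0 k ^ 2 - 13 * q ^ 6)
        (q ^ 8 - ∑ k, x0 k ^ 2 + 13 * q ^ 6) := by
  have g0 := pow_succ_ge hq 0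
  have g1 := pow_succ_ge hq 1
  have g2 := pow_succ_ge hq 2
  have g3 := pow_succ_ge hq 3
  have g4 := pow_succ_ge hq 4
  have g5 := pow_succ_ge hq 5
  have g6 := pow_succ_ge hq 6
  have g7 := pow_succ_ge hq 7
  norm_num at g0 g1 g2 g3 g4 g5 g6 g7
  have hX0 := abs_le_of_sum_sq (by positivity) hx0
  have hxk := abs_of_mem_cbox hx
  obtain ⟨n1, n2⟩ := sum_sq_near hX0 hxk
  have hX : ∀ k, |x k| ≤ q ^ 4 / 2 + 4 * q ^ 2 := fun k => by
    have := abs_add_le (x k - x0 k) (x0 k)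
    rw [sub_add_cancel] at this
    linarith [hX0 k, hxk k]
  have m1 := le_sum_sq_of_mem_Pset hX hx'
  have m2 := sum_sq_le_of_mem_Pset hx'
  have hτ1 : (q ^ 4 - 2 * q ^ 2) ^ 2 ≤ τ ^ 2 := pow_le_pow_left₀ (by linarith) hτ.1 2
  have hτ2 : τ ^ 2 ≤ (q ^ 4 - q ^ 2) ^ 2 := pow_le_pow_left₀ (by linarith [hτ.1]) hτ.2 2
  have e1 : (q ^ 4 - 2 * q ^ 2) ^ 2 = q ^ 8 - 4 * q ^ 6 + 4 * q ^ 4 := by ring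
  have e2 : (q ^ 4 - q ^ 2) ^ 2 = q ^ 8 - 2 * q ^ 6 + q ^ 4 := by ring
  have e3 : 6 * (4 * q ^ 2) * (q ^ 4 / 2) = 12 * q ^ 6 := by ring
  have e4 : 3 * (4 * q ^ 2) ^ 2 = 48 * q ^ 4 := by ring
  have e5 : 6 * (q ^ 3 / 2) * (q ^ 4 / 2 + 4 * q ^ 2) = 3 / 2 * q ^ 7 + 12 * q ^ 5 := by ring
  have e6 : 3 * (q ^ 3 / 2) ^ 2 = 3 / 4 * q ^ 6 := by ring
  have e7 : (q ^ 4 / 2) ^ 2 = q ^ 8 / 4 := by ring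
  rw [e1] at hτ1
  rw [e2] at hτ2
  rw [e3] at n1 n2
  rw [e4] at n2
  rw [e5] at m1
  rw [e6] at m2
  rw [e7] at hx0
  have hz0 : hp (τ ^ 2 - ∑ k, x k ^ 2) x' 0 ≤ q ^ 4 := by
    rw [hp_eq, Fin.cons_zero]
    refine Real.sqrt_le_iff.2 ⟨by positivity, ?_⟩
    rw [show (q ^ 4) ^ 2 = q ^ 8 by ring]
    linarith
  refine ⟨?_, hz0, ?_, ?_, ?_⟩
  · rw [hp_eq, Fin.cons_zero]
    refine Real.le_sqrt_of_sq_le ?_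
    rw [show (19 / 20 * q ^ 4) ^ 2 = 361 / 400 * q ^ 8 by ring]
    linarith
  · refine (one_add_sqrt_le (Y := q ^ 4 / 20) (by linarith) ?_).trans (by linarith)
    have hd := dsq_hp_le (x0 := x0) (x' := x') (R := 4 * q ^ 2 + q ^ 3 / 2)
      (σ := τ ^ 2 - ∑ k, x k ^ 2) fun k => by
        have := abs_add_le (x' k - x k) (x k - x0 k)
        rw [sub_add_sub_cancel] at this
        linarith [hxk k, (hx' k).1]
    have h1 : (2 * q ^ 3 - 1) ^ 2 ≤ (q ^ 4 / 20 - 1) ^ 2 :=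
      pow_le_pow_left₀ (by linarith) (by linarith) 2
    have e8 : (2 * q ^ 3 - 1) ^ 2 = 4 * q ^ 6 - 4 * q ^ 3 + 1 := by ring
    have e9 : 3 * (4 * q ^ 2 + q ^ 3 / 2) ^ 2 = 48 * q ^ 4 + 12 * q ^ 5 + 3 / 4 * q ^ 6 := by ring
    linarith
  · rw [sg_hp (by linarith), e1]
    linarith
  · rw [sg_hp (by linarith)]
    linarith

lemma mem_region_late {q τ τ1 ℓ : ℝ} {x0 x' : Fin 3 → ℝ} (hq : 40 ≤ q)
    (hx0 : ∑ k, x0 k ^ 2 ≤ (q ^ 4 / 2) ^ 2) (hτ : τ ∈ Set.Icc (q ^ 4 - 1) (q ^ 4))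
    (hτ1 : τ1 ≤ q ^ 4 - q ^ 2) (hτ10 : 0 ≤ τ1) (hℓ0 : 0 ≤ ℓ) (hℓ : ℓ ^ 2 ≤ q ^ 4 / 4 * (q ^ 4 - τ))
    (hx' : x' ∈ Pset x0 ℓ) :
    τ1 ≤ hp (τ ^ 2 - ∑ k, x0 k ^ 2) x' 0 ∧ hp (τ ^ 2 - ∑ k, x0 k ^ 2) x' 0 ≤ q ^ 4 ∧
      hp (τ ^ 2 - ∑ k, x0 k ^ 2) x' ∈ Sdom (q ^ 4 + 2 * q ^ 2) x0
        ((q ^ 4 - 1) ^ 2 - ∑ k, x0 k ^ 2) (q ^ 8 - ∑ k, x0 k ^ 2) := by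
  have g0 := pow_succ_ge hq 0
  have g1 := pow_succ_ge hq 1
  have g2 := pow_succ_ge hq 2
  have g3 := pow_succ_ge hq 3
  have g4 := pow_succ_ge hq 4
  have g5 := pow_succ_ge hq 5
  have g6 := pow_succ_ge hq 6
  have g7 := pow_succ_ge hq 7
  norm_num at g0 g1 g2 g3 g4 g5 g6 g7
  have hX0 := abs_le_of_sum_sq (by positivity) hx0
  have hℓ2 : ℓ ≤ q ^ 2 / 2 := by
    refine abs_le_of_sq_le_sq' ?_ (by positivity) |>.2
    have : q ^ 4 / 4 * (q ^ 4 - τ) ≤ q ^ 4 / 4 * 1 :=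
      mul_le_mul_of_nonneg_left (by linarith [hτ.1]) (by positivity)
    rw [show (q ^ 2 / 2) ^ 2 = q ^ 4 / 4 by ring]
    linarith
  have m1 := le_sum_sq_of_mem_Pset hX0 hx'
  have m2 := sum_sq_le_of_mem_Pset hx'
  have m3 : 6 * ℓ * (q ^ 4 / 2) ≤ 6 * (q ^ 2 / 2) * (q ^ 4 / 2) := by gcongr
  have hτ2 : (q ^ 4 - 1) ^ 2 ≤ τ ^ 2 := pow_le_pow_left₀ (by linarith) hτ.1 2
  have hτ3 : τ ^ 2 ≤ (q ^ 4) ^ 2 := pow_le_pow_left₀ (by linarith [hτ.1]) hτ.2 2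
  have e1 : (q ^ 4 - 1) ^ 2 = q ^ 8 - 2 * q ^ 4 + 1 := by ring
  have e2 : (q ^ 4) ^ 2 = q ^ 8 := by ring
  have e3 : 6 * (q ^ 2 / 2) * (q ^ 4 / 2) = 3 / 2 * q ^ 6 := by ring
  have e7 : (q ^ 4 / 2) ^ 2 = q ^ 8 / 4 := by ring
  rw [e1] at hτ2
  rw [e2] at hτ3
  rw [e3] at m3
  rw [e7] at hx0
  have hz0 : hp (τ ^ 2 - ∑ k, x0 k ^ 2) x' 0 ≤ q ^ 4 := by
    rw [hp_eq, Fin.cons_zero]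
    refine Real.sqrt_le_iff.2 ⟨by positivity, ?_⟩
    have h1 : 0 ≤ q ^ 4 - τ := by linarith [hτ.2]
    have h2 : 3 * (q ^ 4 / 4 * (q ^ 4 - τ)) ≤ (q ^ 4 + τ) * (q ^ 4 - τ) := by
      rw [← mul_assoc]
      exact mul_le_mul_of_nonneg_right (by linarith [hτ.1]) h1
    nlinarith
  refine ⟨?_, hz0, ?_, ?_, ?_⟩
  · rw [hp_eq, Fin.cons_zero]
    refine Real.le_sqrt_of_sq_le ?_
    have h2 : τ1 ^ 2 ≤ (q ^ 4 - q ^ 2) ^ 2 := pow_le_pow_left₀ hτ10 hτ1 2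
    have e8 : (q ^ 4 - q ^ 2) ^ 2 = q ^ 8 - 2 * q ^ 6 + q ^ 4 := by ring
    linarith
  · refine (one_add_sqrt_le (Y := 2 * q ^ 2) (by linarith) ?_).trans (by linarith)
    have hd := dsq_hp_le (x0 := x0) (x' := x') (R := q ^ 2 / 2)
      (σ := τ ^ 2 - ∑ k, x0 k ^ 2) fun k => (hx' k).1.trans hℓ2
    have e8 : (2 * q ^ 2 - 1) ^ 2 = 4 * q ^ 4 - 4 * q ^ 2 + 1 := by ring
    have e9 : 3 * (q ^ 2 / 2) ^ 2 = 3 / 4 * q ^ 4 := by ring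
    linarith
  · rw [sg_hp (by linarith), e1]
    linarith
  · rw [sg_hp (by linarith)]
    linarith

lemma EB_le_lintegral (D : SmoothDomain d) (N : ℕ) (u : V d) (s : ℝ) (x0 : Fin 3 → ℝ) (τ : ℝ) :
    EB D N u s x0 τ ≤ ∫⁻ x : Fin 3 → ℝ, NN D N u (Fin.cons τ x) :=
  lintegral_mono fun x => mul_le_of_le_one_left zero_le
    (ENNReal.ofReal_le_one.2 (bump_le_one _ _ _))

lemma EB_le_setLIntegral (D : SmoothDomain d) (N : ℕ) (u : V d) {s τ R : ℝ} (x0 : Fin 3 → ℝ)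
    (h : s - τ ≤ R) : EB D N u s x0 τ ≤ ∫⁻ x in cbox x0 R, NN D N u (Fin.cons τ x) := by
  rw [cbox, ← lintegral_indicator measurableSet_Icc]
  refine lintegral_mono fun x => ?_
  by_cases hx : x ∈ Set.Icc (fun k => x0 k - R) (fun k => x0 k + R)
  · rw [Set.indicator_of_mem hx]
    exact mul_le_of_le_one_left zero_le (ENNReal.ofReal_le_one.2 (bump_le_one _ _ _))
  · have : x ∉ Set.Icc (fun k => x0 k - (s - τ)) (fun k => x0 k + (s - τ)) := fun hc =>
      hx ⟨fun k => by have := hc.1 k; simp only at *; linarith,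
        fun k => by have := hc.2 k; simp only at *; linarith⟩
    rw [Set.indicator_of_notMem hx, bump_eq_zero le_rfl this]
    simp

lemma cone_subset {q ρ τ1 : ℝ} {x0 x : Fin 3 → ℝ} (hq : 0 ≤ q)
    (hx0 : ∑ k, x0 k ^ 2 ≤ (q ^ 4 / 2) ^ 2) (h0 : 0 ≤ ρ) (hρ : ρ ≤ q ^ 4 / 10)
    (hτ : 19 / 20 * q ^ 4 ≤ τ1) (hx : ∑ k, (x k - x0 k) ^ 2 ≤ ρ ^ 2) :
    ∑ k, x k ^ 2 ≤ (9 / 10 * τ1) ^ 2 := by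
  have h1 : ρ ^ 2 ≤ (q ^ 4 / 10) ^ 2 := pow_le_pow_left₀ h0 hρ 2
  have h2 : (9 / 10 * (19 / 20 * q ^ 4)) ^ 2 ≤ (9 / 10 * τ1) ^ 2 := by gcongr
  have h3 : ∀ k, x k ^ 2 ≤ 6 / 5 * x0 k ^ 2 + 6 * (x k - x0 k) ^ 2 := fun k => by
    nlinarith [sq_nonneg (x0 k - 5 * (x k - x0 k))]
  have h4 : ∑ k, x k ^ 2 ≤ 6 / 5 * ∑ k, x0 k ^ 2 + 6 * ∑ k, (x k - x0 k) ^ 2 := by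
    rw [Finset.mul_sum, Finset.mul_sum, ← Finset.sum_add_distrib]
    exact Finset.sum_le_sum fun k _ => h3 k
  nlinarith [sq_nonneg (q ^ 4)]

/-- The flux bound, with all quantities estimated by one number. -/
lemma flux_le' (D : SmoothDomain d) {N : ℕ} {u : V d} (hu : SmoothC u) (hn : NeumannBC D u)
    {s : ℝ} {x0 : Fin 3 → ℝ} {τ1 τ2 S a b A c : ℝ} (h1 : 0 < τ1) (h12 : τ1 ≤ τ2) (hab : a < b)
    (hS : SrcW D N u τ1 τ2 S) (hSA : S ^ 2 ≤ A) (hEB : EB D N u s x0 τ1 ≤ ENNReal.ofReal A)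
    (hc : 10 * (b - a) / τ1 ≤ c)
    (hcone : ∀ x : Fin 3 → ℝ, ∑ k, (x k - x0 k) ^ 2 ≤ (s - τ1) ^ 2 →
      ∑ k, x k ^ 2 ≤ (9 / 10 * τ1) ^ 2) :
    ∫⁻ τ : ℝ, ∫⁻ x : Fin 3 → ℝ, cutNN D N u s x0 a b τ1 τ2 (Fin.cons τ x) ≤
      ENNReal.ofReal (c * ((8 + 16 * wcard (Fin 10) N) * A)) := by
  have hw := wcard_nonneg (Fin 10) N
  have hA : 0 ≤ A := (sq_nonneg S).trans hSA
  have hc0 : 0 ≤ c := le_trans (div_nonneg (by linarith) h1.le) hc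
  rw [lintegral_cutNN]
  refine (flux_le D hu hn h1 h12 hab hS hcone).trans ?_
  rw [ENNReal.ofReal_mul hc0]
  refine mul_le_mul' (ENNReal.ofReal_le_ofReal hc) ?_
  calc _ ≤ 8 * ENNReal.ofReal A + ENNReal.ofReal (wcard (Fin 10) N * (16 * A)) := by
        gcongr
    _ = _ := by
        rw [← ENNReal.ofReal_ofNat 8, ← ENNReal.ofReal_mul (by norm_num), ← ENNReal.ofReal_add
          (by positivity) (by positivity)]
        congr 1; ring

lemma exists_good_time (D : SmoothDomain d) (N : ℕ) : ∃ C : ℝ, 0 < C ∧ ∀ u : V d, SmoothC u →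
    NeumannBC D u → ∀ (q S A : ℝ) (x0 : Fin 3 → ℝ), 40 ≤ q → ∑ k, x0 k ^ 2 ≤ (q ^ 4 / 2) ^ 2 →
      SrcW D (N + 3) u (19 / 20 * q ^ 4) (q ^ 4) S → S ^ 2 ≤ A →
      ∫⁻ x : Fin 3 → ℝ, NN D (N + 3) u (Fin.cons (19 / 20 * q ^ 4) x) ≤ ENNReal.ofReal A →
      ∃ τ1 ∈ Set.Icc (q ^ 4 - 2 * q ^ 2) (q ^ 4 - q ^ 2),
        ∫⁻ x in cbox x0 (4 * q ^ 2), NN D N u (Fin.cons τ1 x) ≤ ENNReal.ofReal (C * A / q ^ 3) := by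
  obtain ⟨C0, hC0, hyp⟩ := NN_hyp D N
  have hw := wcard_nonneg (Fin 10) (N + 3)
  refine ⟨512 * (8 * C0 * (2 * (320 * (8 + 16 * wcard (Fin 10) (N + 3))))), by positivity, ?_⟩
  intro u hu hn q S A x0 hq hx0 hS hSA hE
  have hq0 : 0 < q := by linarith
  have hA : 0 ≤ A := (sq_nonneg S).trans hSA
  have g0 := pow_succ_ge hq 0
  have g1 := pow_succ_ge hq 1
  have g2 := pow_succ_ge hq 2
  have g3 := pow_succ_ge hq 3
  have g4 := pow_succ_ge hq 4
  have g5 := pow_succ_ge hq 5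
  norm_num at g0 g1 g2 g3 g4 g5
  set s := q ^ 4 + q ^ 4 / 20 with hs
  set a := (q ^ 4 - 2 * q ^ 2) ^ 2 - ∑ k, x0 k ^ 2 - 13 * q ^ 6 with ha
  set b := q ^ 8 - ∑ k, x0 k ^ 2 + 13 * q ^ 6 with hb
  have eba : b - a = 30 * q ^ 6 - 4 * q ^ 4 := by rw [ha, hb]; ring
  have h6 : q ^ 6 = q ^ 4 * q ^ 2 := by ring
  set w := wcard (Fin 10) (N + 3)
  have hflux := flux_le' D hu hn (s := s) (x0 := x0) (a := a) (b := b) (c := 320 * q ^ 2)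
    (τ1 := 19 / 20 * q ^ 4) (τ2 := q ^ 4) (by positivity) (by linarith [pow_pos hq0 4])
    (by linarith [pow_pos hq0 4, pow_pos hq0 6]) hS hSA ((EB_le_lintegral D _ u s x0 _).trans hE)
    (by
      rw [div_le_iff₀ (by positivity), eba]
      nlinarith [pow_pos hq0 4, pow_pos hq0 6])
    (fun x hx => cone_subset hq0.le hx0 (by rw [hs]; linarith [pow_pos hq0 4])
      (by rw [hs]; linarith) le_rfl hx)
  set G := cutNN D (N + 3) u s x0 a b (19 / 20 * q ^ 4) (q ^ 4) with hG
  have hGm : Measurable G := measurable_cutNN D (N + 3) hu _ _ _ _ _ _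
  set W := Set.Icc (q ^ 4 - 2 * q ^ 2) (q ^ 4 - q ^ 2) with hW
  have hX0 := abs_le_of_sum_sq (by positivity) hx0
  have hper : ∀ x ∈ cbox x0 (4 * q ^ 2), ∫⁻ τ in W, NN D N u (Fin.cons τ x) ≤
      ENNReal.ofReal (8 * C0 / q ^ 9 * (2 * (320 * q ^ 2 * ((8 + 16 * w) * A)))) := by
    intro x hx
    have hxs : ∑ k, x k ^ 2 ≤ q ^ 8 / 4 + 13 * q ^ 6 := by
      have := (sum_sq_near hX0 (abs_of_mem_cbox hx)).2
      have e3 : 6 * (4 * q ^ 2) * (q ^ 4 / 2) = 12 * q ^ 6 := by ring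
      have e4 : 3 * (4 * q ^ 2) ^ 2 = 48 * q ^ 4 := by ring
      have e7 : (q ^ 4 / 2) ^ 2 = q ^ 8 / 4 := by ring
      rw [e3, e4] at this
      rw [e7] at hx0
      have := pow_succ_ge hq 4
      norm_num at this
      linarith [pow_pos hq0 6, pow_pos hq0 4]
    have g7 := pow_succ_ge hq 6
    have g8 := pow_succ_ge hq 7
    norm_num at g7 g8
    have e1 : (q ^ 4 - 2 * q ^ 2) ^ 2 = q ^ 8 - 4 * q ^ 6 + 4 * q ^ 4 := by ring
    have e2 : (q ^ 3 / 2) ^ 2 = q ^ 6 / 4 := by ring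
    calc _ ≤ ∫⁻ τ in W, ENNReal.ofReal (8 * C0 / q ^ 9) *
          ∫⁻ x' in Pset x (q ^ 3 / 2), G (hp (τ ^ 2 - ∑ k, x k ^ 2) x') := by
          refine setLIntegral_mono' measurableSet_Icc fun τ hτ => ?_
          have hτ0 : 0 ≤ τ := by linarith [hτ.1]
          have hτ1 : (q ^ 4 - 2 * q ^ 2) ^ 2 ≤ τ ^ 2 := pow_le_pow_left₀ (by linarith) hτ.1 2
          rw [e1] at hτ1
          have := hyp u hu (τ ^ 2 - ∑ k, x k ^ 2) (q ^ 3 / 2) x (by positivity) (fun x' _ => by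
            have : 0 ≤ ∑ k, x' k ^ 2 := Finset.sum_nonneg fun _ _ => sq_nonneg _
            rw [e2]; linarith [pow_pos hq0 4, pow_pos hq0 6])
          rw [hp_self hτ0] at this
          refine this.trans (mul_le_mul' (le_of_eq ?_) ?_)
          · congr 1; field_simp; norm_num
          · refine setLIntegral_mono' (measurableSet_Pset x _) fun x' hx' => ?_
            obtain ⟨r1, r2, r3⟩ := mem_region_early hq hx0 hτ hx hx'
            exact (cutNN_eq D (N + 3) u r1 r2 r3).ge
      _ ≤ ENNReal.ofReal (8 * C0 / q ^ 9) *
          (2 * ∫⁻ τ : ℝ, ∫⁻ x' : Fin 3 → ℝ, G (Fin.cons τ x')) := by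
          rw [lintegral_const_mul' _ _ ENNReal.ofReal_ne_top]
          refine mul_le_mul_right (lintegral_hyp_subst hGm (by linarith) (by positivity)
            (by linarith) ?_) _
          rw [e1]; linarith [pow_pos hq0 4, pow_pos hq0 6]
      _ ≤ ENNReal.ofReal (8 * C0 / q ^ 9) *
          (2 * ENNReal.ofReal (320 * q ^ 2 * ((8 + 16 * w) * A))) := by gcongr
      _ = _ := by
          rw [← ENNReal.ofReal_ofNat 2, ← ENNReal.ofReal_mul (by norm_num),
            ← ENNReal.ofReal_mul (by positivity)]
  have hvolW : volume W = ENNReal.ofReal (q ^ 2) := by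
    rw [hW, Real.volume_Icc]; congr 1; ring
  have hvolb : volume (cbox x0 (4 * q ^ 2)) = ENNReal.ofReal (512 * q ^ 6) := by
    rw [cbox, Real.volume_Icc_pi, Fin.prod_univ_three]
    have e : ∀ k : Fin 3, x0 k + 4 * q ^ 2 - (x0 k - 4 * q ^ 2) = 8 * q ^ 2 := fun k => by ring
    rw [e, e, e, ← ENNReal.ofReal_mul (by positivity), ← ENNReal.ofReal_mul (by positivity)]
    congr 1; ring
  have hm : Measurable fun p : ℝ × (Fin 3 → ℝ) => NN D N u (Fin.cons p.1 p.2) :=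
    (measurable_NN D N hu).comp measurable_cons_pair
  have htot : ∫⁻ τ in W, ∫⁻ x in cbox x0 (4 * q ^ 2), NN D N u (Fin.cons τ x) ≤
      ENNReal.ofReal (8 * C0 / q ^ 9 * (2 * (320 * q ^ 2 * ((8 + 16 * w) * A))) *
        (512 * q ^ 6)) := by
    rw [lintegral_lintegral_swap hm.aemeasurable]
    refine (setLIntegral_mono' measurableSet_Icc hper).trans ?_
    rw [setLIntegral_const, ← cbox, hvolb, ← ENNReal.ofReal_mul (by positivity)]
  obtain ⟨τ1, hτ1, h⟩ := exists_le_setLAverage (μ := volume) (s := W)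
    (f := fun τ => ∫⁻ x in cbox x0 (4 * q ^ 2), NN D N u (Fin.cons τ x))
    (by rw [hvolW]; simp [hq0.ne']) (by rw [hvolW]; simp)
    (hm.lintegral_prod_right' (ν := volume.restrict (cbox x0 (4 * q ^ 2)))).aemeasurable
  refine ⟨τ1, hτ1, h.trans ?_⟩
  rw [setLAverage_eq, hvolW]
  refine ENNReal.div_le_of_le_mul (htot.trans (le_of_eq ?_))
  rw [← ENNReal.ofReal_mul (by positivity)]
  congr 1
  field_simp

lemma setLIntegral_sub_left (f : ℝ → ENNReal) (T h : ℝ) :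
    ∫⁻ s in Set.Icc 0 h, f (T - s) = ∫⁻ τ in Set.Icc (T - h) T, f τ := by
  rw [← lintegral_indicator measurableSet_Icc, ← lintegral_indicator measurableSet_Icc,
    ← lintegral_sub_left_eq_self ((Set.Icc (T - h) T).indicator f) T]
  refine lintegral_congr fun s => ?_
  by_cases hs : s ∈ Set.Icc 0 h
  · rw [Set.indicator_of_mem hs, Set.indicator_of_mem]
    exact ⟨by linarith [hs.2], by linarith [hs.1]⟩
  · rw [Set.indicator_of_notMem hs, Set.indicator_of_notMem]
    exact fun hc => hs ⟨by linarith [hc.2], by linarith [hc.1]⟩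

lemma NN_le_of_good_time (D : SmoothDomain d) (N : ℕ) : ∃ C : ℝ, 0 < C ∧ ∀ u : V d, SmoothC u →
    NeumannBC D u → ∀ (q S A τ1 : ℝ) (x0 : Fin 3 → ℝ), 40 ≤ q → ∑ k, x0 k ^ 2 ≤ (q ^ 4 / 2) ^ 2 →
      τ1 ∈ Set.Icc (q ^ 4 - 2 * q ^ 2) (q ^ 4 - q ^ 2) →
      SrcW D (N + 5) u τ1 (q ^ 4) S → S ^ 2 ≤ A →
      ∫⁻ x in cbox x0 (4 * q ^ 2), NN D (N + 5) u (Fin.cons τ1 x) ≤ ENNReal.ofReal A →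
      NN D N u (Fin.cons (q ^ 4) x0) ≤ ENNReal.ofReal (C * A / q ^ 6) := by
  obtain ⟨C1, hC1, htime⟩ := NN_time D N
  obtain ⟨C2, hC2, hyp⟩ := NN_hyp D (N + 2)
  have hw := wcard_nonneg (Fin 10) (N + 5)
  refine ⟨C1 * (8 * C2 * (2 * (40 * (8 + 16 * wcard (Fin 10) (N + 5))))), by positivity, ?_⟩
  intro u hu hn q S A τ1 x0 hq hx0 hτ1 hS hSA hE
  have hq0 : 0 < q := by linarith
  have hA : 0 ≤ A := (sq_nonneg S).trans hSA
  have g0 := pow_succ_ge hq 0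
  have g1 := pow_succ_ge hq 1
  have g2 := pow_succ_ge hq 2
  have g3 := pow_succ_ge hq 3
  have g4 := pow_succ_ge hq 4
  have g5 := pow_succ_ge hq 5
  have g6 := pow_succ_ge hq 6
  have g7 := pow_succ_ge hq 7
  norm_num at g0 g1 g2 g3 g4 g5 g6 g7
  have p4 := pow_pos hq0 4
  have p2 := pow_pos hq0 2
  set s := q ^ 4 + 2 * q ^ 2 with hs
  set a := (q ^ 4 - 1) ^ 2 - ∑ k, x0 k ^ 2 with ha
  set b := q ^ 8 - ∑ k, x0 k ^ 2 with hb
  have eba : b - a = 2 * q ^ 4 - 1 := by rw [ha, hb]; ring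
  have hτh : q ^ 4 / 2 ≤ τ1 := by linarith [hτ1.1]
  have hτ0 : 0 < τ1 := by linarith
  set w := wcard (Fin 10) (N + 5)
  have hsτ : s - τ1 ≤ 4 * q ^ 2 := by rw [hs]; linarith [hτ1.1]
  have hsτ0 : 0 ≤ s - τ1 := by rw [hs]; linarith [hτ1.2]
  have hflux := flux_le' D hu hn (s := s) (x0 := x0) (a := a) (b := b) (c := 40)
    (τ1 := τ1) (τ2 := q ^ 4) hτ0 (by linarith [hτ1.2]) (by linarith) hS hSA
    ((EB_le_setLIntegral D _ u x0 hsτ).trans hE)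
    (by rw [div_le_iff₀ hτ0, eba]; linarith)
    (fun x hx => cone_subset hq0.le hx0 hsτ0 (by linarith) (by linarith [hτ1.1]) hx)
  set G := cutNN D (N + 5) u s x0 a b τ1 (q ^ 4) with hG
  have hGm : Measurable G := measurable_cutNN D (N + 5) hu _ _ _ _ _ _
  have e7 : (q ^ 4 / 2) ^ 2 = q ^ 8 / 4 := by ring
  rw [e7] at hx0
  have e8 : (q ^ 4 - 1) ^ 2 = q ^ 8 - 2 * q ^ 4 + 1 := by ring
  have hpt : ∀ η ∈ Set.Icc (0 : ℝ) 1, ENNReal.ofReal (η * √η) *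
      NN D (N + 2) u (Fin.cons (q ^ 4 - η) x0) ≤ ENNReal.ofReal (8 * C2 / q ^ 6) *
        ∫⁻ x' in Pset x0 (q ^ 2 / 2), G (hp ((q ^ 4 - η) ^ 2 - ∑ k, x0 k ^ 2) x') := by
    intro η hη
    rcases hη.1.eq_or_lt with h0 | h0
    · rw [← h0]; simp
    have hsq : √η ^ 2 = η := Real.sq_sqrt h0.le
    have hsp : 0 < √η := Real.sqrt_pos.2 h0
    have hs1 : √η ≤ 1 := Real.sqrt_le_one.2 hη.2
    set ℓ := q ^ 2 / 2 * √η with hℓ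
    have hℓ0 : 0 < ℓ := by positivity
    have hℓ2 : ℓ ^ 2 = q ^ 4 / 4 * η := by rw [hℓ, mul_pow, hsq]; ring
    have hτ : q ^ 4 - η ∈ Set.Icc (q ^ 4 - 1) (q ^ 4) := ⟨by linarith [hη.2], by linarith⟩
    have hb1 : (q ^ 4 - 1) ^ 2 ≤ (q ^ 4 - η) ^ 2 :=
      pow_le_pow_left₀ (by linarith) hτ.1 2
    have hb2 : q ^ 4 / 4 * η ≤ q ^ 4 / 4 * 1 := by gcongr; exact hη.2
    have := hyp u hu ((q ^ 4 - η) ^ 2 - ∑ k, x0 k ^ 2) ℓ x0 hℓ0 (fun x' _ => by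
      have : 0 ≤ ∑ k, x' k ^ 2 := Finset.sum_nonneg fun _ _ => sq_nonneg _
      rw [hℓ2]; linarith)
    rw [hp_self (by linarith [hη.2])] at this
    calc _ ≤ ENNReal.ofReal (η * √η) * (ENNReal.ofReal (C2 / ℓ ^ 3) *
          ∫⁻ x' in Pset x0 (q ^ 2 / 2), G (hp ((q ^ 4 - η) ^ 2 - ∑ k, x0 k ^ 2) x')) := by
          refine mul_le_mul_right (this.trans (mul_le_mul_right ?_ _)) _
          calc _ ≤ ∫⁻ x' in Pset x0 ℓ, G (hp ((q ^ 4 - η) ^ 2 - ∑ k, x0 k ^ 2) x') := by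
                refine setLIntegral_mono' (measurableSet_Pset x0 _) fun x' hx' => ?_
                obtain ⟨r1, r2, r3⟩ := mem_region_late hq (by rw [e7]; exact hx0) hτ hτ1.2 hτ0.le
                  hℓ0.le (by rw [hℓ2]; linarith) hx'
                exact (cutNN_eq D (N + 5) u r1 r2 r3).ge
            _ ≤ _ := lintegral_mono_set (Pset_mono hℓ0.le
                (mul_le_of_le_one_right (by positivity) hs1))
      _ = _ := by
          rw [← mul_assoc, ← ENNReal.ofReal_mul (by positivity)]
          congr 2
          have : ℓ ^ 3 = q ^ 6 / 8 * (η * √η) := by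
            rw [hℓ]
            calc _ = q ^ 6 / 8 * (√η ^ 2 * √η) := by ring
              _ = _ := by rw [hsq]
          rw [this]
          field_simp
  have h1 := htime u hu (Fin.cons (q ^ 4) x0)
  simp only [Fin.cons_zero, Fin.update_cons_zero] at h1
  refine h1.trans ?_
  calc _ ≤ ENNReal.ofReal C1 * ∫⁻ η in Set.Icc (0 : ℝ) 1, ENNReal.ofReal (8 * C2 / q ^ 6) *
        ∫⁻ x' in Pset x0 (q ^ 2 / 2), G (hp ((q ^ 4 - η) ^ 2 - ∑ k, x0 k ^ 2) x') :=
        mul_le_mul_right (setLIntegral_mono' measurableSet_Icc hpt) _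
    _ ≤ ENNReal.ofReal C1 * (ENNReal.ofReal (8 * C2 / q ^ 6) *
        (2 * ∫⁻ τ : ℝ, ∫⁻ x' : Fin 3 → ℝ, G (Fin.cons τ x'))) := by
        refine mul_le_mul_right ?_ _
        rw [lintegral_const_mul' _ _ ENNReal.ofReal_ne_top]
        refine mul_le_mul_right ?_ _
        refine (setLIntegral_sub_left (fun τ => ∫⁻ x' in Pset x0 (q ^ 2 / 2),
          G (hp (τ ^ 2 - ∑ k, x0 k ^ 2) x')) (q ^ 4) 1).le.trans ?_
        refine lintegral_hyp_subst hGm (by linarith) (by positivity) (by linarith) ?_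
        rw [e8]; linarith
    _ ≤ ENNReal.ofReal C1 * (ENNReal.ofReal (8 * C2 / q ^ 6) *
        (2 * ENNReal.ofReal (40 * ((8 + 16 * w) * A)))) := by gcongr
    _ = _ := by
        rw [← ENNReal.ofReal_ofNat 2, ← ENNReal.ofReal_mul (by norm_num),
          ← ENNReal.ofReal_mul (by positivity), ← ENNReal.ofReal_mul (by positivity)]
        congr 1
        ring

lemma Src.mono {D : SmoothDomain d} {B t Q : ℝ} {N M : ℕ} {u : V d} (h : Src D B N u t Q)
    (hM : M ≤ N) : Src D B M u t Q :=
  ⟨h.nonneg, fun β hβ => h.sup_le β (hβ.trans hM), fun β hβ => h.int_le β (hβ.trans hM)⟩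

lemma continuous_sqrt_IK (D : SmoothDomain d) {u : V d} (hu : SmoothC u) (β : List (Fin 10))
    {K : Set (Fin 3 → ℝ)} (hK : IsCompact K) : Continuous fun τ =>
      √(IK D K (fun z y => zw β (wBox u) z y * zw β (wBox u) z y) τ) := by
  have h := smooth_zw (smooth_wBox hu) β
  exact (continuous_IK D hK (smooth_mul h h)).sqrt

lemma Src.window {D : SmoothDomain d} {B t Q : ℝ} {N : ℕ} {u : V d} (hu : SmoothC u)
    (h : Src D B N u t Q) {τ1 : ℝ} (h1 : 2 * B ≤ τ1) (h2 : τ1 ≤ t) : SrcW D N u τ1 t Q := by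
  intro β hβ K hK
  refine le_trans ?_ (h.int_le β hβ K hK)
  exact intervalIntegral.integral_mono_interval h1 h2 le_rfl
    (Filter.Eventually.of_forall fun τ => Real.sqrt_nonneg _)
    ((continuous_sqrt_IK D hu β hK).intervalIntegrable _ _)

lemma Src.window_late {D : SmoothDomain d} {B t Q : ℝ} {N : ℕ} {u : V d} (hu : SmoothC u)
    (h : Src D B N u t Q) {τ1 : ℝ} (h1 : 2 * B ≤ τ1) (h0 : 0 < τ1) (h2 : τ1 ≤ t) :
    SrcW D N u τ1 t ((t - τ1) * (Q / τ1)) := by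
  intro β hβ K hK
  have := intervalIntegral.integral_mono_on h2
    ((continuous_sqrt_IK D hu β hK).intervalIntegrable _ _)
    (intervalIntegrable_const (μ := volume) (c := Q / τ1))
    (fun τ hτ => by
      have h3 := h.sup_le β hβ K hK τ ⟨h1.trans hτ.1, hτ.2⟩
      rw [le_div_iff₀ h0]
      nlinarith [mul_le_mul_of_nonneg_right hτ.1 (Real.sqrt_nonneg
        (IK D K (fun z y => zw β (wBox u) z y * zw β (wBox u) z y) τ))])
  rwa [intervalIntegral.integral_const, smul_eq_mul] at this

/-- The decay `t⁻²` of the energy density, in terms of the source only. -/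
theorem NN_decay (D : SmoothDomain d) {B : ℝ} (hB : 0 < B) (N : ℕ) : ∃ C : ℝ, 0 < C ∧
    ∀ u : V d, SmoothC u → NeumannBC D u →
      (∀ z : Fin 4 → ℝ, ∀ y ∈ closure D.carrier, 0 ≤ z 0 → z 0 ≤ 2 * B → u z y = 0) →
      ∀ t Q : ℝ, 2 * B ≤ t → Src D B (N + 8) u t Q → ∀ x : Fin 3 → ℝ,
        NN D N u (Fin.cons t x) ≤ ENNReal.ofReal (C * Q ^ 2 / t ^ 2) := by
  obtain ⟨Cf, hCf, hflat⟩ := NN_flat_three D N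
  obtain ⟨Cr, hCr, hrot⟩ := NN_rot D N
  obtain ⟨Cg, hCg, hgood⟩ := exists_good_time D (N + 5)
  obtain ⟨Ca, hCa, hlate⟩ := NN_le_of_good_time D N
  have hw := wcard_nonneg (Fin 10) (N + 8)
  have hw3 := wcard_nonneg (Fin 10) (N + 3)
  set w := wcard (Fin 10) (N + 8)
  set w3 := wcard (Fin 10) (N + 3)
  set T := (40 + B) ^ 4 with hT
  have hT0 : 0 < T := by positivity
  refine ⟨Cf * (4 * w3) * T ^ 2 + Cr * (16 * w3) + Ca * (Cg * (4 * w + 1) + 16), by positivity, ?_⟩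
  intro u hu hn h0 t Q ht hQ x
  have ht0 : 0 < t := by linarith
  have hE3 := lintegral_NN_le D hB hu hn h0 (hQ.mono (show N + 3 ≤ N + 8 by omega))
    (τ := t) ⟨ht, le_rfl⟩
  rcases le_total t T with hc | hc
  · refine (hflat u hu t x).trans ?_
    calc _ ≤ ENNReal.ofReal Cf * ENNReal.ofReal (w3 * (4 * Q ^ 2)) :=
          mul_le_mul_right ((setLIntegral_le_lintegral _ _).trans hE3) _
      _ ≤ _ := by
          rw [← ENNReal.ofReal_mul hCf.le]
          refine ENNReal.ofReal_le_ofReal ?_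
          rw [le_div_iff₀ (by positivity)]
          have : t ^ 2 ≤ T ^ 2 := by gcongr
          have h2 : Cf * (4 * w3) * Q ^ 2 * t ^ 2 ≤ Cf * (4 * w3) * Q ^ 2 * T ^ 2 := by gcongr
          have h3 : 0 ≤ (Cr * (16 * w3) + Ca * (Cg * (4 * w + 1) + 16)) * Q ^ 2 := by positivity
          linarith
  rcases le_total ((t / 2) ^ 2) (∑ k, x k ^ 2) with hx | hx
  · refine (hrot u hu t x (t / 2) (by positivity) hx).trans ?_
    calc _ ≤ ENNReal.ofReal (Cr / (t / 2) ^ 2) * ENNReal.ofReal (w3 * (4 * Q ^ 2)) :=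
          mul_le_mul_right hE3 _
      _ ≤ _ := by
          rw [← ENNReal.ofReal_mul (by positivity)]
          refine ENNReal.ofReal_le_ofReal ?_
          rw [le_div_iff₀ (by positivity)]
          have h2 : Cr / (t / 2) ^ 2 * (w3 * (4 * Q ^ 2)) * t ^ 2 = Cr * (16 * w3) * Q ^ 2 := by
            field_simp; ring
          have h3 : 0 ≤ (Cf * (4 * w3) * T ^ 2 + Ca * (Cg * (4 * w + 1) + 16)) * Q ^ 2 := by
            positivity
          rw [h2]; linarith
  · obtain ⟨q, hq, rfl⟩ : ∃ q : ℝ, 40 + B ≤ q ∧ q ^ 4 = t := by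
      refine ⟨√(√t), ?_, ?_⟩
      · refine Real.le_sqrt_of_sq_le (Real.le_sqrt_of_sq_le ?_)
        rw [← pow_mul]; exact hc
      · rw [show (4 : ℕ) = 2 * 2 from rfl, pow_mul, Real.sq_sqrt (Real.sqrt_nonneg _),
          Real.sq_sqrt ht0.le]
    have hq40 : 40 ≤ q := by linarith
    have hq0 : 0 < q := by linarith
    have g0 := pow_succ_ge hq40 0
    have g1 := pow_succ_ge hq40 1
    have g2 := pow_succ_ge hq40 2
    have g3 := pow_succ_ge hq40 3
    norm_num at g0 g1 g2 g3
    have hwin : SrcW D (N + 8) u (19 / 20 * q ^ 4) (q ^ 4) Q :=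
      hQ.window hu (by linarith) (by linarith)
    have hE8 := lintegral_NN_le D hB hu hn h0 hQ (τ := 19 / 20 * q ^ 4)
      ⟨by linarith, by linarith⟩
    have hQ2 := sq_nonneg Q
    obtain ⟨τ1, hτ1, hE⟩ := hgood u hu hn q Q ((4 * w + 1) * Q ^ 2) x hq40 hx hwin
      (by nlinarith [mul_nonneg hw hQ2])
      (hE8.trans (ENNReal.ofReal_le_ofReal (by linarith)))
    have hτh : q ^ 4 / 2 ≤ τ1 := by linarith [hτ1.1]
    have hτ0 : 0 < τ1 := by linarith [pow_pos hq0 4]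
    have hτt : τ1 ≤ q ^ 4 := by linarith [hτ1.2, pow_pos hq0 2]
    have hlw := (hQ.mono (show N + 5 ≤ N + 8 by omega)).window_late hu (τ1 := τ1)
      (by linarith) hτ0 hτt
    have hS0 : 0 ≤ (q ^ 4 - τ1) * (Q / τ1) :=
      mul_nonneg (by linarith) (div_nonneg hQ.nonneg hτ0.le)
    have hS : (q ^ 4 - τ1) * (Q / τ1) ≤ 4 * Q / q ^ 2 := by
      calc _ ≤ (2 * q ^ 2) * (Q / (q ^ 4 / 2)) := by
            refine mul_le_mul (by linarith [hτ1.1]) ?_ (div_nonneg hQ.nonneg hτ0.le)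
              (by positivity)
            exact div_le_div_of_nonneg_left hQ.nonneg (by positivity) hτh
        _ = _ := by field_simp; ring
    have hSA : ((q ^ 4 - τ1) * (Q / τ1)) ^ 2 ≤
        (Cg * (4 * w + 1) + 16) * Q ^ 2 / q ^ 3 := by
      calc _ ≤ (4 * Q / q ^ 2) ^ 2 := pow_le_pow_left₀ hS0 hS 2
        _ = 16 * Q ^ 2 / q ^ 4 := by ring
        _ ≤ 16 * Q ^ 2 / q ^ 3 := by
            refine div_le_div_of_nonneg_left (by positivity) (by positivity) ?_
            linarith [pow_pos hq0 3]
        _ ≤ _ := by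
            gcongr
            have : 0 ≤ Cg * (4 * w + 1) := by positivity
            linarith
    refine (hlate u hu hn q _ _ τ1 x hq40 hx hτ1 hlw hSA (hE.trans
      (ENNReal.ofReal_le_ofReal ?_))).trans (ENNReal.ofReal_le_ofReal ?_)
    · refine div_le_div_of_nonneg_right ?_ (by positivity)
      linarith
    · have e : Ca * ((Cg * (4 * w + 1) + 16) * Q ^ 2 / q ^ 3) / q ^ 6 =
          Ca * (Cg * (4 * w + 1) + 16) * Q ^ 2 / q ^ 9 := by
        field_simp
      have e2 : (q ^ 4) ^ 2 = q ^ 8 := by ring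
      rw [e, e2]
      have g8 := pow_succ_ge hq40 8
      norm_num at g8
      refine div_le_div₀ (by positivity) ?_ (by positivity) (by linarith [pow_pos hq0 8])
      have : 0 ≤ Cf * (4 * w3) * T ^ 2 + Cr * (16 * w3) := by positivity
      nlinarith [mul_nonneg this hQ2]

/-- One summand of the dyadic sum. -/
def dyTerm (g : ℝ → ℝ) (B t : ℝ) (k : ℤ) : ℝ :=
  sSup ((fun τ => (2:ℝ)^k * g τ) ''
    (Set.Icc ((2:ℝ)^(k-1)) ((2:ℝ)^(k+1)) ∩ Set.Icc (2*B) t))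

lemma dyTerm_nonneg {g : ℝ → ℝ} {B t : ℝ} (h0 : ∀ τ ∈ Set.Icc (2 * B) t, 0 ≤ g τ) (k : ℤ) :
    0 ≤ dyTerm g B t k := by
  refine Real.sSup_nonneg ?_
  rintro _ ⟨τ, hτ, rfl⟩
  exact mul_nonneg (by positivity) (h0 τ hτ.2)

lemma le_dyTerm {g : ℝ → ℝ} {B t : ℝ} (hg : ContinuousOn g (Set.Icc (2 * B) t)) {k : ℤ} {τ : ℝ}
    (h1 : τ ∈ Set.Icc (2 * B) t) (h2 : τ ∈ Set.Ico ((2:ℝ)^k) ((2:ℝ)^(k+1))) :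
    2 ^ k * g τ ≤ dyTerm g B t k := by
  refine le_csSup ?_ ⟨τ, ⟨⟨le_trans ?_ h2.1, h2.2.le⟩, h1⟩, rfl⟩
  · refine ((isCompact_Icc (a := 2 * B) (b := t)).image_of_continuousOn
      (continuousOn_const.mul hg)).bddAbove.mono (Set.image_mono Set.inter_subset_right)
  · exact zpow_le_zpow_right₀ (by norm_num) (by omega)

lemma summable_dyTerm (g : ℝ → ℝ) {B t : ℝ} (hB : 0 < B) (ht : 2 * B ≤ t) :
    Summable (dyTerm g B t) := by
  have ht0 : 0 < t := by linarith
  obtain ⟨a, ha, -⟩ := exists_mem_Ico_zpow (x := 2 * B) (y := (2 : ℝ)) (by linarith) (by norm_num)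
  obtain ⟨b, -, hb⟩ := exists_mem_Ico_zpow (x := t) (y := (2 : ℝ)) ht0 (by norm_num)
  refine summable_of_ne_finset_zero (s := Finset.Icc (a - 1) (b + 2)) fun k hk => ?_
  have : Set.Icc ((2:ℝ)^(k-1)) ((2:ℝ)^(k+1)) ∩ Set.Icc (2*B) t = ∅ := by
    refine Set.eq_empty_of_forall_notMem fun τ hτ => hk ?_
    have h1 : (2 : ℝ) ^ (k - 1) < 2 ^ (b + 1) := (hτ.1.1.trans hτ.2.2).trans_lt hb
    have h2 : (2 : ℝ) ^ a ≤ 2 ^ (k + 1) := (ha.trans hτ.2.1).trans hτ.1.2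
    have h3 := (zpow_lt_zpow_iff_right₀ (by norm_num : (1:ℝ) < 2)).1 h1
    have h4 := (zpow_le_zpow_iff_right₀ (by norm_num : (1:ℝ) < 2)).1 h2
    exact Finset.mem_Icc.2 ⟨by omega, by omega⟩
  rw [dyTerm, this, Set.image_empty, Real.sSup_empty]

lemma dyadic_nonneg {g : ℝ → ℝ} {B t : ℝ} (h0 : ∀ τ ∈ Set.Icc (2 * B) t, 0 ≤ g τ) :
    0 ≤ dyadic g B t := tsum_nonneg fun k => dyTerm_nonneg h0 k

lemma mul_le_dyadic {g : ℝ → ℝ} {B t : ℝ} (hB : 0 < B)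
    (hg : ContinuousOn g (Set.Icc (2 * B) t)) (h0 : ∀ τ ∈ Set.Icc (2 * B) t, 0 ≤ g τ)
    {τ : ℝ} (hτ : τ ∈ Set.Icc (2 * B) t) : τ * g τ ≤ 2 * dyadic g B t := by
  obtain ⟨k, hk⟩ := exists_mem_Ico_zpow (x := τ) (y := (2 : ℝ)) (by linarith [hτ.1]) (by norm_num)
  have h1 := le_dyTerm hg hτ hk
  have h2 : dyTerm g B t k ≤ dyadic g B t :=
    (summable_dyTerm g hB (hτ.1.trans hτ.2)).le_tsum k fun j _ => dyTerm_nonneg h0 j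
  have h3 : τ * g τ ≤ 2 ^ (k + 1) * g τ := mul_le_mul_of_nonneg_right hk.2.le (h0 τ hτ)
  rw [zpow_add_one₀ (by norm_num)] at h3
  linarith

lemma integral_le_dyadic {g : ℝ → ℝ} {B t : ℝ} (hB : 0 < B) (ht : 2 * B ≤ t)
    (hg : ContinuousOn g (Set.Icc (2 * B) t)) (h0 : ∀ τ ∈ Set.Icc (2 * B) t, 0 ≤ g τ) :
    ∫ τ in (2 * B)..t, g τ ≤ dyadic g B t := by
  rw [← ENNReal.ofReal_le_ofReal_iff (dyadic_nonneg h0), ofReal_intervalIntegral ht hg h0]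
  have hcov : Set.Icc (2 * B) t ⊆
      ⋃ k : ℤ, Set.Icc (2 * B) t ∩ Set.Ico ((2:ℝ)^k) ((2:ℝ)^(k+1)) := by
    intro τ hτ
    obtain ⟨k, hk⟩ := exists_mem_Ico_zpow (x := τ) (y := (2 : ℝ)) (by linarith [hτ.1])
      (by norm_num)
    exact Set.mem_iUnion.2 ⟨k, hτ, hk⟩
  calc _ ≤ ∑' k : ℤ, ∫⁻ τ in Set.Icc (2 * B) t ∩ Set.Ico ((2:ℝ)^k) ((2:ℝ)^(k+1)),
        ENNReal.ofReal (g τ) := (lintegral_mono_set hcov).trans (lintegral_iUnion_le _ _)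
    _ ≤ ∑' k : ℤ, ENNReal.ofReal (dyTerm g B t k) := by
        refine ENNReal.tsum_le_tsum fun k => ?_
        have hp : (0 : ℝ) < 2 ^ k := by positivity
        calc _ ≤ ∫⁻ τ in Set.Icc (2 * B) t ∩ Set.Ico ((2:ℝ)^k) ((2:ℝ)^(k+1)),
              ENNReal.ofReal (dyTerm g B t k / 2 ^ k) := by
              refine setLIntegral_mono' (measurableSet_Icc.inter measurableSet_Ico) fun τ hτ => ?_
              refine ENNReal.ofReal_le_ofReal ?_
              rw [le_div_iff₀ hp, mul_comm]
              exact le_dyTerm hg hτ.1 hτ.2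
          _ ≤ ENNReal.ofReal (dyTerm g B t k / 2 ^ k) * volume (Set.Ico ((2:ℝ)^k) (2^(k+1))) := by
              rw [setLIntegral_const]
              exact mul_le_mul_right (measure_mono Set.inter_subset_right) _
          _ = _ := by
              rw [Real.volume_Ico, ← ENNReal.ofReal_mul
                (div_nonneg (dyTerm_nonneg h0 k) hp.le), zpow_add_one₀ (by norm_num)]
              congr 1
              field_simp
              ring
    _ = _ := (ENNReal.ofReal_tsum_of_nonneg (fun k => dyTerm_nonneg h0 k)
        (summable_dyTerm g hB ht)).symm

lemma IK_mono_set (D : SmoothDomain d) {K K' : Set (Fin 3 → ℝ)} (hK' : IsCompact K')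
    (h : K ⊆ K') {F : V d} (hF : SmoothC F) (h0 : ∀ z y, 0 ≤ F z y) (τ : ℝ) :
    IK D K F τ ≤ IK D K' F τ := by
  refine integral_mono_measure ?_ (Filter.Eventually.of_forall fun p => h0 _ _)
    (integrable_IK D hK' hF τ)
  rw [muK_eq, muK_eq]
  exact Measure.restrict_mono (Set.prod_mono h le_rfl) le_rfl

lemma L2txy_eq (D : SmoothDomain d) {B : ℝ} (hB : 0 < B) {G : V d} (hG : SmoothC G)
    (hG0 : ∀ z, ∀ y ∈ D.carrier, 0 < z 0 → z 0 - B < rad z → G z y = 0)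
    {K : Set (Fin 3 → ℝ)} (hK : IsCompact K) {τ : ℝ} (hτ : 0 < τ)
    (hsub : Set.Icc (fun _ => -τ) (fun _ => τ) ⊆ K) :
    L2txy D G τ = √(IK D K (fun z y => G z y * G z y) τ) := by
  rw [IK_eq_iterated D hK (smooth_mul hG hG), L2txy]
  congr 1
  rw [← setIntegral_eq_integral_of_forall_compl_eq_zero (s := K)]
  · simp only [sq]
  intro x hx
  have hx2 : τ - B < rad (Fin.cons τ x) := by
    have : ∃ k, τ < |x k| := by
      by_contra hc
      push Not at hc
      exact hx (hsub ⟨fun k => neg_le_of_abs_le (hc k), fun k => le_of_abs_le (hc k)⟩)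
    obtain ⟨k, hk⟩ := this
    have h1 : |x k| ≤ rad (Fin.cons τ x) := by
      refine Real.le_sqrt_of_sq_le ?_
      rw [sq_abs]
      have e : (Fin.cons τ x : Fin 4 → ℝ) 1 ^ 2 + (Fin.cons τ x : Fin 4 → ℝ) 2 ^ 2 +
        (Fin.cons τ x : Fin 4 → ℝ) 3 ^ 2 = ∑ k, x k ^ 2 := by
        rw [Fin.sum_univ_three]; rfl
      rw [e]
      exact Finset.single_le_sum (f := fun k => x k ^ 2) (fun _ _ => sq_nonneg _)
        (Finset.mem_univ k)
    linarith
  refine (setIntegral_congr_fun D.isOpen.measurableSet (g := fun _ => 0) fun y hy => ?_).trans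
    (by simp)
  simp only [hG0 (Fin.cons τ x) y hy hτ hx2]
  norm_num

lemma IK_dyadic (D : SmoothDomain d) {B : ℝ} (hB : 0 < B) {G : V d} (hG : SmoothC G)
    (hG0 : ∀ z, ∀ y ∈ D.carrier, 0 < z 0 → z 0 - B < rad z → G z y = 0) {t : ℝ}
    (ht : 2 * B ≤ t) {K : Set (Fin 3 → ℝ)} (hK : IsCompact K) :
    0 ≤ dyadic (L2txy D G) B t ∧ (∀ τ ∈ Set.Icc (2 * B) t,
      τ * √(IK D K (fun z y => G z y * G z y) τ) ≤ 2 * dyadic (L2txy D G) B t) ∧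
    ∫ τ in (2 * B)..t, √(IK D K (fun z y => G z y * G z y) τ) ≤ dyadic (L2txy D G) B t := by
  have hK' := hK.union (isCompact_Icc (a := fun _ : Fin 3 => -t) (b := fun _ => t))
  set K' := K ∪ Set.Icc (fun _ : Fin 3 => -t) (fun _ => t)
  have hGG := smooth_mul hG hG
  have heq : ∀ τ ∈ Set.Icc (2 * B) t,
      L2txy D G τ = √(IK D K' (fun z y => G z y * G z y) τ) := fun τ hτ => by
    refine L2txy_eq D hB hG hG0 hK' (by linarith [hτ.1]) (le_trans ?_ Set.subset_union_right)
    exact Set.Icc_subset_Icc (fun _ => by simp only; linarith [hτ.2]) (fun _ => hτ.2)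
  have hcont : ContinuousOn (L2txy D G) (Set.Icc (2 * B) t) :=
    ((continuous_IK D hK' hGG).sqrt.continuousOn).congr heq
  have hnn : ∀ τ ∈ Set.Icc (2 * B) t, 0 ≤ L2txy D G τ := fun _ _ => Real.sqrt_nonneg _
  have hle : ∀ τ ∈ Set.Icc (2 * B) t,
      √(IK D K (fun z y => G z y * G z y) τ) ≤ L2txy D G τ := fun τ hτ => by
    rw [heq τ hτ]
    exact Real.sqrt_le_sqrt (IK_mono_set D hK' Set.subset_union_left hGG
      (fun _ _ => mul_self_nonneg _) τ)
  refine ⟨dyadic_nonneg hnn, fun τ hτ => ?_, ?_⟩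
  · exact (mul_le_mul_of_nonneg_left (hle τ hτ) (by linarith [hτ.1])).trans
      (mul_le_dyadic hB hcont hnn hτ)
  · refine le_trans ?_ (integral_le_dyadic hB ht hcont hnn)
    exact intervalIntegral.integral_mono_on ht
      ((continuous_IK D hK hGG).sqrt.intervalIntegrable _ _)
      (hcont.intervalIntegrable_of_Icc ht) hle

lemma continuous_rad : Continuous rad := by unfold rad; fun_prop

lemma word_wBox_eq_zero (D : SmoothDomain d) {B : ℝ} {u : V d} (hu : SmoothC u)
    (h1 : ∀ z : Fin 4 → ℝ, ∀ y ∈ closure D.carrier, 0 ≤ z 0 → z 0 - B < rad z → wBox u z y = 0)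
    (L : List (Fin 10 ⊕ Fin d)) : ∀ z, ∀ y ∈ D.carrier, 0 < z 0 → z 0 - B < rad z →
      opIter gtF L (wBox u) z y = 0 := by
  intro z y hy hz hz2
  have hc0 : Continuous fun p : (Fin 4 → ℝ) × (Fin d → ℝ) => p.1 0 := by fun_prop
  have hc1 : Continuous fun p : (Fin 4 → ℝ) × (Fin d → ℝ) => rad p.1 :=
    continuous_rad.comp continuous_fst
  have hU : IsOpen {p : (Fin 4 → ℝ) × (Fin d → ℝ) |
      (0 < p.1 0 ∧ p.1 0 - B < rad p.1) ∧ p.2 ∈ D.carrier} :=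
    ((isOpen_lt continuous_const hc0).inter (isOpen_lt (hc0.sub continuous_const) hc1)).inter
      (D.isOpen.preimage continuous_snd)
  exact vanish_word hU (smooth_wBox hu) (fun p hp => h1 p.1 p.2 (subset_closure hp.2) hp.1.1.le
    hp.1.2) L (z, y) ⟨⟨hz, hz2⟩, hy⟩

/-- The right-hand side: the sum of all dyadic sums up to a given order. -/
def dySum (D : SmoothDomain d) (B : ℝ) (M : ℕ) (u : V d) (t : ℝ) : ℝ :=
  wsum M fun L => dyadic (L2txy D (opIter gtF L (wBox u))) B t

lemma le_dySum (D : SmoothDomain d) {B : ℝ} {u : V d} {M : ℕ} {t : ℝ}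
    {L : List (Fin 10 ⊕ Fin d)} (hL : L.length ≤ M) :
    dyadic (L2txy D (opIter gtF L (wBox u))) B t ≤ dySum D B M u t :=
  le_wsum (f := fun L => dyadic (L2txy D (opIter gtF L (wBox u))) B t)
    (fun _ => dyadic_nonneg fun _ _ => Real.sqrt_nonneg _) hL

lemma dySum_nonneg (D : SmoothDomain d) (B : ℝ) (M : ℕ) (u : V d) (t : ℝ) :
    0 ≤ dySum D B M u t :=
  wsum_nonneg fun _ => dyadic_nonneg fun _ _ => Real.sqrt_nonneg _

lemma word_sup_le (D : SmoothDomain d) {B : ℝ} (hB : 0 < B) {u : V d} (hu : SmoothC u)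
    (h1 : ∀ z : Fin 4 → ℝ, ∀ y ∈ closure D.carrier, 0 ≤ z 0 → z 0 - B < rad z → wBox u z y = 0)
    {M : ℕ} {t : ℝ} (ht : 2 * B ≤ t) {L : List (Fin 10 ⊕ Fin d)} (hL : L.length ≤ M)
    {K : Set (Fin 3 → ℝ)} (hK : IsCompact K) {τ : ℝ} (hτ : τ ∈ Set.Icc (2 * B) t) :
    τ * √(IK D K (fun z y => opIter gtF L (wBox u) z y * opIter gtF L (wBox u) z y) τ) ≤
      2 * dySum D B M u t := by
  have := (IK_dyadic D hB (smooth_word (smooth_wBox hu) L) (word_wBox_eq_zero D hu h1 L) ht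
    hK).2.1 τ hτ
  linarith [le_dySum D (B := B) (u := u) (t := t) hL]

lemma src_of_dySum (D : SmoothDomain d) {B : ℝ} (hB : 0 < B) {u : V d} (hu : SmoothC u)
    (h1 : ∀ z : Fin 4 → ℝ, ∀ y ∈ closure D.carrier, 0 ≤ z 0 → z 0 - B < rad z → wBox u z y = 0)
    {M : ℕ} {t : ℝ} (ht : 2 * B ≤ t) : Src D B M u t (2 * dySum D B M u t) := by
  have h0 := dySum_nonneg D B M u t
  refine ⟨by linarith, fun β hβ K hK τ hτ => ?_, fun β hβ K hK => ?_⟩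
  · exact word_sup_le D hB hu h1 ht (L := β.map Sum.inl) (by simpa using hβ) hK hτ
  · have := (IK_dyadic D hB (smooth_word (smooth_wBox hu) (β.map Sum.inl))
      (word_wBox_eq_zero D hu h1 _) ht hK).2.2
    refine this.trans ?_
    have := le_dySum D (B := B) (u := u) (t := t) (M := M) (L := β.map Sum.inl) (by simpa using hβ)
    linarith

/-- The smooth functions on the waveguide, as a subalgebra of all functions. -/
def smSubalgebra (d : ℕ) : Subalgebra ℝ (V d) where
  carrier := {u | SmoothC u}
  mul_mem' hu hv := smooth_mul hu hv
  add_mem' hu hv := smooth_add hu hv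
  algebraMap_mem' r := show SmoothC (fun _ _ => r : V d) from contDiff_const

/-- The algebra of smooth functions on the waveguide. -/
def Sm (d : ℕ) : Type := smSubalgebra d

instance : CommRing (Sm d) := inferInstanceAs (CommRing (smSubalgebra d))

instance : Algebra ℝ (Sm d) := inferInstanceAs (Algebra ℝ (smSubalgebra d))

/-- The subalgebra of smooth functions of `y` only. -/
def Cf (d : ℕ) : Subalgebra ℝ (Sm d) where
  carrier := {c | ∀ z z' y, c.1 z y = c.1 z' y}
  mul_mem' {a b} ha hb z z' y := congrArg₂ (· * ·) (ha z z' y) (hb z z' y)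
  add_mem' {a b} ha hb z z' y := congrArg₂ (· + ·) (ha z z' y) (hb z z' y)
  algebraMap_mem' _ _ _ _ := rfl

/-- Linear operators on smooth functions. -/
abbrev Op (d : ℕ) := Module.End ℝ (Sm d)

/-- The derivative `∂_{y_j}` as an operator. -/
def Dy (j : Fin d) : Op d where
  toFun w := ⟨pdy j w.1, smooth_pdy w.2 j⟩
  map_add' u v := Subtype.ext (pdmix_add u.2 v.2 (Sum.inr j))
  map_smul' c u := Subtype.ext (pdmix_const_mul u.2 c (Sum.inr j))

/-- Multiplication by a smooth function as an operator. -/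
def Mc (c : Sm d) : Op d := LinearMap.mulLeft ℝ c

lemma Mc_apply (c w : Sm d) : Mc c w = c * w := rfl

lemma Mc_mul (a b : Sm d) : Mc a * Mc b = Mc (a * b) :=
  LinearMap.ext fun w => (mul_assoc a b w).symm

lemma Mc_add (a b : Sm d) : Mc a + Mc b = Mc (a + b) :=
  LinearMap.ext fun w => (add_mul a b w).symm

lemma Mc_comm (a b : Sm d) : Mc a * Mc b = Mc b * Mc a := by rw [Mc_mul, Mc_mul, mul_comm]

lemma Dy_mul_apply (j : Fin d) (c w : Sm d) : Dy j (c * w) = c * Dy j w + Dy j c * w :=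
  Subtype.ext (pdmix_mul c.2 w.2 (Sum.inr j))

lemma Dy_Mc (j : Fin d) (c : Sm d) : Dy j * Mc c = Mc c * Dy j + Mc (Dy j c) :=
  LinearMap.ext fun w => Dy_mul_apply j c w

lemma Dy_comm (i j : Fin d) : Dy i * Dy j = Dy j * Dy i :=
  LinearMap.ext fun w => Subtype.ext (pdy_comm w.2 i j)

lemma Dy_mem_Cf {c : Sm d} (hc : c ∈ Cf d) (j : Fin d) : Dy j c ∈ Cf d := by
  intro z z' y
  change pdy j c.1 z y = pdy j c.1 z' y
  unfold pdy
  rw [show c.1 z = c.1 z' from funext fun y => hc z z' y]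

/-- Differential operators in `y` of order less than `n`, with coefficients depending on `y`
only. -/
inductive DO : ℕ → Op d → Prop
  | zero (n : ℕ) : DO n 0
  | one (n : ℕ) : DO (n + 1) 1
  | add {n : ℕ} {P Q : Op d} (hP : DO n P) (hQ : DO n Q) : DO n (P + Q)
  | coef {n : ℕ} {P : Op d} (c : Sm d) (hc : c ∈ Cf d) (hP : DO n P) : DO n (Mc c * P)
  | der {n : ℕ} {P : Op d} (j : Fin d) (hP : DO n P) : DO (n + 1) (Dy j * P)

namespace DO

variable {n m p q : ℕ} {P Q : Op d}

lemma succ (h : DO n P) : DO (n + 1) P := by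
  induction h with
  | zero n => exact zero _
  | one n => exact one _
  | add _ _ h1 h2 => exact add h1 h2
  | coef c hc _ h => exact coef c hc h
  | der j _ h => exact der j h

lemma mono (h : DO n P) (hnm : n ≤ m) : DO m P := by
  induction m, hnm using Nat.le_induction with
  | base => exact h
  | succ k _ ih => exact ih.succ

lemma sum {ι : Type*} (s : Finset ι) {f : ι → Op d} (h : ∀ i ∈ s, DO n (f i)) :
    DO n (∑ i ∈ s, f i) := Finset.sum_induction f (DO n) (fun _ _ => add) (zero n) h

lemma Mc {c : Sm d} (hc : c ∈ Cf d) : DO 1 (Mc c) := by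
  simpa using coef c hc (one (d := d) 0)

lemma Dy (j : Fin d) : DO 2 (Dy j) := by simpa using der j (one (d := d) 0)

lemma neg (h : DO n P) : DO n (-P) := by
  have := coef (-1) (neg_mem (one_mem (Cf d))) h
  rwa [show Waveguide.Mc (-1 : Sm d) * P = -P from LinearMap.ext fun w => by
    simp [Mc_apply]] at this

lemma sub (hP : DO n P) (hQ : DO n Q) : DO n (P - Q) := by
  rw [sub_eq_add_neg]; exact add hP hQ.neg

lemma mul_aux (hP : DO n P) : ∀ p, n = p + 1 → ∀ q Q, DO q Q → DO (p + q) (P * Q) := by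
  induction hP with
  | zero n => intro p _ q Q hQ; rw [zero_mul]; exact zero _
  | one n => intro p _ q Q hQ; rw [one_mul]; exact hQ.mono (by omega)
  | add _ _ h1 h2 =>
    intro p hp q Q hQ
    rw [add_mul]
    exact add (h1 p hp q Q hQ) (h2 p hp q Q hQ)
  | coef c hc _ h =>
    intro p hp q Q hQ
    rw [mul_assoc]
    exact coef c hc (h p hp q Q hQ)
  | @der n P j hP h =>
    intro p hp q Q hQ
    rw [mul_assoc]
    cases p with
    | zero =>
      obtain rfl : n = 0 := by omega
      have h0 : ∀ {k : ℕ} {R : Op d}, DO k R → k = 0 → R = 0 := by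
        intro k R hR
        induction hR with
        | zero n => intro _; rfl
        | one n => intro hn; omega
        | add _ _ h1 h2 => intro hn; rw [h1 hn, h2 hn, add_zero]
        | coef c hc _ h => intro hn; rw [h hn, mul_zero]
        | der j _ h => intro hn; omega
      rw [h0 hP rfl, zero_mul, mul_zero]
      exact zero _
    | succ p =>
      rw [Nat.add_right_comm]
      exact der j (h p (by omega) q Q hQ)

lemma mul (hP : DO (p + 1) P) (hQ : DO q Q) : DO (p + q) (P * Q) := mul_aux hP p rfl q Q hQ

lemma eq_zero (hP : DO 0 P) : P = 0 := by
  have := mul (p := 0) hP.succ (one (d := d) 0)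
  have h0 : ∀ {k : ℕ} {R : Op d}, DO k R → k = 0 → R = 0 := by
    intro k R hR
    induction hR with
    | zero n => intro _; rfl
    | one n => intro hn; omega
    | add _ _ h1 h2 => intro hn; rw [h1 hn, h2 hn, add_zero]
    | coef c hc _ h => intro hn; rw [h hn, mul_zero]
    | der j _ h => intro hn; omega
  exact h0 hP rfl

lemma comm_Mc {c : Sm d} (hc : c ∈ Cf d) (hQ : DO n Q) :
    ∀ q, n = q + 1 → DO q (Q * Waveguide.Mc c - Waveguide.Mc c * Q) := by
  induction hQ with
  | zero n => intro q _; simpa using zero q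
  | one n => intro q _; simpa using zero q
  | @add n P Q _ _ h1 h2 =>
    intro q hq
    have := add (h1 q hq) (h2 q hq)
    convert this using 1
    simp only [mul_sub, sub_mul, mul_add, add_mul, mul_assoc]
    abel
  | @coef n P c' hc' _ h =>
    intro q hq
    have := coef c' hc' (h q hq)
    convert this using 1
    rw [mul_sub, ← mul_assoc, ← mul_assoc, ← mul_assoc, Mc_comm c c', mul_assoc]
  | @der n P j hP h =>
    intro q hq
    obtain rfl : n = q := by omega
    have e : Waveguide.Dy j * P * Waveguide.Mc c - Waveguide.Mc c * (Waveguide.Dy j * P) =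
        Waveguide.Dy j * (P * Waveguide.Mc c - Waveguide.Mc c * P) +
          Waveguide.Mc (Waveguide.Dy j c) * P := by
      have e1 := Dy_Mc j c
      have e2 : Waveguide.Mc (Waveguide.Dy j c) =
        Waveguide.Dy j * Waveguide.Mc c - Waveguide.Mc c * Waveguide.Dy j := by
        rw [e1]; abel
      rw [e2]
      simp only [mul_sub, sub_mul, mul_add, add_mul, mul_assoc]
      abel
    rw [e]
    refine add ?_ (coef _ (Dy_mem_Cf hc j) hP)
    cases n with
    | zero => rw [eq_zero hP]; simpa using zero 0
    | succ n => exact der j (h n rfl)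

lemma comm_Dy (j : Fin d) (hQ : DO n Q) :
    DO n (Q * Waveguide.Dy j - Waveguide.Dy j * Q) := by
  induction hQ with
  | zero n => simpa using zero n
  | one n => simpa using zero _
  | @add n P Q _ _ h1 h2 =>
    have := add h1 h2
    convert this using 1
    simp only [mul_sub, sub_mul, mul_add, add_mul, mul_assoc]
    abel
  | @coef n P c' hc' hP h =>
    have := sub (coef c' hc' h) (coef _ (Dy_mem_Cf hc' j) hP)
    convert this using 1
    rw [mul_sub, ← mul_assoc, ← mul_assoc, ← mul_assoc, Dy_Mc, add_mul]
    abel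
  | @der n P i hP h =>
    have := der i h
    convert this using 1
    rw [mul_sub, ← mul_assoc, ← mul_assoc, ← mul_assoc, Dy_comm]

lemma comm_aux (hP : DO n P) : ∀ p, n = p + 1 → ∀ q Q, DO (q + 1) Q → DO (p + q) (P * Q - Q * P) := by
  induction hP with
  | zero n => intro p _ q Q hQ; simpa using zero _
  | one n => intro p _ q Q hQ; simpa using zero _
  | @add n P P' _ _ h1 h2 =>
    intro p hp q Q hQ
    have := add (h1 p hp q Q hQ) (h2 p hp q Q hQ)
    convert this using 1
    simp only [mul_sub, sub_mul, mul_add, add_mul, mul_assoc]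
    abel
  | @coef n P c hc hP h =>
    intro p hp q Q hQ
    have h1 := coef c hc (h p hp q Q hQ)
    have h2 : DO (q + p) ((Q * Waveguide.Mc c - Waveguide.Mc c * Q) * P) := by
      cases q with
      | zero => rw [eq_zero (comm_Mc hc hQ 0 rfl), zero_mul]; exact zero _
      | succ q =>
        subst hp
        exact (mul (comm_Mc hc hQ _ rfl) hP).mono (by omega)
    rw [add_comm] at h2
    have := sub h1 h2
    convert this using 1
    simp only [mul_sub, sub_mul, mul_add, add_mul, mul_assoc]
    abel
  | @der n P j hP h =>
    intro p hp q Q hQ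
    obtain rfl : n = p := by omega
    have h2 : DO (q + n) ((Q * Waveguide.Dy j - Waveguide.Dy j * Q) * P) := mul (comm_Dy j hQ) hP
    have h1 : DO (n + q) (Waveguide.Dy j * (P * Q - Q * P)) := by
      cases n with
      | zero => rw [eq_zero hP]; simpa using zero _
      | succ n => rw [Nat.add_right_comm]; exact der j (h n rfl q Q hQ)
    rw [add_comm] at h2
    have := sub h1 h2
    convert this using 1
    simp only [mul_sub, sub_mul, mul_add, add_mul, mul_assoc]
    abel

lemma comm (hP : DO (p + 1) P) (hQ : DO (q + 1) Q) : DO (p + q) (P * Q - Q * P) :=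
  comm_aux hP p rfl q Q hQ

end DO

/-- The sum of the squares of all `y`-derivatives of order less than `n` (with multiplicity). -/
def DS : ℕ → Sm d → V d
  | 0, _ => fun _ _ => 0
  | n + 1, w => fun z y => (w.1 z y) ^ 2 + ∑ j, DS n (Dy j w) z y

lemma DS_succ (n : ℕ) (w : Sm d) (z : Fin 4 → ℝ) (y : Fin d → ℝ) :
    DS (n + 1) w z y = (w.1 z y) ^ 2 + ∑ j, DS n (Dy j w) z y := rfl

lemma DS_nonneg (n : ℕ) : ∀ (w : Sm d) z y, 0 ≤ DS n w z y := by
  induction n with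
  | zero => intro w z y; exact le_rfl
  | succ n ih =>
    intro w z y
    exact add_nonneg (sq_nonneg _) (Finset.sum_nonneg fun j _ => ih _ z y)

lemma smooth_DS (n : ℕ) : ∀ w : Sm d, SmoothC (DS n w) := by
  induction n with
  | zero => intro w; exact smooth_zero
  | succ n ih =>
    intro w
    have h1 : SmoothC (fun z y => w.1 z y * w.1 z y) := smooth_mul w.2 w.2
    have h2 := smooth_add h1 (smooth_sum Finset.univ fun j => ih (Dy j w))
    convert h2 using 3
    rw [DS_succ, pow_two]

lemma sq_le_DS (n : ℕ) (w : Sm d) (z : Fin 4 → ℝ) (y : Fin d → ℝ) :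
    (w.1 z y) ^ 2 ≤ DS (n + 1) w z y :=
  le_add_of_nonneg_right (Finset.sum_nonneg fun j _ => DS_nonneg n _ z y)

lemma DS_Dy_le (n : ℕ) (j : Fin d) (w : Sm d) (z : Fin 4 → ℝ) (y : Fin d → ℝ) :
    DS n (Dy j w) z y ≤ DS (n + 1) w z y :=
  (Finset.single_le_sum (f := fun j => DS n (Dy j w) z y) (fun j _ => DS_nonneg n _ z y)
    (Finset.mem_univ j)).trans (le_add_of_nonneg_left (sq_nonneg _))

lemma DS_le_succ (n : ℕ) : ∀ (w : Sm d) z y, DS n w z y ≤ DS (n + 1) w z y := by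
  induction n with
  | zero => intro w z y; exact DS_nonneg 1 w z y
  | succ n ih =>
    intro w z y
    rw [DS_succ, DS_succ]
    have := Finset.sum_le_sum fun j (_ : j ∈ Finset.univ) => ih (Dy j w) z y
    linarith

lemma DS_mono {n m : ℕ} (h : n ≤ m) (w : Sm d) (z : Fin 4 → ℝ) (y : Fin d → ℝ) :
    DS n w z y ≤ DS m w z y := by
  induction m, h using Nat.le_induction with
  | base => exact le_rfl
  | succ k _ ih => exact ih.trans (DS_le_succ k w z y)

lemma DS_add_le (n : ℕ) : ∀ (u v : Sm d) z y,
    DS n (u + v) z y ≤ 2 * DS n u z y + 2 * DS n v z y := by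
  induction n with
  | zero => intro u v z y; simp [DS]
  | succ n ih =>
    intro u v z y
    rw [DS_succ, DS_succ, DS_succ]
    have h1 := Finset.sum_le_sum fun j (_ : j ∈ Finset.univ) => ih (Dy j u) (Dy j v) z y
    rw [Finset.sum_add_distrib, ← Finset.mul_sum, ← Finset.mul_sum] at h1
    have h2 : ((u + v).1 z y) ^ 2 ≤ 2 * (u.1 z y) ^ 2 + 2 * (v.1 z y) ^ 2 := by
      change (u.1 z y + v.1 z y) ^ 2 ≤ _
      nlinarith [sq_nonneg (u.1 z y - v.1 z y)]
    simp only [map_add]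
    linarith

lemma DS_zero (n : ℕ) (z : Fin 4 → ℝ) (y : Fin d → ℝ) : DS n (0 : Sm d) z y = 0 := by
  induction n with
  | zero => rfl
  | succ n ih => simp [DS_succ, ih]; rfl

/-- A coefficient is bounded on `Ω̄`. -/
lemma exists_sq_bound (D : SmoothDomain d) {c : Sm d} (hc : c ∈ Cf d) :
    ∃ C : ℝ, 0 ≤ C ∧ ∀ z, ∀ y ∈ closure D.carrier, (c.1 z y) ^ 2 ≤ C := by
  have h : Continuous fun y => (c.1 0 y) ^ 2 := ((smooth_slice c.2 0).continuous).pow 2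
  obtain ⟨C, hC⟩ := (isCompact_closure D).bddAbove_image h.continuousOn
  refine ⟨max C 0, le_max_right _ _, fun z y hy => ?_⟩
  rw [hc z 0 y]
  exact (hC ⟨y, hy, rfl⟩).trans (le_max_left _ _)

lemma DS_Mc_le (D : SmoothDomain d) (n : ℕ) : ∀ c ∈ Cf d, ∃ C : ℝ, 0 ≤ C ∧
    ∀ (w : Sm d) z, ∀ y ∈ closure D.carrier, DS n (c * w) z y ≤ C * DS n w z y := by
  induction n with
  | zero => intro c _; exact ⟨0, le_rfl, fun w z y _ => by simp [DS]⟩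
  | succ n ih =>
    intro c hc
    obtain ⟨C0, h0, hb0⟩ := exists_sq_bound D hc
    obtain ⟨C1, h1, hb1⟩ := ih c hc
    choose C2 h2 hb2 using fun j => ih (Dy j c) (Dy_mem_Cf hc j)
    have h2s : 0 ≤ ∑ j, C2 j := Finset.sum_nonneg fun j _ => h2 j
    refine ⟨C0 + 2 * C1 + 2 * ∑ j, C2 j, by positivity, fun w z y hy => ?_⟩
    have e1 : ((c * w).1 z y) ^ 2 ≤ C0 * (w.1 z y) ^ 2 := by
      change (c.1 z y * w.1 z y) ^ 2 ≤ _
      rw [mul_pow]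
      exact mul_le_mul_of_nonneg_right (hb0 z y hy) (sq_nonneg _)
    have e2 : ∑ j, DS n (Dy j (c * w)) z y ≤
        2 * C1 * ∑ j, DS n (Dy j w) z y + 2 * (∑ j, C2 j) * DS n w z y := by
      rw [Finset.mul_sum, Finset.mul_sum, Finset.sum_mul, ← Finset.sum_add_distrib]
      refine Finset.sum_le_sum fun j _ => ?_
      rw [Dy_mul_apply]
      have := DS_add_le n (c * Dy j w) (Dy j c * w) z y
      have := hb1 (Dy j w) z y hy
      have := hb2 j w z y hy
      linarith
    have e3 := DS_le_succ n w z y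
    have e4 := DS_nonneg n w z y
    have e5 := DS_succ n w z y
    have e6 : 0 ≤ ∑ j, DS n (Dy j w) z y := Finset.sum_nonneg fun j _ => DS_nonneg n _ z y
    have e7 := sq_nonneg (w.1 z y)
    have e8 := mul_le_mul_of_nonneg_left e3 h2s
    rw [DS_succ n (c * w)]
    nlinarith [mul_nonneg h0 e6, mul_nonneg h1 e7]

lemma DO.DS_le (D : SmoothDomain d) {n : ℕ} {P : Op d} (hP : DO n P) : ∀ k m, k + n ≤ m + 1 →
    ∃ C : ℝ, 0 ≤ C ∧ ∀ (w : Sm d) z, ∀ y ∈ closure D.carrier, DS k (P w) z y ≤ C * DS m w z y := by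
  induction hP with
  | zero n =>
    intro k m _
    exact ⟨0, le_rfl, fun w z y _ => by rw [LinearMap.zero_apply, DS_zero, zero_mul]⟩
  | one n =>
    intro k m h
    exact ⟨1, zero_le_one, fun w z y _ => by
      rw [one_mul]; exact DS_mono (by omega) w z y⟩
  | add _ _ h1 h2 =>
    intro k m h
    obtain ⟨C1, h1, hb1⟩ := h1 k m h
    obtain ⟨C2, h2, hb2⟩ := h2 k m h
    refine ⟨2 * C1 + 2 * C2, by positivity, fun w z y hy => ?_⟩
    have := DS_add_le k (_ : Sm d) _ z y |>.trans
      (add_le_add (mul_le_mul_of_nonneg_left (hb1 w z y hy) zero_le_two)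
        (mul_le_mul_of_nonneg_left (hb2 w z y hy) zero_le_two))
    rw [LinearMap.add_apply]
    linarith
  | coef c hc _ h =>
    intro k m hk
    obtain ⟨C1, h1, hb1⟩ := h k m hk
    obtain ⟨C2, h2, hb2⟩ := DS_Mc_le D k c hc
    refine ⟨C2 * C1, by positivity, fun w z y hy => ?_⟩
    rw [mul_assoc]
    exact (hb2 _ z y hy).trans (mul_le_mul_of_nonneg_left (hb1 w z y hy) h2)
  | der j _ h =>
    intro k m hk
    obtain ⟨C1, h1, hb1⟩ := h (k + 1) m (by omega)
    exact ⟨C1, h1, fun w z y hy => (DS_Dy_le k j _ z y).trans (hb1 w z y hy)⟩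

/-- The integral over `Ω` of the squares of all `y`-derivatives of order less than `n`. -/
def HS (D : SmoothDomain d) (n : ℕ) (w : Sm d) (z : Fin 4 → ℝ) : ℝ :=
  ∫ y in D.carrier, DS n w z y

lemma HS_nonneg (D : SmoothDomain d) (n : ℕ) (w : Sm d) (z : Fin 4 → ℝ) : 0 ≤ HS D n w z :=
  setIntegral_nonneg D.isOpen.measurableSet fun y _ => DS_nonneg n w z y

lemma setIntegral_mono_smooth (D : SmoothDomain d) {f g : V d} (hf : SmoothC f) (hg : SmoothC g)
    {z : Fin 4 → ℝ} (h : ∀ y ∈ closure D.carrier, f z y ≤ g z y) :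
    ∫ y in D.carrier, f z y ≤ ∫ y in D.carrier, g z y :=
  setIntegral_mono_on (integrableOn_slice D hf z) (integrableOn_slice D hg z)
    D.isOpen.measurableSet fun y hy => h y (subset_closure hy)

lemma HS_mono (D : SmoothDomain d) {n m : ℕ} (h : n ≤ m) (w : Sm d) (z : Fin 4 → ℝ) :
    HS D n w z ≤ HS D m w z :=
  setIntegral_mono_smooth D (smooth_DS n w) (smooth_DS m w) fun y _ => DS_mono h w z y

lemma HS_add_le (D : SmoothDomain d) (n : ℕ) (u v : Sm d) (z : Fin 4 → ℝ) :
    HS D n (u + v) z ≤ 2 * HS D n u z + 2 * HS D n v z := by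
  have hu := smooth_const_mul (smooth_DS n u) 2
  have hv := smooth_const_mul (smooth_DS n v) 2
  refine (setIntegral_mono_smooth D (smooth_DS n _) (smooth_add hu hv)
    fun y _ => DS_add_le n u v z y).trans_eq ?_
  rw [integral_add (integrableOn_slice D hu z) (integrableOn_slice D hv z), integral_const_mul,
    integral_const_mul]
  rfl

lemma HS_succ (D : SmoothDomain d) (n : ℕ) (w : Sm d) (z : Fin 4 → ℝ) :
    HS D (n + 1) w z = (∫ y in D.carrier, (w.1 z y) ^ 2) + ∑ j, HS D n (Dy j w) z := by
  have h1 : SmoothC (fun z y => (w.1 z y) ^ 2) := by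
    have := smooth_mul w.2 w.2
    simpa only [pow_two] using this
  unfold HS
  rw [← integral_finsetSum _ fun j _ => integrableOn_slice D (smooth_DS n (Dy j w)) z,
    ← integral_add (integrableOn_slice D h1 z)
      (integrableOn_slice D (smooth_sum Finset.univ fun j => smooth_DS n (Dy j w)) z)]
  rfl

lemma HS_one (D : SmoothDomain d) (w : Sm d) (z : Fin 4 → ℝ) :
    HS D 1 w z = ∫ y in D.carrier, (w.1 z y) ^ 2 := by
  rw [HS_succ]; simp [HS, DS]

lemma DO.HS_le (D : SmoothDomain d) {n : ℕ} {P : Op d} (hP : DO n P) (k m : ℕ)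
    (h : k + n ≤ m + 1) :
    ∃ C : ℝ, 0 ≤ C ∧ ∀ (w : Sm d) z, HS D k (P w) z ≤ C * HS D m w z := by
  obtain ⟨C, hC, hb⟩ := hP.DS_le D k m h
  refine ⟨C, hC, fun w z => ?_⟩
  unfold HS
  rw [← integral_const_mul]
  exact setIntegral_mono_smooth D (smooth_DS k _) (smooth_const_mul (smooth_DS m w) C)
    fun y hy => hb w z y hy

/-- The Laplacian in `y`. -/
def Lap (d : ℕ) : Op d := ∑ j, Dy j * Dy j

/-- Integration over `Ω` at a fixed point of space-time. -/
def Iy (D : SmoothDomain d) (z : Fin 4 → ℝ) : Sm d →ₗ[ℝ] ℝ where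
  toFun f := ∫ y in D.carrier, f.1 z y
  map_add' f g := integral_add (integrableOn_slice D f.2 z) (integrableOn_slice D g.2 z)
  map_smul' c f := integral_const_mul c _

lemma HS_one_eq (D : SmoothDomain d) (w : Sm d) (z : Fin 4 → ℝ) : HS D 1 w z = Iy D z (w * w) := by
  rw [HS_one]
  refine integral_congr_ae (Filter.Eventually.of_forall fun y => ?_)
  exact pow_two _

/-- The defining function as an element of the algebra. -/
def rhoS (D : SmoothDomain d) : Sm d := ⟨rho D, smooth_rho D⟩

lemma rhoS_mem (D : SmoothDomain d) : rhoS D ∈ Cf d := fun _ _ _ => rfl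

lemma Sm_sum_apply {ι : Type*} (s : Finset ι) (f : ι → Sm d) (z : Fin 4 → ℝ) (y : Fin d → ℝ) :
    (∑ i ∈ s, f i).1 z y = ∑ i ∈ s, (f i).1 z y := by
  classical
  induction s using Finset.induction_on with
  | empty => rw [Finset.sum_empty, Finset.sum_empty]; rfl
  | insert a s ha ih => rw [Finset.sum_insert ha, Finset.sum_insert ha, ← ih]; rfl

/-- First-order operators tangential to the boundary. -/
def Tang (D : SmoothDomain d) (T : Op d) : Prop :=
  ∃ a : Fin d → Sm d, (∀ k, a k ∈ Cf d) ∧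
    (∀ z, ∀ y ∈ frontier D.carrier, ∑ k, (a k).1 z y * (Dy k (rhoS D)).1 z y = 0) ∧
    T = ∑ k, Mc (a k) * Dy k

lemma Tang.DO {D : SmoothDomain d} {T : Op d} (h : Tang D T) : DO 2 T := by
  obtain ⟨a, ha, -, rfl⟩ := h
  exact DO.sum _ fun k _ => DO.coef _ (ha k) (DO.Dy k)

/-- Products of `m` tangential operators. -/
inductive TW (D : SmoothDomain d) : ℕ → Op d → Prop
  | one : TW D 0 1
  | cons {m : ℕ} {T P : Op d} (hT : Tang D T) (hP : TW D m P) : TW D (m + 1) (T * P)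

lemma TW.DO {D : SmoothDomain d} {m : ℕ} {P : Op d} (h : TW D m P) : DO (m + 1) P := by
  induction h with
  | one => exact DO.one 0
  | cons hT _ h => exact (DO.mul (p := 1) hT.DO h).mono (by omega)

/-- Operators of the form `A + B Δ` with `A` of order at most `m` and `B` of order less
than `m`. -/
def Rem (m : ℕ) (Q : Op d) : Prop := ∃ A B : Op d, DO (m + 1) A ∧ DO m B ∧ Q = A + B * Lap d

namespace Rem

variable {m p : ℕ} {P Q : Op d}

lemma of_DO (h : DO (m + 1) Q) : Rem m Q := ⟨Q, 0, h, DO.zero _, by simp⟩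

lemma add (hP : Rem m P) (hQ : Rem m Q) : Rem m (P + Q) := by
  obtain ⟨A, B, hA, hB, rfl⟩ := hP
  obtain ⟨A', B', hA', hB', rfl⟩ := hQ
  refine ⟨A + A', B + B', hA.add hA', hB.add hB', ?_⟩
  rw [add_mul]; abel

lemma mul (hP : DO (p + 1) P) (hQ : Rem m Q) : Rem (p + m) (P * Q) := by
  obtain ⟨A, B, hA, hB, rfl⟩ := hQ
  exact ⟨P * A, P * B, hP.mul hA, hP.mul hB, by rw [mul_add, mul_assoc]⟩

lemma coef {c : Sm d} (hc : c ∈ Cf d) (hQ : Rem m Q) : Rem m (Mc c * Q) := by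
  simpa using mul (p := 0) (DO.Mc hc) hQ

lemma neg (hQ : Rem m Q) : Rem m (-Q) := by
  have := mul (p := 0) (DO.one 0).neg hQ
  rwa [show -1 * Q = -Q from rfl, zero_add] at this

lemma sub (hP : Rem m P) (hQ : Rem m Q) : Rem m (P - Q) := by
  rw [sub_eq_add_neg]; exact hP.add hQ.neg

lemma succ (hQ : Rem m Q) : Rem (m + 1) Q := by
  obtain ⟨A, B, hA, hB, rfl⟩ := hQ
  exact ⟨A, B, hA.succ, hB.succ, rfl⟩

lemma sum {ι : Type*} (s : Finset ι) {f : ι → Op d} (h : ∀ i ∈ s, Rem m (f i)) :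
    Rem m (∑ i ∈ s, f i) := Finset.sum_induction f (Rem m) (fun _ _ => add)
      (of_DO (DO.zero _)) h

end Rem

/-- The weak form `∫ Σ (E_i w) ∂_i ψ = ∫ (F w) ψ` for Neumann functions `w` and all `ψ`. -/
def Weak (D : SmoothDomain d) (E : Fin d → Op d) (F : Op d) : Prop :=
  ∀ w : Sm d, NeumannBC D w.1 → ∀ (z : Fin 4 → ℝ) (ψ : Sm d),
    Iy D z (∑ i, E i w * Dy i ψ) = Iy D z (F w * ψ)

lemma weak_Lap (D : SmoothDomain d) : Weak D (fun i => Dy i) (-Lap d) := by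
  intro w hw z ψ
  have h := integral_grad_mul_grad D w.2 ψ.2 (hw z)
  rw [← integral_neg] at h
  refine (integral_congr_ae (Filter.Eventually.of_forall fun y => ?_)).trans
    (h.trans (integral_congr_ae (Filter.Eventually.of_forall fun y => ?_)))
  · exact Sm_sum_apply _ _ _ _
  · change -((∑ i, (Dy i (Dy i w)).1 z y) * ψ.1 z y) = -(Lap d w).1 z y * ψ.1 z y
    rw [neg_mul, ← Sm_sum_apply, Lap, LinearMap.sum_apply]
    rfl

lemma Iy_div (D : SmoothDomain d) {a : Fin d → Sm d}
    (ht : ∀ z, ∀ y ∈ frontier D.carrier, ∑ k, (a k).1 z y * (Dy k (rhoS D)).1 z y = 0)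
    (z : Fin 4 → ℝ) (f : Sm d) : Iy D z (∑ k, Dy k (a k * f)) = 0 := by
  refine Eq.trans ?_ (integral_div_eq_zero D (X := fun k => (a k * f).1) (fun k => (a k * f).2) z ?_)
  · refine integral_congr_ae (Filter.Eventually.of_forall fun y => ?_)
    exact Sm_sum_apply _ _ _ _
  · intro y hy
    have := ht z y hy
    calc _ = (∑ k, (a k).1 z y * (Dy k (rhoS D)).1 z y) * f.1 z y := by
          rw [Finset.sum_mul]
          refine Finset.sum_congr rfl fun k _ => ?_
          change (a k).1 z y * f.1 z y * (Dy k (rhoS D)).1 z y = _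
          ring
      _ = 0 := by rw [this, zero_mul]

/-- Commuting a tangential operator through the weak form. -/
lemma weak_tang {D : SmoothDomain d} {E : Fin d → Op d} {F : Op d} (h : Weak D E F)
    {a : Fin d → Sm d}
    (ht : ∀ z, ∀ y ∈ frontier D.carrier, ∑ k, (a k).1 z y * (Dy k (rhoS D)).1 z y = 0) :
    Weak D (fun i => (∑ k, Mc (a k) * Dy k) * E i + Mc (∑ k, Dy k (a k)) * E i + Mc (a i) * F -
      ∑ k, Mc (Dy k (a i)) * E k) 0 := by
  intro w hw z ψ
  have h1 := h w hw z (∑ k, a k * Dy k ψ)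
  have h2 := Iy_div D ht z (∑ i, E i w * Dy i ψ)
  rw [LinearMap.zero_apply, zero_mul, map_zero]
  have key : (∑ i, ((∑ k, Mc (a k) * Dy k) * E i + Mc (∑ k, Dy k (a k)) * E i + Mc (a i) * F -
      ∑ k, Mc (Dy k (a i)) * E k) w * Dy i ψ) =
      (∑ k, Dy k (a k * ∑ i, E i w * Dy i ψ)) - (∑ i, E i w * Dy i (∑ k, a k * Dy k ψ)) +
        F w * (∑ k, a k * Dy k ψ) := by
    have c : ∀ i k, Dy i (Dy k ψ) = Dy k (Dy i ψ) := fun i k => LinearMap.congr_fun (Dy_comm i k) ψ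
    simp only [Dy_mul_apply, map_sum, LinearMap.add_apply, LinearMap.sub_apply, LinearMap.sum_apply,
      Module.End.mul_apply, Mc_apply, mul_add, add_mul, sub_mul, Finset.sum_add_distrib,
      Finset.sum_sub_distrib, Finset.mul_sum, Finset.sum_mul]
    have e1 : ∑ x, ∑ k, a k * Dy k (E x w) * Dy x ψ = ∑ k, ∑ x, a k * (Dy k (E x w) * Dy x ψ) := by
      rw [Finset.sum_comm]; simp only [mul_assoc]
    have e2 : ∑ x, ∑ k, Dy k (a k) * E x w * Dy x ψ = ∑ k, ∑ x, Dy k (a k) * (E x w * Dy x ψ) := by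
      rw [Finset.sum_comm]; simp only [mul_assoc]
    have e3 : ∑ x, ∑ k, Dy k (a x) * E k w * Dy x ψ = ∑ k, ∑ x, E k w * (Dy k (a x) * Dy x ψ) := by
      rw [Finset.sum_comm]
      exact Finset.sum_congr rfl fun k _ => Finset.sum_congr rfl fun x _ => by ring
    have e4 : ∑ x, ∑ k, E x w * (a k * Dy x (Dy k ψ)) = ∑ k, ∑ x, a k * (E x w * Dy k (Dy x ψ)) := by
      rw [Finset.sum_comm]
      exact Finset.sum_congr rfl fun k _ => Finset.sum_congr rfl fun x _ => by rw [c x k]; ring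
    have e5 : ∑ x, a x * F w * Dy x ψ = ∑ x, F w * (a x * Dy x ψ) :=
      Finset.sum_congr rfl fun x _ => by ring
    rw [e1, e2, e3, e4, e5]
    abel
  rw [key, map_add, map_sub, h2, h1]
  ring

lemma weak_TW {D : SmoothDomain d} {m : ℕ} {P : Op d} (hP : TW D m P) :
    ∃ (E : Fin d → Op d) (F : Op d), (∀ i, Rem m (Dy i * P - E i)) ∧ Rem (m + 1) F ∧
      (0 < m → F = 0) ∧ Weak D E F := by
  induction hP with
  | one =>
    refine ⟨fun i => Dy i, -Lap d, fun i => ?_, ⟨0, -1, DO.zero _, (DO.one 0).neg,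
        (zero_add (-1 * Lap d)).symm⟩,
      fun h => absurd h (lt_irrefl 0), weak_Lap D⟩
    rw [mul_one, sub_self]
    exact Rem.of_DO (DO.zero _)
  | @cons m T P hT hP ih =>
    obtain ⟨E, F, hE, hF, -, hW⟩ := ih
    have hTD := hT.DO
    obtain ⟨a, ha, ht, hTa⟩ := hT
    have hE' : ∀ i, Rem (m + 1) (E i) := fun i => by
      have h1 : Rem (m + 1) (Dy i * P) := Rem.of_DO (hP.DO.der i)
      simpa using h1.sub (hE i).succ
    refine ⟨_, 0, fun i => ?_, Rem.of_DO (DO.zero _), fun _ => rfl, weak_tang hW ht⟩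
    have e : Dy i * (T * P) - ((∑ k, Mc (a k) * Dy k) * E i + Mc (∑ k, Dy k (a k)) * E i +
        Mc (a i) * F - ∑ k, Mc (Dy k (a i)) * E k) = T * (Dy i * P - E i) +
        (Dy i * T - T * Dy i) * P - Mc (∑ k, Dy k (a k)) * E i - Mc (a i) * F +
        ∑ k, Mc (Dy k (a i)) * E k := by
      rw [← hTa]
      simp only [mul_sub, sub_mul, mul_add, add_mul, mul_assoc]
      abel
    rw [e]
    have r1 : Rem (m + 1) (T * (Dy i * P - E i)) := by
      rw [add_comm]; exact Rem.mul (p := 1) hTD (hE i)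
    have r2 : Rem (m + 1) ((Dy i * T - T * Dy i) * P) := by
      have := DO.mul (p := 1) (DO.comm (p := 1) (q := 1) (DO.Dy i) hTD) hP.DO
      exact Rem.of_DO (this.mono (by omega))
    exact (((r1.add r2).sub (Rem.coef (sum_mem fun k _ => Dy_mem_Cf (ha k) k) (hE' i))).sub
      (Rem.coef (ha i) hF)).add (Rem.sum _ fun k _ => Rem.coef (Dy_mem_Cf (ha i) k) (hE' k))

/-- Operators controlled by lower-order derivatives and derivatives of the Laplacian of a Neumann
function. -/
def Ctl (D : SmoothDomain d) (m : ℕ) (Q : Op d) : Prop :=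
  ∃ C : ℝ, 0 ≤ C ∧ ∀ w : Sm d, NeumannBC D w.1 → ∀ z,
    HS D 1 (Q w) z ≤ C * (HS D (m + 1) w z + HS D m (Lap d w) z)

namespace Ctl

variable {D : SmoothDomain d} {m : ℕ} {P Q : Op d}

lemma add (hP : Ctl D m P) (hQ : Ctl D m Q) : Ctl D m (P + Q) := by
  obtain ⟨C, hC, h⟩ := hP
  obtain ⟨C', hC', h'⟩ := hQ
  refine ⟨2 * C + 2 * C', by positivity, fun w hw z => ?_⟩
  have := HS_add_le D 1 (P w) (Q w) z
  have := h w hw z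
  have := h' w hw z
  rw [LinearMap.add_apply]
  linarith

lemma coef {c : Sm d} (hc : c ∈ Cf d) (hQ : Ctl D m Q) : Ctl D m (Mc c * Q) := by
  obtain ⟨C, hC, h⟩ := hQ
  obtain ⟨C', hC', h'⟩ := (DO.Mc hc).HS_le D 1 1 (by omega)
  refine ⟨C' * C, by positivity, fun w hw z => ?_⟩
  rw [mul_assoc]
  exact (h' _ z).trans (mul_le_mul_of_nonneg_left (h w hw z) hC')

lemma of_DO (h : DO (m + 1) Q) : Ctl D m Q := by
  obtain ⟨C, hC, h⟩ := h.HS_le D 1 (m + 1) (by omega)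
  exact ⟨C, hC, fun w _ z => (h w z).trans
    (mul_le_mul_of_nonneg_left (le_add_of_nonneg_right (HS_nonneg D _ _ _)) hC)⟩

lemma of_DO_Lap (h : DO m Q) : Ctl D m (Q * Lap d) := by
  obtain ⟨C, hC, h⟩ := h.HS_le D 1 m (by omega)
  exact ⟨C, hC, fun w _ z => (h _ z).trans
    (mul_le_mul_of_nonneg_left (le_add_of_nonneg_left (HS_nonneg D _ _ _)) hC)⟩

lemma of_Rem (h : Rem m Q) : Ctl D m Q := by
  obtain ⟨A, B, hA, hB, rfl⟩ := h
  exact (of_DO hA).add (of_DO_Lap hB)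

lemma sum {ι : Type*} (s : Finset ι) {f : ι → Op d} (h : ∀ i ∈ s, Ctl D m (f i)) :
    Ctl D m (∑ i ∈ s, f i) := Finset.sum_induction f (Ctl D m) (fun _ _ => add)
      (of_DO (DO.zero _)) h

end Ctl

lemma Iy_nonneg_sq (D : SmoothDomain d) (z : Fin 4 → ℝ) (f : Sm d) : 0 ≤ Iy D z (f * f) := by
  rw [← HS_one_eq]; exact HS_nonneg D 1 f z

/-- The tangential energy estimate. -/
lemma ctl_Dy_TW {D : SmoothDomain d} {m : ℕ} {P : Op d} (hP : TW D m P) (hm : 0 < m) (j : Fin d) :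
    Ctl D m (Dy j * P) := by
  obtain ⟨E, F, hE, -, hF, hW⟩ := weak_TW hP
  obtain rfl := hF hm
  choose C hC h using fun i => Ctl.of_Rem (D := D) (hE i)
  refine ⟨∑ i, C i, Finset.sum_nonneg fun i _ => hC i, fun w hw z => ?_⟩
  have h1 := hW w hw z (P w)
  rw [LinearMap.zero_apply, zero_mul, map_zero, map_sum] at h1
  have h2 : ∀ i, Iy D z (Dy i (P w) * Dy i (P w)) ≤ 2 * Iy D z (E i w * Dy i (P w)) +
      HS D 1 ((Dy i * P - E i) w) z := by
    intro i
    rw [HS_one_eq]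
    have h3 : (Dy i * P - E i) w = Dy i (P w) - E i w := rfl
    have h4 := Iy_nonneg_sq D z (E i w)
    have h5 : Dy i (P w) * Dy i (P w) + E i w * E i w = (2 : ℝ) • (E i w * Dy i (P w)) +
        (Dy i (P w) - E i w) * (Dy i (P w) - E i w) := by
      rw [two_smul]; ring
    have h6 := congrArg (Iy D z) h5
    rw [map_add, map_add, map_smul, smul_eq_mul] at h6
    rw [h3]
    linarith
  have h7 := Finset.sum_le_sum fun i (_ : i ∈ Finset.univ) => h2 i
  rw [Finset.sum_add_distrib, ← Finset.mul_sum, h1, mul_zero, zero_add] at h7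
  have h8 := Finset.single_le_sum (f := fun i => Iy D z (Dy i (P w) * Dy i (P w)))
    (fun i _ => Iy_nonneg_sq D z _) (Finset.mem_univ j)
  rw [HS_one_eq, Finset.sum_mul]
  exact h8.trans (h7.trans (Finset.sum_le_sum fun i _ => h i w hw z))

/-- The derivatives of the defining function. -/
def rhoD (D : SmoothDomain d) (i : Fin d) : Sm d := Dy i (rhoS D)

lemma rhoD_mem (D : SmoothDomain d) (i : Fin d) : rhoD D i ∈ Cf d := Dy_mem_Cf (rhoS_mem D) i

/-- The function `ρ² + |∇ρ|²`. -/
def qS (D : SmoothDomain d) : Sm d := rhoS D * rhoS D + ∑ i, rhoD D i * rhoD D i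

lemma qS_apply (D : SmoothDomain d) (z : Fin 4 → ℝ) (y : Fin d → ℝ) : (qS D).1 z y =
    D.defFun y * D.defFun y + ∑ i, (rhoD D i).1 z y * (rhoD D i).1 z y := by
  change D.defFun y * D.defFun y + (∑ i, rhoD D i * rhoD D i).1 z y = _
  rw [Sm_sum_apply]
  rfl

lemma qS_pos (D : SmoothDomain d) (z : Fin 4 → ℝ) (y : Fin d → ℝ) : 0 < (qS D).1 z y := by
  rw [qS_apply]
  have hs : ∀ i ∈ Finset.univ, 0 ≤ (rhoD D i).1 z y * (rhoD D i).1 z y :=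
    fun i _ => mul_self_nonneg _
  by_cases h : D.defFun y = 0
  · have hy : y ∈ frontier D.carrier := by rw [D.frontier_eq]; exact h
    refine add_pos_of_nonneg_of_pos (mul_self_nonneg _)
      ((Finset.sum_nonneg hs).lt_of_ne fun h0 => D.grad_ne y hy ?_)
    have h1 := (Finset.sum_eq_zero_iff_of_nonneg hs).1 h0.symm
    refine ContinuousLinearMap.coe_injective (LinearMap.pi_ext' fun i => LinearMap.ext_ring ?_)
    have h2 : fderiv ℝ D.defFun y (Pi.single i 1) = 0 :=
      mul_self_eq_zero.1 (h1 i (Finset.mem_univ i))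
    simpa using h2
  · exact add_pos_of_pos_of_nonneg (mul_self_pos.2 h) (Finset.sum_nonneg hs)

/-- The reciprocal of `ρ² + |∇ρ|²`. -/
def qInv (D : SmoothDomain d) : Sm d :=
  ⟨fun z y => ((qS D).1 z y)⁻¹, ContDiff.inv (show ContDiff ℝ (⊤ : ℕ∞) (un (qS D).1) from (qS D).2)
    fun p => (qS_pos D p.1 p.2).ne'⟩

lemma qInv_mul (D : SmoothDomain d) : qInv D * qS D = 1 := by
  refine Subtype.ext (funext fun z => funext fun y => ?_)
  exact inv_mul_cancel₀ (qS_pos D z y).ne'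

lemma qS_mem (D : SmoothDomain d) : qS D ∈ Cf d :=
  add_mem (mul_mem (rhoS_mem D) (rhoS_mem D))
    (sum_mem fun i _ => mul_mem (rhoD_mem D i) (rhoD_mem D i))

lemma qInv_mem (D : SmoothDomain d) : qInv D ∈ Cf d :=
  fun z z' y => congrArg (·⁻¹) (qS_mem D z z' y)

/-- The tangential operators `ρ_i ∂_k - ρ_k ∂_i`. -/
def tang (D : SmoothDomain d) (i k : Fin d) : Op d := Mc (rhoD D i) * Dy k - Mc (rhoD D k) * Dy i

lemma ite_mem_Cf {c : Sm d} (hc : c ∈ Cf d) (p : Prop) [Decidable p] :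
    (if p then c else 0) ∈ Cf d := by
  split_ifs
  exacts [hc, zero_mem _]

lemma Mc_ite_mul (p : Prop) [Decidable p] (c : Sm d) (P : Op d) :
    Mc (if p then c else 0) * P = if p then Mc c * P else 0 := by
  split_ifs
  · rfl
  · refine LinearMap.ext fun w => ?_
    exact zero_mul (P w)

lemma tang_Tang (D : SmoothDomain d) (i k : Fin d) : Tang D (tang D i k) := by
  refine ⟨fun l => (if l = k then rhoD D i else 0) + (if l = i then -rhoD D k else 0),
    fun l => add_mem (ite_mem_Cf (rhoD_mem D i) _) (ite_mem_Cf (neg_mem (rhoD_mem D k)) _), ?_, ?_⟩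
  · intro z y _
    have e : ∀ l, ((if l = k then rhoD D i else 0) + (if l = i then -rhoD D k else 0)) *
        rhoD D l = (if l = k then rhoD D i * rhoD D k else 0) -
          (if l = i then rhoD D k * rhoD D i else 0) := by
      intro l
      split_ifs with h1 h2 h2
      · rw [h1]; rw [← h2, ← h1]; ring
      · rw [h1]; ring
      · rw [h2]; ring
      · ring
    have e2 : ∑ l, ((if l = k then rhoD D i else 0) + (if l = i then -rhoD D k else 0)) *
        rhoD D l = 0 := by
      simp only [e, Finset.sum_sub_distrib, Finset.sum_ite_eq', Finset.mem_univ, if_true]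
      ring
    have e3 := congrArg (fun f : Sm d => f.1 z y) e2
    exact (Sm_sum_apply _ _ _ _).symm.trans e3
  · simp only [← Mc_add, add_mul, Finset.sum_add_distrib, Mc_ite_mul, Finset.sum_ite_eq',
      Finset.mem_univ, if_true]
    rw [tang, sub_eq_add_neg]
    congr 1
    refine LinearMap.ext fun w => ?_
    exact (neg_mul (rhoD D k) (Dy i w)).symm

lemma rho_Tang (D : SmoothDomain d) (j : Fin d) : Tang D (Mc (rhoS D) * Dy j) := by
  refine ⟨fun l => if l = j then rhoS D else 0, fun l => ite_mem_Cf (rhoS_mem D) _, ?_, ?_⟩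
  · intro z y hy
    refine Finset.sum_eq_zero fun l _ => ?_
    rw [D.frontier_eq] at hy
    have h0 : (if l = j then rhoS D else 0 : Sm d).1 z y = 0 := by
      split_ifs
      · exact hy
      · rfl
    rw [h0, zero_mul]
  · simp only [Mc_ite_mul, Finset.sum_ite_eq', Finset.mem_univ, if_true]

/-- Second derivatives in terms of the Laplacian and tangential second derivatives. -/
lemma Dy_mul_Dy (D : SmoothDomain d) (j k : Fin d) : Dy j * Dy k =
    Mc (rhoD D j * qInv D) * (∑ i, tang D i k * Dy i + Mc (rhoD D k) * Lap d) +
      ∑ i, Mc (rhoD D i * qInv D) * (tang D i j * Dy k) +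
        Mc (rhoS D * qInv D) * (Mc (rhoS D) * Dy j * Dy k) := by
  refine LinearMap.ext fun w => ?_
  have c : ∀ i, Dy i (Dy k w) = Dy k (Dy i w) := fun i => LinearMap.congr_fun (Dy_comm i k) w
  have h1 : qInv D * (rhoS D * rhoS D + ∑ i, rhoD D i * rhoD D i) * Dy j (Dy k w) =
    Dy j (Dy k w) := by rw [← qS, qInv_mul, one_mul]
  simp only [LinearMap.add_apply, LinearMap.sum_apply, Module.End.mul_apply, Mc_apply, tang,
    LinearMap.sub_apply, Lap]
  have e1 : ∑ i, (rhoD D i * Dy k (Dy i w) - rhoD D k * Dy i (Dy i w)) =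
      ∑ i, rhoD D i * Dy i (Dy k w) - rhoD D k * ∑ i, Dy i (Dy i w) := by
    rw [Finset.sum_sub_distrib, Finset.mul_sum]
    simp only [c]
  have e2 : ∑ i, rhoD D i * qInv D * (rhoD D i * Dy j (Dy k w) - rhoD D j * Dy i (Dy k w)) =
      qInv D * (∑ i, rhoD D i * rhoD D i) * Dy j (Dy k w) -
        rhoD D j * qInv D * ∑ i, rhoD D i * Dy i (Dy k w) := by
    rw [Finset.mul_sum, Finset.sum_mul, Finset.mul_sum, ← Finset.sum_sub_distrib]
    exact Finset.sum_congr rfl fun i _ => by ring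
  rw [e1, e2]
  linear_combination -h1

lemma DO_Lap : DO 3 (Lap d) := DO.sum _ fun j _ => (DO.Dy j).der j

lemma DO_prod (γ : List (Fin d)) : DO (γ.length + 1) (γ.map Dy).prod := by
  induction γ with
  | nil => exact DO.one 0
  | cons j γ ih => exact ih.der j

lemma ctl_word {D : SmoothDomain d} {m : ℕ} (hm : 0 < m) (l : ℕ) : ∀ (b : ℕ) (P : Op d)
    (γ : List (Fin d)), TW D b P → γ.length = l → b + l = m + 1 →
      Ctl D m ((γ.map Dy).prod * P) := by
  induction l with
  | zero =>
    intro b P γ hP hγ hb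
    obtain rfl : γ = [] := List.length_eq_zero_iff.1 hγ
    rw [List.map_nil, List.prod_nil, one_mul]
    cases hP with
    | one => omega
    | @cons b T P hT hP =>
      obtain rfl : b = m := by omega
      obtain ⟨a, ha, -, rfl⟩ := hT
      rw [Finset.sum_mul]
      refine Ctl.sum _ fun k _ => ?_
      rw [mul_assoc]
      exact Ctl.coef (ha k) (ctl_Dy_TW hP hm k)
  | succ l ih =>
    intro b P γ hP hγ hb
    match γ, hγ with
    | [j], hγ =>
      obtain rfl : b = m := by simp at hγ; omega
      simpa using ctl_Dy_TW hP hm j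
    | j :: k :: γ, hγ =>
      obtain rfl : l = γ.length + 1 := by simpa using hγ.symm
      set X : Op d := (γ.map Dy).prod * P with hX
      have hXD : DO m X := (DO.mul (DO_prod γ) hP.DO).mono (by omega)
      have hA : ∀ T, Tang D T → ∀ i, Ctl D m (T * Dy i * X) := by
        intro T hT i
        have e : T * Dy i * X = ((i :: γ).map Dy).prod * (T * P) +
            (T * ((i :: γ).map Dy).prod - ((i :: γ).map Dy).prod * T) * P := by
          rw [hX, List.map_cons, List.prod_cons]
          simp only [sub_mul, mul_assoc]
          abel
        rw [e]
        refine (ih (b + 1) _ (i :: γ) (TW.cons hT hP) rfl (by omega)).add (Ctl.of_DO ?_)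
        have := DO.comm (p := 1) hT.DO (DO_prod (i :: γ))
        rw [List.length_cons, show 1 + (γ.length + 1) = (γ.length + 1) + 1 by ring] at this
        exact (DO.mul this hP.DO).mono (by omega)
      have hL : Ctl D m (Lap d * X) := by
        have e : Lap d * X = X * Lap d + (Lap d * X - X * Lap d) := by abel
        rw [e]
        refine (Ctl.of_DO_Lap hXD).add (Ctl.of_DO ?_)
        obtain ⟨m, rfl⟩ : ∃ n, m = n + 1 := ⟨m - 1, by omega⟩
        exact (DO.comm (p := 2) DO_Lap hXD).mono (by omega)
      have e : ((j :: k :: γ).map Dy).prod * P =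
          Mc (rhoD D j * qInv D) * (∑ i, tang D i k * Dy i * X + Mc (rhoD D k) * (Lap d * X)) +
          ∑ i, Mc (rhoD D i * qInv D) * (tang D i j * Dy k * X) +
          Mc (rhoS D * qInv D) * (Mc (rhoS D) * Dy j * Dy k * X) := by
        rw [List.map_cons, List.map_cons, List.prod_cons, List.prod_cons, ← mul_assoc (Dy j),
          mul_assoc, ← hX, Dy_mul_Dy D j k]
        simp only [add_mul, Finset.sum_mul, mul_assoc]
      rw [e]
      have hi := qInv_mem D
      exact ((Ctl.coef (mul_mem (rhoD_mem D j) hi)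
        ((Ctl.sum _ fun i _ => hA _ (tang_Tang D i k) i).add (Ctl.coef (rhoD_mem D k) hL))).add
        (Ctl.sum _ fun i _ => Ctl.coef (mul_mem (rhoD_mem D i) hi) (hA _ (tang_Tang D i j) k))).add
        (Ctl.coef (mul_mem (rhoS_mem D) hi) (hA _ (rho_Tang D j) k))

/-- Reordering: the sums of squares in terms of words. -/
lemma HS_le_of_words (D : SmoothDomain d) (n : ℕ) : ∃ C : ℝ, 0 ≤ C ∧ ∀ (w : Sm d) z (M : ℝ),
    (∀ γ : List (Fin d), γ.length < n → HS D 1 ((γ.map Dy).prod w) z ≤ M) →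
      HS D n w z ≤ C * M := by
  induction n with
  | zero => exact ⟨0, le_rfl, fun w z M _ => by simp [HS, DS]⟩
  | succ n ih =>
    obtain ⟨C, hC, h⟩ := ih
    refine ⟨1 + d * C, by positivity, fun w z M hM => ?_⟩
    rw [HS_succ, ← HS_one]
    have h0 := hM [] (by simp)
    have h1 : ∀ j, HS D n (Dy j w) z ≤ C * M := fun j => h _ z M fun γ hγ => by
      have := hM (γ ++ [j]) (by simpa using hγ)
      simpa using this
    have h2 := Finset.sum_le_sum fun j (_ : j ∈ Finset.univ) => h1 j
    simp only [Finset.sum_const, Finset.card_univ, Fintype.card_fin, nsmul_eq_mul] at h2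
    have h3 : HS D 1 w z ≤ M := by simpa using h0
    linarith

/-- One step of elliptic regularity. -/
lemma elliptic_step (D : SmoothDomain d) {m : ℕ} (hm : 0 < m) : ∃ C : ℝ, 0 ≤ C ∧
    ∀ w : Sm d, NeumannBC D w.1 → ∀ z,
      HS D (m + 2) w z ≤ C * (HS D (m + 1) w z + HS D m (Lap d w) z) := by
  obtain ⟨C, hC, h⟩ := HS_le_of_words D (m + 2)
  have h1 : ∀ σ : Fin (m + 1) → Fin d, Ctl D m (((List.ofFn σ).map Dy).prod) := fun σ => by
    have := ctl_word (D := D) hm (m + 1) 0 1 (List.ofFn σ) TW.one (by simp) (by omega)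
    rwa [mul_one] at this
  choose C1 hC1 hb1 using h1
  have h2 : ∀ (n : Fin (m + 1)) (σ : Fin n → Fin d),
      Ctl D m (((List.ofFn σ).map Dy).prod) := fun n σ =>
    Ctl.of_DO ((DO_prod _).mono (by simp; omega))
  choose C2 hC2 hb2 using h2
  have p1 : 0 ≤ ∑ σ, C1 σ := Finset.sum_nonneg fun σ _ => hC1 σ
  have p2 : 0 ≤ ∑ n, ∑ σ, C2 n σ :=
    Finset.sum_nonneg fun n _ => Finset.sum_nonneg fun σ _ => hC2 n σ
  refine ⟨C * (∑ σ, C1 σ + ∑ n, ∑ σ, C2 n σ), by positivity, fun w hw z => ?_⟩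
  rw [mul_assoc]
  refine h w z _ fun γ hγ => ?_
  have hR : 0 ≤ HS D (m + 1) w z + HS D m (Lap d w) z :=
    add_nonneg (HS_nonneg _ _ _ _) (HS_nonneg _ _ _ _)
  rcases Nat.lt_succ_iff_lt_or_eq.1 hγ with hl | hl
  · have e := hb2 ⟨γ.length, hl⟩ γ.get w hw z
    rw [List.ofFn_get] at e
    refine e.trans (mul_le_mul_of_nonneg_right ?_ hR)
    have s1 := Finset.single_le_sum (f := fun σ => C2 ⟨γ.length, hl⟩ σ) (fun σ _ => hC2 _ σ)
      (Finset.mem_univ γ.get)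
    have s2 := Finset.single_le_sum (f := fun n => ∑ σ, C2 n σ)
      (fun n _ => Finset.sum_nonneg fun σ _ => hC2 n σ) (Finset.mem_univ ⟨γ.length, hl⟩)
    simp only at s1 s2
    linarith
  · obtain ⟨σ, rfl⟩ : ∃ σ : Fin (m + 1) → Fin d, γ = List.ofFn σ :=
      ⟨fun i => γ.get (i.cast hl.symm), by
        rw [← List.ofFn_congr hl, List.ofFn_get]⟩
    refine (hb1 σ w hw z).trans (mul_le_mul_of_nonneg_right ?_ hR)
    have s1 := Finset.single_le_sum (f := C1) (fun σ _ => hC1 σ) (Finset.mem_univ σ)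
    linarith

lemma elliptic_one (D : SmoothDomain d) (w : Sm d) (hw : NeumannBC D w.1) (z : Fin 4 → ℝ) :
    HS D 2 w z ≤ 2 * (HS D 1 w z + HS D 1 (Lap d w) z) := by
  have h := weak_Lap D w hw z w
  rw [HS_succ, ← HS_one]
  simp only [HS_one_eq]
  rw [map_sum] at h
  have h1 := Iy_nonneg_sq D z (Lap d w + w)
  have e : (Lap d w + w) * (Lap d w + w) = Lap d w * Lap d w + w * w + (2 : ℝ) • (Lap d w * w) := by
    rw [two_smul]; ring
  have e2 : (-Lap d) w * w = -(Lap d w * w) := neg_mul _ _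
  rw [e2, map_neg] at h
  rw [e, map_add, map_add, map_smul, smul_eq_mul] at h1
  have := Iy_nonneg_sq D z w
  have := Iy_nonneg_sq D z (Lap d w)
  linarith

/-- Elliptic regularity for the Neumann Laplacian. -/
lemma elliptic (D : SmoothDomain d) (n : ℕ) : ∃ C : ℝ, 0 ≤ C ∧
    ∀ w : Sm d, NeumannBC D w.1 → ∀ z,
      HS D (n + 3) w z ≤ C * (HS D 1 w z + HS D (n + 1) (Lap d w) z) := by
  induction n with
  | zero =>
    obtain ⟨C, hC, h⟩ := elliptic_step D (m := 1) one_pos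
    refine ⟨3 * C, by positivity, fun w hw z => (h w hw z).trans ?_⟩
    have h1 := elliptic_one D w hw z
    have h2 : HS D (1 + 1) w z + HS D 1 (Lap d w) z ≤
        3 * (HS D 1 w z + HS D 1 (Lap d w) z) := by
      have := HS_nonneg D 1 w z
      norm_num
      linarith
    rw [mul_comm 3 C, mul_assoc]
    exact mul_le_mul_of_nonneg_left h2 hC
  | succ n ih =>
    obtain ⟨C', hC', h'⟩ := ih
    obtain ⟨C, hC, h⟩ := elliptic_step D (m := n + 2) (by omega)
    refine ⟨C * (C' + 1), by positivity, fun w hw z => (h w hw z).trans ?_⟩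
    rw [mul_assoc]
    refine mul_le_mul_of_nonneg_left ?_ hC
    have h1 := h' w hw z
    have h2 := HS_mono D (show n + 1 ≤ n + 2 by omega) (Lap d w) z
    have h3 := mul_le_mul_of_nonneg_left h2 hC'
    have h4 := HS_nonneg D 1 w z
    change HS D (n + 3) w z + HS D (n + 2) (Lap d w) z ≤
      (C' + 1) * (HS D 1 w z + HS D (n + 2) (Lap d w) z)
    linarith

/-- A partial derivative in any of the `t,x,y` directions, as an operator. -/
def Dx (i : Fin 4 ⊕ Fin d) : Op d where
  toFun w := ⟨pdmix i w.1, smooth_pdmix w.2 i⟩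
  map_add' u v := Subtype.ext (pdmix_add u.2 v.2 i)
  map_smul' c u := Subtype.ext (pdmix_const_mul u.2 c i)

/-- The d'Alembertian as an operator. -/
def Bx : Op d where
  toFun w := ⟨wBox w.1, smooth_wBox w.2⟩
  map_add' u v := Subtype.ext <| funext fun z => funext fun y => by
    have h : ∀ i : Fin 4 ⊕ Fin d, pdmix i (pdmix i (u + v).1) z y =
        pdmix i (pdmix i u.1) z y + pdmix i (pdmix i v.1) z y := fun i => by
      change (Dx i (Dx i (u + v))).1 z y = _
      rw [map_add, map_add]
      rfl
    change wBox (u + v).1 z y = wBox u.1 z y + wBox v.1 z y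
    have h0 := h (Sum.inl 0)
    have h1 := h (Sum.inl 1)
    have h2 := h (Sum.inl 2)
    have h3 := h (Sum.inl 3)
    have h4 := Finset.sum_congr rfl fun j (_ : j ∈ Finset.univ) => h (Sum.inr j)
    rw [Finset.sum_add_distrib] at h4
    simp only [pdmix] at h0 h1 h2 h3 h4
    simp only [wBox, h0, h1, h2, h3, h4]
    ring
  map_smul' c u := Subtype.ext <| funext fun z => funext fun y => by
    have h : ∀ i : Fin 4 ⊕ Fin d, pdmix i (pdmix i (c • u).1) z y =
        c * pdmix i (pdmix i u.1) z y := fun i => by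
      change (Dx i (Dx i (c • u))).1 z y = _
      rw [map_smul, map_smul]
      rfl
    change wBox (c • u).1 z y = c * wBox u.1 z y
    have h0 := h (Sum.inl 0)
    have h1 := h (Sum.inl 1)
    have h2 := h (Sum.inl 2)
    have h3 := h (Sum.inl 3)
    have h4 := Finset.sum_congr rfl fun j (_ : j ∈ Finset.univ) => h (Sum.inr j)
    rw [← Finset.mul_sum] at h4
    simp only [pdmix] at h0 h1 h2 h3 h4
    simp only [wBox, h0, h1, h2, h3, h4]
    ring

lemma Bx_Dx (i : Fin 4 ⊕ Fin d) (w : Sm d) : Bx (Dx i w) = Dx i (Bx w) :=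
  Subtype.ext (wBox_pdmix w.2 i)

lemma Lap_eq (w : Sm d) : Lap d w = Dx (Sum.inl 0) (Dx (Sum.inl 0) w) -
    Dx (Sum.inl 1) (Dx (Sum.inl 1) w) - Dx (Sum.inl 2) (Dx (Sum.inl 2) w) -
    Dx (Sum.inl 3) (Dx (Sum.inl 3) w) - Bx w := by
  refine Subtype.ext (funext fun z => funext fun y => ?_)
  have h1 : (Lap d w).1 z y = ∑ j, pdy j (pdy j w.1) z y := by
    rw [Lap, LinearMap.sum_apply, Sm_sum_apply]
    rfl
  rw [h1]
  change _ = pdtx 0 (pdtx 0 w.1) z y - pdtx 1 (pdtx 1 w.1) z y - pdtx 2 (pdtx 2 w.1) z y -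
    pdtx 3 (pdtx 3 w.1) z y - wBox w.1 z y
  unfold wBox
  ring

lemma DS_neg (n : ℕ) : ∀ (w : Sm d) z y, DS n (-w) z y = DS n w z y := by
  induction n with
  | zero => intro w z y; rfl
  | succ n ih =>
    intro w z y
    rw [DS_succ, DS_succ]
    have h : (-w).1 z y = -(w.1 z y) := rfl
    rw [h, neg_sq]
    simp only [map_neg, ih]

lemma HS_sub_le (D : SmoothDomain d) (n : ℕ) (u v : Sm d) (z : Fin 4 → ℝ) :
    HS D n (u - v) z ≤ 2 * HS D n u z + 2 * HS D n v z := by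
  have h : HS D n (-v) z = HS D n v z := by
    unfold HS
    simp only [DS_neg]
  rw [sub_eq_add_neg, ← h]
  exact HS_add_le D n u (-v) z

lemma gtF_eq_pdtx (i : Fin 4) (u : V d) : gtF (Sum.inl (Fin.castLE (by omega) i)) u = pdtx i u := by
  fin_cases i <;> rfl

lemma nder_Dx {D : SmoothDomain d} {w : Sm d} (hw : NeumannBC D w.1) (i : Fin 4) :
    NeumannBC D (Dx (Sum.inl i) w).1 := by
  have h := nder_zw D w.2 hw [Fin.castLE (by omega) i]
  rw [zw_cons, zw_nil, gtF_eq_pdtx] at h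
  exact h

/-- Elliptic regularity, iterated: `y`-derivatives are controlled by `(t,x)`-derivatives and by
the derivatives of the d'Alembertian. -/
lemma elliptic_wave (D : SmoothDomain d) (k : ℕ) : ∃ C : ℝ, 0 ≤ C ∧
    ∀ w : Sm d, NeumannBC D w.1 → ∀ z M,
      (∀ a : List (Fin 4), a.length ≤ 2 * k →
        HS D 1 ((a.map fun i => Dx (d := d) (Sum.inl i)).prod w) z ≤ M) →
      (∀ b : List (Fin 4 ⊕ Fin d), b.length + 2 ≤ 2 * k →
        HS D 1 ((b.map Dx).prod (Bx w)) z ≤ M) → HS D (2 * k + 1) w z ≤ C * M := by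
  induction k with
  | zero => exact ⟨1, one_pos.le, fun w _ z M h _ => by simpa using h [] (by simp)⟩
  | succ k ih =>
    obtain ⟨C, hC, h⟩ := ih
    obtain ⟨C₁, hC₁, h₁⟩ := elliptic D (2 * k)
    obtain ⟨C₂, hC₂, h₂⟩ := HS_le_of_words D (2 * k + 1)
    refine ⟨C₁ * (1 + (46 * C + 2 * C₂)), by positivity, fun w hw z M ha hb => ?_⟩
    refine (h₁ w hw z).trans ?_
    rw [mul_assoc]
    refine mul_le_mul_of_nonneg_left ?_ hC₁
    have e0 : HS D 1 w z ≤ M := by simpa using ha [] (by simp)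
    have e1 : ∀ i : Fin 4, HS D (2 * k + 1) (Dx (Sum.inl i) (Dx (Sum.inl i) w)) z ≤ C * M := by
      intro i
      refine h _ (nder_Dx (nder_Dx hw i) i) z M (fun a hl => ?_) fun b hl => ?_
      · have := ha (a ++ [i, i]) (by simp; omega)
        simpa using this
      · have := hb (b ++ [Sum.inl i, Sum.inl i]) (by simp; omega)
        rw [Bx_Dx, Bx_Dx]
        simpa using this
    have e2 : HS D (2 * k + 1) (Bx w) z ≤ C₂ * M := by
      refine h₂ _ z M fun γ hγ => ?_
      have := hb (γ.map Sum.inr) (by simp; omega)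
      rw [List.map_map] at this
      exact this
    have a0 := e1 0
    have a1 := e1 1
    have a2 := e1 2
    have a3 := e1 3
    rw [Lap_eq]
    refine (add_le_add e0 (HS_sub_le D _ _ _ z)).trans ?_
    have b1 := HS_sub_le D (2 * k + 1) (Dx (Sum.inl 0) (Dx (Sum.inl 0) w) -
      Dx (Sum.inl 1) (Dx (Sum.inl 1) w) - Dx (Sum.inl 2) (Dx (Sum.inl 2) w))
      (Dx (Sum.inl 3) (Dx (Sum.inl 3) w)) z
    have b2 := HS_sub_le D (2 * k + 1) (Dx (Sum.inl 0) (Dx (Sum.inl 0) w) -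
      Dx (Sum.inl 1) (Dx (Sum.inl 1) w)) (Dx (Sum.inl 2) (Dx (Sum.inl 2) w)) z
    have b3 := HS_sub_le D (2 * k + 1) (Dx (Sum.inl 0) (Dx (Sum.inl 0) w))
      (Dx (Sum.inl 1) (Dx (Sum.inl 1) w)) z
    have hM : 0 ≤ C * M := (HS_nonneg D _ _ z).trans a0
    linarith

lemma le_integral_of_hasDerivAt {f f' g : ℝ → ℝ} (hd : ∀ s, HasDerivAt f (f' s) s)
    (hc : Continuous f') (hg : Continuous g) (hf0 : ∀ s, 0 ≤ f s) (h : ∀ s, f s + |f' s| ≤ g s) :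
    f 0 ≤ ∫ s in (0 : ℝ)..1, g s := by
  have hfc : Continuous f := continuous_iff_continuousAt.2 fun s => (hd s).continuousAt
  have h1 : ∀ s ∈ Set.uIcc (0 : ℝ) 1, HasDerivAt (fun s => (s - 1) * f s)
      (f s + (s - 1) * f' s) s := fun s _ =>
    (((hasDerivAt_id' s).sub_const 1).mul (hd s)).congr_deriv (by ring)
  have hi : Continuous fun s => f s + (s - 1) * f' s := by fun_prop
  have h2 := intervalIntegral.integral_eq_sub_of_hasDerivAt h1 (hi.intervalIntegrable _ _)
  have h3 : f 0 = ∫ s in (0 : ℝ)..1, (f s + (s - 1) * f' s) := by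
    rw [h2]; ring
  rw [h3]
  refine intervalIntegral.integral_mono_on zero_le_one (hi.intervalIntegrable _ _)
    (hg.intervalIntegrable _ _) fun s hs => ?_
  have h4 : |(s - 1) * f' s| ≤ |f' s| := by
    rw [abs_mul]
    exact mul_le_of_le_one_left (abs_nonneg _) (abs_le.2 ⟨by linarith [hs.1], by linarith [hs.2]⟩)
  have h5 := le_abs_self ((s - 1) * f' s)
  have h6 := h s
  linarith

lemma abs_pdy_DS_le (n : ℕ) (j : Fin d) : ∀ (w : Sm d) z y,
    |pdy j (DS n w) z y| ≤ DS n w z y + DS n (Dy j w) z y := by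
  induction n with
  | zero =>
    intro w z y
    have h : pdy j (DS 0 w) z y = 0 := congrFun (congrFun (pdmix_zero (d := d) (Sum.inr j)) z) y
    rw [h, abs_zero]
    exact add_nonneg (DS_nonneg 0 w z y) (DS_nonneg 0 _ z y)
  | succ n ih =>
    intro w z y
    have e : DS (n + 1) w = fun z y => w.1 z y * w.1 z y + ∑ i, DS n (Dy i w) z y := by
      funext z y
      rw [DS_succ, pow_two]
    have h : pdy j (DS (n + 1) w) z y = 2 * (w.1 z y * (Dy j w).1 z y) +
        ∑ i, pdy j (DS n (Dy i w)) z y := by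
      rw [e]
      have h1 := congrFun (congrFun (pdmix_add (smooth_mul w.2 w.2)
        (smooth_sum Finset.univ fun i => smooth_DS n (Dy i w)) (Sum.inr j)) z) y
      have h2 := congrFun (congrFun (pdmix_mul w.2 w.2 (Sum.inr j)) z) y
      have h3 := congrFun (congrFun (pdmix_sum Finset.univ
        (fun i => smooth_DS n (Dy i w)) (Sum.inr j)) z) y
      refine h1.trans ?_
      rw [h2, h3]
      change w.1 z y * (Dy j w).1 z y + (Dy j w).1 z y * w.1 z y + _ = _
      simp only [pdmix]
      ring
    have h1 := Finset.sum_le_sum fun i (_ : i ∈ Finset.univ) => ih (Dy i w) z y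
    have h2 := Finset.abs_sum_le_sum_abs (fun i => pdy j (DS n (Dy i w)) z y) Finset.univ
    have h3 : |2 * (w.1 z y * (Dy j w).1 z y)| ≤ (w.1 z y) ^ 2 + ((Dy j w).1 z y) ^ 2 :=
      abs_le.2 ⟨by nlinarith [sq_nonneg (w.1 z y + (Dy j w).1 z y)],
        by nlinarith [sq_nonneg (w.1 z y - (Dy j w).1 z y)]⟩
    have h4 : ∀ i, Dy i (Dy j w) = Dy j (Dy i w) := fun i => LinearMap.congr_fun (Dy_comm i j) w
    rw [Finset.sum_add_distrib] at h1
    rw [h, DS_succ n w, DS_succ n (Dy j w)]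
    simp only [h4]
    have h5 := abs_add_le (2 * (w.1 z y * (Dy j w).1 z y)) (∑ i, pdy j (DS n (Dy i w)) z y)
    linarith

lemma DS_le_lintegral (n : ℕ) (w : Sm d) (z : Fin 4 → ℝ) (ℓ p : Fin d → ℝ) {c : ℝ}
    (hc : 1 + 2 * ∑ j, |ℓ j| ≤ c) :
    ENNReal.ofReal (DS n w z p) ≤ ENNReal.ofReal c *
      ∫⁻ s in Set.Ioc (0 : ℝ) 1, ENNReal.ofReal (DS (n + 1) w z (p + s • ℓ)) := by
  have hc0 : 0 ≤ c := by
    have : 0 ≤ ∑ j, |ℓ j| := Finset.sum_nonneg fun j _ => abs_nonneg _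
    linarith
  have hs := smooth_slice (smooth_DS n w) z
  have hp : Continuous fun s : ℝ => p + s • ℓ := by fun_prop
  have hd : ∀ s : ℝ, HasDerivAt (fun s : ℝ => DS n w z (p + s • ℓ))
      (fderiv ℝ (DS n w z) (p + s • ℓ) ℓ) s := fun s => by
    have h1 : HasDerivAt (fun s : ℝ => p + s • ℓ) ℓ s := by
      simpa using ((hasDerivAt_id' s).smul_const ℓ).const_add p
    exact ((hs.differentiable (by simp)) (p + s • ℓ)).hasFDerivAt.comp_hasDerivAt s h1
  have hcd : Continuous fun s : ℝ => fderiv ℝ (DS n w z) (p + s • ℓ) ℓ :=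
    ((hs.continuous_fderiv (by simp)).comp hp).clm_apply continuous_const
  have hg : Continuous fun s : ℝ => c * DS (n + 1) w z (p + s • ℓ) :=
    ((smooth_slice (smooth_DS (n + 1) w) z).continuous.comp hp).const_mul c
  have hb : ∀ y, |fderiv ℝ (DS n w z) y ℓ| ≤ 2 * (∑ j, |ℓ j|) * DS (n + 1) w z y := fun y => by
    have e : fderiv ℝ (DS n w z) y ℓ = ∑ j, ℓ j * pdy j (DS n w) z y := by
      conv_lhs => rw [← ContinuousLinearMap.coe_coe, LinearMap.pi_apply_eq_sum_univ _ ℓ]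
      refine Finset.sum_congr rfl fun j _ => ?_
      rw [smul_eq_mul, pdy, ContinuousLinearMap.coe_coe]
      congr 3
      funext i
      simp [Pi.single_apply, eq_comm]
    rw [e, mul_comm 2, mul_assoc, Finset.sum_mul]
    refine (Finset.abs_sum_le_sum_abs _ _).trans (Finset.sum_le_sum fun j _ => ?_)
    rw [abs_mul]
    refine mul_le_mul_of_nonneg_left ((abs_pdy_DS_le n j w z y).trans ?_) (abs_nonneg _)
    have h1 := DS_le_succ n w z y
    have h2 := DS_Dy_le n j w z y
    linarith
  have h := le_integral_of_hasDerivAt hd hcd hg (fun s => DS_nonneg n w z _) fun s => by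
    have h1 := hb (p + s • ℓ)
    have h2 := DS_le_succ n w z (p + s • ℓ)
    have h3 := mul_le_mul_of_nonneg_right hc (DS_nonneg (n + 1) w z (p + s • ℓ))
    linarith
  simp only [zero_smul, add_zero] at h
  refine (ENNReal.ofReal_le_ofReal h).trans ?_
  rw [intervalIntegral.integral_const_mul, ENNReal.ofReal_mul hc0,
    intervalIntegral.integral_of_le zero_le_one, ofReal_integral_eq_lintegral_ofReal]
  · have hg' : Continuous fun s : ℝ => DS (n + 1) w z (p + s • ℓ) :=
      (smooth_slice (smooth_DS (n + 1) w) z).continuous.comp hp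
    exact (hg'.continuousOn.integrableOn_Icc (a := 0) (b := 1)).mono_set Set.Ioc_subset_Icc_self
  · exact Filter.Eventually.of_forall fun s => DS_nonneg _ _ _ _

/-- Iterating a one-dimensional estimate along several directions. -/
lemma le_iterate_dirs {E : Type*} [AddCommGroup E] [Module ℝ E] [TopologicalSpace E]
    [IsTopologicalAddGroup E] [ContinuousSMul ℝ E] {c : ENNReal} (hct : c ≠ ⊤)
    (f : ℕ → E → ENNReal)
    (hf : ∀ n, Continuous (f n)) (k : ℕ) :
    ∀ ℓ : Fin k → E, (∀ i n p, f n p ≤ c * ∫⁻ s in Set.Ioc (0 : ℝ) 1, f (n + 1) (p + s • ℓ i)) →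
      ∀ n p, f n p ≤ c ^ k * ∫⁻ s in Set.univ.pi fun _ : Fin k => Set.Ioc (0 : ℝ) 1,
        f (n + k) (p + ∑ i, s i • ℓ i) := by
  induction k with
  | zero =>
    intro ℓ _ n p
    have h : (Set.univ.pi fun _ : Fin 0 => Set.Ioc (0 : ℝ) 1) = Set.univ :=
      Set.eq_univ_of_forall fun s i => i.elim0
    rw [h, Measure.restrict_univ, volume_pi, Measure.pi_of_empty _ default]
    simp
  | succ k ih =>
    intro ℓ h n p
    have hm : ∀ m (ℓ : Fin m → E) p n, Measurable fun s : Fin m → ℝ => f n (p + ∑ i, s i • ℓ i) :=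
      fun m ℓ p n => ((hf n).comp (by fun_prop)).measurable
    have hms : ∀ m, MeasurableSet (Set.univ.pi fun _ : Fin m => Set.Ioc (0 : ℝ) 1) := fun m =>
      MeasurableSet.univ_pi fun _ => measurableSet_Ioc
    rw [← lintegral_indicator (hms _), lintegral_insertNth 0 ((hm _ _ _ _).indicator (hms _))]
    refine (h 0 n p).trans ?_
    rw [pow_succ', mul_assoc]
    refine mul_le_mul_right ?_ c
    rw [← lintegral_indicator measurableSet_Ioc, ← lintegral_const_mul' _ _ (ENNReal.pow_ne_top hct)]
    refine lintegral_mono fun a => ?_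
    by_cases ha : a ∈ Set.Ioc (0 : ℝ) 1
    · rw [Set.indicator_of_mem ha]
      refine (ih (fun i => ℓ i.succ) (fun i => h i.succ) (n + 1) (p + a • ℓ 0)).trans
        (le_of_eq ?_)
      rw [← lintegral_indicator (hms _)]
      congr 1
      refine lintegral_congr fun x => ?_
      have e : n + 1 + k = n + (k + 1) := by omega
      by_cases hx : x ∈ Set.univ.pi fun _ : Fin k => Set.Ioc (0 : ℝ) 1
      · rw [Set.indicator_of_mem hx, Set.indicator_of_mem, Fin.sum_univ_succ, e]
        · simp [add_assoc]
        · intro i _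
          refine Fin.cases ?_ (fun i => ?_) i
          · simpa using ha
          · simpa using hx i (Set.mem_univ i)
      · rw [Set.indicator_of_notMem hx, Set.indicator_of_notMem]
        intro hx'
        exact hx fun i _ => by simpa using hx' i.succ (Set.mem_univ _)
    · rw [Set.indicator_of_notMem ha]
      exact zero_le

lemma ofReal_HS (D : SmoothDomain d) (n : ℕ) (w : Sm d) (z : Fin 4 → ℝ) :
    ENNReal.ofReal (HS D n w z) = ∫⁻ y in D.carrier, ENNReal.ofReal (DS n w z y) :=
  ofReal_integral_eq_lintegral_ofReal (integrableOn_slice D (smooth_DS n w) z)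
    (Filter.Eventually.of_forall fun y => DS_nonneg n w z y)

/-- Sobolev inequality on a parallelepiped contained in the domain. -/
lemma sobolev_corner (D : SmoothDomain d) (ℓ : Fin d → Fin d → ℝ)
    (hℓ : ∀ s : Fin d → ℝ, ∑ i, s i • ℓ i = 0 → s = 0) : ∃ C : ℝ, 0 ≤ C ∧
      ∀ p, (∀ s : Fin d → ℝ, (∀ i, s i ∈ Set.Ioc (0 : ℝ) 1) → p + ∑ i, s i • ℓ i ∈ D.carrier) →
        ∀ (w : Sm d) z, (w.1 z p) ^ 2 ≤ C * HS D (d + 1) w z := by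
  set c : ℝ := 1 + 2 * ∑ i, ∑ j, |ℓ i j| with hc
  set L : (Fin d → ℝ) →ₗ[ℝ] (Fin d → ℝ) := Fintype.linearCombination ℝ ℓ with hL
  have hLa : ∀ s, L s = ∑ i, s i • ℓ i := fun s => Fintype.linearCombination_apply ℝ ℓ s
  have hdet : LinearMap.det L ≠ 0 := by
    intro h0
    refine (LinearMap.bot_lt_ker_of_det_eq_zero h0).ne' ((Submodule.eq_bot_iff _).2 fun s hs => ?_)
    exact hℓ s (by rw [← hLa]; exact hs)
  have hc0 : 0 ≤ c := by
    have : 0 ≤ ∑ i, ∑ j, |ℓ i j| :=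
      Finset.sum_nonneg fun i _ => Finset.sum_nonneg fun j _ => abs_nonneg _
    linarith
  refine ⟨c ^ d * |(LinearMap.det L)⁻¹|, by positivity, fun p hp w z => ?_⟩
  set F : (Fin d → ℝ) → ENNReal := fun y => ENNReal.ofReal (DS (1 + d) w z y) with hF
  have hcont : ∀ n, Continuous fun y => ENNReal.ofReal (DS n w z y) := fun n =>
    ENNReal.continuous_ofReal.comp (smooth_slice (smooth_DS n w) z).continuous
  have h1 := le_iterate_dirs (c := ENNReal.ofReal c) ENNReal.ofReal_ne_top
    (fun n y => ENNReal.ofReal (DS n w z y)) hcont d ℓ (fun i n q =>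
      DS_le_lintegral n w z (ℓ i) q (by
        have : ∑ j, |ℓ i j| ≤ ∑ i, ∑ j, |ℓ i j| :=
          Finset.single_le_sum (f := fun i => ∑ j, |ℓ i j|)
            (fun i _ => Finset.sum_nonneg fun j _ => abs_nonneg _) (Finset.mem_univ i)
        linarith)) 1 p
  have hLm : Measurable L := (LinearMap.continuous_of_finiteDimensional L).measurable
  have hFi : Measurable (D.carrier.indicator F) :=
    (hcont (1 + d)).measurable.indicator D.isOpen.measurableSet
  have h2 : ∫⁻ s in Set.univ.pi fun _ : Fin d => Set.Ioc (0 : ℝ) 1, F (p + ∑ i, s i • ℓ i) ≤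
      ENNReal.ofReal |(LinearMap.det L)⁻¹| * ∫⁻ y in D.carrier, F y := by
    have e : ∫⁻ y in D.carrier, F y = ∫⁻ x, D.carrier.indicator F (p + x) := by
      rw [lintegral_add_left_eq_self (D.carrier.indicator F) p,
        lintegral_indicator D.isOpen.measurableSet]
    rw [e, ← smul_eq_mul, ← lintegral_smul_measure,
      ← Measure.map_linearMap_addHaar_eq_smul_addHaar volume hdet,
      lintegral_map (f := fun x => D.carrier.indicator F (p + x))
        (hFi.comp (measurable_const_add p)) hLm,
      ← lintegral_indicator (MeasurableSet.univ_pi fun _ => measurableSet_Ioc)]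
    refine lintegral_mono fun s => ?_
    by_cases hs : s ∈ Set.univ.pi fun _ : Fin d => Set.Ioc (0 : ℝ) 1
    · rw [Set.indicator_of_mem hs, hLa]
      rw [Set.indicator_of_mem (hp s fun i => hs i (Set.mem_univ i))]
    · rw [Set.indicator_of_notMem hs]
      exact zero_le
  have h3 : ENNReal.ofReal ((w.1 z p) ^ 2) ≤
      ENNReal.ofReal (c ^ d * |(LinearMap.det L)⁻¹| * HS D (d + 1) w z) := by
    rw [mul_assoc, ENNReal.ofReal_mul (by positivity), ENNReal.ofReal_mul (by positivity),
      ofReal_HS, ENNReal.ofReal_pow hc0, add_comm d 1]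
    refine (ENNReal.ofReal_le_ofReal (sq_le_DS 0 w z p)).trans (h1.trans ?_)
    exact mul_le_mul_right h2 _
  exact (ENNReal.ofReal_le_ofReal_iff (mul_nonneg (by positivity) (HS_nonneg _ _ _ _))).1 h3

lemma exists_directions (D : SmoothDomain d) {y₀ : Fin d → ℝ} (h₀ : y₀ ∈ frontier D.carrier) :
    ∃ m : Fin d → Fin d → ℝ, (∀ s : Fin d → ℝ, ∑ i, s i • m i = 0 → s = 0) ∧
      ∀ i, fderiv ℝ D.defFun y₀ (m i) < 0 := by
  obtain ⟨e, he⟩ := exists_dir_of_ne (D.grad_ne y₀ h₀)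
  set l := fderiv ℝ D.defFun y₀ with hl
  set K : ℝ := ∑ i, |l (Pi.single i 1)| + 1 with hK
  have hK0 : 0 < K := add_pos_of_nonneg_of_pos (Finset.sum_nonneg fun i _ => abs_nonneg _) one_pos
  obtain ⟨η, hη, hηK, hne⟩ : ∃ η : ℝ, 0 < η ∧ η * K < l e ∧ η - ∑ i, e i ≠ 0 := by
    have h1 : l e / K / 2 * K < l e := by
      field_simp
      linarith
    have h2 : l e / K / 3 * K < l e := by
      field_simp
      linarith
    by_cases h : l e / K / 2 - ∑ i, e i = 0
    · refine ⟨l e / K / 3, by positivity, h2, fun h' => ?_⟩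
      have : 0 < l e / K := by positivity
      linarith
    · exact ⟨l e / K / 2, by positivity, h1, h⟩
  refine ⟨fun i => -e + η • Pi.single i 1, fun s hs => ?_, fun i => ?_⟩
  · have h1 : ∀ j, η * s j = (∑ i, s i) * e j := fun j => by
      have := congrFun hs j
      simp only [Finset.sum_apply, Pi.smul_apply, Pi.add_apply, Pi.neg_apply, smul_eq_mul,
        Pi.single_apply, mul_add, Finset.sum_add_distrib, mul_ite, mul_one, mul_zero,
        Finset.sum_ite_eq, Finset.mem_univ, if_true, Pi.zero_apply, mul_neg,
        Finset.sum_neg_distrib, ← Finset.sum_mul] at this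
      linarith
    have h2 : (η - ∑ i, e i) * ∑ i, s i = 0 := by
      rw [sub_mul, Finset.mul_sum, Finset.sum_congr rfl fun j _ => h1 j, ← Finset.mul_sum]
      ring
    have h3 : ∑ i, s i = 0 := (mul_eq_zero.1 h2).resolve_left hne
    funext j
    have h4 := h1 j
    rw [h3, zero_mul] at h4
    exact (mul_eq_zero.1 h4).resolve_left hη.ne'
  · have h1 : |l (Pi.single i 1)| ≤ K := by
      have := Finset.single_le_sum (f := fun i => |l (Pi.single i 1)|)
        (fun i _ => abs_nonneg _) (Finset.mem_univ i)
      linarith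
    have h2 := mul_le_mul_of_nonneg_left ((le_abs_self _).trans h1) hη.le
    rw [map_add, map_neg, map_smul, smul_eq_mul]
    linarith

/-- The uniform interior cone condition, in terms of parallelepipeds. -/
lemma exists_corner (D : SmoothDomain d) {y₀ : Fin d → ℝ} (h₀ : y₀ ∈ closure D.carrier) :
    ∃ ℓ : Fin d → Fin d → ℝ, (∀ s : Fin d → ℝ, ∑ i, s i • ℓ i = 0 → s = 0) ∧
      ∃ r > 0, ∀ y ∈ Metric.ball y₀ r ∩ closure D.carrier, ∀ s : Fin d → ℝ,
        (∀ i, s i ∈ Set.Ioc (0 : ℝ) 1) → y + ∑ i, s i • ℓ i ∈ D.carrier := by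
  obtain ⟨m, hm, r, hr, h⟩ : ∃ m : Fin d → Fin d → ℝ,
      (∀ s : Fin d → ℝ, ∑ i, s i • m i = 0 → s = 0) ∧ ∃ r > 0,
        ∀ y ∈ Metric.ball y₀ r ∩ closure D.carrier, ∀ s : Fin d → ℝ, (∀ i, 0 < s i) →
          ‖∑ i, s i • m i‖ < r → y + ∑ i, s i • m i ∈ D.carrier := by
    rw [closure_eq_self_union_frontier] at h₀
    rcases h₀ with h₀ | h₀
    · obtain ⟨R, hR, hb⟩ := Metric.isOpen_iff.1 D.isOpen y₀ h₀
      refine ⟨fun i => Pi.single i 1, fun s hs => ?_, R / 2, by positivity,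
        fun y hy s _ hs => hb ?_⟩
      · funext j
        have := congrFun hs j
        simpa [Pi.single_apply] using this
      · have h1 := Metric.mem_ball.1 hy.1
        rw [Metric.mem_ball, dist_eq_norm, add_sub_right_comm]
        rw [dist_eq_norm] at h1
        exact (norm_add_le _ _).trans_lt (by linarith)
    · obtain ⟨m, hm, hneg⟩ := exists_directions D h₀
      have hd : Nonempty (Fin d) := by
        by_contra hd
        rw [not_nonempty_iff] at hd
        exact D.grad_ne y₀ h₀ (Subsingleton.elim _ _)
      have hcont : ∀ i, Continuous fun y => fderiv ℝ D.defFun y (m i) := fun i =>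
        (D.defFun_smooth.continuous_fderiv (by simp)).clm_apply continuous_const
      have hev : ∀ᶠ y in nhds y₀, ∀ i, fderiv ℝ D.defFun y (m i) < 0 :=
        Filter.eventually_all.2 fun i => (hcont i).continuousAt.eventually_lt_const (hneg i)
      obtain ⟨R, hR, hb⟩ := Metric.eventually_nhds_iff.1 hev
      refine ⟨m, hm, R / 2, by positivity, fun y hy s hs0 hs => ?_⟩
      set v := ∑ i, s i • m i with hv
      have hder : ∀ τ : ℝ, HasDerivAt (fun τ : ℝ => D.defFun (y + τ • v))
          (fderiv ℝ D.defFun (y + τ • v) v) τ := fun τ => by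
        have h1 : HasDerivAt (fun s : ℝ => y + s • v) v τ := by
          simpa using ((hasDerivAt_id' τ).smul_const v).const_add y
        exact ((D.defFun_smooth.differentiable (by simp)) (y + τ • v)).hasFDerivAt.comp_hasDerivAt
          τ h1
      obtain ⟨τ, hτ, he⟩ := exists_hasDerivAt_eq_slope (fun τ : ℝ => D.defFun (y + τ • v)) _
        (zero_lt_one' ℝ) (fun τ _ => (hder τ).continuousAt.continuousWithinAt)
        fun τ _ => hder τ
      have hmem : dist (y + τ • v) y₀ < R := by
        have h1 := Metric.mem_ball.1 hy.1
        rw [dist_eq_norm] at h1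
        rw [dist_eq_norm, add_sub_right_comm]
        refine (norm_add_le _ _).trans_lt ?_
        have h2 : ‖τ • v‖ ≤ ‖v‖ := by
          rw [norm_smul, Real.norm_eq_abs, abs_of_pos hτ.1]
          exact mul_le_of_le_one_left (norm_nonneg _) hτ.2.le
        linarith
      have hlt : fderiv ℝ D.defFun (y + τ • v) v < 0 := by
        nth_rewrite 2 [hv]
        rw [map_sum]
        refine Finset.sum_neg (fun i _ => ?_) Finset.univ_nonempty
        rw [map_smul, smul_eq_mul]
        exact mul_neg_of_pos_of_neg (hs0 i) (hb hmem i)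
      have hy0 : D.defFun y ≤ 0 := by
        have := hy.2
        rwa [closure_eq] at this
      simp only [one_smul, zero_smul, add_zero, sub_zero, div_one] at he
      rw [D.carrier_eq]
      change D.defFun (y + v) < 0
      linarith
  set K : ℝ := ∑ i, ‖m i‖ + 1 with hK
  have hK1 : 0 ≤ ∑ i, ‖m i‖ := Finset.sum_nonneg fun i _ => norm_nonneg _
  have hK0 : 0 < K := by linarith
  have hδ : 0 < r / K := by positivity
  have e : ∀ s : Fin d → ℝ, ∑ i, s i • (r / K) • m i = ∑ i, ((r / K) • s) i • m i := fun s =>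
    Finset.sum_congr rfl fun i _ => by rw [Pi.smul_apply, smul_smul, smul_eq_mul, mul_comm]
  refine ⟨fun i => (r / K) • m i, fun s hs => ?_, r, hr, fun y hy s hs => ?_⟩
  · rw [e] at hs
    exact (smul_eq_zero.1 (hm _ hs)).resolve_left hδ.ne'
  · rw [e]
    refine h y hy _ (fun i => mul_pos hδ (hs i).1) ?_
    have h1 : ∀ i ∈ Finset.univ, ‖((r / K) • s) i • m i‖ ≤ r / K * ‖m i‖ := fun i _ => by
      rw [norm_smul, Pi.smul_apply, smul_eq_mul, Real.norm_eq_abs, abs_mul, abs_of_pos hδ,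
        abs_of_pos (hs i).1]
      have := mul_le_mul_of_nonneg_left (hs i).2 hδ.le
      exact mul_le_mul_of_nonneg_right (by linarith) (norm_nonneg _)
    refine (norm_sum_le_of_le _ h1).trans_lt ?_
    rw [← Finset.mul_sum, div_mul_eq_mul_div, div_lt_iff₀ hK0]
    exact mul_lt_mul_of_pos_left (by linarith) hr

/-- Sobolev inequality on the closure of the domain. -/
lemma sobolev_y (D : SmoothDomain d) : ∃ C : ℝ, 0 ≤ C ∧ ∀ y ∈ closure D.carrier,
    ∀ (w : Sm d) z, (w.1 z y) ^ 2 ≤ C * HS D (d + 1) w z := by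
  have h := (isCompact_closure D).induction_on (p := fun S => ∃ C : ℝ, 0 ≤ C ∧
    ∀ y ∈ S ∩ closure D.carrier, ∀ (w : Sm d) z, (w.1 z y) ^ 2 ≤ C * HS D (d + 1) w z) ?_ ?_ ?_ ?_
  · simpa only [Set.inter_self] using h
  · exact ⟨0, le_rfl, fun y hy => absurd hy.1 (Set.notMem_empty y)⟩
  · rintro s t hst ⟨C, hC, h⟩
    exact ⟨C, hC, fun y hy => h y ⟨hst hy.1, hy.2⟩⟩
  · rintro s t ⟨C, hC, h⟩ ⟨C', hC', h'⟩
    refine ⟨C + C', by positivity, fun y hy w z => ?_⟩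
    have h0 := HS_nonneg D (d + 1) w z
    rw [add_mul]
    rcases hy.1 with h1 | h1
    · have := h y ⟨h1, hy.2⟩ w z
      have := mul_nonneg hC' h0
      linarith
    · have := h' y ⟨h1, hy.2⟩ w z
      have := mul_nonneg hC h0
      linarith
  · intro y₀ h₀
    obtain ⟨ℓ, hℓ, r, hr, h⟩ := exists_corner D h₀
    obtain ⟨C, hC, hs⟩ := sobolev_corner D ℓ hℓ
    exact ⟨Metric.ball y₀ r, mem_nhdsWithin_of_mem_nhds (Metric.ball_mem_nhds y₀ hr), C, hC,
      fun y hy w z => hs y (fun s h' => h y hy s h') w z⟩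

lemma gtF_inl_dyWord {w : V d} (hw : SmoothC w) (i : Fin 10) (γ : List (Fin d)) :
    gtF (Sum.inl i) (opIter gtF (γ.map Sum.inr) w) =
      opIter gtF (γ.map Sum.inr) (gtF (Sum.inl i) w) := by
  induction γ with
  | nil => rfl
  | cons j γ ih =>
    change gtF (Sum.inl i) (pdy j (opIter gtF (γ.map Sum.inr) w)) =
      pdy j (opIter gtF (γ.map Sum.inr) (gtF (Sum.inl i) w))
    rw [← ih, pdy_gtF (smooth_word hw _)]

lemma zw_dyWord {w : V d} (hw : SmoothC w) (β : List (Fin 10)) (γ : List (Fin d)) :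
    zw β (opIter gtF (γ.map Sum.inr) w) = opIter gtF (γ.map Sum.inr) (zw β w) := by
  induction β with
  | nil => rfl
  | cons i β ih => rw [zw_cons, zw_cons, ih, gtF_inl_dyWord (smooth_zw hw β)]

lemma pdtx_dyWord {w : V d} (hw : SmoothC w) (i : Fin 4) (γ : List (Fin d)) :
    pdtx i (opIter gtF (γ.map Sum.inr) w) = opIter gtF (γ.map Sum.inr) (pdtx i w) := by
  rw [← gtF_eq_pdtx, ← gtF_eq_pdtx, gtF_inl_dyWord hw]

/-- The `y`-derivatives in a product of admissible fields can be moved to the left. -/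
lemma exists_word_split (L : List (Fin 10 ⊕ Fin d)) : ∃ (γ : List (Fin d)) (β : List (Fin 10)),
    γ.length + β.length = L.length ∧ ∀ w : V d, SmoothC w →
      opIter gtF L w = opIter gtF (γ.map Sum.inr) (zw β w) := by
  induction L with
  | nil => exact ⟨[], [], rfl, fun w _ => rfl⟩
  | cons i L ih =>
    obtain ⟨γ, β, h, hw⟩ := ih
    cases i with
    | inl i =>
      refine ⟨γ, i :: β, by simp; omega, fun w hs => ?_⟩
      change gtF (Sum.inl i) (opIter gtF L w) = _
      rw [hw w hs, gtF_inl_dyWord (smooth_zw hs β), zw_cons]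
    | inr j =>
      refine ⟨j :: γ, β, by simp; omega, fun w hs => ?_⟩
      change gtF (Sum.inr j) (opIter gtF L w) = gtF (Sum.inr j) _
      rw [hw w hs]

/-- A partial derivative as an admissible field. -/
def mixField : Fin 4 ⊕ Fin d → Fin 10 ⊕ Fin d := Sum.map (Fin.castLE (by omega)) id

lemma gtF_mixField (i : Fin 4 ⊕ Fin d) (u : V d) : gtF (mixField i) u = pdmix i u := by
  cases i with
  | inl i => exact gtF_eq_pdtx i u
  | inr j => rfl

lemma prod_Dx (b : List (Fin 4 ⊕ Fin d)) (w : Sm d) :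
    ((b.map Dx).prod w).1 = opIter gtF (b.map mixField) w.1 := by
  induction b with
  | nil => rfl
  | cons i b ih =>
    rw [List.map_cons, List.prod_cons, List.map_cons]
    change pdmix i ((b.map Dx).prod w).1 = gtF (mixField i) (opIter gtF (b.map mixField) w.1)
    rw [ih, gtF_mixField]

lemma prod_Dx_inl (a : List (Fin 4)) (w : Sm d) :
    ((a.map fun i => Dx (d := d) (Sum.inl i)).prod w).1 =
      zw (a.map (Fin.castLE (by omega))) w.1 := by
  have h := prod_Dx (a.map Sum.inl) w
  rw [List.map_map, List.map_map] at h
  rw [zw, List.map_map]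
  exact h

lemma prod_Dy (γ : List (Fin d)) (w : Sm d) :
    ((γ.map Dy).prod w).1 = opIter gtF (γ.map Sum.inr) w.1 := by
  have h := prod_Dx (γ.map Sum.inr) w
  rw [List.map_map, List.map_map] at h
  exact h

lemma HS_prod_Dy_le (D : SmoothDomain d) (n : ℕ) (γ : List (Fin d)) (w : Sm d) (z : Fin 4 → ℝ) :
    HS D n ((γ.map Dy).prod w) z ≤ HS D (γ.length + n) w z := by
  induction γ generalizing n with
  | nil => simp
  | cons j γ ih =>
    rw [List.map_cons, List.prod_cons]
    refine le_trans ?_ ((ih (n + 1)).trans_eq (by rw [List.length_cons]; congr 1; omega))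
    exact setIntegral_mono_smooth D (smooth_DS _ _) (smooth_DS _ _) fun y _ =>
      DS_Dy_le n j _ z y

lemma exists_zw_pdtx_sq_le (n : ℕ) : ∃ C : ℝ, 0 ≤ C ∧ ∀ β : List (Fin 10), β.length ≤ n →
    ∀ w : V d, SmoothC w → ∀ j z y, (zw β (pdtx j w) z y) ^ 2 ≤ C * EE n w z y := by
  choose C hC h using zw_pdtx_sq_le (d := d)
  refine ⟨∑ k ∈ Finset.range (n + 1), C k, Finset.sum_nonneg fun k _ => (hC k).le,
    fun β hβ w hw j z y => ?_⟩
  refine (h _ β rfl w hw j z y).trans ?_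
  refine mul_le_mul ?_ (EE_mono hβ w z y) (EE_nonneg _ _ _ _)
    (Finset.sum_nonneg fun k _ => (hC k).le)
  exact Finset.single_le_sum (f := C) (fun k _ => (hC k).le) (Finset.mem_range.2 (by omega))

lemma ofReal_integral_EE (D : SmoothDomain d) (n : ℕ) {u : V d} (hu : SmoothC u)
    (z : Fin 4 → ℝ) : ENNReal.ofReal (∫ y in D.carrier, EE n u z y) = NN D n u z :=
  ofReal_integral_eq_lintegral_ofReal (integrableOn_slice D (smooth_EE hu n) z)
    (Filter.Eventually.of_forall fun y => EE_nonneg n u z y)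

/-- The `L²(Ω)` norms of `Γ`-words on first derivatives are controlled by the energy. -/
lemma exists_HS_zw_pdtx_le (D : SmoothDomain d) (n : ℕ) : ∃ C : ℝ, 0 ≤ C ∧
    ∀ u : V d, SmoothC u → ∀ z Q, 0 ≤ Q → NN D n u z ≤ ENNReal.ofReal Q →
      ∀ β : List (Fin 10), β.length ≤ n → ∀ i, ∀ w : Sm d, w.1 = zw β (pdtx i u) →
        HS D 1 w z ≤ C * Q := by
  obtain ⟨C, hC, h⟩ := exists_zw_pdtx_sq_le (d := d) n
  refine ⟨C, hC, fun u hu z Q hQ hN β hβ i w hw => ?_⟩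
  rw [← ofReal_integral_EE D n hu, ENNReal.ofReal_le_ofReal_iff hQ] at hN
  refine le_trans ?_ (mul_le_mul_of_nonneg_left hN hC)
  rw [← integral_const_mul]
  refine setIntegral_mono_smooth D (smooth_DS 1 w) (smooth_const_mul (smooth_EE hu n) C)
    fun y _ => ?_
  have : DS 1 w z y = (w.1 z y) ^ 2 := by simp [DS]
  rw [this, hw]
  exact h β hβ u hu i z y

lemma lintegral_IK (D : SmoothDomain d) {K : Set (Fin 3 → ℝ)} (hK : IsCompact K) {F : V d}
    (hF : SmoothC F) (h0 : ∀ z y, 0 ≤ F z y) (τ : ℝ) :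
    ∫⁻ x in K, ∫⁻ y in D.carrier, ENNReal.ofReal (F (Fin.cons τ x) y) =
      ENNReal.ofReal (IK D K F τ) := by
  rw [IK, ofReal_integral_eq_lintegral_ofReal (integrable_IK D hK hF τ)
    (Filter.Eventually.of_forall fun p => h0 _ _), muK, lintegral_prod]
  exact ((continuous_slice_cons hF τ).measurable.ennreal_ofReal).aemeasurable

lemma isCompact_unit_box (x : Fin 3 → ℝ) :
    IsCompact {x' : Fin 3 → ℝ | ∀ k, x' k ∈ Set.Icc (x k - 1) (x k + 1)} := by
  have : {x' : Fin 3 → ℝ | ∀ k, x' k ∈ Set.Icc (x k - 1) (x k + 1)} =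
      Set.univ.pi fun k => Set.Icc (x k - 1) (x k + 1) := by
    ext; simp only [Set.mem_setOf_eq, Set.mem_pi, Set.mem_univ, forall_const]
  rw [this]
  exact isCompact_univ_pi fun k => isCompact_Icc

lemma IK_EE_le (D : SmoothDomain d) (n : ℕ) {K : Set (Fin 3 → ℝ)} (hK : IsCompact K) {v : V d}
    (hv : SmoothC v) {τ Q : ℝ} (h : ∀ β : List (Fin 10), β.length ≤ n → ∀ i : Fin 4 ⊕ Fin d,
      IK D K (fun z y => (pdmix i (zw β v) z y) ^ 2) τ ≤ Q) :
    IK D K (EE n v) τ ≤ wcard (Fin 10) n * ((4 + d) * Q) := by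
  have hs : ∀ (β : List (Fin 10)) (i : Fin 4 ⊕ Fin d),
      SmoothC (fun z y => (pdmix i (zw β v) z y) ^ 2) := fun β i => by
    have := smooth_mul (smooth_pdmix (smooth_zw hv β) i) (smooth_pdmix (smooth_zw hv β) i)
    simpa only [sq] using this
  have hb : ∀ β : List (Fin 10), IK D K (ed (zw β v)) τ =
      ∑ i, IK D K (fun z y => (pdmix i (zw β v) z y) ^ 2) τ := fun β => by
    unfold IK
    rw [← integral_finsetSum _ fun i _ => integrable_IK D hK (hs β i) τ]
    simp only [ed_eq_sum]
  have he : IK D K (EE n v) τ = wsum n fun β : List (Fin 10) => IK D K (ed (zw β v)) τ := by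
    unfold IK EE wsum
    have hi : ∀ β : List (Fin 10), Integrable
        (fun p : (Fin 3 → ℝ) × (Fin d → ℝ) => ed (zw β v) (Fin.cons τ p.1) p.2) (muK D K) :=
      fun β => integrable_IK D hK (smooth_ed (smooth_zw hv β)) τ
    rw [integral_finsetSum _ fun n _ => integrable_finsetSum _ fun σ _ => hi _]
    exact Finset.sum_congr rfl fun n _ => integral_finsetSum _ fun σ _ => hi _
  rw [he]
  refine wsum_le_card fun β hβ => ?_
  rw [hb]
  refine (Finset.sum_le_card_nsmul _ _ Q fun i _ => h β hβ i).trans_eq ?_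
  simp

/-- Sobolev in `x`: pointwise-in-`x` bounds of words on a first derivative. -/
lemma exists_word_pdtx_le (D : SmoothDomain d) (L : List (Fin 10 ⊕ Fin d)) : ∃ C : ℝ, 0 ≤ C ∧
    ∀ v : V d, SmoothC v → ∀ t x Q, 0 ≤ Q →
      (∀ L' : List (Fin 10 ⊕ Fin d), L'.length ≤ L.length + 4 → ∀ K, IsCompact K →
        IK D K (fun z y => opIter gtF L' v z y * opIter gtF L' v z y) t ≤ Q) →
      ∀ i, ∀ w : Sm d, w.1 = opIter gtF L (pdtx i v) → HS D 1 w (Fin.cons t x) ≤ C * Q := by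
  obtain ⟨γ, β, hl, hsp⟩ := exists_word_split L
  obtain ⟨C₁, hC₁, h₁⟩ := NN_flat_three D β.length
  obtain ⟨C₂, hC₂, h₂⟩ := exists_HS_zw_pdtx_le D β.length
  have hc := wcard_nonneg (Fin 10) (β.length + 3)
  refine ⟨C₂ * (C₁ * (wcard (Fin 10) (β.length + 3) * (4 + d))), by positivity,
    fun v hv t x Q hQ hI i w hw => ?_⟩
  have hg := smooth_word hv (γ.map Sum.inr)
  rw [mul_assoc]
  refine h₂ (opIter gtF (γ.map Sum.inr) v) hg _ _ (by positivity) ?_ β le_rfl i w ?_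
  · refine (h₁ _ hg t x).trans ?_
    rw [mul_assoc, ENNReal.ofReal_mul hC₁.le]
    refine mul_le_mul_right ?_ _
    have hK := isCompact_unit_box x
    refine (lintegral_IK D hK (smooth_EE hg _) (EE_nonneg _ _) t).trans_le ?_
    refine ENNReal.ofReal_le_ofReal ?_
    rw [mul_assoc]
    refine IK_EE_le D _ hK hg fun δ hδ j => ?_
    have := hI (mixField j :: (δ.map Sum.inl ++ γ.map Sum.inr)) (by simp; omega) _ hK
    simp only [sq]
    have e : opIter gtF (mixField j :: (δ.map Sum.inl ++ γ.map Sum.inr)) v =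
        pdmix j (zw δ (opIter gtF (γ.map Sum.inr) v)) := by
      change gtF (mixField j) (opIter gtF (δ.map Sum.inl ++ γ.map Sum.inr) v) = _
      rw [gtF_mixField, opIter_append]
      rfl
    rwa [e] at this
  · rw [hw, hsp _ (smooth_pdtx hv i), pdtx_dyWord hv, zw_dyWord (smooth_pdtx hv i)]

lemma exists_words_pdtx_le (D : SmoothDomain d) (n : ℕ) : ∃ C : ℝ, 0 ≤ C ∧
    ∀ L : List (Fin 10 ⊕ Fin d), L.length ≤ n → ∀ v : V d, SmoothC v → ∀ t x Q, 0 ≤ Q →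
      (∀ L' : List (Fin 10 ⊕ Fin d), L'.length ≤ n + 4 → ∀ K, IsCompact K →
        IK D K (fun z y => opIter gtF L' v z y * opIter gtF L' v z y) t ≤ Q) →
      ∀ i, ∀ w : Sm d, w.1 = opIter gtF L (pdtx i v) → HS D 1 w (Fin.cons t x) ≤ C * Q := by
  choose C hC h using exists_word_pdtx_le D
  refine ⟨wsum n C, wsum_nonneg hC, fun L hL v hv t x Q hQ hI i w hw => ?_⟩
  refine (h L v hv t x Q hQ (fun L' hL' => hI L' (by omega)) i w hw).trans ?_
  exact mul_le_mul_of_nonneg_right (le_wsum (f := C) hC hL) hQ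

lemma sq_le_div_sq {a t S : ℝ} (ht : 0 < t) (ha : 0 ≤ a) (h : t * √a ≤ S) : a ≤ S ^ 2 / t ^ 2 := by
  rw [le_div_iff₀ (by positivity)]
  calc a * t ^ 2 = (t * √a) ^ 2 := by rw [mul_pow, Real.sq_sqrt ha]; ring
    _ ≤ S ^ 2 := pow_le_pow_left₀ (by positivity) h 2

/-- The pointwise decay estimate for one product of fields. -/
lemma exists_word_decay (D : SmoothDomain d) {B : ℝ} (hB : 0 < B) (L : List (Fin 10 ⊕ Fin d)) :
    ∃ C : ℝ, 0 ≤ C ∧ ∀ u : V d, SmoothC u →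
      (∀ z : Fin 4 → ℝ, ∀ y ∈ closure D.carrier, 0 ≤ z 0 → z 0 ≤ 2 * B → u z y = 0) →
      (∀ z : Fin 4 → ℝ, ∀ y ∈ closure D.carrier, 0 ≤ z 0 → z 0 - B < rad z → wBox u z y = 0) →
      NeumannBC D u → ∀ t, 2 * B ≤ t → ∀ x, ∀ y ∈ closure D.carrier, ∀ i,
        (1 + t) * |opIter gtF L (pdtx i u) (Fin.cons t x) y| ≤
          C * dySum D B (L.length + (5 * d + 16) / 2) u t := by
  obtain ⟨γ, β, hl, hsp⟩ := exists_word_split L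
  obtain ⟨k, hk1, hk2, hk3⟩ : ∃ k, γ.length + d ≤ 2 * k ∧ 2 * k ≤ γ.length + d + 1 ∧
      β.length + 2 * k + 8 ≤ L.length + (5 * d + 16) / 2 := by
    refine ⟨(γ.length + d + 1) / 2, by omega, by omega, ?_⟩
    rcases Nat.eq_zero_or_pos d with rfl | hd
    · have : γ.length = 0 := by
        rcases γ with _ | ⟨j, _⟩
        · rfl
        · exact j.elim0
      omega
    · omega
  set M := L.length + (5 * d + 16) / 2 with hM
  obtain ⟨C₁, hC₁, h₁⟩ := sobolev_y D
  obtain ⟨C₂, hC₂, h₂⟩ := elliptic_wave D k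
  obtain ⟨C₃, hC₃, h₃⟩ := NN_decay D hB (β.length + 2 * k)
  obtain ⟨C₄, hC₄, h₄⟩ := exists_HS_zw_pdtx_le D (β.length + 2 * k)
  obtain ⟨C₅, hC₅, h₅⟩ := exists_words_pdtx_le D (β.length + (2 * k - 2))
  set A := C₁ * (C₂ * (C₄ * C₃ + C₅)) with hA
  have hA0 : 0 ≤ A := by positivity
  refine ⟨(1 / (2 * B) + 1) * (√A * 2), by positivity, fun u hu h0 hb hn t ht x y hy i => ?_⟩
  have ht0 : 0 < t := by linarith
  set S := 2 * dySum D B M u t with hS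
  have hS0 : 0 ≤ S := mul_nonneg zero_le_two (dySum_nonneg D B M u t)
  have hQ0 : 0 ≤ S ^ 2 / t ^ 2 := by positivity
  have hI : ∀ L' : List (Fin 10 ⊕ Fin d), L'.length ≤ M → ∀ K, IsCompact K →
      IK D K (fun z y => opIter gtF L' (wBox u) z y * opIter gtF L' (wBox u) z y) t ≤
        S ^ 2 / t ^ 2 := fun L' hL' K hK =>
    sq_le_div_sq ht0 (integral_nonneg fun p => mul_self_nonneg _)
      (word_sup_le D hB hu hb ht hL' hK ⟨ht, le_rfl⟩)
  have hNN := h₃ u hu hn h0 t S ht ((src_of_dySum D hB hu hb ht).mono hk3) x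
  set w : Sm d := ⟨zw β (pdtx i u), smooth_zw (smooth_pdtx hu i) β⟩ with hw
  have hwn : NeumannBC D w.1 := by
    have := nder_zw D hu hn (β ++ [Fin.castLE (by omega) i])
    rwa [zw_append, zw_cons, zw_nil, gtF_eq_pdtx] at this
  have hHS : HS D (2 * k + 1) w (Fin.cons t x) ≤ C₂ * ((C₄ * C₃ + C₅) * (S ^ 2 / t ^ 2)) := by
    refine h₂ w hwn _ _ (fun a ha => ?_) fun b hb' => ?_
    · have := h₄ u hu (Fin.cons t x) (C₃ * S ^ 2 / t ^ 2) (by positivity) hNN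
        (a.map (Fin.castLE (by omega)) ++ β) (by simp; omega) i
        ((a.map fun i => Dx (d := d) (Sum.inl i)).prod w) (by rw [prod_Dx_inl, zw_append])
      refine this.trans ?_
      rw [add_mul, mul_assoc C₄, ← mul_div_assoc C₃]
      exact le_add_of_nonneg_right (by positivity)
    · have := h₅ (b.map mixField ++ β.map Sum.inl) (by simp; omega) (wBox u) (smooth_wBox hu) t x
        (S ^ 2 / t ^ 2) hQ0 (fun L' hL' => hI L' (by omega)) i ((b.map Dx).prod (Bx w)) (by
          rw [prod_Dx, opIter_append]
          congr 1
          change wBox (zw β (pdtx i u)) = zw β (pdtx i (wBox u))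
          rw [wBox_zw (smooth_pdtx hu i)]
          congr 1
          exact wBox_pdmix hu (Sum.inl i))
      refine this.trans ?_
      rw [add_mul]
      exact le_add_of_nonneg_left (by positivity)
  have hsq : (opIter gtF L (pdtx i u) (Fin.cons t x) y) ^ 2 ≤ A * (S ^ 2 / t ^ 2) := by
    have e : opIter gtF L (pdtx i u) = ((γ.map Dy).prod w).1 := by
      rw [prod_Dy, hsp _ (smooth_pdtx hu i)]
    rw [e]
    refine (h₁ y hy _ _).trans ?_
    rw [hA, mul_assoc, mul_assoc]
    refine mul_le_mul_of_nonneg_left (le_trans ?_ hHS) hC₁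
    exact (HS_prod_Dy_le D _ γ w _).trans (HS_mono D (by omega) w _)
  have habs : |opIter gtF L (pdtx i u) (Fin.cons t x) y| ≤ √A * (S / t) := by
    refine abs_le_of_sq_le_sq' ?_ (by positivity) |> fun h => abs_le.2 h
    rw [mul_pow, Real.sq_sqrt hA0, div_pow]
    exact hsq
  have h1t : 1 + t ≤ (1 / (2 * B) + 1) * t := by
    have : 1 ≤ 1 / (2 * B) * t := by
      rw [one_div_mul_eq_div, le_div_iff₀ (by positivity)]
      linarith
    linarith
  calc _ ≤ ((1 / (2 * B) + 1) * t) * (√A * (S / t)) :=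
        mul_le_mul h1t habs (abs_nonneg _) (by positivity)
    _ = _ := by
        rw [hS]
        field_simp

end Waveguide

open Waveguide

/-- main decay estimate, Neumann case: let `Ω ⊂ ℝ^d` be a nonempty bounded
domain with smooth boundary and fix `B > 0`.  For every multi-index length `m` there is a
constant `C` such that: if `u ∈ C^∞(ℝ₊×ℝ³×Ω̄)` vanishes for `t ≤ 2B`, has `□u = 0` for
`|x| > t-B` and satisfies the Neumann condition, then for every product `Γ̃^β` of `|β| ≤ m`
admissible fields and all `t ≥ 2B`, `x`, `y`,
`(1+t)|Γ̃^β ∂_{t,x} u(t,x,y)| ≤ C Σ_{|α|≤|β|+(5d+16)/2} Σ_k sup 2^k ‖Γ̃^α □u(τ,·)‖₂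
  + C (1+t) Σ_{|α|≤|β|+(5d+6)/2} ‖Γ̃^α □u(t,·)‖₂`. -/
theorem stmt17 (d : ℕ) (D : SmoothDomain d) (B : ℝ) (hB : 0 < B) (m : ℕ) :
    ∃ C : ℝ, 0 < C ∧
      ∀ u : (Fin 4 → ℝ) → (Fin d → ℝ) → ℝ, SmoothC u →
        (∀ z : Fin 4 → ℝ, ∀ y ∈ closure D.carrier, 0 ≤ z 0 → z 0 ≤ 2*B → u z y = 0) →
        (∀ z : Fin 4 → ℝ, ∀ y ∈ closure D.carrier, 0 ≤ z 0 → rad z > z 0 - B →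
          wBox u z y = 0) →
        NeumannBC D u →
        ∀ L : List (Fin 10 ⊕ Fin d), L.length ≤ m →
          ∀ t : ℝ, 2*B ≤ t → ∀ x : Fin 3 → ℝ, ∀ y ∈ closure D.carrier, ∀ i : Fin 4,
            (1 + t) * |opIter gtF L (pdtx i u) (Fin.cons t x) y| ≤
              C * (∑ n ∈ Finset.range (L.length + (5*d + 16)/2 + 1),
                    ∑ σ : Fin n → (Fin 10 ⊕ Fin d),
                    dyadic (L2txy D (opIter gtF (List.ofFn σ) (wBox u))) B t) +
              C * (1 + t) * (∑ n ∈ Finset.range (L.length + (5*d + 6)/2 + 1),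
                    ∑ σ : Fin n → (Fin 10 ⊕ Fin d),
                    L2txy D (opIter gtF (List.ofFn σ) (wBox u)) t) := by
  choose C hC h using fun L => exists_word_decay D hB L
  have hw : 0 ≤ wsum m C := wsum_nonneg hC
  refine ⟨wsum m C + 1, by linarith, fun u hu h0 hb hn L hL t ht x y hy i => ?_⟩
  refine (h L u hu h0 hb hn t ht x y hy i).trans (le_add_of_le_of_nonneg ?_ ?_)
  · refine mul_le_mul_of_nonneg_right ?_ (dySum_nonneg D B _ u t)
    linarith [le_wsum (f := C) hC hL]
  · have ht0 : 0 ≤ 1 + t := by linarith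
    exact mul_nonneg (mul_nonneg (by linarith) ht0)
      (Finset.sum_nonneg fun _ _ => Finset.sum_nonneg fun _ _ => Real.sqrt_nonneg _)
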